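/- Let σ : A → B be a flat local homomorphism of Noetherian local commutative rings, with m the maximal ideal of A. Assume the formal fibers of A are geometrically normal, i.e. for every prime ideal p of A the fiber κ(p)⊗_A Â of the completion map A → Â is geometrically normal over the residue field κ(p). If the closed fiber B/mB is geometrically normal over A/m, then σ is a normal homomorphism, i.e. for every prime ideal p of A the fiber B⊗_A κ(p) is geometrically normal over κ(p). -/

import Mathlib

open TensorProduct IsLocalRing

/-- A commutative ring is normal if its localization at every prime ideal is an
integrally closed domain. -/
def IsNormalRing (R : Type*) [CommRing R] : Prop :=
  ∀ (P : Ideal R) (hP : P.IsPrime),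
    haveI : P.IsPrime := hP
    IsDomain (Localization.AtPrime P) ∧ IsIntegrallyClosed (Localization.AtPrime P)

universe u v

/-- An algebra `R` over a field `F` is geometrically normal if `L ⊗[F] R` is a normal
ring for every finite field extension `L` of `F`. -/
def GeometricallyNormal (F : Type u) (R : Type v) [Field F] [CommRing R]
    [Algebra F R] : Prop :=
  ∀ (L : Type u) [Field L] [Algebra F L] [FiniteDimensional F L], IsNormalRing (L ⊗[F] R)

set_option linter.all false

namespace GN

/-- integrally closed domain -/
def NDom (R : Type*) [CommRing R] : Prop := IsDomain R ∧ IsIntegrallyClosed R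

/-- `a / b` is formally integral -/
def IntRel {R : Type*} [CommRing R] (a b : R) : Prop :=
  ∃ p : Polynomial R, p.Monic ∧ (p.scaleRoots b).eval a = 0

theorem IntRel.map {R S : Type*} [CommRing R] [CommRing S] (f : R →+* S) {a b : R}
    (h : IntRel a b) : IntRel (f a) (f b) := by
  rcases subsingleton_or_nontrivial S with hS | hS
  · exact ⟨1, Polynomial.monic_one, Subsingleton.elim _ _⟩
  obtain ⟨p, hp, h⟩ := h
  refine ⟨p.map f, hp.map f, ?_⟩
  rw [← Polynomial.map_scaleRoots _ _ _ (by rw [hp.leadingCoeff]; simp), Polynomial.eval_map,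
    Polynomial.eval₂_at_apply, h, map_zero]

theorem ndom_iff (R : Type*) [CommRing R] :
    NDom R ↔ IsDomain R ∧ ∀ a b : R, b ≠ 0 → IntRel a b → b ∣ a := by
  refine and_congr_right fun hd => ?_
  constructor
  · intro hi a b hb ⟨p, hp, h⟩
    have hb' : algebraMap R (FractionRing R) b ≠ 0 := by
      simpa using hb
    have : IsIntegral R (algebraMap R (FractionRing R) a / algebraMap R (FractionRing R) b) := by
      refine ⟨p, hp, ?_⟩
      have := Polynomial.scaleRoots_eval₂_mul (p := p) (algebraMap R (FractionRing R))
        (algebraMap R (FractionRing R) a / algebraMap R (FractionRing R) b) b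
      rw [mul_div_cancel₀ _ hb', Polynomial.eval₂_at_apply, h, map_zero] at this
      have h3 := mul_eq_zero.1 this.symm
      exact h3.resolve_left (pow_ne_zero _ hb')
    obtain ⟨y, hy⟩ := (isIntegrallyClosed_iff (FractionRing R)).1 hi this
    refine ⟨y, ?_⟩
    rw [eq_div_iff hb', ← map_mul] at hy
    rw [mul_comm]
    exact (IsFractionRing.injective R (FractionRing R) hy).symm
  · intro h
    refine (isIntegrallyClosed_iff (FractionRing R)).2 ?_
    intro x ⟨p, hp, hx⟩
    obtain ⟨a, b, hb, rfl⟩ := IsFractionRing.div_surjective (A := R) x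
    have hb0 : b ≠ 0 := nonZeroDivisors.ne_zero hb
    have hb' : algebraMap R (FractionRing R) b ≠ 0 := by
      simpa using hb0
    have := Polynomial.scaleRoots_eval₂_mul (p := p) (algebraMap R (FractionRing R))
        (algebraMap R (FractionRing R) a / algebraMap R (FractionRing R) b) b
    rw [mul_div_cancel₀ _ hb', hx, mul_zero, Polynomial.eval₂_at_apply] at this
    obtain ⟨y, rfl⟩ := h a b hb0 ⟨p, hp, by
      apply IsFractionRing.injective R (FractionRing R); rw [this, map_zero]⟩
    exact ⟨y, by rw [map_mul, mul_div_cancel_left₀ _ hb']⟩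

theorem NDom.of_equiv {R S : Type*} [CommRing R] [CommRing S] (e : R ≃+* S) (h : NDom R) :
    NDom S := by
  obtain ⟨h1, h2⟩ := h
  exact ⟨MulEquiv.isDomain R e.symm.toMulEquiv, IsIntegrallyClosed.of_equiv e⟩

theorem NDom.of_field (R : Type*) [Field R] : NDom R := ⟨inferInstance, inferInstance⟩

theorem NDom.localization {R : Type*} [CommRing R] (h : NDom R) (P : Ideal R) [P.IsPrime] :
    NDom (Localization.AtPrime P) := by
  obtain ⟨h1, h2⟩ := h
  exact ⟨inferInstance, isIntegrallyClosed_of_isLocalization _ P.primeCompl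
    P.primeCompl_le_nonZeroDivisors⟩

theorem NDom.isNormalRing {R : Type*} [CommRing R] (h : NDom R) : IsNormalRing R :=
  fun P _ => h.localization P

theorem isNormalRing_iff (R : Type*) [CommRing R] : IsNormalRing R ↔
    ∀ (P : Ideal R) [P.IsPrime], NDom (Localization.AtPrime P) := Iff.rfl

theorem NDom.of_isLocalization {R : Type*} [CommRing R] (h : IsNormalRing R) (P : Ideal R)
    [P.IsPrime] (S : Type*) [CommRing S] [Algebra R S] [IsLocalization.AtPrime S P] : NDom S :=
  NDom.of_equiv (IsLocalization.algEquiv P.primeCompl (Localization.AtPrime P) S).toRingEquiv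
    (h P inferInstance)

theorem isNormalRing_of_isLocalization {R : Type*} [CommRing R] (M : Submonoid R)
    (S : Type*) [CommRing S] [Algebra R S] [IsLocalization M S] (h : IsNormalRing R) :
    IsNormalRing S := by
  intro P hP
  have := IsLocalization.isLocalization_isLocalization_atPrime_isLocalization M
    (Localization.AtPrime P) P
  exact NDom.of_isLocalization h (P.comap (algebraMap R S)) _

theorem isNormalRing_of_ringEquiv {R S : Type*} [CommRing R] [CommRing S] (e : R ≃+* S)
    (h : IsNormalRing R) : IsNormalRing S := by
  letI := e.toRingHom.toAlgebra
  have : IsLocalization (⊥ : Submonoid R) S :=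
    IsLocalization.of_le_isUnit_of_bijective (M := (⊥ : Submonoid R)) (S := S)
     (by
        rintro _ ⟨x, hx, rfl⟩
        have hx1 : x = 1 := hx
        rw [hx1, map_one]; exact isUnit_one) e.bijective
  exact isNormalRing_of_isLocalization (⊥ : Submonoid R) S h

/-- A normal local ring is an integrally closed domain. -/
theorem IsNormalRing.ndom {R : Type*} [CommRing R] [IsLocalRing R] (h : IsNormalRing R) :
    NDom R := by
  have : IsLocalization.AtPrime R (maximalIdeal R) := by
    refine IsLocalization.of_le_isUnit_of_bijective (M := (maximalIdeal R).primeCompl) (S := R) ?_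
      Function.bijective_id
    rintro _ ⟨x, hx, rfl⟩
    have : x ∉ maximalIdeal R := hx
    exact not_not.1 this
  exact NDom.of_isLocalization h (maximalIdeal R) R

/-- descent along faithfully flat local maps -/
theorem NDom.descent {R S : Type*} [CommRing R] [CommRing S] [Algebra R S]
    [Module.FaithfullyFlat R S] (h : NDom S) : NDom R := by
  rw [ndom_iff] at h ⊢
  obtain ⟨h1, h2⟩ := h
  have hinj : Function.Injective (algebraMap R S) := FaithfulSMul.algebraMap_injective R S
  refine ⟨hinj.isDomain (algebraMap R S), fun a b hb hab => ?_⟩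
  have := h2 _ _ (by simpa using hinj.ne hb) (hab.map (algebraMap R S))
  rw [← Ideal.mem_span_singleton, ← Ideal.comap_map_eq_self_of_faithfullyFlat (B := S)
    (Ideal.span {b}), Ideal.mem_comap, Ideal.map_span, Set.image_singleton,
    Ideal.mem_span_singleton]
  exact this

/-- flat local map induced on localizations -/
theorem exists_flat_localization {R S : Type*} [CommRing R] [CommRing S] [Algebra R S]
    [Module.Flat R S] (Q : Ideal S) [Q.IsPrime] :
    ∃ _ : Algebra (Localization.AtPrime (Q.under R)) (Localization.AtPrime Q),
      IsScalarTower R (Localization.AtPrime (Q.under R)) (Localization.AtPrime Q) ∧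
      Module.Flat (Localization.AtPrime (Q.under R)) (Localization.AtPrime Q) ∧
      IsLocalHom (algebraMap (Localization.AtPrime (Q.under R)) (Localization.AtPrime Q)) := by
  letI : Algebra (Localization.AtPrime (Q.under R)) (Localization.AtPrime Q) :=
    (Localization.localRingHom (Q.under R) Q (algebraMap R S) rfl).toAlgebra
  have h1 : IsScalarTower R (Localization.AtPrime (Q.under R)) (Localization.AtPrime Q) := by
    refine IsScalarTower.of_algebraMap_eq fun x => ?_
    rw [RingHom.algebraMap_toAlgebra, Localization.localRingHom_to_map]
    rfl
  refine ⟨inferInstance, h1, ?_, ?_⟩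
  · have : Module.Flat R (Localization.AtPrime Q) := Module.Flat.trans R S _
    exact (Module.flat_iff_of_isLocalization (Localization.AtPrime (Q.under R))
      (Q.under R).primeCompl (M := Localization.AtPrime Q)).2 this
  · exact Localization.isLocalHom_localRingHom _ _ _ _

theorem IsNormalRing.descent {R S : Type*} [CommRing R] [CommRing S] [Algebra R S]
    [Module.FaithfullyFlat R S] (h : IsNormalRing S) : IsNormalRing R := by
  intro P hP
  obtain ⟨Q, hQ, hQP⟩ := Ideal.exists_isPrime_liesOver_of_faithfullyFlat (B := S) P
  obtain rfl := hQP.over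
  obtain ⟨i1, i2, i3, i4⟩ := exists_flat_localization (R := R) Q
  have := Module.FaithfullyFlat.of_flat_of_isLocalHom
    (A := Localization.AtPrime (Q.under R)) (B := Localization.AtPrime Q)
  exact NDom.descent (S := Localization.AtPrime Q) (h Q hQ)

end GN

namespace GN

/-- `Q` is an associated prime of `T ⧸ J`. -/
def AssMod {T : Type*} [CommRing T] (Q J : Ideal T) : Prop :=
  Q.IsPrime ∧ ∃ x, ∀ y, y ∈ Q ↔ y * x ∈ J

theorem assMod_iff {T : Type*} [CommRing T] [IsNoetherianRing T] (Q J : Ideal T) :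
    AssMod Q J ↔ Q ∈ associatedPrimes T (T ⧸ J) := by
  rw [AssociatedPrimes.mem_iff, isAssociatedPrime_iff, AssMod]
  refine and_congr_right fun _ => ?_
  constructor
  · rintro ⟨x, hx⟩
    refine ⟨Ideal.Quotient.mk J x, ?_⟩
    ext y
    rw [hx, Submodule.mem_colon_singleton, Submodule.mem_bot, Algebra.smul_def,
      Ideal.Quotient.algebraMap_eq, ← map_mul, Ideal.Quotient.eq_zero_iff_mem]
  · rintro ⟨x, hx⟩
    obtain ⟨x, rfl⟩ := Ideal.Quotient.mk_surjective x
    refine ⟨x, fun y => ?_⟩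
    rw [hx, Submodule.mem_colon_singleton, Submodule.mem_bot, Algebra.smul_def,
      Ideal.Quotient.algebraMap_eq, ← map_mul, Ideal.Quotient.eq_zero_iff_mem]

theorem AssMod.le {T : Type*} [CommRing T] {Q J : Ideal T} (h : AssMod Q J) : J ≤ Q := by
  obtain ⟨_, x, hx⟩ := h
  intro y hy
  exact (hx y).2 (J.mul_mem_right _ hy)

theorem assMod_finite {T : Type*} [CommRing T] [IsNoetherianRing T] (J : Ideal T) :
    {Q | AssMod Q J}.Finite := by
  refine (associatedPrimes.finite T (T ⧸ J)).subset fun Q hQ => (assMod_iff Q J).1 hQ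

theorem exists_assMod {T : Type*} [CommRing T] [IsNoetherianRing T] (J : Ideal T) (x : T)
    (hx : x ∉ J) : ∃ Q, AssMod Q J ∧ ∀ y, y * x ∈ J → y ∈ Q := by
  obtain ⟨Q, hQ, h⟩ := exists_le_isAssociatedPrime_of_isNoetherianRing T
    (Ideal.Quotient.mk J x) (by rwa [Ne, Ideal.Quotient.eq_zero_iff_mem])
  refine ⟨Q, (assMod_iff Q J).2 hQ, fun y hy => h ?_⟩
  rw [Submodule.mem_colon_singleton, Submodule.mem_bot, Algebra.smul_def,
      Ideal.Quotient.algebraMap_eq, ← map_mul, Ideal.Quotient.eq_zero_iff_mem]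
  exact hy

/-- prime avoidance: an ideal not inside any associated prime contains an element regular on `T/J`. -/
theorem exists_regular {T : Type*} [CommRing T] [IsNoetherianRing T] (J I : Ideal T)
    (h : ∀ Q, AssMod Q J → ¬ I ≤ Q) : ∃ u ∈ I, ∀ x, u * x ∈ J → x ∈ J := by
  by_contra hcon
  push Not at hcon
  have hsub : (I : Set T) ⊆ ⋃ Q ∈ (assMod_finite J).toFinset, (Q : Set T) := by
    intro u hu
    obtain ⟨x, hx1, hx2⟩ := hcon u hu
    obtain ⟨Q, hQ, hQ'⟩ := exists_assMod J x hx2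
    simp only [Set.mem_iUnion]
    exact ⟨Q, by simpa using hQ, hQ' _ hx1⟩
  obtain ⟨Q, hQ, hle⟩ := (Ideal.subset_union_prime (s := (assMod_finite J).toFinset) (f := id) ⊥ ⊥
    (fun Q hQ _ _ => (by simpa using hQ : AssMod Q J).1)).1 hsub
  exact h Q (by simpa using hQ) hle

/-- variant with extra finitely many primes to avoid. -/
theorem exists_regular' {T : Type*} [CommRing T] [IsNoetherianRing T] (J I : Ideal T)
    (F : Finset (Ideal T)) (hF : ∀ Q ∈ F, Q.IsPrime)
    (h : ∀ Q, AssMod Q J → ¬ I ≤ Q) (h' : ∀ Q ∈ F, ¬ I ≤ Q) :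
    ∃ u ∈ I, (∀ x, u * x ∈ J → x ∈ J) ∧ ∀ Q ∈ F, u ∉ Q := by
  classical
  by_contra hcon
  push Not at hcon
  have hsub : (I : Set T) ⊆ ⋃ Q ∈ (assMod_finite J).toFinset ∪ F, (Q : Set T) := by
    intro u hu
    by_cases h1 : ∀ x, u * x ∈ J → x ∈ J
    · obtain ⟨Q, hQ, hQ'⟩ := hcon u hu h1
      simp only [Set.mem_iUnion]
      exact ⟨Q, by simp [hQ], hQ'⟩
    push Not at h1
    obtain ⟨x, hx1, hx2⟩ := h1
    obtain ⟨Q, hQ, hQ'⟩ := exists_assMod J x hx2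
    simp only [Set.mem_iUnion]
    exact ⟨Q, by simp [hQ], hQ' _ hx1⟩
  obtain ⟨Q, hQ, hle⟩ := (Ideal.subset_union_prime (s := (assMod_finite J).toFinset ∪ F) (f := id)
    ⊥ ⊥ (fun Q hQ _ _ => by
      rcases Finset.mem_union.1 hQ with hQ | hQ
      · exact (by simpa using hQ : AssMod Q J).1
      · exact hF Q hQ)).1 hsub
  rcases Finset.mem_union.1 hQ with hQ | hQ
  · exact h Q (by simpa using hQ) hle
  · exact h' Q hQ hle

/-- Localization of associated primes: forward. -/
theorem AssMod.localization {T : Type*} [CommRing T] {Q J : Ideal T} (h : AssMod Q J)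
    (P : Ideal T) [P.IsPrime] (hQP : Q ≤ P)
    (S : Type*) [CommRing S] [Algebra T S] [IsLocalization.AtPrime S P] :
    AssMod (Q.map (algebraMap T S)) (J.map (algebraMap T S)) := by
  obtain ⟨hQ, x, hx⟩ := h
  have hdis : Disjoint (P.primeCompl : Set T) (Q : Set T) := by
    rw [Set.disjoint_left]
    intro x hx hx'
    exact hx (hQP hx')
  refine ⟨IsLocalization.isPrime_of_isPrime_disjoint P.primeCompl _ Q hQ hdis,
    algebraMap T S x, fun y => ?_⟩
  obtain ⟨y, s, rfl⟩ := IsLocalization.exists_mk'_eq P.primeCompl y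
  rw [IsLocalization.mk'_mem_map_algebraMap_iff, mul_comm, IsLocalization.mul_mk'_eq_mk'_of_mul,
    IsLocalization.mk'_mem_map_algebraMap_iff]
  constructor
  · rintro ⟨t, ht, h⟩
    exact ⟨t, ht, by have := (hx _).1 h; rwa [mul_assoc, mul_comm y] at this⟩
  · rintro ⟨t, ht, h⟩
    exact ⟨t, ht, (hx _).2 (by rwa [mul_assoc, mul_comm y])⟩

/-- Localization of associated primes: backward. -/
theorem AssMod.of_localization {T : Type*} [CommRing T] [IsNoetherianRing T] {Q J : Ideal T}
    [Q.IsPrime]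
    (S : Type*) [CommRing S] [IsLocalRing S] [Algebra T S] [IsLocalization.AtPrime S Q]
    (h : AssMod (maximalIdeal S) (J.map (algebraMap T S))) : AssMod Q J := by
  obtain ⟨hQ, x, hx⟩ := h
  obtain ⟨x, s, rfl⟩ := IsLocalization.exists_mk'_eq Q.primeCompl x
  -- uniform denominator
  obtain ⟨F, hF⟩ := (isNoetherianRing_iff_ideal_fg T).1 inferInstance Q
  have h1 : ∀ y ∈ Q, ∃ t ∈ Q.primeCompl, t * (x * y) ∈ J := by
    intro y hy
    have : algebraMap T S y ∈ maximalIdeal S := by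
      rw [IsLocalization.AtPrime.to_map_mem_maximal_iff S Q]; exact hy
    have := (hx _).1 this
    rw [IsLocalization.mul_mk'_eq_mk'_of_mul, IsLocalization.mk'_mem_map_algebraMap_iff] at this
    obtain ⟨t, ht, h⟩ := this
    exact ⟨t, ht, by rwa [mul_comm x]⟩
  choose! t ht hty using h1
  have hFQ : ∀ f ∈ F, f ∈ Q := fun f hf => by rw [← hF]; exact Ideal.subset_span hf
  let t0 := ∏ f ∈ F, t f
  have ht0 : t0 ∈ Q.primeCompl := Submonoid.prod_mem _ fun f hf => ht f (hFQ f hf)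
  refine ⟨inferInstance, t0 * x, fun y => ?_⟩
  constructor
  · intro hy
    have : Q ≤ J.colon {t0 * x} := by
      rw [← hF, Ideal.span_le]
      intro f hf
      rw [SetLike.mem_coe, Submodule.mem_colon_singleton, smul_eq_mul]
      obtain ⟨c, hc⟩ := Finset.dvd_prod_of_mem t hf
      have := J.mul_mem_left c (hty f (hFQ f hf))
      have h2 : f * (t0 * x) = c * (t f * (x * f)) := by
        simp only [t0]; rw [hc]; ring
      rw [h2]; exact this
    have := this hy
    rwa [Submodule.mem_colon_singleton, smul_eq_mul] at this
  · intro hy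
    have h3 : algebraMap T S y * IsLocalization.mk' S x s ∈ J.map (algebraMap T S) := by
      rw [IsLocalization.mul_mk'_eq_mk'_of_mul, IsLocalization.mk'_mem_map_algebraMap_iff]
      exact ⟨t0, ht0, by convert hy using 1; ring⟩
    rw [← hx, IsLocalization.AtPrime.to_map_mem_maximal_iff S Q] at h3
    exact h3

/-- For local rings: `m ∈ Ass(T/J)`, elementary form. -/
theorem assMod_max_iff {T : Type*} [CommRing T] [IsLocalRing T] (J : Ideal T) :
    AssMod (maximalIdeal T) J ↔ ∃ x ∉ J, ∀ y ∈ maximalIdeal T, y * x ∈ J := by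
  constructor
  · rintro ⟨_, x, hx⟩
    refine ⟨x, fun h => ?_, fun y => (hx y).1⟩
    have := (hx 1).2 (by rwa [one_mul])
    exact (Ideal.ne_top_iff_one _).1 (maximalIdeal.isMaximal T).ne_top this
  · rintro ⟨x, hx, h⟩
    refine ⟨inferInstance, x, fun y => ⟨h y, fun hy => ?_⟩⟩
    by_contra hcon
    have : IsUnit y := by simpa using hcon
    exact hx ((Ideal.unit_mul_mem_iff_mem J this).1 hy)

/-- depth lemma -/
theorem AssMod.change {S : Type*} [CommRing S] {q : Ideal S} {s s' : S}
    (h : AssMod q (Ideal.span {s})) (hs : s ∈ nonZeroDivisors S) (hs' : s' ∈ nonZeroDivisors S)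
    (hs'q : s' ∈ q) : AssMod q (Ideal.span {s'}) := by
  obtain ⟨hq, x, hx⟩ := h
  have h1 := (hx s').1 hs'q
  rw [Ideal.mem_span_singleton] at h1
  obtain ⟨y, hy⟩ := h1
  refine ⟨hq, y, fun z => ?_⟩
  rw [hx z, Ideal.mem_span_singleton, Ideal.mem_span_singleton]
  constructor
  · rintro ⟨w, hw⟩
    refine ⟨w, ?_⟩
    apply (mul_right_mem_nonZeroDivisors_eq_zero_iff hs).1 |> fun h => sub_eq_zero.1 (h _)
    have e1 : (z * y - s' * w) * s = z * (s * y) - s' * (s * w) := by ring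
    rw [e1, ← hy, ← hw]; ring
  · rintro ⟨w, hw⟩
    refine ⟨w, ?_⟩
    apply (mul_right_mem_nonZeroDivisors_eq_zero_iff hs').1 |> fun h => sub_eq_zero.1 (h _)
    have e1 : (z * x - s * w) * s' = z * (s' * x) - s * (s' * w) := by ring
    rw [e1, hy, ← hw]; ring

/-- A local ring of depth at most one. -/
def Dep1 (T : Type*) [CommRing T] [IsLocalRing T] : Prop :=
  AssMod (maximalIdeal T) ⊥ ∨
    ∃ s ∈ nonZeroDivisors T, AssMod (maximalIdeal T) (Ideal.span {s})

theorem maximalIdeal_map_equiv {S T : Type*} [CommRing S] [CommRing T] [IsLocalRing S]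
    [IsLocalRing T] (e : S ≃+* T) : (maximalIdeal S).map e = maximalIdeal T := by
  ext x
  rw [Ideal.mem_map_of_equiv]
  constructor
  · rintro ⟨y, hy, rfl⟩
    simpa using hy
  · intro hx
    exact ⟨e.symm x, by simpa using hx, by simp⟩

theorem AssMod.of_equiv {S T : Type*} [CommRing S] [CommRing T] (e : S ≃+* T) {Q J : Ideal S}
    (h : AssMod Q J) : AssMod (Q.map e) (J.map e) := by
  obtain ⟨hQ, x, hx⟩ := h
  refine ⟨Ideal.map_isPrime_of_equiv e, e x, fun y => ?_⟩
  obtain ⟨y, rfl⟩ := e.surjective y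
  have aux : ∀ (I : Ideal S) (z : S), e z ∈ I.map e ↔ z ∈ I := by
    intro I z
    rw [Ideal.mem_map_of_equiv]
    constructor
    · rintro ⟨y, hy, h⟩
      rwa [← e.injective h]
    · intro hz; exact ⟨z, hz, rfl⟩
  rw [aux, ← map_mul, aux]
  exact hx y

theorem Dep1.of_equiv {S T : Type*} [CommRing S] [CommRing T] [IsLocalRing S] [IsLocalRing T]
    (e : S ≃+* T) (h : Dep1 S) : Dep1 T := by
  rcases h with h | ⟨s, hs, h⟩
  · left
    have := h.of_equiv e
    rwa [maximalIdeal_map_equiv, Ideal.map_bot] at this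
  · right
    refine ⟨e s, ?_, ?_⟩
    · rw [mem_nonZeroDivisors_iff_right] at hs ⊢
      intro x hx
      have := hs (e.symm x) (by apply e.injective; simpa using hx)
      simpa using this
    · have := h.of_equiv e
      rwa [maximalIdeal_map_equiv, Ideal.map_span, Set.image_singleton] at this

/-- Local form of the criterion. -/
theorem ndom_of_dep1 (T : Type*) [CommRing T] [IsNoetherianRing T] [IsLocalRing T]
    (h0 : ∀ (Q : Ideal T) [Q.IsPrime], AssMod Q ⊥ → IsDomain (Localization.AtPrime Q))
    (h1 : ∀ (Q : Ideal T) [Q.IsPrime], ∀ s ∈ nonZeroDivisors T, AssMod Q (Ideal.span {s}) →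
      NDom (Localization.AtPrime Q)) : NDom T := by
  have key : ∀ a b : T, b ∈ nonZeroDivisors T → IntRel a b → b ∣ a := by
    intro a b hb hab
    rw [← Ideal.mem_span_singleton]
    by_contra hcon
    obtain ⟨Q, hQ, hQ'⟩ := exists_assMod _ _ hcon
    have := hQ.1
    have hN := (ndom_iff _).1 (h1 Q b hb hQ)
    have := hN.1
    have hb0 : algebraMap T (Localization.AtPrime Q) b ≠ 0 := by
      have := IsLocalization.map_nonZeroDivisors_le Q.primeCompl (Localization.AtPrime Q)
        (Submonoid.mem_map_of_mem (algebraMap T (Localization.AtPrime Q)) hb)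
      exact nonZeroDivisors.ne_zero this
    have h2 := hN.2 _ _ hb0 (hab.map (algebraMap T (Localization.AtPrime Q)))
    rw [← Ideal.mem_span_singleton, ← Set.image_singleton, ← Ideal.map_span] at h2
    rw [IsLocalization.algebraMap_mem_map_algebraMap_iff Q.primeCompl] at h2
    obtain ⟨m, hm, hm'⟩ := h2
    exact hm (hQ' m hm')
  have hdom : IsDomain T := by
    have : NoZeroDivisors T := by
      refine ⟨fun {x y} hxy => ?_⟩
      by_contra hcon
      push Not at hcon
      obtain ⟨hx, hy⟩ := hcon
      let I : Ideal T := Ideal.span {x} |>.annihilator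
      let J : Ideal T := I.annihilator
      have hI : ∀ z, z ∈ I ↔ z * x = 0 := by
        intro z; simp only [I]; rw [Submodule.mem_annihilator_span_singleton, smul_eq_mul]
      have hJ : ∀ z, z ∈ J ↔ ∀ i ∈ I, z * i = 0 := by
        intro z; simp only [J]; rw [Submodule.mem_annihilator]; rfl
      obtain ⟨b, hb, hreg⟩ := exists_regular (⊥ : Ideal T) (I ⊔ J) (by
        intro Q hQ hle
        have := hQ.1
        have hd := h0 Q hQ
        have hIQ : I ≤ Q := le_sup_left.trans hle
        have hJQ : J ≤ Q := le_sup_right.trans hle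
        -- every `i ∈ I` vanishes in `T_Q`
        have hx0 : algebraMap T (Localization.AtPrime Q) x ≠ 0 := by
          intro h
          rw [IsLocalization.map_eq_zero_iff Q.primeCompl] at h
          obtain ⟨m, hm⟩ := h
          exact m.2 (hIQ ((hI _).2 hm))
        have hi : ∀ i ∈ I, ∃ m ∈ Q.primeCompl, m * i = 0 := by
          intro i hi
          have h2 : algebraMap T (Localization.AtPrime Q) i = 0 := by
            have : algebraMap T (Localization.AtPrime Q) i *
                algebraMap T (Localization.AtPrime Q) x = 0 := by
              rw [← map_mul, (hI i).1 hi, map_zero]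
            exact (mul_eq_zero.1 this).resolve_right hx0
          rw [IsLocalization.map_eq_zero_iff Q.primeCompl] at h2
          obtain ⟨m, hm⟩ := h2
          exact ⟨m, m.2, hm⟩
        choose! m hm hmi using hi
        obtain ⟨F, hF⟩ := (isNoetherianRing_iff_ideal_fg T).1 inferInstance I
        have hFI : ∀ f ∈ F, f ∈ I := fun f hf => by rw [← hF]; exact Ideal.subset_span hf
        have h3 : ∏ f ∈ F, m f ∈ J := by
          rw [hJ]
          have : I ≤ (Ideal.span {∏ f ∈ F, m f}).annihilator := by
            rw [← hF, Ideal.span_le]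
            intro f hf
            rw [SetLike.mem_coe, Submodule.mem_annihilator_span_singleton, smul_eq_mul]
            obtain ⟨c, hc⟩ := Finset.dvd_prod_of_mem m hf
            rw [hc]
            linear_combination c * hmi f (hFI f hf)
          intro i hi
          have := this hi
          rw [Submodule.mem_annihilator_span_singleton, smul_eq_mul] at this
          rw [mul_comm]; exact this
        exact Submonoid.prod_mem Q.primeCompl (fun f hf => hm f (hFI f hf)) (hJQ h3))
      obtain ⟨i, hi, j, hj, rfl⟩ := Submodule.mem_sup.1 hb
      have hij : j * i = 0 := (hJ j).1 hj i hi
      have hnzd : i + j ∈ nonZeroDivisors T := by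
        rw [mem_nonZeroDivisors_iff_right]
        intro z hz
        have := hreg z (by rw [Ideal.mem_bot, mul_comm]; exact hz)
        simpa using this
      obtain ⟨r, hr⟩ := key i (i + j) hnzd ⟨Polynomial.X ^ 2 - Polynomial.X, by
          monicity!, by
          have hd : (Polynomial.X ^ 2 - Polynomial.X : Polynomial T).natDegree = 2 := by
            compute_degree!
          rw [Polynomial.eval_eq_sum_range, Polynomial.natDegree_scaleRoots, hd]
          simp [Finset.sum_range_succ, Polynomial.coeff_scaleRoots, hd, Polynomial.coeff_X]
          linear_combination -hij⟩
      have hrr : r * (1 - r) = 0 := by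
        have h4 : (r * (1 - r)) * (i + j) * (i + j) = 0 := by
          have e : i * i = i * (i + j) := by linear_combination -hij
          have e2 : (r * (1 - r)) * (i + j) * (i + j)
            = ((i + j) * r) * (i + j) - ((i+j) * r) * ((i + j) * r) := by ring
          rw [e2, ← hr, e]; ring
        exact (mem_nonZeroDivisors_iff_right.1 hnzd) _ ((mem_nonZeroDivisors_iff_right.1 hnzd) _ h4)
      rcases IsLocalRing.isUnit_or_isUnit_of_add_one (a := r) (b := 1 - r) (by ring) with hu | hu
      · have : r = 1 := by
          have := (hu.mul_right_eq_zero).1 hrr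
          linear_combination -this
        rw [this, mul_one] at hr
        apply hx
        have := (mem_nonZeroDivisors_iff_right.1 hnzd) x
          (by rw [← hr, mul_comm]; exact (hI i).1 hi)
        exact this
      · have : r = 0 := (hu.mul_left_eq_zero).1 hrr
        rw [this, mul_zero] at hr
        apply hy
        have := (mem_nonZeroDivisors_iff_right.1 hnzd) y
          (by rw [hr, zero_add, mul_comm]; exact (hJ j).1 hj y ((hI y).2 (by rw [mul_comm]; exact hxy)))
        exact this
    exact NoZeroDivisors.to_isDomain T
  rw [ndom_iff]
  exact ⟨hdom, fun a b hb => key a b (mem_nonZeroDivisors_of_ne_zero hb)⟩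

/-- the criterion -/
theorem isNormalRing_of_dep1 (S : Type*) [CommRing S] [IsNoetherianRing S]
    (h : ∀ (P : Ideal S) [P.IsPrime], Dep1 (Localization.AtPrime P) →
      NDom (Localization.AtPrime P)) : IsNormalRing S := by
  intro P hP
  let T := Localization.AtPrime P
  have aux : ∀ (Q : Ideal T) [Q.IsPrime], Dep1 (Localization.AtPrime Q) →
      NDom (Localization.AtPrime Q) := by
    intro Q hQ hd
    have := IsLocalization.isLocalization_isLocalization_atPrime_isLocalization P.primeCompl
      (Localization.AtPrime Q) Q
    let e := (IsLocalization.algEquiv (Q.comap (algebraMap S T)).primeCompl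
      (Localization.AtPrime (Q.comap (algebraMap S T))) (Localization.AtPrime Q)).toRingEquiv
    exact (h (Q.comap (algebraMap S T)) (hd.of_equiv e.symm)).of_equiv e
  have : IsNoetherianRing T := IsLocalization.isNoetherianRing P.primeCompl T inferInstance
  refine ndom_of_dep1 T ?_ ?_
  · intro Q hQ hA
    refine (aux Q (Or.inl ?_)).1
    have := hA.localization Q le_rfl (Localization.AtPrime Q)
    rwa [Localization.AtPrime.map_eq_maximalIdeal, Ideal.map_bot] at this
  · intro Q hQ s hs hA
    refine (aux Q (Or.inr ⟨algebraMap T _ s, ?_, ?_⟩))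
    · exact IsLocalization.map_nonZeroDivisors_le Q.primeCompl (Localization.AtPrime Q)
        (Submonoid.mem_map_of_mem (algebraMap T (Localization.AtPrime Q)) hs)
    · have := hA.localization Q le_rfl (Localization.AtPrime Q)
      rwa [Localization.AtPrime.map_eq_maximalIdeal, Ideal.map_span, Set.image_singleton] at this

end GN

namespace GN

theorem exists_pow_dvd_max {S : Type*} [CommRing S] [IsNoetherianRing S] [IsLocalRing S] {u : S}
    (hu : u ∈ maximalIdeal S) {x : S} (hx : x ≠ 0) : ∃ n y, x = u ^ n * y ∧ ¬ u ∣ y := by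
  classical
  have h1 : ∃ n, ¬ u ^ n ∣ x := by
    by_contra hcon
    push Not at hcon
    apply hx
    have h2 : x ∈ (⨅ i : ℕ, Ideal.span {u} ^ i : Ideal S) := by
      rw [Ideal.mem_iInf]
      intro i
      rw [Ideal.span_singleton_pow, Ideal.mem_span_singleton]
      exact hcon i
    rw [Ideal.iInf_pow_eq_bot_of_isLocalRing] at h2
    · simpa using h2
    · rw [Ne, Ideal.span_singleton_eq_top]
      exact hu
  have h3 : Nat.find h1 ≠ 0 := by
    intro h
    have := Nat.find_spec h1
    rw [h] at this
    simp at this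
  obtain ⟨n, hn⟩ := Nat.exists_eq_succ_of_ne_zero h3
  have h4 : u ^ n ∣ x := by
    by_contra hcon
    exact Nat.find_min h1 (by omega) hcon
  obtain ⟨y, rfl⟩ := h4
  refine ⟨n, y, rfl, ?_⟩
  rintro ⟨z, rfl⟩
  have := Nat.find_spec h1
  rw [hn] at this
  exact this ⟨z, by rw [Nat.succ_eq_add_one, pow_succ, mul_assoc]⟩

theorem isDomain_of_prime_element {S : Type*} [CommRing S] [IsNoetherianRing S] [IsLocalRing S]
    {u : S} (hu : u ∈ maximalIdeal S) (hreg : u ∈ nonZeroDivisors S)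
    (hp : (Ideal.span {u}).IsPrime) : IsDomain S := by
  have : NoZeroDivisors S := by
    refine ⟨fun {x y} hxy => ?_⟩
    by_contra hcon
    push Not at hcon
    obtain ⟨n, x', rfl, hx'⟩ := exists_pow_dvd_max hu hcon.1
    obtain ⟨m, y', rfl, hy'⟩ := exists_pow_dvd_max hu hcon.2
    have h1 : (x' * y') * u ^ (n + m) = 0 := by rw [← hxy]; ring
    have h2 : x' * y' = 0 := (mem_nonZeroDivisors_iff_right.1 (pow_mem hreg _)) _ h1
    have h3 : x' * y' ∈ Ideal.span {u} := by rw [h2]; exact zero_mem _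
    rcases hp.mem_or_mem h3 with h | h <;> rw [Ideal.mem_span_singleton] at h
    · exact hx' h
    · exact hy' h
  exact NoZeroDivisors.to_isDomain S

theorem ndom_of_principal {T : Type*} [CommRing T] [IsNoetherianRing T] [IsLocalRing T] {π : T}
    (h : maximalIdeal T = Ideal.span {π}) (hreg : π ∈ nonZeroDivisors T) :
    NDom T := by
  have hπ : π ∈ maximalIdeal T := by rw [h]; exact Ideal.mem_span_singleton_self π
  have hd : IsDomain T := isDomain_of_prime_element hπ hreg (by rw [← h]; infer_instance)
  have hf : ¬ IsField T := by
    intro hf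
    have := (IsLocalRing.isField_iff_maximalIdeal_eq).1 hf
    rw [this] at hπ
    exact nonZeroDivisors.ne_zero hreg (by simpa using hπ)
  have := ((IsDiscreteValuationRing.TFAE T hf).out 0 4 : IsDiscreteValuationRing T ↔ (maximalIdeal T).IsPrincipal).2 ⟨π, h⟩
  exact ⟨inferInstance, inferInstance⟩

/-- depth one in a normal local domain forces a principal maximal ideal. -/
theorem principal_of_assMod {V : Type*} [CommRing V] [IsNoetherianRing V] [IsLocalRing V]
    (hV : NDom V) {t : V} (ht : t ≠ 0) (h : AssMod (maximalIdeal V) (Ideal.span {t})) :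
    ∃ π : V, π ≠ 0 ∧ maximalIdeal V = Ideal.span {π} := by
  obtain ⟨hd, hi⟩ := hV
  have htm : t ∈ maximalIdeal V := h.le (Ideal.mem_span_singleton_self t)
  obtain ⟨y, hy, hm⟩ := (assMod_max_iff _).1 h
  by_cases hc : ∃ a ∈ maximalIdeal V, ∃ w, IsUnit w ∧ a * y = t * w
  · obtain ⟨a, ha, w, hw, haw⟩ := hc
    refine ⟨a, ?_, le_antisymm ?_ ?_⟩
    · rintro rfl
      rw [zero_mul] at haw
      rcases mul_eq_zero.1 haw.symm with h | h
      · exact ht h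
      · exact hw.ne_zero h
    · intro b hb
      obtain ⟨c, hc⟩ := Ideal.mem_span_singleton.1 (hm b hb)
      rw [Ideal.mem_span_singleton]
      rw [← hw.dvd_mul_right]
      refine ⟨c, mul_left_cancel₀ ht ?_⟩
      calc t * (b * w) = b * (t * w) := by ring
        _ = a * (b * y) := by rw [← haw]; ring
        _ = t * (a * c) := by rw [hc]; ring
    · rw [Ideal.span_singleton_le_iff_mem]; exact ha
  · exfalso
    push Not at hc
    let K := FractionRing V
    have ht' : algebraMap V K t ≠ 0 := by simpa [K] using ht
    let z : K := algebraMap V K y / algebraMap V K t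
    let N : Submodule V K := Submodule.map (Algebra.linearMap V K) (maximalIdeal V)
    have hN : N ≠ ⊥ := by
      intro hN
      have : algebraMap V K t ∈ N := ⟨t, htm, rfl⟩
      rw [hN] at this
      exact ht' (by simpa using this)
    have hNfg : N.FG := Submodule.FG.map _ ((isNoetherianRing_iff_ideal_fg V).1 inferInstance _)
    have hz : IsIntegral V z := by
      refine isIntegral_of_smul_mem_submodule N hN hNfg z ?_
      rintro _ ⟨a, ha, rfl⟩
      obtain ⟨c, hc'⟩ := Ideal.mem_span_singleton.1 (hm a ha)
      have hcm : c ∈ maximalIdeal V := by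
        by_contra hcon
        exact hc a ha c (by simpa using hcon) hc'
      refine ⟨c, hcm, ?_⟩
      simp only [Algebra.linearMap_apply, smul_eq_mul, z]
      rw [div_mul_eq_mul_div, eq_div_iff ht', ← map_mul, ← map_mul]
      congr 1
      rw [mul_comm c, ← hc', mul_comm]
    obtain ⟨w, hw⟩ := (isIntegrallyClosed_iff K).1 hi hz
    apply hy
    rw [Ideal.mem_span_singleton]
    refine ⟨w, ?_⟩
    simp only [z] at hw
    rw [eq_div_iff ht', ← map_mul] at hw
    rw [mul_comm]
    exact (IsFractionRing.injective V K hw).symm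

/-- lifting of associated primes modulo a regular element, local version -/
theorem AssMod.lift_local {S : Type*} [CommRing S] [IsNoetherianRing S] [IsLocalRing S]
    {q J : Ideal S} (h : AssMod q J) {u : S} (hu : u ∈ maximalIdeal S)
    (hreg : ∀ x, u * x ∈ J → x ∈ J) (hmin : maximalIdeal S ∈ (q ⊔ Ideal.span {u}).minimalPrimes) :
    AssMod (maximalIdeal S) (J ⊔ Ideal.span {u}) := by
  obtain ⟨hq, x, hx⟩ := h
  let N : Ideal S := J.colon q
  have hN : ∀ y, y ∈ N ↔ ∀ p ∈ q, y * p ∈ J := by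
    intro y
    simp only [N]
    rw [Submodule.mem_colon]
    rfl
  have hxN : x ∈ N := (hN x).2 fun p hp => by rw [mul_comm]; exact (hx p).1 hp
  have hJN : J ≤ N := fun j hj => (hN j).2 fun p _ => J.mul_mem_right _ hj
  have hxJ : x ∉ J := by
    intro hxJ
    exact hq.ne_top ((Ideal.eq_top_iff_one _).2 ((hx 1).2 (by rwa [one_mul])))
  have hnot : ¬ N ≤ J ⊔ Ideal.span {u} := by
    intro hle
    have h1 : N ≤ J ⊔ maximalIdeal S • N := by
      intro n hn
      obtain ⟨j, hj, w, hw, rfl⟩ := Submodule.mem_sup.1 (hle hn)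
      obtain ⟨s, rfl⟩ := Ideal.mem_span_singleton'.1 hw
      refine Submodule.add_mem_sup hj ?_
      rw [mul_comm]
      refine Submodule.smul_mem_smul hu ?_
      rw [hN] at hn ⊢
      intro p hp
      apply hreg
      have := J.sub_mem (hn p hp) (J.mul_mem_right p hj)
      convert this using 1
      ring
    have h2 := Submodule.le_of_le_smul_of_le_jacobson_bot
      ((isNoetherianRing_iff_ideal_fg S).1 inferInstance N)
      (IsLocalRing.maximalIdeal_le_jacobson _) h1
    exact hxJ (h2 hxN)
  obtain ⟨n, hnN, hn⟩ := Set.not_subset.1 hnot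
  -- m^k ≤ q + u
  have hrad : maximalIdeal S ≤ (q ⊔ Ideal.span {u}).radical := by
    rw [Ideal.radical_eq_sInf]
    refine le_sInf fun P hP => ?_
    exact (hmin.2 hP.symm (le_maximalIdeal hP.2.ne_top))
  obtain ⟨k, hk⟩ := Ideal.exists_pow_le_of_le_radical_of_fg hrad
    ((isNoetherianRing_iff_ideal_fg S).1 inferInstance _)
  obtain ⟨Q, hQ, hQ'⟩ := exists_assMod _ _ hn
  have hmQ : maximalIdeal S ≤ Q := by
    have := hQ.1
    refine Ideal.IsPrime.le_of_pow_le (n := k) (hk.trans ?_)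
    intro y hy
    apply hQ'
    obtain ⟨p, hp, w, hw, rfl⟩ := Submodule.mem_sup.1 hy
    rw [add_mul]
    refine Submodule.add_mem_sup ?_ (Ideal.mul_mem_right _ _ hw)
    rw [mul_comm]
    exact (hN n).1 hnN p hp
  have : Q = maximalIdeal S := le_antisymm (le_maximalIdeal hQ.1.ne_top) hmQ
  rwa [← this]

theorem regular_localization {S : Type*} [CommRing S] {J : Ideal S} {u : S}
    (hreg : ∀ x, u * x ∈ J → x ∈ J) (M : Submonoid S) (T : Type*) [CommRing T] [Algebra S T]
    [IsLocalization M T] (x : T) (hx : algebraMap S T u * x ∈ J.map (algebraMap S T)) :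
    x ∈ J.map (algebraMap S T) := by
  obtain ⟨x, s, rfl⟩ := IsLocalization.exists_mk'_eq M x
  rw [IsLocalization.mul_mk'_eq_mk'_of_mul, IsLocalization.mk'_mem_map_algebraMap_iff] at hx
  obtain ⟨m, hm, h⟩ := hx
  rw [IsLocalization.mk'_mem_map_algebraMap_iff]
  exact ⟨m, hm, hreg _ (by convert h using 1; ring)⟩

theorem minimalPrimes_localization {S : Type*} [CommRing S] {I P : Ideal S} [P.IsPrime]
    (hP : P ∈ I.minimalPrimes) :
    maximalIdeal (Localization.AtPrime P) ∈
      (I.map (algebraMap S (Localization.AtPrime P))).minimalPrimes := by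
  refine ⟨⟨inferInstance, ?_⟩, ?_⟩
  · rw [← Localization.AtPrime.map_eq_maximalIdeal]
    exact Ideal.map_mono hP.1.2
  · intro Q ⟨hQ, hIQ⟩ hle
    rw [← Localization.AtPrime.map_eq_maximalIdeal, Ideal.map_le_iff_le_comap]
    refine hP.2 ⟨inferInstance, Ideal.map_le_iff_le_comap.1 hIQ⟩ ?_
    have := Ideal.comap_mono (f := algebraMap S (Localization.AtPrime P)) hle
    exact this.trans (le_of_eq Localization.AtPrime.comap_maximalIdeal)

theorem AssMod.lift {S : Type*} [CommRing S] [IsNoetherianRing S]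
    {q J P : Ideal S} (h : AssMod q J) {u : S}
    (hreg : ∀ x, u * x ∈ J → x ∈ J) (hP : P ∈ (q ⊔ Ideal.span {u}).minimalPrimes) :
    AssMod P (J ⊔ Ideal.span {u}) := by
  have := hP.1.1
  let T := Localization.AtPrime P
  have : IsNoetherianRing T := IsLocalization.isNoetherianRing P.primeCompl T inferInstance
  have h1 := h.localization P (le_sup_left.trans hP.1.2) T
  have h2 := h1.lift_local (u := algebraMap S T u) (by
    rw [← Localization.AtPrime.map_eq_maximalIdeal]
    exact Ideal.mem_map_of_mem _ (hP.1.2 (Ideal.mem_sup_right (Ideal.mem_span_singleton_self u))))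
    (regular_localization hreg P.primeCompl T) (by
      have := minimalPrimes_localization hP
      rwa [Ideal.map_sup, Ideal.map_span, Set.image_singleton] at this)
  refine AssMod.of_localization T ?_
  rwa [Ideal.map_sup, Ideal.map_span, Set.image_singleton]

end GN

namespace GN

theorem isLocalRing_quot_of_le {T : Type*} [CommRing T] [IsLocalRing T] {I : Ideal T}
    (h : I ≤ maximalIdeal T) : IsLocalRing (T ⧸ I) := by
  have : Nontrivial (T ⧸ I) := Ideal.Quotient.nontrivial_iff.2 (fun hI => by
    rw [hI, top_le_iff] at h
    exact (maximalIdeal.isMaximal T).ne_top h)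
  exact IsLocalRing.of_surjective' (Ideal.Quotient.mk I) Ideal.Quotient.mk_surjective

theorem ndom_quot_localization {S : Type*} [CommRing S] {I P : Ideal S} [P.IsPrime]
    (hIP : I ≤ P) (h : IsNormalRing (S ⧸ I)) (T : Type*) [CommRing T] [Algebra S T]
    [IsLocalization.AtPrime T P] : NDom (T ⧸ I.map (algebraMap S T)) := by
  have h1 := isNormalRing_of_isLocalization (Algebra.algebraMapSubmonoid (S ⧸ I) P.primeCompl)
    (T ⧸ I.map (algebraMap S T)) h
  have : IsLocalRing T := IsLocalization.AtPrime.isLocalRing T P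
  have : IsLocalRing (T ⧸ I.map (algebraMap S T)) := by
    apply isLocalRing_quot_of_le
    rw [← IsLocalization.AtPrime.map_eq_maximalIdeal P T]
    exact Ideal.map_mono hIP
  exact IsNormalRing.ndom h1

theorem maximalIdeal_quot {T : Type*} [CommRing T] [IsLocalRing T] {I : Ideal T}
    [IsLocalRing (T ⧸ I)] :
    maximalIdeal (T ⧸ I) = (maximalIdeal T).map (Ideal.Quotient.mk I) := by
  have hI : I ≤ maximalIdeal T := IsLocalRing.le_maximalIdeal (fun h => by
    have := Ideal.Quotient.nontrivial_iff.1 (inferInstance : Nontrivial (T ⧸ I))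
    exact this h)
  symm
  rcases Ideal.map_eq_top_or_isMaximal_of_surjective (Ideal.Quotient.mk I)
    Ideal.Quotient.mk_surjective (maximalIdeal.isMaximal T) with h | h
  · have := congrArg (Ideal.comap (Ideal.Quotient.mk I)) h
    rw [Ideal.comap_map_of_surjective _ Ideal.Quotient.mk_surjective,
      ← RingHom.ker_eq_comap_bot, Ideal.mk_ker, sup_eq_left.2 hI, Ideal.comap_top] at this
    exact absurd this (maximalIdeal.isMaximal T).ne_top
  · exact IsLocalRing.eq_maximalIdeal h

theorem AssMod.quot_max {T : Type*} [CommRing T] [IsLocalRing T] {I J : Ideal T}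
    [IsLocalRing (T ⧸ I)] (hI : I ≤ J) (h : AssMod (maximalIdeal T) J) :
    AssMod (maximalIdeal (T ⧸ I)) (J.map (Ideal.Quotient.mk I)) := by
  obtain ⟨x, hx, hm⟩ := (assMod_max_iff _).1 h
  have key : ∀ z, Ideal.Quotient.mk I z ∈ J.map (Ideal.Quotient.mk I) ↔ z ∈ J := by
    intro z
    rw [← Ideal.mem_comap, Ideal.comap_map_of_surjective _ Ideal.Quotient.mk_surjective,
      ← RingHom.ker_eq_comap_bot, Ideal.mk_ker, sup_eq_left.2 hI]
  refine (assMod_max_iff _).2 ⟨Ideal.Quotient.mk I x, by rwa [key], ?_⟩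
  intro y hy
  rw [maximalIdeal_quot] at hy
  obtain ⟨y, hy', rfl⟩ := (Ideal.mem_map_iff_of_surjective _ Ideal.Quotient.mk_surjective).1 hy
  rw [← map_mul, key]
  exact hm y hy'

theorem prime_span_of_ndom_quot {S : Type*} [CommRing S] {u : S} (h : NDom (S ⧸ Ideal.span {u})) :
    (Ideal.span {u}).IsPrime :=
  (Ideal.Quotient.isDomain_iff_prime _).1 h.1

/-- one-step version of N4 -/
theorem principal_of_cut {T : Type*} [CommRing T] [IsNoetherianRing T] [IsLocalRing T] {u : T}
    (hu : u ∈ maximalIdeal T) (hreg : u ∈ nonZeroDivisors T) (hN : NDom (T ⧸ Ideal.span {u}))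
    {Q : Ideal T} (huQ : u ∉ Q) {s : T} (hs : s ≠ 0) (hQ : AssMod Q (Ideal.span {s}))
    (hmin : maximalIdeal T ∈ (Q ⊔ Ideal.span {u}).minimalPrimes) :
    ∃ g, Q = Ideal.span {g} := by
  have hp := prime_span_of_ndom_quot hN
  have hd : IsDomain T := isDomain_of_prime_element hu hreg hp
  have hu0 : u ≠ 0 := nonZeroDivisors.ne_zero hreg
  have hQp := hQ.1
  obtain ⟨n, s', rfl, hs'⟩ := exists_pow_dvd_max hu hs
  have hQ' : AssMod Q (Ideal.span {s'}) := by
    let V := Localization.AtPrime Q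
    have h1 := hQ.localization Q le_rfl V
    rw [Localization.AtPrime.map_eq_maximalIdeal] at h1
    refine AssMod.of_localization V ?_
    convert h1 using 1
    rw [Ideal.map_span, Ideal.map_span, Set.image_singleton, Set.image_singleton, map_mul, map_pow]
    refine (Ideal.span_singleton_mul_left_unit ?_ _).symm
    exact (IsLocalization.map_units V (⟨u, huQ⟩ : Q.primeCompl)).pow n
  have hreg' : ∀ x, u * x ∈ Ideal.span {s'} → x ∈ Ideal.span {s'} := by
    intro x hx
    obtain ⟨y, hy⟩ := Ideal.mem_span_singleton.1 hx
    have : s' * y ∈ Ideal.span {u} := by rw [← hy]; exact Ideal.mem_span_singleton.2 ⟨x, rfl⟩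
    rcases hp.mem_or_mem this with h | h <;> rw [Ideal.mem_span_singleton] at h
    · exact absurd h hs'
    · obtain ⟨z, rfl⟩ := h
      rw [Ideal.mem_span_singleton]
      exact ⟨z, mul_left_cancel₀ hu0 (by rw [hy]; ring)⟩
  have h2 := hQ'.lift_local hu hreg' hmin
  have : IsLocalRing (T ⧸ Ideal.span {u}) :=
    isLocalRing_quot_of_le ((Ideal.span_singleton_le_iff_mem _).2 hu)
  have h3 := h2.quot_max (I := Ideal.span {u}) le_sup_right
  rw [Ideal.map_sup, Ideal.map_quotient_self, sup_bot_eq, Ideal.map_span, Set.image_singleton] at h3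
  have hne : Ideal.Quotient.mk (Ideal.span {u}) s' ≠ 0 := by
    rw [Ne, Ideal.Quotient.eq_zero_iff_mem, Ideal.mem_span_singleton]; exact hs'
  obtain ⟨π, hπ0, hπ⟩ := principal_of_assMod hN hne h3
  have := hN.1
  have hpid := ((tfae_of_isNoetherianRing_of_isLocalRing_of_isDomain (T ⧸ Ideal.span {u})).out 0 4 :
    IsPrincipalIdealRing (T ⧸ Ideal.span {u}) ↔ (maximalIdeal (T ⧸ Ideal.span {u})).IsPrincipal).2 ⟨π, hπ⟩
  obtain ⟨gb, hgb⟩ := (hpid.principal (Q.map (Ideal.Quotient.mk (Ideal.span {u})))).principal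
  have hgm : gb ∈ Q.map (Ideal.Quotient.mk (Ideal.span {u})) := by
    rw [hgb]; exact Submodule.mem_span_singleton_self gb
  obtain ⟨g, hg, rfl⟩ := (Ideal.mem_map_iff_of_surjective _ Ideal.Quotient.mk_surjective).1 hgm
  refine ⟨g, le_antisymm ?_ ((Ideal.span_singleton_le_iff_mem _).2 hg)⟩
  have hle : Q ≤ Ideal.span {g} ⊔ Ideal.span {u} • Q := by
    intro x hx
    have h4 := Ideal.mem_map_of_mem (Ideal.Quotient.mk (Ideal.span {u})) hx
    rw [hgb] at h4
    obtain ⟨c, hc⟩ := Submodule.mem_span_singleton.1 h4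
    obtain ⟨c, rfl⟩ := Ideal.Quotient.mk_surjective c
    rw [smul_eq_mul, ← map_mul, Ideal.Quotient.eq, Ideal.mem_span_singleton] at hc
    obtain ⟨y, hy⟩ := hc
    have h5 : u * y ∈ Q := by rw [← hy]; exact Q.sub_mem (Q.mul_mem_left _ hg) hx
    have h6 : y ∈ Q := (hQp.mem_or_mem h5).resolve_left huQ
    have : x = c * g - u * y := by rw [← hy]; ring
    rw [this]
    refine Submodule.sub_mem _ (Submodule.mem_sup_left (Ideal.mul_mem_left _ _
      (Ideal.mem_span_singleton_self g))) (Submodule.mem_sup_right ?_)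
    exact Submodule.smul_mem_smul (Ideal.mem_span_singleton_self u) h6
  refine Submodule.le_of_le_smul_of_le_jacobson_bot (IsNoetherian.noetherian Q) ?_ hle
  rw [IsLocalRing.jacobson_eq_maximalIdeal _ bot_ne_top]
  exact (Ideal.span_singleton_le_iff_mem _).2 hu

theorem ndom_of_cut {S : Type*} [CommRing S] [IsNoetherianRing S] [IsLocalRing S] {u : S}
    (hu : u ∈ maximalIdeal S) (hreg : u ∈ nonZeroDivisors S) (hN : NDom (S ⧸ Ideal.span {u})) :
    NDom S := by
  have hp := prime_span_of_ndom_quot hN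
  have hd : IsDomain S := isDomain_of_prime_element hu hreg hp
  have hu0 : u ≠ 0 := nonZeroDivisors.ne_zero hreg
  refine ndom_of_dep1 S (fun Q _ _ => IsLocalization.isDomain_localization
    (Ideal.primeCompl_le_nonZeroDivisors Q)) ?_
  intro Q hQp s hs hQ
  have hs0 : s ≠ 0 := nonZeroDivisors.ne_zero hs
  have hsQ : s ∈ Q := hQ.le (Ideal.mem_span_singleton_self s)
  have hinj : Function.Injective (algebraMap S (Localization.AtPrime Q)) :=
    IsLocalization.injective _ (Ideal.primeCompl_le_nonZeroDivisors Q)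
  have hdQ : IsDomain (Localization.AtPrime Q) := IsLocalization.isDomain_localization
    (Ideal.primeCompl_le_nonZeroDivisors Q)
  have : IsNoetherianRing (Localization.AtPrime Q) :=
    IsLocalization.isNoetherianRing Q.primeCompl _ inferInstance
  by_cases huQ : u ∈ Q
  · have h1 := hQ.change hs hreg huQ
    obtain ⟨_, x, hx⟩ := h1
    have hQu : Q = Ideal.span {u} := by
      refine le_antisymm ?_ ((Ideal.span_singleton_le_iff_mem _).2 huQ)
      intro y hy
      rcases hp.mem_or_mem ((hx y).1 hy) with h | h
      · exact h
      · exact absurd ((hx 1).2 (by simpa using h)) (fun h => hQp.ne_top (Q.eq_top_iff_one.2 h))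
    refine ndom_of_principal (π := algebraMap _ _ u) ?_ ?_
    · rw [← Localization.AtPrime.map_eq_maximalIdeal]
      refine Eq.trans ?_ ((Ideal.map_span _ _).trans (by rw [Set.image_singleton]))
      rw [← hQu]
    · rw [mem_nonZeroDivisors_iff_ne_zero]
      exact fun h => hu0 (hinj (by rw [h, map_zero]))
  · obtain ⟨P, hPmin, hPm⟩ := Ideal.exists_minimalPrimes_le (I := Q ⊔ Ideal.span {u})
      (J := maximalIdeal S) (sup_le (IsLocalRing.le_maximalIdeal hQp.ne_top)
        ((Ideal.span_singleton_le_iff_mem _).2 hu))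
    have hPp := hPmin.1.1
    have hQP : Q ≤ P := le_sup_left.trans hPmin.1.2
    have huP : u ∈ P := hPmin.1.2 (Ideal.mem_sup_right (Ideal.mem_span_singleton_self u))
    let T := Localization.AtPrime P
    have : IsNoetherianRing T := IsLocalization.isNoetherianRing P.primeCompl T inferInstance
    have hinjT : Function.Injective (algebraMap S T) :=
      IsLocalization.injective _ (Ideal.primeCompl_le_nonZeroDivisors P)
    have hdT : IsDomain T := IsLocalization.isDomain_localization
      (Ideal.primeCompl_le_nonZeroDivisors P)
    have hNT := ndom_quot_localization ((Ideal.span_singleton_le_iff_mem _).2 huP)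
      hN.isNormalRing T
    rw [Ideal.map_span, Set.image_singleton] at hNT
    have hQT := hQ.localization P hQP T
    rw [Ideal.map_span, Set.image_singleton] at hQT
    have hcom : (Q.map (algebraMap S T)).comap (algebraMap S T) = Q :=
      IsLocalization.comap_map_of_isPrime_disjoint P.primeCompl T hQp
        (Set.disjoint_left.2 fun x hx hxQ => hx (hQP hxQ))
    have hmin := minimalPrimes_localization hPmin
    rw [Ideal.map_sup, Ideal.map_span, Set.image_singleton] at hmin
    obtain ⟨g, hg⟩ := principal_of_cut (T := T) (u := algebraMap S T u)
      (by rw [← Localization.AtPrime.map_eq_maximalIdeal]; exact Ideal.mem_map_of_mem _ huP)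
      (mem_nonZeroDivisors_iff_ne_zero.2 fun h => hu0 (hinjT (by rw [h, map_zero])))
      hNT (Q := Q.map (algebraMap S T)) (fun h => huQ (by rw [← hcom]; exact h))
      (fun h => hs0 (hinjT (by rw [h, map_zero]))) hQT hmin
    obtain ⟨⟨a, b⟩, hab⟩ := IsLocalization.surj P.primeCompl g
    have hga : Q.map (algebraMap S T) = Ideal.span {algebraMap S T a} := by
      rw [hg, ← hab]
      exact (Ideal.span_singleton_mul_right_unit (IsLocalization.map_units T b) g).symm
    have haQ : a ∈ Q := by
      rw [← hcom, Ideal.mem_comap, hga]; exact Ideal.mem_span_singleton_self _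
    refine ndom_of_principal (π := algebraMap _ _ a) ?_ ?_
    · rw [← Localization.AtPrime.map_eq_maximalIdeal]
      refine le_antisymm ?_ ?_
      · rw [Ideal.map_le_iff_le_comap]
        intro y hy
        have : algebraMap S T y ∈ Ideal.map (algebraMap S T) (Ideal.span {a}) := by
          rw [Ideal.map_span, Set.image_singleton, ← hga]; exact Ideal.mem_map_of_mem _ hy
        rw [IsLocalization.algebraMap_mem_map_algebraMap_iff P.primeCompl] at this
        obtain ⟨c, hc, hcy⟩ := this
        obtain ⟨d, hd⟩ := Ideal.mem_span_singleton.1 hcy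
        rw [Ideal.mem_comap, Ideal.mem_span_singleton]
        have hcu : IsUnit (algebraMap S (Localization.AtPrime Q) c) :=
          IsLocalization.map_units (Localization.AtPrime Q) (⟨c, fun h => hc (hQP h)⟩ : Q.primeCompl)
        rw [← hcu.dvd_mul_left, ← map_mul, hd]
        exact map_dvd _ ⟨d, rfl⟩
      · rw [Ideal.span_singleton_le_iff_mem]; exact Ideal.mem_map_of_mem _ haQ
    · rw [mem_nonZeroDivisors_iff_ne_zero]
      intro h
      have ha0 : a = 0 := hinj (by rw [h, map_zero])
      rw [ha0, map_zero, Ideal.span_singleton_eq_bot.2 rfl] at hga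
      have : algebraMap S T s ∈ Q.map (algebraMap S T) := Ideal.mem_map_of_mem _ hsQ
      rw [hga] at this
      exact hs0 (hinjT (by simpa using this))

end GN

namespace GN

theorem flat_colon {V T : Type*} [CommRing V] [CommRing T] [Algebra V T] [Module.Flat V T]
    {J I : Ideal V} {y : V} (hI : ∀ z, z * y ∈ J → z ∈ I) {t : T}
    (h : algebraMap V T y * t ∈ J.map (algebraMap V T)) : t ∈ I.map (algebraMap V T) := by
  classical
  obtain ⟨n, a, b, hab⟩ : ∃ (n : ℕ) (a : Fin n → V) (b : Fin n → T), (∀ i, a i ∈ J) ∧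
      algebraMap V T y * t = ∑ i, algebraMap V T (a i) * b i := by
    rw [Ideal.map, Ideal.span, Submodule.mem_span_image_iff_exists_fun] at h
    obtain ⟨s, hs, c, hc⟩ := h
    let e := s.equivFin
    refine ⟨s.card, fun i => (e.symm i : V), fun i => c (e.symm i), fun i => hs (e.symm i).2, ?_⟩
    rw [← hc, ← e.symm.sum_comp]
    exact Finset.sum_congr rfl fun i _ => by rw [smul_eq_mul, mul_comm]
  obtain ⟨ha, hsum⟩ := hab
  let f : Option (Fin n) → V := fun o => o.elim y (fun i => - a i)
  let x : Option (Fin n) → T := fun o => o.elim t b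
  have hrel : ∑ o, f o • x o = 0 := by
    rw [Fintype.sum_option]
    simp only [f, x, Option.elim, Algebra.smul_def, map_neg, neg_mul, Finset.sum_neg_distrib]
    rw [hsum, add_neg_cancel]
  obtain ⟨k, c, z, h1, h2⟩ := Module.Flat.isTrivialRelation_of_sum_smul_eq_zero (R := V) (M := T) (f := f) (x := x) hrel
  have ht : t = ∑ j, c none j • z j := h1 none
  rw [ht]
  refine Ideal.sum_mem _ fun j _ => ?_
  rw [Algebra.smul_def]
  refine Ideal.mul_mem_right _ _ (Ideal.mem_map_of_mem _ (hI _ ?_))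
  have := h2 j
  rw [Fintype.sum_option] at this
  simp only [f, Option.elim] at this
  have h3 : c none j * y = ∑ i, a i * c (some i) j := by
    rw [mul_comm, eq_neg_of_add_eq_zero_left this, ← Finset.sum_neg_distrib]
    exact Finset.sum_congr rfl fun i _ => by ring
  rw [h3]
  exact Ideal.sum_mem _ fun i _ => Ideal.mul_mem_right _ _ (ha i)

theorem flat_regular {V T : Type*} [CommRing V] [CommRing T] [Algebra V T] [Module.Flat V T]
    {J : Ideal V} {u : V} (hu : ∀ x, u * x ∈ J → x ∈ J) (t : T)
    (h : algebraMap V T u * t ∈ J.map (algebraMap V T)) : t ∈ J.map (algebraMap V T) :=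
  flat_colon (fun z hz => hu z (by rwa [mul_comm])) h

theorem flat_nzd {V T : Type*} [CommRing V] [CommRing T] [Algebra V T] [Module.Flat V T]
    {u : V} (hu : u ∈ nonZeroDivisors V) : algebraMap V T u ∈ nonZeroDivisors T := by
  rw [mem_nonZeroDivisors_iff_right]
  intro t ht
  have := flat_regular (J := (⊥ : Ideal V)) (u := u) (fun x hx => by
    rw [Ideal.mem_bot] at hx ⊢
    exact mem_nonZeroDivisors_iff_right.1 hu x (by rwa [mul_comm])) t
      (by rw [Ideal.map_bot, Ideal.mem_bot, mul_comm]; exact ht)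
  simpa using this

section
variable {V T : Type*} [CommRing V] [CommRing T] [Algebra V T] [Module.Flat V T]
  [IsNoetherianRing V] [IsLocalRing V] [IsLocalRing T]
  [IsLocalHom (algebraMap V T)]

theorem map_max_le : (maximalIdeal V).map (algebraMap V T) ≤ maximalIdeal T := by
  rw [Ideal.map_le_iff_le_comap]
  intro x hx
  exact (map_mem_nonunits_iff (algebraMap V T) x).2 hx

theorem flatAss_base {J : Ideal V} (h : AssMod (maximalIdeal T) (J.map (algebraMap V T))) :
    AssMod (maximalIdeal V) J := by
  by_contra hcon
  obtain ⟨u, hu, hreg⟩ := exists_regular J (maximalIdeal V) (fun Q hQ hle => by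
    have := (maximalIdeal.isMaximal V).eq_of_le hQ.1.ne_top hle
    exact hcon (this ▸ hQ))
  obtain ⟨x, hx, hm⟩ := (assMod_max_iff _).1 h
  exact hx (flat_regular hreg x (hm _ (map_max_le (V := V) (Ideal.mem_map_of_mem _ hu))))

theorem flatAss_fiber {J : Ideal V} (h : AssMod (maximalIdeal T) (J.map (algebraMap V T))) :
    AssMod (maximalIdeal T) ((maximalIdeal V).map (algebraMap V T)) := by
  induction J using IsNoetherian.induction with
  | hgt J IH =>
  have hb := flatAss_base h
  obtain ⟨y, hy, hmy⟩ := (assMod_max_iff _).1 hb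
  obtain ⟨x, hx, hm⟩ := (assMod_max_iff _).1 h
  have hJ' : J < J ⊔ Ideal.span {y} := by
    refine lt_of_le_of_ne le_sup_left fun he => hy ?_
    rw [he]; exact Ideal.mem_sup_right (Ideal.mem_span_singleton_self y)
  by_cases hxJ : x ∈ Ideal.map (algebraMap V T) (J ⊔ Ideal.span {y})
  · rw [Ideal.map_sup, Ideal.map_span, Set.image_singleton] at hxJ
    obtain ⟨j, hj, w, hw, rfl⟩ := Submodule.mem_sup.1 hxJ
    obtain ⟨t, rfl⟩ := Ideal.mem_span_singleton.1 hw
    refine (assMod_max_iff _).2 ⟨t, fun ht => hx ?_, fun z hz => ?_⟩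
    · refine Ideal.add_mem _ hj ?_
      rw [mul_comm]
      have : (maximalIdeal V).map (algebraMap V T) ≤
          Submodule.comap (LinearMap.mulRight T (algebraMap V T y)) (Ideal.map (algebraMap V T) J) := by
        rw [Ideal.map, Ideal.span, Submodule.span_le]
        rintro _ ⟨a, ha, rfl⟩
        show algebraMap V T a * algebraMap V T y ∈ Ideal.map (algebraMap V T) J
        rw [← map_mul]
        exact Ideal.mem_map_of_mem _ (hmy a ha)
      exact this ht
    · refine flat_colon (y := y) (J := J) (fun a ha => ?_) ?_
      · by_contra hcon
        have hau : IsUnit a := by simpa using hcon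
        exact hy ((Ideal.unit_mul_mem_iff_mem _ hau).1 ha)
      · have h1 := hm z hz
        rw [mul_add] at h1
        have h2 := (Ideal.add_mem_iff_right _ (Ideal.mul_mem_left _ z hj)).1 h1
        convert h2 using 1; ring
  · exact IH _ hJ' ((assMod_max_iff _).2 ⟨x, hxJ, fun z hz =>
      Ideal.map_mono le_sup_left (hm z hz)⟩)

theorem eq_max_of_ass_fiber (hF : IsDomain (T ⧸ (maximalIdeal V).map (algebraMap V T)))
    (h : AssMod (maximalIdeal T) ((maximalIdeal V).map (algebraMap V T))) :
    maximalIdeal T = (maximalIdeal V).map (algebraMap V T) := by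
  have hp := (Ideal.Quotient.isDomain_iff_prime _).1 hF
  obtain ⟨x, hx, hm⟩ := (assMod_max_iff _).1 h
  exact le_antisymm (fun z hz => (hp.mem_or_mem (hm z hz)).resolve_right hx) map_max_le

theorem ndom_of_max_bot {R : Type*} [CommRing R] [IsLocalRing R] (h : maximalIdeal R = ⊥) :
    NDom R := by
  have hf := IsLocalRing.isField_iff_maximalIdeal_eq.2 h
  letI := hf.toField
  exact NDom.of_field R

theorem ndom_of_flat_local [IsNoetherianRing T] (hV : NDom V)
    (hF : NDom (T ⧸ (maximalIdeal V).map (algebraMap V T))) (hd : Dep1 T) : NDom T := by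
  have hVd := hV.1
  by_cases hm : maximalIdeal V = ⊥
  · rw [hm, Ideal.map_bot] at hF
    exact hF.of_equiv (RingEquiv.quotientBot T)
  rcases hd with h | ⟨s, hs, h⟩
  · exfalso
    have h0 : AssMod (maximalIdeal T) ((⊥ : Ideal V).map (algebraMap V T)) := by
      rwa [Ideal.map_bot]
    obtain ⟨x, hx, hm'⟩ := (assMod_max_iff _).1 (flatAss_base h0)
    refine hm (eq_bot_iff.2 fun y hy => ?_)
    have := hm' y hy
    rw [Ideal.mem_bot] at this hx ⊢
    exact (mul_eq_zero.1 this).resolve_right hx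
  · obtain ⟨t, htm, ht0⟩ := Submodule.exists_mem_ne_zero_of_ne_bot hm
    have htn : algebraMap V T t ∈ nonZeroDivisors T := flat_nzd (mem_nonZeroDivisors_iff_ne_zero.2 ht0)
    have h1 := h.change hs htn (map_max_le (Ideal.mem_map_of_mem _ htm))
    have h2 : AssMod (maximalIdeal T) ((Ideal.span {t}).map (algebraMap V T)) := by
      rwa [Ideal.map_span, Set.image_singleton]
    obtain ⟨π, hπ0, hπ⟩ := principal_of_assMod hV ht0 (flatAss_base h2)
    have h3 := eq_max_of_ass_fiber hF.1 (flatAss_fiber h2)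
    rw [hπ, Ideal.map_span, Set.image_singleton] at h3
    exact ndom_of_principal h3 (flat_nzd (mem_nonZeroDivisors_iff_ne_zero.2 hπ0))

end

/-- N5 in local form -/
theorem isNormalRing_of_flat {D E : Type*} [CommRing D] [CommRing E] [Algebra D E]
    [IsNoetherianRing D] [IsNoetherianRing E] [Module.Flat D E] (hD : IsNormalRing D)
    (hF : ∀ (Q : Ideal E) [Q.IsPrime], NDom (Localization.AtPrime Q ⧸
      ((Q.under D).map (algebraMap D E)).map (algebraMap E (Localization.AtPrime Q)))) :
    IsNormalRing E := by
  refine isNormalRing_of_dep1 E fun P _ hdep => ?_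
  obtain ⟨_, h1, h2, h3⟩ := exists_flat_localization (R := D) P
  have : IsNoetherianRing (Localization.AtPrime P) :=
    IsLocalization.isNoetherianRing P.primeCompl _ inferInstance
  have : IsNoetherianRing (Localization.AtPrime (P.under D)) :=
    IsLocalization.isNoetherianRing (P.under D).primeCompl _ inferInstance
  refine ndom_of_flat_local ((isNormalRing_iff D).1 hD (P.under D)) ?_ hdep
  rw [← Localization.AtPrime.map_eq_maximalIdeal, Ideal.map_map, ← IsScalarTower.algebraMap_eq]
  have := hF P
  rwa [Ideal.map_map, ← IsScalarTower.algebraMap_eq] at this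

/-- the local form of the fiber hypothesis -/
theorem ndom_fiber_local {D E : Type*} [CommRing D] [CommRing E] [Algebra D E]
    (Q : Ideal E) [Q.IsPrime] (h : IsNormalRing ((Q.under D).Fiber E)) :
    NDom (Localization.AtPrime Q ⧸
      ((Q.under D).map (algebraMap D E)).map (algebraMap E (Localization.AtPrime Q))) := by
  let p : PrimeSpectrum D := ⟨Q.under D, inferInstance⟩
  let q := PrimeSpectrum.preimageEquivFiber D E p ⟨⟨Q, inferInstance⟩, rfl⟩
  have hq : q.asIdeal.comap Algebra.TensorProduct.includeRight = Q := by
    have := (PrimeSpectrum.preimageEquivFiber D E p).symm_apply_apply ⟨⟨Q, inferInstance⟩, rfl⟩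
    exact congrArg (fun x => x.1.asIdeal) this
  have := ((isNormalRing_iff _).1 h q.asIdeal).of_equiv
    (Ideal.Fiber.algEquivAux₂ (Q.under D) q.asIdeal).toRingEquiv
  revert this
  have key : ∀ Q' : Ideal E, ∀ _ : Q'.IsPrime, Q' = Q → NDom (Localization.AtPrime Q' ⧸
      ((Q.under D).map (algebraMap D E)).map (algebraMap E (Localization.AtPrime Q'))) →
      NDom (Localization.AtPrime Q ⧸
      ((Q.under D).map (algebraMap D E)).map (algebraMap E (Localization.AtPrime Q))) := by
    rintro Q' _ rfl h; exact h
  exact key _ _ hq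

theorem isNormalRing_of_flat' {D E : Type*} [CommRing D] [CommRing E] [Algebra D E]
    [IsNoetherianRing D] [IsNoetherianRing E] [Module.Flat D E] (hD : IsNormalRing D)
    (hF : ∀ (p : Ideal D) [p.IsPrime], IsNormalRing (p.Fiber E)) :
    IsNormalRing E :=
  isNormalRing_of_flat hD fun Q _ => ndom_fiber_local Q (hF _)

end GN

namespace GN

theorem isNormalRing_of_artinian_reduced (R : Type*) [CommRing R] [IsArtinianRing R] [IsReduced R] :
    IsNormalRing R := by
  rw [isNormalRing_iff]
  intro P _
  have : IsArtinianRing (Localization.AtPrime P) := inferInstance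
  have : IsReduced (Localization.AtPrime P) :=
    isReduced_localizationPreserves P.primeCompl (Localization.AtPrime P) inferInstance
  have hf := IsArtinianRing.isField_of_isReduced_of_isLocalRing (Localization.AtPrime P)
  letI := hf.toField
  exact NDom.of_field _

theorem isNormalRing_tensor_separable (K L O : Type*) [Field K] [Field L] [CommRing O]
    [Algebra K L] [Algebra K O] [FiniteDimensional K L] [Algebra.IsSeparable K L]
    [IsNoetherianRing O] (hO : IsNormalRing O) : IsNormalRing (L ⊗[K] O) := by
  refine isNormalRing_of_ringEquiv (Algebra.TensorProduct.comm K O L).toRingEquiv ?_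
  have : IsNoetherianRing (O ⊗[K] L) := Algebra.FiniteType.isNoetherianRing O _
  refine isNormalRing_of_flat' (D := O) hO fun p _ => ?_
  have : Algebra.FormallyUnramified K L := Algebra.FormallyUnramified.of_isSeparable K L
  have h1 : Algebra.FormallyUnramified p.ResidueField (p.ResidueField ⊗[O] (O ⊗[K] L)) :=
    inferInstance
  have : IsArtinianRing (p.ResidueField ⊗[O] (O ⊗[K] L)) :=
    IsArtinianRing.of_finite p.ResidueField _
  have : IsReduced (p.ResidueField ⊗[O] (O ⊗[K] L)) :=
    Algebra.FormallyUnramified.isReduced_of_field p.ResidueField _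
  exact isNormalRing_of_artinian_reduced _
end GN

namespace GN

theorem haus_zero {T : Type*} [CommRing T] (J : Ideal T) [IsHausdorff J T] {x : T}
    (h : ∀ n, x ∈ J ^ n) : x = 0 := by
  apply IsHausdorff.haus (I := J) (M := T) inferInstance
  intro n
  rw [SModEq.zero, smul_eq_mul, Ideal.mul_top]
  exact h n

theorem haus_iff {T : Type*} [CommRing T] (J : Ideal T) :
    IsHausdorff J T ↔ ∀ x : T, (∀ n, x ∈ J ^ n) → x = 0 := by
  constructor
  · intro h x hx; exact haus_zero J hx
  · intro h
    refine ⟨fun x hx => h x fun n => ?_⟩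
    have := hx n
    rwa [SModEq.zero, smul_eq_mul, Ideal.mul_top] at this

theorem prec_iff {T : Type*} [CommRing T] (J : Ideal T) :
    IsPrecomplete J T ↔ ∀ f : ℕ → T, (∀ n, f (n + 1) - f n ∈ J ^ n) → ∃ L, ∀ n, L - f n ∈ J ^ n := by
  constructor
  · intro h f hf
    have key : ∀ {m n}, m ≤ n → f m ≡ f n [SMOD (J ^ m • ⊤ : Submodule T T)] := by
      intro m n hmn
      induction n, hmn using Nat.le_induction with
      | base => exact SModEq.refl _
      | succ n hmn ih =>
        refine ih.trans ?_
        rw [SModEq.sub_mem, smul_eq_mul, Ideal.mul_top, ← neg_sub]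
        exact neg_mem (Ideal.pow_le_pow_right hmn (hf n))
    obtain ⟨L, hL⟩ := IsPrecomplete.prec h key
    refine ⟨L, fun n => ?_⟩
    have := (hL n).symm
    rwa [SModEq.sub_mem, smul_eq_mul, Ideal.mul_top] at this
  · intro h
    refine ⟨fun f hf => ?_⟩
    obtain ⟨L, hL⟩ := h f (fun n => by
      have := (hf (Nat.le_succ n)).symm
      rwa [SModEq.sub_mem, smul_eq_mul, Ideal.mul_top] at this)
    refine ⟨L, fun n => ?_⟩
    apply SModEq.symm
    rw [SModEq.sub_mem, smul_eq_mul, Ideal.mul_top]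
    exact hL n

theorem adic_iff {T : Type*} [CommRing T] (J : Ideal T) :
    IsAdicComplete J T ↔ (∀ x : T, (∀ n, x ∈ J ^ n) → x = 0) ∧
      ∀ f : ℕ → T, (∀ n, f (n + 1) - f n ∈ J ^ n) → ∃ L, ∀ n, L - f n ∈ J ^ n := by
  rw [← haus_iff, ← prec_iff, isAdicComplete_iff]

theorem exists_extend {R T : Type*} [CommRing R] [CommRing T] (I : Ideal R) (J : Ideal T)
    [IsAdicComplete J T] (f : R →+* T) (hf : I.map f ≤ J) :
    ∃ F : AdicCompletion I R →+* T, F.comp (algebraMap R (AdicCompletion I R)) = f := by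
  have hn : ∀ n, I ^ n ≤ (J ^ n).comap f := fun n => by
    rw [← Ideal.map_le_iff_le_comap, Ideal.map_pow]
    exact Ideal.pow_right_mono hf n
  let g : ∀ n, AdicCompletion I R →+* T ⧸ J ^ n := fun n =>
    (Ideal.quotientMap (J ^ n) f (hn n)).comp (AdicCompletion.evalₐ I n : AdicCompletion I R →+* R ⧸ I ^ n)
  have hg : ∀ {m n : ℕ} (hle : m ≤ n), (Ideal.Quotient.factorPow J hle).comp (g n) = g m := by
    intro m n hle
    ext x
    obtain ⟨c, rfl⟩ := AdicCompletion.mk_surjective I R x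
    simp only [g, RingHom.comp_apply, RingHom.coe_coe, AdicCompletion.evalₐ_mk, Ideal.quotientMap_mk]
    have h1 := (AdicCompletion.AdicCauchySequence.mk_eq_mk hle c)
    have h2 : c m - c n ∈ I ^ m := by
      have := c.2 hle
      rwa [SModEq.sub_mem, smul_eq_mul, Ideal.mul_top] at this
    change Ideal.Quotient.mk (J ^ m) (f (c n)) = _
    rw [eq_comm, Ideal.Quotient.eq, ← map_sub]
    exact hn m h2
  refine ⟨IsAdicComplete.liftRingHom J g hg, ?_⟩
  ext x
  apply sub_eq_zero.mp
  apply haus_zero J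
  intro n
  rw [← Ideal.Quotient.eq_zero_iff_mem, map_sub, sub_eq_zero]
  rw [RingHom.comp_apply, IsAdicComplete.mk_liftRingHom]
  simp only [g, RingHom.comp_apply, RingHom.coe_coe, AdicCompletion.algebraMap_apply, Algebra.algebraMap_self, RingHom.id_apply, AdicCompletion.evalₐ_of, Ideal.quotientMap_mk]

/-- Evaluation of power series. -/
theorem exists_evalPS {C T : Type*} [CommRing C] [CommRing T] (J : Ideal T)
    [IsAdicComplete J T] (f : C →+* T) {n : ℕ} (y : Fin n → T) (hy : ∀ i, y i ∈ J) :
    ∃ F : MvPowerSeries (Fin n) C →+* T, (∀ c, F (MvPowerSeries.C c) = f c) ∧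
      ∀ i, F (MvPowerSeries.X i) = y i := by
  obtain ⟨F, hF⟩ := exists_extend (MvPolynomial.idealOfVars (Fin n) C) J (MvPolynomial.eval₂Hom f y)
    (by
      rw [MvPolynomial.idealOfVars, Ideal.map_span, Ideal.span_le]
      rintro _ ⟨_, ⟨i, rfl⟩, rfl⟩
      simpa using hy i)
  have key : ∀ p : MvPolynomial (Fin n) C, F ((MvPowerSeries.toAdicCompletionAlgEquiv (Fin n) C) (p : MvPowerSeries (Fin n) C)) = MvPolynomial.eval₂Hom f y p := by
    intro p
    rw [← hF, RingHom.comp_apply]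
    refine congrArg F ?_
    exact (MvPowerSeries.toAdicCompletionAlgEquiv (Fin n) C).commutes p
  refine ⟨F.comp ((MvPowerSeries.toAdicCompletionAlgEquiv (Fin n) C) : MvPowerSeries (Fin n) C →+* _), fun c => ?_, fun i => ?_⟩
  · have := key (MvPolynomial.C c)
    simpa using this
  · have := key (MvPolynomial.X i)
    simpa using this


theorem prec_pi {S : Type*} [CommRing S] (I : Ideal S) [IsPrecomplete I S] (n : ℕ) :
    IsPrecomplete I (Fin n → S) := by
  have key : ∀ (k : ℕ) (x : Fin n → S), x ∈ (I ^ k • ⊤ : Submodule S (Fin n → S)) ↔ ∀ i, x i ∈ I ^ k := by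
    intro k x
    constructor
    · intro h i
      have := Submodule.mem_map_of_mem (f := LinearMap.proj (R := S) (φ := fun _ : Fin n => S) i) h
      rw [Submodule.map_smul''] at this
      have h2 := Submodule.smul_mono le_rfl le_top this
      rwa [smul_eq_mul, Ideal.mul_top] at h2
    · intro h
      rw [← Finset.univ_sum_single x]
      refine Submodule.sum_mem _ fun i _ => ?_
      have : (Pi.single i (x i) : Fin n → S) = x i • Pi.single i (1 : S) := by
        rw [← Pi.single_smul]; simp
      rw [this]
      exact Submodule.smul_mem_smul (h i) trivial
  refine ⟨fun f hf => ?_⟩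
  have h1 := (prec_iff I).mp inferInstance
  have h2 : ∀ i, ∃ L : S, ∀ k, L - f k i ∈ I ^ k := fun i => h1 (fun k => f k i) fun k => by
    have := (hf (Nat.le_succ k)).symm
    rw [SModEq.sub_mem, key] at this
    exact this i
  choose L hL using h2
  refine ⟨L, fun k => ?_⟩
  apply SModEq.symm
  rw [SModEq.sub_mem, key]
  exact fun i => hL i k

/-- Complete Nakayama. -/
theorem complete_span {S T : Type*} [CommRing S] [CommRing T] [Algebra S T] (I : Ideal S)
    [IsPrecomplete I S] (hH : IsHausdorff (I.map (algebraMap S T)) T) {n : ℕ} (t : Fin n → T)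
    (h : ∀ x : T, ∃ a : Fin n → S, x - ∑ i, a i • t i ∈ I.map (algebraMap S T)) (x : T) :
    ∃ a : Fin n → S, x = ∑ i, a i • t i := by
  haveI := prec_pi I n
  haveI : IsHausdorff I T := (IsHausdorff.map_algebraMap_iff (S := T) (I := I) (M := T)).mp hH
  have := surjective_of_mkQ_comp_surjective (I := I) (f := Fintype.linearCombination S t) (by
    intro y
    obtain ⟨y, rfl⟩ := Submodule.mkQ_surjective _ y
    obtain ⟨a, ha⟩ := h y
    refine ⟨a, ?_⟩
    simp only [LinearMap.comp_apply]
    rw [eq_comm]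
    simp only [Submodule.mkQ_apply]
    rw [Submodule.Quotient.eq]
    rw [Fintype.linearCombination_apply]
    have h3 : (I • ⊤ : Submodule S T) = (I.map (algebraMap S T)).restrictScalars S := Ideal.smul_top_eq_map I
    rw [h3]
    exact ha)
  obtain ⟨a, ha⟩ := this x
  exact ⟨a, by rw [← ha, Fintype.linearCombination_apply]⟩

/-- Precompleteness passes to surjective images. -/
theorem prec_of_surj {S T : Type*} [CommRing S] [CommRing T] [Algebra S T] (I : Ideal S)
    [IsPrecomplete I S] {n : ℕ} (t : Fin n → T)
    (h : ∀ x : T, ∃ a : Fin n → S, x = ∑ i, a i • t i) :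
    IsPrecomplete (I.map (algebraMap S T)) T := by
  haveI := prec_pi I n
  rw [IsPrecomplete.map_algebraMap_iff, ← AdicCompletion.of_surjective_iff]
  have hs : Function.Surjective (Fintype.linearCombination S t) := fun x => by
    obtain ⟨a, ha⟩ := h x
    exact ⟨a, by rw [ha, Fintype.linearCombination_apply]⟩
  intro z
  obtain ⟨w, rfl⟩ := AdicCompletion.map_surjective I hs z
  obtain ⟨v, rfl⟩ := AdicCompletion.of_surjective I (Fin n → S) w
  exact ⟨_, (AdicCompletion.map_of ..).symm⟩

theorem adic_of_finite {S T : Type*} [CommRing S] [CommRing T] [Algebra S T] (I : Ideal S)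
    [IsAdicComplete I S] [Module.Finite S T] [IsNoetherianRing S] :
    IsAdicComplete (I.map (algebraMap S T)) T := by
  obtain ⟨n, t, ht⟩ := Module.Finite.exists_fin (R := S) (M := T)
  have h := prec_of_surj I t (fun x => by
    have : x ∈ Submodule.span S (Set.range t) := ht ▸ trivial
    rw [Submodule.mem_span_range_iff_exists_fun] at this
    obtain ⟨c, hc⟩ := this
    exact ⟨c, hc.symm⟩)
  have h2 : IsHausdorff I T := IsHausdorff.of_le_jacobson I T (IsAdicComplete.le_jacobson_bot I)
  have h3 := (IsHausdorff.map_algebraMap_iff (S := T) (I := I) (M := T)).mpr h2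
  exact (isAdicComplete_iff _ _).mpr ⟨h3, h⟩

theorem adic_quot {S : Type*} [CommRing S] [IsNoetherianRing S] (I K : Ideal S)
    [IsAdicComplete I S] : IsAdicComplete (I.map (Ideal.Quotient.mk K)) (S ⧸ K) :=
  adic_of_finite (T := S ⧸ K) I

theorem surj_of_complete {S T : Type*} [CommRing S] [CommRing T] (f : S →+* T) (I : Ideal S)
    [IsPrecomplete I S] (hH : IsHausdorff (I.map f) T)
    (h : ∀ x : T, ∃ a, x - f a ∈ I.map f) : Function.Surjective f := by
  letI := f.toAlgebra
  intro x
  obtain ⟨a, ha⟩ := complete_span (S := S) (T := T) I hH (fun _ : Fin 1 => (1 : T)) (fun x => by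
    obtain ⟨a, ha⟩ := h x
    refine ⟨fun _ => a, ?_⟩
    simp [Algebra.smul_def]
    exact ha) x
  refine ⟨a 0, ?_⟩
  simp [Algebra.smul_def] at ha
  exact ha.symm

section completion
variable {R : Type*} [CommRing R] (I : Ideal R)

theorem comp_mem_iff (h : I.FG) (n : ℕ) (x : AdicCompletion I R) :
    x ∈ (I.map (algebraMap R (AdicCompletion I R))) ^ n ↔ AdicCompletion.evalₐ I n x = 0 := by
  have h1 := AdicCompletion.pow_smul_top_eq_ker_eval (I := I) (M := R) (n := n) h
  have h2 : (I ^ n • ⊤ : Submodule R (AdicCompletion I R)) =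
    ((I ^ n).map (algebraMap R (AdicCompletion I R))).restrictScalars R := Ideal.smul_top_eq_map _
  rw [← Ideal.map_pow]
  have h3 : x ∈ (I ^ n).map (algebraMap R (AdicCompletion I R)) ↔ x ∈ (I ^ n • ⊤ : Submodule R (AdicCompletion I R)) := by
    rw [h2]; rfl
  rw [h3, h1, LinearMap.mem_ker]
  have h4 : (I ^ n • ⊤ : Ideal R) ≤ I ^ n := by simp
  have h5 : I ^ n ≤ (I ^ n • ⊤ : Ideal R) := by simp
  constructor
  · intro h; rw [← AdicCompletion.factor_eval_eq_evalₐ I x h4, h]; simp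
  · intro h; rw [← AdicCompletion.factor_evalₐ_eq_eval I x h5, h]; simp

theorem comp_dense (h : I.FG) (n : ℕ) (x : AdicCompletion I R) :
    ∃ r, x - algebraMap R (AdicCompletion I R) r ∈ (I.map (algebraMap R (AdicCompletion I R))) ^ n := by
  obtain ⟨r, hr⟩ := Ideal.Quotient.mk_surjective (AdicCompletion.evalₐ I n x)
  refine ⟨r, ?_⟩
  rw [comp_mem_iff I h, map_sub, AdicCompletion.algebraMap_apply, Algebra.algebraMap_self_apply,
    AdicCompletion.evalₐ_of, hr, sub_self]

theorem comp_comap (h : I.FG) (n : ℕ) (r : R) :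
    algebraMap R (AdicCompletion I R) r ∈ (I.map (algebraMap R (AdicCompletion I R))) ^ n ↔ r ∈ I ^ n := by
  rw [comp_mem_iff I h, AdicCompletion.algebraMap_apply, Algebra.algebraMap_self_apply,
    AdicCompletion.evalₐ_of, Ideal.Quotient.eq_zero_iff_mem]

theorem comp_complete (h : I.FG) :
    IsAdicComplete (I.map (algebraMap R (AdicCompletion I R))) (AdicCompletion I R) :=
  AdicCompletion.isAdicComplete_self I h

theorem comp_noeth [IsNoetherianRing R] : IsNoetherianRing (AdicCompletion I R) := by
  have hI : I.FG := IsNoetherian.noetherian I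
  obtain ⟨n, y, hy⟩ := Submodule.fg_iff_exists_fin_generating_family.mp hI
  haveI := comp_complete I hI
  have hyI : ∀ i, y i ∈ I := fun i => hy ▸ Submodule.subset_span ⟨i, rfl⟩
  obtain ⟨F, hF1, hF2⟩ := exists_evalPS (I.map (algebraMap R (AdicCompletion I R)))
    (algebraMap R (AdicCompletion I R)) (fun i => algebraMap R _ (y i)) (fun i => Ideal.mem_map_of_mem _ (hyI i))
  have hmap : (Ideal.span (Set.range (MvPowerSeries.X (R := R) (σ := Fin n)))).map F = I.map (algebraMap R (AdicCompletion I R)) := by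
    have h3 : I.map (algebraMap R (AdicCompletion I R)) = (Ideal.span (Set.range y)).map (algebraMap R (AdicCompletion I R)) :=
      congrArg (Ideal.map (algebraMap R (AdicCompletion I R))) hy.symm
    rw [Ideal.map_span, h3, Ideal.map_span, ← Set.range_comp, ← Set.range_comp]
    congr 2
    funext i
    exact hF2 i
  have hs : Function.Surjective F := by
    refine surj_of_complete F (Ideal.span (Set.range (MvPowerSeries.X (R := R) (σ := Fin n)))) (by rw [hmap]; infer_instance) ?_
    intro x
    obtain ⟨r, hr⟩ := comp_dense I hI 1 x
    refine ⟨MvPowerSeries.C r, ?_⟩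
    rw [hF1, hmap]
    simpa using hr
  exact isNoetherianRing_of_surjective _ _ F hs

theorem comp_flat [IsNoetherianRing R] : Module.Flat R (AdicCompletion I R) := inferInstance

end completion

end GN

namespace GN

theorem mem_of_krull {B : Type*} [CommRing B] [IsNoetherianRing B] (K : Ideal B)
    (hK : K ≤ Ideal.jacobson ⊥) {l : ℕ} (N : Submodule B (Fin l → B)) (x : Fin l → B)
    (h : ∀ n, ∃ y ∈ N, ∀ i, x i - y i ∈ K ^ n) : x ∈ N := by
  have hH : IsHausdorff K ((Fin l → B) ⧸ N) := IsHausdorff.of_le_jacobson K _ hK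
  rw [← Submodule.Quotient.mk_eq_zero]
  apply hH.haus
  intro n
  rw [SModEq.zero]
  obtain ⟨y, hy, hxy⟩ := h n
  have h1 : (Submodule.Quotient.mk x : (Fin l → B) ⧸ N) = N.mkQ (x - y) := by
    rw [map_sub, Submodule.mkQ_apply, Submodule.mkQ_apply, (Submodule.Quotient.mk_eq_zero N).mpr hy, sub_zero]
  rw [h1, ← Finset.univ_sum_single (x - y), map_sum]
  refine Submodule.sum_mem _ fun i _ => ?_
  have : (Pi.single i ((x - y) i) : Fin l → B) = (x - y) i • Pi.single i (1 : B) := by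
    rw [← Pi.single_smul]; simp
  rw [this, map_smul]
  exact Submodule.smul_mem_smul (hxy i) trivial

theorem flat_of_dense {A A₁ B : Type*} [CommRing A] [CommRing A₁] [CommRing B] [Algebra A A₁]
    [Algebra A₁ B] [Algebra A B] [IsScalarTower A A₁ B] [IsNoetherianRing A] [IsNoetherianRing A₁]
    [IsNoetherianRing B] [Module.Flat A B] (I : Ideal A)
    (hjac : I.map (algebraMap A B) ≤ Ideal.jacobson ⊥)
    (hd : ∀ n (x : A₁), ∃ a, x - algebraMap A A₁ a ∈ (I.map (algebraMap A A₁)) ^ n) :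
    Module.Flat A₁ B := by
  rw [Module.Flat.iff_forall_isTrivialRelation]
  intro l f x hfx
  set J := I.map (algebraMap A A₁) with hJ
  let N : Submodule B (Fin l → B) := Submodule.span B
    ((fun r : Fin l → A₁ => fun i => algebraMap A₁ B (r i)) '' {r | ∑ i, f i * r i = 0})
  have hJB : J.map (algebraMap A₁ B) = I.map (algebraMap A B) := by
    rw [hJ, Ideal.map_map, ← IsScalarTower.algebraMap_eq]
  have hx : x ∈ N := by
    refine mem_of_krull (I.map (algebraMap A B)) hjac N x fun n => ?_
    obtain ⟨k, hk⟩ := Ideal.exists_pow_inf_eq_pow_smul J (Ideal.span (Set.range f))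
    choose a ha using fun i => hd (n + k) (f i)
    have h1 : ∑ i, a i • x i ∈ (I ^ (n + k)).map (algebraMap A B) := by
      have h2 : ∑ i, a i • x i = - ∑ i, (f i - algebraMap A A₁ (a i)) • x i := by
        simp only [sub_smul, Finset.sum_sub_distrib, hfx, algebraMap_smul]
        simp
      rw [h2]
      refine neg_mem (Ideal.sum_mem _ fun i _ => ?_)
      rw [Algebra.smul_def]
      refine Ideal.mul_mem_right _ _ ?_
      rw [Ideal.map_pow, ← hJB, ← Ideal.map_pow]
      exact Ideal.mem_map_of_mem _ (ha i)
    obtain ⟨s, c, hc⟩ := Submodule.fg_iff_exists_fin_generating_family.mp (IsNoetherian.noetherian (I ^ (n + k)))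
    have hc' : Ideal.span (Set.range c) = I ^ (n + k) := hc
    have hcI : ∀ j, c j ∈ I ^ (n + k) := fun j => hc' ▸ Ideal.subset_span ⟨j, rfl⟩
    rw [← hc', Ideal.map_span, ← Set.range_comp, Ideal.mem_span_range_iff_exists_fun] at h1
    obtain ⟨d, hdd⟩ := h1
    obtain ⟨t, r, z, hr, hz⟩ := Module.Flat.isTrivialRelation_of_sum_smul_eq_zero (R := A) (M := B)
      (ι := Fin l ⊕ Fin s) (f := Sum.elim a (fun j => - c j)) (x := Sum.elim x d) (by
        rw [Fintype.sum_sum_type]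
        simp only [Sum.elim_inl, Sum.elim_inr, neg_smul, Finset.sum_neg_distrib]
        rw [← hdd, ← sub_eq_add_neg, sub_eq_zero]
        refine Finset.sum_congr rfl fun j _ => ?_
        rw [Algebra.smul_def, mul_comm]; rfl)
    -- each column is approximately a relation
    have h3 : ∀ j, ∃ e : Fin l → A₁, (∀ i, e i ∈ J ^ n) ∧
        ∑ i, f i * algebraMap A A₁ (r (Sum.inl i) j) = ∑ i, e i * f i := by
      intro j
      have h4 : ∑ i, f i * algebraMap A A₁ (r (Sum.inl i) j) ∈ (J ^ (n + k) • ⊤ ⊓ Ideal.span (Set.range f) : Submodule A₁ A₁) := by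
        constructor
        · rw [smul_eq_mul, Ideal.mul_top]
          have h5 : ∑ i, f i * algebraMap A A₁ (r (Sum.inl i) j) =
              ∑ i, (f i - algebraMap A A₁ (a i)) * algebraMap A A₁ (r (Sum.inl i) j) +
              algebraMap A A₁ (∑ i, a i * r (Sum.inl i) j) := by
            rw [map_sum, ← Finset.sum_add_distrib]
            refine Finset.sum_congr rfl fun i _ => ?_
            rw [map_mul]; ring
          rw [h5]
          refine add_mem (Ideal.sum_mem _ fun i _ => Ideal.mul_mem_right _ _ (ha i)) ?_
          rw [hJ, ← Ideal.map_pow]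
          apply Ideal.mem_map_of_mem
          have h6 := hz j
          rw [Fintype.sum_sum_type] at h6
          simp only [Sum.elim_inl, Sum.elim_inr, neg_mul, Finset.sum_neg_distrib] at h6
          rw [← sub_eq_add_neg, sub_eq_zero] at h6
          rw [h6]
          exact Ideal.sum_mem _ fun i _ => Ideal.mul_mem_right _ _ (hcI i)
        · exact Ideal.sum_mem _ fun i _ => Ideal.mul_mem_right _ _ (Ideal.subset_span ⟨i, rfl⟩)
      rw [hk (n + k) (Nat.le_add_left _ _), Nat.add_sub_cancel] at h4
      have h5 := Submodule.smul_mono le_rfl inf_le_right h4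
      have h6 := (Submodule.mem_ideal_smul_span_iff_exists_sum (J ^ n) f _).mp h5
      obtain ⟨e, he, hes⟩ := h6
      refine ⟨fun i => e i, he, ?_⟩
      rw [← hes, Finsupp.sum_fintype _ _ (by simp)]
      rfl
    choose e he hes using h3
    refine ⟨∑ j, z j • (fun i => algebraMap A₁ B (algebraMap A A₁ (r (Sum.inl i) j) - e j i)), ?_, ?_⟩
    · refine Submodule.sum_mem _ fun j _ => Submodule.smul_mem _ _ (Submodule.subset_span
        ⟨fun i => algebraMap A A₁ (r (Sum.inl i) j) - e j i, ?_, rfl⟩)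
      simp only [Set.mem_setOf_eq, mul_sub, Finset.sum_sub_distrib, hes]
      rw [sub_eq_zero]
      exact Finset.sum_congr rfl fun i _ => mul_comm _ _
    · intro i
      have h7 := hr (Sum.inl i)
      simp only [Sum.elim_inl] at h7
      rw [h7, Finset.sum_apply, ← Finset.sum_sub_distrib]
      refine Ideal.sum_mem _ fun j _ => ?_
      have h8 : r (Sum.inl i) j • z j - (z j • (fun i => algebraMap A₁ B (algebraMap A A₁ (r (Sum.inl i) j) - e j i))) i
          = algebraMap A₁ B (e j i) * z j := by
        rw [Pi.smul_apply, smul_eq_mul, map_sub, ← IsScalarTower.algebraMap_apply, Algebra.smul_def]; ring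
      rw [h8, ← hJB, ← Ideal.map_pow]
      exact Ideal.mul_mem_right _ _ (Ideal.mem_map_of_mem _ (he j i))
  obtain ⟨k, b, g, hbg⟩ := Submodule.mem_span_set'.mp hx
  choose r hr using fun j => (g j).2
  refine ⟨k, fun i j => r j i, b, fun i => ?_, fun j => (hr j).1⟩
  rw [← hbg, Finset.sum_apply]
  refine Finset.sum_congr rfl fun j _ => ?_
  rw [Pi.smul_apply, ← (hr j).2, smul_eq_mul, Algebra.smul_def, mul_comm]

end GN

namespace GN

/-- monomials -/
noncomputable def mon {X Q : Type*} [CommRing Q] (β : X → Q) (e : X →₀ ℕ) : Q :=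
  e.prod fun x n => β x ^ n

theorem mon_add {X Q : Type*} [CommRing Q] (β : X → Q) (e f : X →₀ ℕ) :
    mon β (e + f) = mon β e * mon β f :=
  Finsupp.prod_add_index' (by simp) (by intros; rw [pow_add])

theorem mon_zero {X Q : Type*} [CommRing Q] (β : X → Q) : mon β 0 = 1 := by simp [mon]

theorem mon_single {X Q : Type*} [CommRing Q] (β : X → Q) (x : X) (n : ℕ) :
    mon β (Finsupp.single x n) = β x ^ n := by simp [mon]

theorem mon_smul {X Q : Type*} [CommRing Q] (β : X → Q) (n : ℕ) (e : X →₀ ℕ) :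
    mon β (n • e) = mon β e ^ n := by
  induction n with
  | zero => simp [mon_zero]
  | succ n ih => rw [succ_nsmul, mon_add, ih, pow_succ]

theorem map_mon {X Q Q' : Type*} [CommRing Q] [CommRing Q'] (f : Q →+* Q') (β : X → Q) (e : X →₀ ℕ) :
    f (mon β e) = mon (fun x => f (β x)) e := by
  simp [mon, Finsupp.prod, map_prod]

/-- Exponents supported in `B` and bounded by `q`. -/
def GE {X : Type*} (B : Set X) (q : ℕ) (e : X →₀ ℕ) : Prop := (∀ x ∈ e.support, x ∈ B) ∧ ∀ x, e x < q

noncomputable def emod {X : Type*} (q : ℕ) (e : X →₀ ℕ) : X →₀ ℕ := e.mapRange (· % q) (by simp)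
noncomputable def ediv {X : Type*} (q : ℕ) (e : X →₀ ℕ) : X →₀ ℕ := e.mapRange (· / q) (by simp)

theorem emod_apply {X : Type*} (q : ℕ) (e : X →₀ ℕ) (x : X) : emod q e x = e x % q := rfl
theorem ediv_apply {X : Type*} (q : ℕ) (e : X →₀ ℕ) (x : X) : ediv q e x = e x / q := rfl
theorem emod_supp {X : Type*} {q : ℕ} {e : X →₀ ℕ} {x : X} (h : x ∈ (emod q e).support) : x ∈ e.support := by
  rw [Finsupp.mem_support_iff] at h ⊢
  intro h0; exact h (by rw [emod_apply, h0, Nat.zero_mod])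
theorem ediv_supp {X : Type*} {q : ℕ} {e : X →₀ ℕ} {x : X} (h : x ∈ (ediv q e).support) : x ∈ e.support := by
  rw [Finsupp.mem_support_iff] at h ⊢
  intro h0; exact h (by rw [ediv_apply, h0, Nat.zero_div])

theorem emod_add_ediv {X : Type*} (q : ℕ) (e : X →₀ ℕ) : emod q e + q • ediv q e = e := by
  ext x; rw [Finsupp.add_apply, Finsupp.smul_apply, emod_apply, ediv_apply, smul_eq_mul, Nat.mod_add_div]

theorem span_closure {K Q X : Type*} [CommRing K] [CommRing Q] (φ : K →+* Q) (β : X → Q) (B : Set X)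
    (q : ℕ) (hq : 0 < q) (h : ∀ x ∈ B, ∃ k, β x ^ q = φ k) (z : Q)
    (hz : z ∈ Subring.closure (Set.range φ ∪ β '' B)) :
    ∃ (s : Finset (X →₀ ℕ)) (c : (X →₀ ℕ) → K), (∀ e ∈ s, GE B q e) ∧ z = ∑ e ∈ s, φ (c e) * mon β e := by
  classical
  letI := φ.toAlgebra
  let M : Submodule K Q := Submodule.span K (mon β '' {e | GE B q e})
  have hpow : ∀ d : X →₀ ℕ, (∀ x ∈ d.support, x ∈ B) → ∃ k, mon β d ^ q = φ k := by
    intro d hd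
    have : ∀ x ∈ d.support, ∃ k, (β x ^ d x) ^ q = φ k := by
      intro x hx
      obtain ⟨k, hk⟩ := h x (hd x hx)
      exact ⟨k ^ d x, by rw [← pow_mul, mul_comm, pow_mul, hk, map_pow]⟩
    choose! k hk using this
    refine ⟨∏ x ∈ d.support, k x, ?_⟩
    rw [mon, Finsupp.prod, ← Finset.prod_pow, map_prod]
    exact Finset.prod_congr rfl hk
  have hmon : ∀ e : X →₀ ℕ, (∀ x ∈ e.support, x ∈ B) → mon β e ∈ M := by
    intro e he
    rw [← emod_add_ediv q e, mon_add, mon_smul]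
    obtain ⟨k, hk⟩ := hpow (ediv q e) (fun x hx => he x (ediv_supp hx))
    rw [hk, mul_comm]
    change k • mon β (emod q e) ∈ M
    refine Submodule.smul_mem _ _ (Submodule.subset_span ⟨_, ⟨fun x hx => he x (emod_supp hx), fun x => ?_⟩, rfl⟩)
    rw [emod_apply]; exact Nat.mod_lt _ hq
  have hmul : ∀ x ∈ M, ∀ y ∈ M, x * y ∈ M := by
    intro x hx y hy
    induction hx using Submodule.span_induction with
    | zero => simp
    | add a b _ _ ha hb => rw [add_mul]; exact add_mem ha hb
    | smul a b _ hb => rw [smul_mul_assoc]; exact Submodule.smul_mem _ _ hb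
    | mem a ha =>
      induction hy using Submodule.span_induction with
      | zero => simp
      | add a b _ _ ha hb => rw [mul_add]; exact add_mem ha hb
      | smul a b _ hb => rw [mul_smul_comm]; exact Submodule.smul_mem _ _ hb
      | mem b hb =>
        obtain ⟨e, he, rfl⟩ := ha
        obtain ⟨f, hf, rfl⟩ := hb
        rw [← mon_add]
        refine hmon _ fun x hx => ?_
        rcases Finset.mem_union.mp (Finsupp.support_add hx) with h | h
        · exact he.1 x h
        · exact hf.1 x h
  have hone : (1 : Q) ∈ M := by rw [← mon_zero β]; exact hmon 0 (by simp)
  have hzM : z ∈ M := by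
    induction hz using Subring.closure_induction with
    | mem x hx =>
      rcases hx with ⟨k, rfl⟩ | ⟨x, hx, rfl⟩
      · have : φ k = k • (1 : Q) := by rw [Algebra.smul_def, mul_one]; rfl
        rw [this]; exact Submodule.smul_mem _ _ hone
      · have := hmon (Finsupp.single x 1) (fun y hy => by
          rw [Finsupp.mem_support_iff, Finsupp.single_apply] at hy
          split_ifs at hy with h1
          · exact h1 ▸ hx
          · exact absurd rfl hy)
        rwa [mon_single, pow_one] at this
    | zero => exact zero_mem _
    | one => exact hone
    | add _ _ _ _ h1 h2 => exact add_mem h1 h2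
    | neg _ _ h1 => exact neg_mem h1
    | mul _ _ _ _ h1 h2 => exact hmul _ h1 _ h2
  obtain ⟨c, hcs, hc⟩ := (Finsupp.mem_span_image_iff_linearCombination K).mp hzM
  refine ⟨c.support, c, fun e he => ?_, ?_⟩
  · exact (Finsupp.mem_supported K c).mp hcs he
  · rw [← hc, Finsupp.linearCombination_apply, Finsupp.sum]
    rfl

variable {κ : Type*} [Field κ] (p : ℕ)

/-- `p`-independence at level `N`. -/
def PInd (B : Set κ) (N : ℕ) : Prop :=
  ∀ (s : Finset (κ →₀ ℕ)) (c : (κ →₀ ℕ) → κ), (∀ e ∈ s, GE B (p ^ N) e) →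
    ∑ e ∈ s, c e ^ (p ^ N) * mon id e = 0 → ∀ e ∈ s, c e = 0

theorem PInd.level [Fact p.Prime] [CharP κ p] {B : Set κ} (h : PInd p B 1) (N : ℕ) : PInd p B N := by
  classical
  have hp : p.Prime := Fact.out
  induction N with
  | zero =>
    intro s c hs hsum e he
    have h0 : ∀ e ∈ s, e = 0 := fun e he => by
      ext x; have := (hs e he).2 x; simp at this; simpa using this
    have : s = {0} := by
      apply Finset.eq_singleton_iff_unique_mem.mpr ⟨h0 e he ▸ he, h0⟩
    rw [this] at hsum
    rw [h0 e he]
    simpa [mon_zero] using hsum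
  | succ N ih =>
    intro s c hs hsum e he
    have hmap : ∀ e ∈ s, emod p e ∈ s.image (emod p) := fun e he => Finset.mem_image_of_mem _ he
    rw [← Finset.sum_fiberwise_of_maps_to hmap] at hsum
    let d : (κ →₀ ℕ) → κ := fun r => ∑ e ∈ s with emod p e = r, c e ^ (p ^ N) * mon id (ediv p e)
    have hsum' : ∑ r ∈ s.image (emod p), d r ^ (p ^ 1) * mon id r = 0 := by
      rw [← hsum]
      refine Finset.sum_congr rfl fun r hr => ?_
      rw [pow_one, sum_pow_char, Finset.sum_mul]
      refine Finset.sum_congr rfl fun e he => ?_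
      rw [Finset.mem_filter] at he
      have hm : mon id e = mon id r * mon id (ediv p e) ^ p := by
        conv_lhs => rw [← emod_add_ediv p e, mon_add, mon_smul, he.2]
      rw [hm, mul_pow, ← pow_mul, ← pow_succ]
      ring
    have hd := h _ d (by
      intro r hr
      obtain ⟨e, he, rfl⟩ := Finset.mem_image.mp hr
      refine ⟨fun x hx => (hs e he).1 x (emod_supp hx), fun x => ?_⟩
      rw [emod_apply, pow_one]; exact Nat.mod_lt _ hp.pos) hsum' (emod p e) (hmap e he)
    have hinj : Set.InjOn (ediv p) (({e' ∈ s | emod p e' = emod p e} : Finset (κ →₀ ℕ)) : Set (κ →₀ ℕ)) := by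
      intro a ha b hb hab
      simp only [Finset.coe_filter, Set.mem_setOf_eq] at ha hb
      rw [← emod_add_ediv p a, ← emod_add_ediv p b, ha.2, hb.2, hab]
    have hg := ih (({e' ∈ s | emod p e' = emod p e} : Finset (κ →₀ ℕ)).image (ediv p))
      (fun f => c (emod p e + p • f)) (by
        intro f hf
        obtain ⟨e', he', rfl⟩ := Finset.mem_image.mp hf
        have h1 := hs e' (Finset.mem_filter.mp he').1
        refine ⟨fun x hx => h1.1 x (ediv_supp hx), fun x => ?_⟩
        · have := h1.2 x
          rw [ediv_apply, Nat.div_lt_iff_lt_mul hp.pos, ← pow_succ]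
          exact this) (by
        rw [Finset.sum_image hinj, ← hd]
        refine Finset.sum_congr rfl fun e' he' => ?_
        rw [← (Finset.mem_filter.mp he').2, emod_add_ediv]) (ediv p e)
        (Finset.mem_image_of_mem _ (by simp [he]))
    simpa [emod_add_ediv] using hg

end GN

namespace GN

section
variable {κ : Type*} [Field κ] (p : ℕ)

/-- the subring generated by p-th powers and B -/
def pcl [Fact p.Prime] [CharP κ p] (B : Set κ) : Subring κ :=
  Subring.closure (Set.range (frobenius κ p) ∪ id '' B)

theorem pow_mem_pcl [Fact p.Prime] [CharP κ p] (B : Set κ) (y : κ) : y ^ p ∈ pcl p B :=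
  Subring.subset_closure (Or.inl ⟨y, rfl⟩)

/-- it is a subfield -/
def pclF [Fact p.Prime] [CharP κ p] (B : Set κ) : Subfield κ :=
  { pcl p B with
    inv_mem' := by
      intro y hy
      rcases eq_or_ne y 0 with rfl | hy0
      · simpa using hy
      have hp : p.Prime := Fact.out
      have : y⁻¹ = y ^ (p - 1) * (y⁻¹) ^ p := by
        have : p = (p - 1) + 1 := by have := hp.pos; omega
        conv_rhs => rw [this]
        rw [pow_succ, ← mul_assoc]
        simp only [Nat.add_sub_cancel]
        rw [← mul_pow, mul_inv_cancel₀ hy0, one_pow, one_mul]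
      rw [this]
      exact (pcl p B).mul_mem ((pcl p B).pow_mem hy _) (pow_mem_pcl p B _) }

theorem mon_mem_pcl [Fact p.Prime] [CharP κ p] {B : Set κ} {e : κ →₀ ℕ} (h : ∀ x ∈ e.support, x ∈ B) :
    mon id e ∈ pcl p B :=
  (pcl p B).prod_mem fun x hx => (pcl p B).pow_mem (Subring.subset_closure (Or.inr ⟨x, h x hx, rfl⟩)) _

theorem PInd.insert [Fact p.Prime] [CharP κ p] {B : Set κ} (h : PInd p B 1) {x : κ} (hx : x ∉ pcl p B) :
    PInd p (Set.insert x B) 1 := by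
  classical
  have hp : p.Prime := Fact.out
  have hxB : x ∉ B := fun h' => hx (Subring.subset_closure (Or.inr ⟨x, h', rfl⟩))
  intro s c hs hsum
  simp only [pow_one] at hsum hs
  have hex : ∀ e ∈ s, ∀ y ∈ (e.erase x).support, y ∈ B := by
    intro e he y hy
    rw [Finsupp.support_erase, Finset.mem_erase] at hy
    exact ((hs e he).1 y hy.2).resolve_left hy.1
  let F := pclF p B
  have ha : ∀ j, ∑ e ∈ s with e x = j, c e ^ p * mon id (e.erase x) ∈ pcl p B := fun j =>
    (pcl p B).sum_mem fun e he =>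
      (pcl p B).mul_mem (pow_mem_pcl p B _) (mon_mem_pcl p (hex e (Finset.mem_filter.1 he).1))
  let a : ℕ → F := fun j => ⟨_, ha j⟩
  let P : Polynomial F := ∑ j ∈ Finset.range p, Polynomial.C (a j) * Polynomial.X ^ j
  have hPx : Polynomial.aeval x P = 0 := by
    rw [← hsum]
    simp only [P, map_sum, map_mul, Polynomial.aeval_C, map_pow, Polynomial.aeval_X]
    rw [← Finset.sum_fiberwise_of_maps_to (g := fun e : κ →₀ ℕ => e x) (t := Finset.range p)
      (fun e he => Finset.mem_range.2 ((hs e he).2 x))]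
    refine Finset.sum_congr rfl fun j _ => ?_
    change (∑ e ∈ s with e x = j, c e ^ p * mon id (e.erase x)) * x ^ j = _
    rw [Finset.sum_mul]
    refine Finset.sum_congr rfl fun e he => ?_
    rw [mul_assoc]
    congr 1
    conv_rhs => rw [← Finsupp.erase_add_single x e]
    rw [mon_add, mon_single, (Finset.mem_filter.1 he).2]; rfl
  have hirr : Irreducible (Polynomial.X ^ p - Polynomial.C (⟨x ^ p, pow_mem_pcl p B x⟩ : F)) := by
    apply X_pow_sub_C_irreducible_of_prime hp
    rintro ⟨b, hb⟩ hb'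
    have h1 : b ^ p = x ^ p := congrArg Subtype.val hb'
    have : b = x := frobenius_inj κ p h1
    exact hx (this ▸ hb)
  have hmin := minpoly.eq_of_irreducible_of_monic hirr (x := x) (by
    simp only [map_sub, map_pow, Polynomial.aeval_X, Polynomial.aeval_C]
    exact sub_self _) (Polynomial.monic_X_pow_sub_C _ hp.ne_zero)
  have hP0 : P = 0 := by
    by_contra hne
    have h1 := minpoly.degree_le_of_ne_zero F x hne hPx
    rw [← hmin, Polynomial.degree_X_pow_sub_C hp.pos] at h1
    have h2 : P.degree < p := by
      refine lt_of_le_of_lt (Polynomial.degree_sum_le _ _) ?_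
      rw [Finset.sup_lt_iff (WithBot.bot_lt_coe _)]
      intro j hj
      exact lt_of_le_of_lt (Polynomial.degree_C_mul_X_pow_le _ _) (by exact_mod_cast Finset.mem_range.1 hj)
    exact absurd h1 (not_le.2 h2)
  have ha0 : ∀ j < p, ∑ e ∈ s with e x = j, c e ^ p * mon id (e.erase x) = 0 := by
    intro j hj
    have : P.coeff j = 0 := by rw [hP0, Polynomial.coeff_zero]
    simp only [P, Polynomial.finsetSum_coeff, Polynomial.coeff_C_mul_X_pow] at this
    rw [Finset.sum_ite_eq, if_pos (Finset.mem_range.2 hj)] at this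
    exact congrArg Subtype.val this
  intro e he
  have key := ha0 (e x) ((hs e he).2 x)
  have hinj : Set.InjOn (fun e' : κ →₀ ℕ => e'.erase x) (↑(s.filter fun e' => e' x = e x)) := by
    intro e1 h1 e2 h2 h12
    rw [← Finsupp.erase_add_single x e1, ← Finsupp.erase_add_single x e2]
    simp only [Finset.coe_filter, Set.mem_setOf_eq] at h1 h2
    rw [h1.2, h2.2]
    exact congrArg (· + _) h12
  have h3 := h ((s.filter fun e' => e' x = e x).image fun e' => e'.erase x)
    (fun e' => c (e' + Finsupp.single x (e x))) (by
      intro e' he'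
      obtain ⟨e1, h1, rfl⟩ := Finset.mem_image.1 he'
      refine ⟨hex e1 (Finset.mem_filter.1 h1).1, fun y => ?_⟩
      rw [pow_one]
      by_cases hy : y = x
      · subst hy; simpa using hp.pos
      · rw [Finsupp.erase_ne hy]; exact (hs e1 (Finset.mem_filter.1 h1).1).2 y) (by
      rw [Finset.sum_image hinj, ← key]
      refine Finset.sum_congr rfl fun e1 h1 => ?_
      rw [pow_one]
      congr 3
      rw [← (Finset.mem_filter.1 h1).2, Finsupp.erase_add_single])
  have h4 := h3 (e.erase x) (Finset.mem_image.2 ⟨e, Finset.mem_filter.2 ⟨he, rfl⟩, rfl⟩)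
  simpa [Finsupp.erase_add_single] using h4

theorem exists_pbasis [Fact p.Prime] [CharP κ p] {B0 : Set κ} (h0 : PInd p B0 1) :
    ∃ B, B0 ⊆ B ∧ PInd p B 1 ∧ pcl p B = ⊤ := by
  classical
  obtain ⟨B, hB0, hB⟩ := zorn_subset_nonempty {B : Set κ | PInd p B 1} (by
    intro c hc hch hne
    refine ⟨⋃₀ c, ?_, fun s hs => Set.subset_sUnion_of_mem hs⟩
    intro s d hs hsum
    have hfin : (⋃ e ∈ s, (e.support : Set κ)).Finite :=
      s.finite_toSet.biUnion fun e _ => e.support.finite_toSet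
    obtain ⟨B, hBc, hB⟩ := DirectedOn.exists_mem_subset_of_finite_of_subset_sUnion hne hch.directedOn hfin (by
      intro y hy
      simp only [Set.mem_iUnion] at hy
      obtain ⟨e, he, hy⟩ := hy
      exact (hs e he).1 y hy)
    refine hc hBc s d (fun e he => ⟨fun y hy => hB ?_, (hs e he).2⟩) hsum
    simp only [Set.mem_iUnion]
    exact ⟨e, he, hy⟩) B0 h0
  refine ⟨B, hB0, hB.1, ?_⟩
  rw [eq_top_iff]
  intro x _
  by_contra hx
  have h1 := hB.2 (PInd.insert p hB.1 hx) (fun y hy => Or.inr hy)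
  exact hx (Subring.subset_closure (Or.inr ⟨x, h1 (Or.inl rfl), rfl⟩))

theorem PInd.empty [Fact p.Prime] [CharP κ p] : PInd p (∅ : Set κ) 1 := by
  intro s c hs hsum e he
  have h0 : ∀ e ∈ s, e = 0 := fun e he => by
    ext x
    by_contra hx
    exact (hs e he).1 x (Finsupp.mem_support_iff.2 hx)
  have : s = {0} := by
    apply Finset.eq_singleton_iff_unique_mem.2
    exact ⟨h0 e he ▸ he, h0⟩
  subst this
  simp [mon_zero] at hsum
  rw [h0 e he]
  exact hsum.1

end
end GN

namespace GN

section
variable {κ : Type*} [Field κ] (p : ℕ)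

theorem pcl_level [Fact p.Prime] [CharP κ p] {B : Set κ} (h : pcl p B = ⊤) (N : ℕ) :
    Subring.closure (Set.range (iterateFrobenius κ p N) ∪ id '' B) = ⊤ := by
  induction N with
  | zero =>
    rw [eq_top_iff]
    intro x _
    exact Subring.subset_closure (Or.inl ⟨x, by simp⟩)
  | succ N ih =>
    rw [eq_top_iff, ← ih, Subring.closure_le]
    rintro _ (⟨y, rfl⟩ | hb)
    · have hy : y ∈ pcl p B := by rw [h]; trivial
      have h1 : iterateFrobenius κ p N y ∈ (pcl p B).map (iterateFrobenius κ p N) := ⟨y, hy, rfl⟩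
      rw [pcl, RingHom.map_closure] at h1
      refine (Subring.closure_le.2 ?_) h1
      rintro _ ⟨z, (⟨w, rfl⟩ | ⟨b, hb, rfl⟩), rfl⟩
      · refine Subring.subset_closure (Or.inl ⟨w, ?_⟩)
        simp [iterateFrobenius_def, frobenius_def, ← pow_mul, pow_succ, mul_comm]
      · have hb' : b ∈ Subring.closure (Set.range (iterateFrobenius κ p (N + 1)) ∪ id '' B) :=
          Subring.subset_closure (Or.inr ⟨b, hb, rfl⟩)
        exact pow_mem hb' _
    · exact Subring.subset_closure (Or.inr hb)

end

/-- separability in the reducedness sense -/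
def SepExt (κ : Type u) (l : Type v) [Field κ] [Field l] [Algebra κ l] : Prop :=
  ∀ (κ' : Type u) [Field κ'] [Algebra κ κ'] [FiniteDimensional κ κ'], IsReduced (κ' ⊗[κ] l)

theorem exists_roots (κ : Type u) [Field κ] {ι : Type*} [Finite ι] (c : ι → κ) (q : ℕ) (hq : 0 < q) :
    ∃ (κ' : Type u) (_ : Field κ') (_ : Algebra κ κ') (_ : FiniteDimensional κ κ') (r' : ι → κ'),
      ∀ i, r' i ^ q = algebraMap κ κ' (c i) := by
  let Ω := AlgebraicClosure κ
  have hr : ∀ i, ∃ r : Ω, r ^ q = algebraMap κ Ω (c i) := fun i =>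
    IsAlgClosed.exists_pow_nat_eq _ hq
  choose r hr using hr
  let κ' := IntermediateField.adjoin κ (Set.range r)
  haveI : FiniteDimensional κ κ' :=
    IntermediateField.finiteDimensional_adjoin fun x _ => Algebra.IsIntegral.isIntegral x
  exact ⟨κ', inferInstance, inferInstance, inferInstance,
    fun i => ⟨r i, IntermediateField.subset_adjoin _ _ ⟨i, rfl⟩⟩, fun i => Subtype.ext (hr i)⟩

theorem sep_q (κ : Type u) (l : Type v) [Field κ] [Field l] [Algebra κ l] (hsep : SepExt κ l)
    (p : ℕ) [Fact p.Prime] [CharP κ p] (N : ℕ) {ι : Type*} [Fintype ι] (c : ι → κ)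
    (hc : ∀ d : ι → κ, ∑ i, c i * d i ^ (p ^ N) = 0 → ∀ i, d i = 0)
    (y : ι → l) (hy : ∑ i, algebraMap κ l (c i) * y i ^ (p ^ N) = 0) : ∀ i, y i = 0 := by
  classical
  have hp : p.Prime := Fact.out
  obtain ⟨κ', _, _, _, r', hr'⟩ := exists_roots κ c (p ^ N) (pow_pos hp.pos _)
  haveI := hsep κ'
  haveI : CharP κ' p := charP_of_injective_algebraMap (algebraMap κ κ').injective p
  haveI : CharP (κ' ⊗[κ] l) p := charP_of_injective_algebraMap (algebraMap κ (κ' ⊗[κ] l)).injective p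
  have hz : ∑ i, r' i ⊗ₜ[κ] y i = 0 := by
    apply IsReduced.eq_zero
    refine ⟨p ^ N, ?_⟩
    rw [sum_pow_char_pow]
    have : ∀ i, (r' i ⊗ₜ[κ] y i) ^ (p ^ N) = 1 ⊗ₜ (algebraMap κ l (c i) * y i ^ (p ^ N)) := fun i => by
      rw [Algebra.TensorProduct.tmul_pow, hr', ← Algebra.smul_def, Algebra.algebraMap_eq_smul_one,
        TensorProduct.smul_tmul]
    simp_rw [this]
    rw [← TensorProduct.tmul_sum, hy, TensorProduct.tmul_zero]
  have hli : LinearIndependent κ r' := by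
    rw [Fintype.linearIndependent_iff]
    intro d hd
    apply hc
    apply (algebraMap κ κ').injective
    have := congrArg (· ^ (p ^ N)) hd
    simp only [sum_pow_char_pow, smul_pow, hr'] at this
    rw [zero_pow (pow_ne_zero _ hp.ne_zero)] at this
    rw [map_zero, ← this, map_sum]
    refine Finset.sum_congr rfl fun i _ => ?_
    rw [map_mul, mul_comm, Algebra.smul_def]
  obtain ⟨g, hg⟩ := LinearMap.exists_leftInverse_of_injective (Finsupp.linearCombination κ r')
    (LinearMap.ker_eq_bot.2 hli)
  have hg' : ∀ i, g (r' i) = Finsupp.single i 1 := fun i => by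
    have := LinearMap.congr_fun hg (Finsupp.single i 1)
    simpa using this
  intro i
  have := congrArg (TensorProduct.lid κ l ∘ (LinearMap.rTensor l ((Finsupp.lapply i).comp g))) hz
  simp only [Function.comp, map_sum, LinearMap.rTensor_tmul, LinearMap.comp_apply, hg',
    Finsupp.lapply_apply, map_zero, TensorProduct.lid_tmul] at this
  rw [Finset.sum_eq_single i] at this
  · simpa using this
  · intro j _ hj
    rw [Finsupp.single_eq_of_ne (Ne.symm hj)]; simp
  · simp

/-- images of p-independent sets are p-independent -/
theorem PInd.image {κ : Type u} {l : Type v} [Field κ] [Field l] [Algebra κ l] (hsep : SepExt κ l)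
    (p : ℕ) [Fact p.Prime] [CharP κ p] {B : Set κ} (h : PInd p B 1) :
    PInd p (algebraMap κ l '' B) 1 := by
  classical
  intro s c hs hsum
  let j : κ ↪ l := ⟨algebraMap κ l, (algebraMap κ l).injective⟩
  have hex : ∀ e ∈ s, ∃ e' : κ →₀ ℕ, e = e'.embDomain j ∧ GE B (p ^ 1) e' := by
    intro e he
    have hsup : ↑e.support ⊆ Set.range j := fun x hx => by
      obtain ⟨b, _, hb⟩ := (hs e he).1 x hx
      exact ⟨b, hb⟩
    refine ⟨e.comapDomain j j.injective.injOn, ?_, ?_, ?_⟩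
    · rw [Finsupp.embDomain_comapDomain hsup]
    · intro x hx
      rw [Finsupp.mem_support_iff, Finsupp.comapDomain_apply] at hx
      obtain ⟨b, hb, hbx⟩ := (hs e he).1 (j x) (Finsupp.mem_support_iff.2 hx)
      exact j.injective hbx ▸ hb
    · intro x
      rw [Finsupp.comapDomain_apply]
      exact (hs e he).2 _
  choose! f hf using hex
  have hmon : ∀ e ∈ s, mon id e = algebraMap κ l (mon id (f e)) := by
    intro e he
    conv_lhs => rw [(hf e he).1]
    rw [map_mon]
    unfold mon
    rw [Finsupp.prod_embDomain]; rfl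
  have key := sep_q κ l hsep p 1 (ι := s) (fun e => mon id (f e)) (by
    intro d hd
    have hinj : Function.Injective (fun e : s => f e) := by
      intro e1 e2 h12
      apply Subtype.ext
      rw [(hf e1 e1.2).1, (hf e2 e2.2).1]
      exact congrArg _ h12
    intro e
    have := h (Finset.univ.image fun e : s => f e)
      (fun e' => if h : ∃ e : s, f e = e' then d h.choose else 0) (by
        intro e' he'
        obtain ⟨e1, _, rfl⟩ := Finset.mem_image.1 he'
        exact (hf e1 e1.2).2) (by
        rw [Finset.sum_image (fun a _ b _ hab => hinj hab), ← hd]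
        refine Finset.sum_congr rfl fun e _ => ?_
        have hex : ∃ e1 : s, f e1 = f e := ⟨e, rfl⟩
        rw [dif_pos hex, hinj hex.choose_spec, mul_comm]) (f e) (Finset.mem_image.2 ⟨e, Finset.mem_univ _, rfl⟩)
    have hex : ∃ e1 : s, f e1 = f e := ⟨e, rfl⟩
    rw [dif_pos hex, hinj hex.choose_spec] at this
    exact this) (fun e => c e) (by
      rw [← hsum, ← Finset.sum_coe_sort s]
      refine Finset.sum_congr rfl fun e _ => ?_
      rw [hmon e e.2, mul_comm])
  intro e he
  exact key ⟨e, he⟩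

end GN

namespace GN

theorem pow_dvd_choose {p : ℕ} (hp : p.Prime) (N i : ℕ) (hi : 0 < i) (hiN : i < p ^ N) :
    ∃ v i', i = p ^ v * i' ∧ v < N ∧ p ^ (N - v) ∣ (p ^ N).choose i := by
  obtain ⟨v, i', hi', rfl⟩ := Nat.exists_eq_pow_mul_and_not_dvd hi.ne' p hp.ne_one
  have hi0 : 0 < i' := Nat.pos_of_ne_zero (by rintro rfl; simp at hi')
  have hv : v < N := by
    by_contra hv
    push Not at hv
    have : p ^ N ≤ p ^ v * i' := (Nat.pow_le_pow_right hp.pos hv).trans (Nat.le_mul_of_pos_right _ hi0)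
    omega
  refine ⟨v, i', rfl, hv, ?_⟩
  have h1 := Nat.add_one_mul_choose_eq (p ^ N - 1) (p ^ v * i' - 1)
  rw [Nat.sub_add_cancel (Nat.pow_pos hp.pos), Nat.sub_add_cancel hi] at h1
  have h2 : p ^ v * (p ^ (N - v) * (p ^ N - 1).choose (p ^ v * i' - 1)) =
      p ^ v * ((p ^ N).choose (p ^ v * i') * i') := by
    rw [← mul_assoc, ← pow_add, Nat.add_sub_cancel' hv.le, h1]; ring
  have h3 := Nat.eq_of_mul_eq_mul_left (Nat.pow_pos hp.pos) h2
  have h4 : p ^ (N - v) ∣ (p ^ N).choose (p ^ v * i') * i' := ⟨_, h3.symm⟩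
  exact Nat.Coprime.dvd_of_dvd_mul_right
    (Nat.Coprime.pow_left _ ((Nat.Prime.coprime_iff_not_dvd hp).2 hi')) h4

section
variable {T : Type*} [CommRing T] [IsLocalRing T] (p : ℕ) [Fact p.Prime] [CharP (ResidueField T) p]
  (σ : ResidueField T → T) (B : Set (ResidueField T))

/-- level N subring -/
def SN (N : ℕ) : Subring T := Subring.closure (Set.range (fun x : T => x ^ (p ^ N)) ∪ σ '' B)

theorem pow_mem_SN (N : ℕ) (x : T) : x ^ (p ^ N) ∈ SN p σ B N := Subring.subset_closure (Or.inl ⟨x, rfl⟩)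
theorem sec_mem_SN (N : ℕ) {b : ResidueField T} (hb : b ∈ B) : σ b ∈ SN p σ B N :=
  Subring.subset_closure (Or.inr ⟨b, hb, rfl⟩)

theorem SN_succ (N : ℕ) : SN p σ B (N + 1) ≤ SN p σ B N := by
  refine Subring.closure_le.2 ?_
  rintro _ (⟨x, rfl⟩ | ⟨b, hb, rfl⟩)
  · change x ^ (p ^ (N + 1)) ∈ _
    rw [pow_succ, mul_comm, pow_mul]
    exact pow_mem_SN p σ B N _
  · exact sec_mem_SN p σ B N hb

theorem SN_anti : Antitone (SN p σ B) := antitone_nat_of_succ_le (SN_succ p σ B)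

theorem p_mem : (p : T) ∈ maximalIdeal T := by
  rw [← residue_eq_zero_iff, map_natCast, CharP.cast_eq_zero]

variable {B}

/-- D(k) -/
def DN (B : Set (ResidueField T)) (k : ℕ) : Prop := ∀ s ∈ SN p σ B k, ∃ s' ∈ SN p σ B (k + 1), s - s' ∈ maximalIdeal T ^ (k + 1)

theorem DN_le {N : ℕ} (h : ∀ k < N, DN p σ B k) {k : ℕ} (hk : k ≤ N) :
    ∀ s ∈ SN p σ B k, ∃ s' ∈ SN p σ B N, s - s' ∈ maximalIdeal T ^ (k + 1) := by
  induction N with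
  | zero =>
    intro s hs
    obtain rfl : k = 0 := by omega
    exact ⟨s, hs, by simp⟩
  | succ N ih =>
    intro s hs
    rcases Nat.lt_or_ge N k with h1 | h1
    · obtain rfl : k = N + 1 := by omega
      exact ⟨s, hs, by simp⟩
    · obtain ⟨s', hs', h2⟩ := ih (fun k hk => h k (by omega)) h1 s hs
      obtain ⟨s'', hs'', h3⟩ := h N (by omega) s' hs'
      refine ⟨s'', hs'', ?_⟩
      have : s - s'' = (s - s') + (s' - s'') := by ring
      rw [this]
      exact add_mem h2 (Ideal.pow_le_pow_right (by omega) h3)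

theorem BN (hσ : ∀ b ∈ B, residue T (σ b) = b) (hB : PInd p B 1) (N : ℕ) (h : ∀ k < N, DN p σ B k) :
    ∀ s ∈ SN p σ B N, s ∈ maximalIdeal T → ∃ s' ∈ SN p σ B N, s - p * s' ∈ maximalIdeal T ^ (N + 1) := by
  classical
  have hp : p.Prime := Fact.out
  let I : Ideal T := maximalIdeal T ^ (N + 1)
  let π := Ideal.Quotient.mk I
  let S' : Subring (T ⧸ I) := (SN p σ B N).map π
  let J : Ideal S' := Ideal.span {(p : S')}
  let Q := S' ⧸ J
  have hmem : ∀ s ∈ SN p σ B N, π s ∈ S' := fun s hs => ⟨s, hs, rfl⟩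
  have hJ : ∀ (y : S'), Ideal.Quotient.mk J y = 0 → ∃ s' ∈ SN p σ B N, (y : T ⧸ I) = p * π s' := by
    intro y hy
    rw [Ideal.Quotient.eq_zero_iff_mem, Ideal.mem_span_singleton'] at hy
    obtain ⟨⟨_, s', hs', rfl⟩, rfl⟩ := hy
    exact ⟨s', hs', by simp [mul_comm]⟩
  -- additivity
  have hadd : ∀ x y : T, ∃ s' ∈ SN p σ B N, π ((x + y) ^ (p ^ N)) - π (x ^ (p ^ N)) - π (y ^ (p ^ N)) = p * π s' := by
    intro x y
    have hterm : ∀ i ∈ Finset.Ico 1 (p ^ N), ∃ s' ∈ SN p σ B N,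
        π (x ^ i * y ^ (p ^ N - i) * ((p ^ N).choose i : ℕ)) = p * π s' := by
      intro i hi
      rw [Finset.mem_Ico] at hi
      obtain ⟨v, i', rfl, hv, c, hc⟩ := pow_dvd_choose hp N i (by omega) hi.2
      have hz : x ^ (p ^ v * i') * y ^ (p ^ N - p ^ v * i') = (x ^ i' * y ^ (p ^ (N - v) - i')) ^ (p ^ v) := by
        rw [mul_pow, ← pow_mul, ← pow_mul, Nat.sub_mul, ← pow_add, Nat.sub_add_cancel hv.le, mul_comm i']
      obtain ⟨s', hs', h1⟩ := DN_le p σ h hv.le _ (pow_mem_SN p σ B v (x ^ i' * y ^ (p ^ (N - v) - i')))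
      refine ⟨p ^ (N - v - 1) * c * s', ?_, ?_⟩
      · exact mul_mem (mul_mem (pow_mem (natCast_mem _ _) _) (natCast_mem _ _)) hs'
      · rw [hz, hc]
        have h2 : π (p ^ (N - v) * ((x ^ i' * y ^ (p ^ (N - v) - i')) ^ (p ^ v) - s')) = 0 := by
          rw [Ideal.Quotient.eq_zero_iff_mem]
          have : maximalIdeal T ^ (N - v) * maximalIdeal T ^ (v + 1) = I := by
            rw [← pow_add]; congr 1; omega
          rw [← this]
          exact Ideal.mul_mem_mul (Ideal.pow_mem_pow (p_mem p) _) h1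
        have h3 : (p : T) ^ (N - v) = p * p ^ (N - v - 1) := by
          rw [← pow_succ']; congr 1; omega
        simp only [map_mul, map_sub, map_pow, map_natCast, Nat.cast_mul, Nat.cast_pow] at h2 ⊢
        have h3' : (p : T ⧸ I) ^ (N - v) = p * p ^ (N - v - 1) := by
          rw [← pow_succ']; congr 1; omega
        rw [h3'] at h2 ⊢
        linear_combination (c : T ⧸ I) * h2
    choose! g hg using hterm
    refine ⟨∑ i ∈ Finset.Ico 1 (p ^ N), g i, sum_mem fun i hi => (hg i hi).1, ?_⟩
    rw [map_sum, Finset.mul_sum, ← Finset.sum_congr rfl fun i hi => (hg i hi).2, ← map_sum,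
      ← map_sub, ← map_sub]
    congr 1
    rw [add_pow, Finset.sum_range_succ, Finset.range_eq_Ico, Finset.sum_eq_sum_Ico_succ_bot (Nat.pow_pos hp.pos)]
    simp
  let φ : T →+* Q :=
    { toFun := fun x => Ideal.Quotient.mk J ⟨π (x ^ (p ^ N)), hmem _ (pow_mem_SN p σ B N x)⟩
      map_one' := by
        rw [← map_one (Ideal.Quotient.mk J)]
        congr 1
        apply Subtype.ext; simp
      map_mul' := by
        intro x y
        rw [← map_mul]
        congr 1
        apply Subtype.ext; simp [mul_pow]
      map_zero' := by
        rw [← map_zero (Ideal.Quotient.mk J)]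
        congr 1
        apply Subtype.ext
        simp [hp.ne_zero]
      map_add' := by
        intro x y
        rw [← map_add, Ideal.Quotient.eq, Ideal.mem_span_singleton']
        obtain ⟨s', hs', h1⟩ := hadd x y
        refine ⟨⟨π s', hmem _ hs'⟩, ?_⟩
        apply Subtype.ext
        simp only [Subring.coe_mul, AddSubgroupClass.coe_sub, Subring.coe_add, Subring.coe_natCast]
        rw [mul_comm, ← h1]; ring }
  let β : ResidueField T → Q := fun x => if hx : x ∈ B then
    Ideal.Quotient.mk J ⟨π (σ x), hmem _ (sec_mem_SN p σ B N hx)⟩ else 0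
  -- S' → Q lands in the closure
  let ψ : SN p σ B N →+* Q := (Ideal.Quotient.mk J).comp
    ((π.comp (SN p σ B N).subtype).codRestrict S' fun x => hmem _ x.2)
  have hcl : ∀ s (hs : s ∈ SN p σ B N), ψ ⟨s, hs⟩ ∈ Subring.closure (Set.range φ ∪ β '' B) := by
    intro s hs
    refine Subring.closure_induction (p := fun s hs => ψ ⟨s, hs⟩ ∈ Subring.closure (Set.range φ ∪ β '' B)) ?_ ?_ ?_ ?_ ?_ ?_ hs
    · rintro _ (⟨x, rfl⟩ | ⟨b, hb, rfl⟩)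
      · exact Subring.subset_closure (Or.inl ⟨x, rfl⟩)
      · refine Subring.subset_closure (Or.inr ⟨b, hb, ?_⟩)
        simp only [β, dif_pos hb]; rfl
    · exact (map_zero ψ).symm ▸ zero_mem _
    · exact (map_one ψ).symm ▸ one_mem _
    · intro x y hx hy h1 h2
      exact (map_add ψ ⟨x, hx⟩ ⟨y, hy⟩) ▸ add_mem h1 h2
    · intro x hx h1
      exact (map_neg ψ ⟨x, hx⟩) ▸ neg_mem h1
    · intro x y hx hy h1 h2
      exact (map_mul ψ ⟨x, hx⟩ ⟨y, hy⟩) ▸ mul_mem h1 h2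
  intro s hs hsm
  obtain ⟨t, c, ht, hc⟩ := span_closure φ β B (p ^ N) (Nat.pow_pos hp.pos) (by
    intro x hx
    refine ⟨σ x, ?_⟩
    simp only [β, dif_pos hx]
    rw [← map_pow]; rfl) _ (hcl s hs)
  have hmonS : ∀ e ∈ t, mon σ e ∈ SN p σ B N := fun e he =>
    prod_mem fun x hx => pow_mem (sec_mem_SN p σ B N ((ht e he).1 x hx)) _
  have hmonβ : ∀ e (he : e ∈ t), mon β e = ψ ⟨mon σ e, hmonS e he⟩ := by
    intro e he
    have : (⟨mon σ e, hmonS e he⟩ : SN p σ B N) =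
        e.support.attach.prod fun x => (⟨σ x, sec_mem_SN p σ B N ((ht e he).1 x x.2)⟩ : SN p σ B N) ^ e x := by
      apply Subtype.ext
      rw [← Subring.subtype_apply, ← Subring.subtype_apply, map_prod]
      simp only [map_pow, Subring.subtype_apply]
      unfold mon Finsupp.prod
      rw [← Finset.prod_attach]
    rw [this, map_prod]
    unfold mon Finsupp.prod
    rw [← Finset.prod_attach]
    refine Finset.prod_congr rfl fun x _ => ?_
    rw [map_pow]
    congr 1
    simp only [β, dif_pos ((ht e he).1 x x.2)]; rfl
  have hsum : ψ (⟨s, hs⟩ - ∑ e ∈ t.attach, ⟨c e ^ (p ^ N), pow_mem_SN p σ B N _⟩ * ⟨mon σ e, hmonS e e.2⟩) = 0 := by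
    rw [map_sub, hc, map_sum, ← Finset.sum_attach, sub_eq_zero]
    refine Finset.sum_congr rfl fun e _ => ?_
    rw [map_mul, hmonβ e e.2]
    rfl
  obtain ⟨s', hs', h1⟩ := hJ _ hsum
  have h2 : s - (∑ e ∈ t, c e ^ (p ^ N) * mon σ e) - p * s' ∈ I := by
    rw [← Ideal.Quotient.eq_zero_iff_mem, map_sub, sub_eq_zero, map_mul, map_natCast]
    change _ = (p : T ⧸ I) * π s'
    rw [← h1, ← Finset.sum_attach]
    refine congrArg π ?_
    change _ = Subring.subtype _ _
    rw [map_sub, map_sum]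
    rfl
  have h3 : ∑ e ∈ t, (residue T (c e)) ^ (p ^ N) * mon id e = 0 := by
    have : s - (∑ e ∈ t, c e ^ (p ^ N) * mon σ e) - p * s' ∈ maximalIdeal T :=
      Ideal.pow_le_self (by omega) h2
    rw [← residue_eq_zero_iff, map_sub, map_sub, (residue_eq_zero_iff s).2 hsm, map_mul,
      (residue_eq_zero_iff _).2 (p_mem p), zero_mul, sub_zero, zero_sub, neg_eq_zero, map_sum] at this
    rw [← this]
    refine Finset.sum_congr rfl fun e he => ?_
    rw [map_mul, map_pow, map_mon]
    congr 1
    unfold mon Finsupp.prod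
    refine Finset.prod_congr rfl fun x hx => ?_
    change x ^ e x = residue T (σ x) ^ e x
    rw [hσ x ((ht e he).1 x hx)]
  have h4 := PInd.level p hB N t (fun e => residue T (c e)) ht h3
  have h5 : ∑ e ∈ t, c e ^ (p ^ N) * mon σ e ∈ I := by
    refine sum_mem fun e he => Ideal.mul_mem_right _ _ ?_
    refine Ideal.pow_le_pow_right ?_ (Ideal.pow_mem_pow ((residue_eq_zero_iff _).1 (h4 e he)) (p ^ N))
    exact Nat.lt_pow_self hp.one_lt
  refine ⟨s', hs', ?_⟩
  have : s - p * s' = (s - (∑ e ∈ t, c e ^ (p ^ N) * mon σ e) - p * s') + ∑ e ∈ t, c e ^ (p ^ N) * mon σ e := by ring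
  rw [this]
  exact add_mem h2 h5

end
end GN

namespace GN

section
variable {T : Type*} [CommRing T] [IsLocalRing T] (p : ℕ) [Fact p.Prime] [CharP (ResidueField T) p]
  (σ : ResidueField T → T) {B : Set (ResidueField T)}

theorem SN_surj (hσ : ∀ b ∈ B, residue T (σ b) = b) (hB' : pcl p B = ⊤) (N : ℕ) (x : ResidueField T) :
    ∃ s ∈ SN p σ B N, residue T s = x := by
  have h1 : (SN p σ B N).map (residue T) = ⊤ := by
    rw [eq_top_iff, ← pcl_level p hB' N, Subring.closure_le]
    rintro _ (⟨y, rfl⟩ | ⟨b, hb, rfl⟩)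
    · obtain ⟨y, rfl⟩ := residue_surjective y
      exact ⟨y ^ (p ^ N), pow_mem_SN p σ B N y, by simp [iterateFrobenius_def]⟩
    · exact ⟨σ b, sec_mem_SN p σ B N hb, hσ b hb⟩
  have h2 : x ∈ (SN p σ B N).map (residue T) := by rw [h1]; trivial
  exact h2

theorem DN_all (hσ : ∀ b ∈ B, residue T (σ b) = b) (hB : PInd p B 1) (hB' : pcl p B = ⊤) (N : ℕ) :
    DN p σ B N := by
  induction N using Nat.strong_induction_on with
  | _ N ih =>
    have hBN := BN p σ hσ hB N ih
    have h1 : ∀ s ∈ SN p σ B N, ∃ s' ∈ SN p σ B (N + 1), ∃ s'' ∈ SN p σ B N,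
        s - s' - p * s'' ∈ maximalIdeal T ^ (N + 1) := by
      intro s hs
      obtain ⟨s', hs', h2⟩ := SN_surj p σ hσ hB' (N + 1) (residue T s)
      obtain ⟨s'', hs'', h3⟩ := hBN (s - s') (sub_mem hs (SN_succ p σ B N hs'))
        (by rw [← residue_eq_zero_iff, map_sub, h2, sub_self])
      exact ⟨s', hs', s'', hs'', h3⟩
    have h2 : ∀ k, ∀ s ∈ SN p σ B N, ∃ s' ∈ SN p σ B (N + 1), ∃ s'' ∈ SN p σ B N,
        s - s' - p ^ k * s'' ∈ maximalIdeal T ^ (N + 1) := by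
      intro k
      induction k with
      | zero => intro s hs; exact ⟨0, zero_mem _, s, hs, by simp⟩
      | succ k ihk =>
        intro s hs
        obtain ⟨s1, hs1, s2, hs2, h3⟩ := ihk s hs
        obtain ⟨s3, hs3, s4, hs4, h4⟩ := h1 s2 hs2
        refine ⟨s1 + p ^ k * s3, add_mem hs1 (mul_mem (pow_mem (natCast_mem _ _) _) hs3), s4, hs4, ?_⟩
        have : s - (s1 + p ^ k * s3) - p ^ (k + 1) * s4 = (s - s1 - p ^ k * s2) + p ^ k * (s2 - s3 - p * s4) := by ring
        rw [this]
        exact add_mem h3 (Ideal.mul_mem_left _ _ h4)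
    intro s hs
    obtain ⟨s1, hs1, s2, hs2, h3⟩ := h2 (N + 1) s hs
    refine ⟨s1, hs1, ?_⟩
    have : s - s1 = (s - s1 - p ^ (N + 1) * s2) + p ^ (N + 1) * s2 := by ring
    rw [this]
    exact add_mem h3 (Ideal.mul_mem_right _ _ (Ideal.pow_mem_pow (p_mem p) _))

end

structure Coef {T : Type*} [CommRing T] [IsLocalRing T] (C : Subring T) (p : ℕ) : Prop where
  pm : (p : T) ∈ maximalIdeal T
  reg : (p : T) = 0 ∨ (p : T) ∈ nonZeroDivisors T
  mem : ∀ x ∈ C, x ∈ maximalIdeal T → ∃ c ∈ C, x = p * c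
  surj : ∀ t, ∃ c ∈ C, t - c ∈ maximalIdeal T
  closed : ∀ x, (∀ N, ∃ c ∈ C, x - c ∈ maximalIdeal T ^ N) → x ∈ C

theorem artin_rees_elt {T : Type*} [CommRing T] [IsNoetherianRing T] (I : Ideal T) (u : T)
    (hu : u ∈ nonZeroDivisors T) : ∃ k, ∀ n x, u * x ∈ I ^ (n + k) → x ∈ I ^ n := by
  obtain ⟨k, hk⟩ := Ideal.exists_pow_inf_eq_pow_smul I (Ideal.span {u} : Ideal T)
  refine ⟨k, fun n x hx => ?_⟩
  have h1 := hk (n + k) (by omega)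
  have h2 : u * x ∈ (I ^ (n + k) • ⊤ ⊓ Ideal.span {u} : Ideal T) := by
    refine ⟨?_, Ideal.mul_mem_right _ _ (Ideal.mem_span_singleton_self u)⟩
    simpa using hx
  rw [h1, Nat.add_sub_cancel] at h2
  have h3 : u * x ∈ I ^ n * Ideal.span {u} := by
    refine Submodule.smul_mono le_rfl inf_le_right h2
  rw [Ideal.mem_mul_span_singleton] at h3
  obtain ⟨z, hz, h4⟩ := h3
  have : z = x := by
    have h5 : u * (z - x) = 0 := by linear_combination h4
    exact sub_eq_zero.1 ((mem_nonZeroDivisors_iff.1 hu).1 _ h5)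
  exact this ▸ hz

/-- limits in adically complete rings -/
theorem exists_lim {T : Type*} [CommRing T] (J : Ideal T) [IsAdicComplete J T] (f : ℕ → T)
    (h : ∀ n, f (n + 1) - f n ∈ J ^ n) : ∃ L, ∀ n, L - f n ∈ J ^ n :=
  ((adic_iff J).1 inferInstance).2 f h

section
variable {T : Type*} [CommRing T] [IsLocalRing T] [IsNoetherianRing T] [IsAdicComplete (maximalIdeal T) T]
  (p : ℕ) [Fact p.Prime] [CharP (ResidueField T) p]
  (σ : ResidueField T → T) {B : Set (ResidueField T)}

/-- the coefficient ring -/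
def CR (B : Set (ResidueField T)) : Subring T where
  carrier := {x | ∀ N, ∃ s ∈ SN p σ B N, x - s ∈ maximalIdeal T ^ (N + 1)}
  zero_mem' := fun N => ⟨0, zero_mem _, by simp⟩
  one_mem' := fun N => ⟨1, one_mem _, by simp⟩
  add_mem' := fun {x y} hx hy N => by
    obtain ⟨s, hs, h1⟩ := hx N
    obtain ⟨t, ht, h2⟩ := hy N
    refine ⟨s + t, add_mem hs ht, ?_⟩
    have : x + y - (s + t) = (x - s) + (y - t) := by ring
    rw [this]; exact add_mem h1 h2
  neg_mem' := fun {x} hx N => by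
    obtain ⟨s, hs, h1⟩ := hx N
    refine ⟨-s, neg_mem hs, ?_⟩
    have : -x - -s = -(x - s) := by ring
    rw [this]; exact neg_mem h1
  mul_mem' := fun {x y} hx hy N => by
    obtain ⟨s, hs, h1⟩ := hx N
    obtain ⟨t, ht, h2⟩ := hy N
    refine ⟨s * t, mul_mem hs ht, ?_⟩
    have : x * y - (s * t) = (x - s) * y + s * (y - t) := by ring
    rw [this]; exact add_mem (Ideal.mul_mem_right _ _ h1) (Ideal.mul_mem_left _ _ h2)

theorem CR_approx (hσ : ∀ b ∈ B, residue T (σ b) = b) (hB : PInd p B 1) (hB' : pcl p B = ⊤) (N : ℕ) :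
    ∀ s ∈ SN p σ B N, ∃ c ∈ CR p σ B, s - c ∈ maximalIdeal T ^ (N + 1) := by
  intro s hs
  have hD := DN_all p σ hσ hB hB'
  choose! g hg1 hg2 using hD
  let f : ℕ → T := fun n => Nat.rec s (fun k t => g (N + k) t) n
  have hf : ∀ n, f n ∈ SN p σ B (N + n) := by
    intro n
    induction n with
    | zero => exact hs
    | succ n ih => exact hg1 (N + n) _ ih
  have hf' : ∀ n, f n - f (n + 1) ∈ maximalIdeal T ^ (N + n + 1) := fun n => hg2 (N + n) _ (hf n)
  have hd : ∀ k n, f k - f (k + n) ∈ maximalIdeal T ^ (N + k + 1) := by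
    intro k n
    induction n with
    | zero => simp
    | succ n ih =>
      have : f k - f (k + (n + 1)) = (f k - f (k + n)) + (f (k + n) - f (k + n + 1)) := by rw [← add_assoc]; ring
      rw [this]
      exact add_mem ih (Ideal.pow_le_pow_right (by omega) (hf' (k + n)))
  obtain ⟨L, hL⟩ := exists_lim (maximalIdeal T) f (fun n => by
    rw [← neg_sub]
    exact neg_mem (Ideal.pow_le_pow_right (by omega) (hf' n)))
  have hL' : ∀ n, f n - L ∈ maximalIdeal T ^ (N + n + 1) := by
    intro n
    have : f n - L = (f n - f (n + (N + n + 1))) - (L - f (n + (N + n + 1))) := by ring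
    rw [this]
    exact sub_mem (hd n (N + n + 1)) (Ideal.pow_le_pow_right (by omega) (hL (n + (N + n + 1))))
  refine ⟨L, fun M => ?_, hL' 0⟩
  refine ⟨f M, SN_anti p σ B (by omega) (hf M), ?_⟩
  rw [← neg_sub]
  exact neg_mem (Ideal.pow_le_pow_right (by omega) (hL' M))

theorem CR_coef (hσ : ∀ b ∈ B, residue T (σ b) = b) (hB : PInd p B 1) (hB' : pcl p B = ⊤)
    (hreg : (p : T) = 0 ∨ (p : T) ∈ nonZeroDivisors T) : Coef (CR p σ B) p := by
  have happ := CR_approx p σ hσ hB hB'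
  have hclosed : ∀ x, (∀ N, ∃ c ∈ CR p σ B, x - c ∈ maximalIdeal T ^ N) → x ∈ CR p σ B := by
    intro x hx N
    obtain ⟨c, hc, h1⟩ := hx (N + 1)
    obtain ⟨s, hs, h2⟩ := hc N
    refine ⟨s, hs, ?_⟩
    have : x - s = (x - c) + (c - s) := by ring
    rw [this]; exact add_mem h1 h2
  refine ⟨p_mem p, hreg, ?_, ?_, hclosed⟩
  · intro x hx hxm
    have h1 : ∀ N, ∃ c ∈ CR p σ B, x - p * c ∈ maximalIdeal T ^ (N + 1) := by
      intro N
      obtain ⟨s, hs, h2⟩ := hx N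
      obtain ⟨s', hs', h3⟩ := BN p σ hσ hB N (fun k _ => DN_all p σ hσ hB hB' k) s hs (by
        have : s = x - (x - s) := by ring
        rw [this]; exact sub_mem hxm (Ideal.pow_le_self (by omega) h2))
      obtain ⟨c, hc, h4⟩ := happ N s' hs'
      refine ⟨c, hc, ?_⟩
      have : x - p * c = (x - s) + (s - p * s') + p * (s' - c) := by ring
      rw [this]
      exact add_mem (add_mem h2 h3) (Ideal.mul_mem_left _ _ h4)
    choose c hc h1 using h1
    rcases hreg with h0 | hreg
    · refine ⟨0, zero_mem _, ?_⟩
      rw [mul_zero]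
      apply haus_zero (maximalIdeal T)
      intro n
      have := h1 n
      rw [h0, zero_mul, sub_zero] at this
      exact Ideal.pow_le_pow_right (by omega) this
    · obtain ⟨k, hk⟩ := artin_rees_elt (maximalIdeal T) (p : T) hreg
      obtain ⟨L, hL⟩ := exists_lim (maximalIdeal T) (fun n => c (n + k)) (fun n => by
        apply hk
        have : (p : T) * (c (n + 1 + k) - c (n + k)) = (x - p * c (n + k)) - (x - p * c (n + 1 + k)) := by ring
        rw [this]
        exact sub_mem (Ideal.pow_le_pow_right (by omega) (h1 (n + k)))
          (Ideal.pow_le_pow_right (by omega) (h1 (n + 1 + k))))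
      refine ⟨L, hclosed L fun N => ⟨_, hc (N + k), hL N⟩, ?_⟩
      rw [← sub_eq_zero]
      apply haus_zero (maximalIdeal T)
      intro n
      have : x - p * L = (x - p * c (n + k)) - p * (L - c (n + k)) := by ring
      rw [this]
      exact sub_mem (Ideal.pow_le_pow_right (by omega) (h1 (n + k))) (Ideal.mul_mem_left _ _ (hL n))
  · intro t
    obtain ⟨c, hc, h1⟩ := happ 0 t (by
      have := pow_mem_SN p σ B 0 t
      simpa using this)
    exact ⟨c, hc, by simpa using h1⟩

end
end GN

namespace GN

section
variable {T : Type*} [CommRing T] [IsLocalRing T] [IsAdicComplete (maximalIdeal T) T]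
  {C : Subring T} {p : ℕ}

theorem Coef.inv (h : Coef C p) {x : T} (hx : x ∈ C) (hxm : x ∉ maximalIdeal T) :
    ∃ y ∈ C, x * y = 1 := by
  have hxu : IsUnit x := by simpa using hxm
  obtain ⟨z, hz⟩ := hxu.exists_right_inv
  obtain ⟨c, hc, h1⟩ := h.surj z
  have h2 : 1 - x * c ∈ maximalIdeal T := by
    have : 1 - x * c = x * (z - c) := by rw [mul_sub, hz]
    rw [this]; exact Ideal.mul_mem_left _ _ h1
  obtain ⟨d, hd, h3⟩ := h.mem _ (sub_mem (one_mem _) (mul_mem hx hc)) h2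
  have h4 : IsUnit (1 - (p : T) * d) := by
    rw [← h3]
    have : 1 - (1 - x * c) ∉ maximalIdeal T := by
      intro h5
      have := add_mem h5 h2
      simp at this
    simpa using this
  obtain ⟨y, hy⟩ := h4.exists_right_inv
  have hyC : y ∈ C := by
    apply h.closed
    intro N
    refine ⟨∑ i ∈ Finset.range N, ((p : T) * d) ^ i, sum_mem fun i _ =>
      pow_mem (mul_mem (natCast_mem _ _) hd) _, ?_⟩
    have h5 := mul_neg_geom_sum ((p : T) * d) N
    have h6 : y - ∑ i ∈ Finset.range N, ((p : T) * d) ^ i = y * ((p : T) * d) ^ N := by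
      linear_combination (-y) * h5 + (∑ i ∈ Finset.range N, ((p : T) * d) ^ i) * hy
    rw [h6]
    exact Ideal.mul_mem_left _ _ (Ideal.pow_mem_pow (Ideal.mul_mem_right _ _ h.pm) _)
  refine ⟨c * y, mul_mem hc hyC, ?_⟩
  have : x * c = 1 - p * d := by rw [← h3]; ring
  rw [← mul_assoc, this, hy]

theorem Coef.isUnit_iff (h : Coef C p) (x : C) : IsUnit x ↔ (x : T) ∉ maximalIdeal T := by
  constructor
  · intro hx
    have := hx.map C.subtype
    simpa using this
  · intro hx
    obtain ⟨y, hy, h1⟩ := h.inv x.2 hx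
    exact IsUnit.of_mul_eq_one ⟨y, hy⟩ (Subtype.ext h1)

theorem Coef.isLocalRing (h : Coef C p) : IsLocalRing C := by
  refine IsLocalRing.of_nonunits_add ?_
  intro a b ha hb
  rw [mem_nonunits_iff, h.isUnit_iff, not_not] at ha hb ⊢
  exact add_mem ha hb

theorem Coef.mem_max [IsLocalRing C] (h : Coef C p) (x : C) : x ∈ maximalIdeal C ↔ (x : T) ∈ maximalIdeal T := by
  rw [IsLocalRing.mem_maximalIdeal, mem_nonunits_iff, h.isUnit_iff, not_not]

theorem Coef.max_eq [IsLocalRing C] (h : Coef C p) : maximalIdeal C = Ideal.span {(p : C)} := by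
  apply le_antisymm
  · intro x hx
    rw [h.mem_max] at hx
    obtain ⟨c, hc, h1⟩ := h.mem x x.2 hx
    rw [Ideal.mem_span_singleton]
    exact ⟨⟨c, hc⟩, Subtype.ext (by simpa using h1)⟩
  · rw [Ideal.span_singleton_le_iff_mem, h.mem_max]
    simpa using h.pm

theorem Coef.pow_mem (h : Coef C p) {n : ℕ} {x : C} (hx : x ∈ Ideal.span {(p : C)} ^ n) :
    ∃ c : C, x = p ^ n * c ∧ (x : T) ∈ maximalIdeal T ^ n := by
  rw [Ideal.span_singleton_pow, Ideal.mem_span_singleton] at hx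
  obtain ⟨c, rfl⟩ := hx
  refine ⟨c, rfl, ?_⟩
  simp only [Subring.coe_mul, Subring.coe_pow, Subring.coe_natCast]
  exact Ideal.mul_mem_right _ _ (Ideal.pow_mem_pow h.pm _)

theorem Coef.series (h : Coef C p) (g : ℕ → C) :
    ∃ L : C, ∀ n, (L : T) - ∑ i ∈ Finset.range n, p ^ i * (g i : T) ∈ maximalIdeal T ^ n := by
  obtain ⟨L, hL⟩ := exists_lim (maximalIdeal T) (fun n => ∑ i ∈ Finset.range n, p ^ i * (g i : T)) (by
    intro n
    rw [Finset.sum_range_succ, add_sub_cancel_left]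
    exact Ideal.mul_mem_right _ _ (Ideal.pow_mem_pow h.pm _))
  refine ⟨⟨L, h.closed L fun N => ⟨_, ?_, hL N⟩⟩, hL⟩
  exact sum_mem fun i _ => mul_mem (_root_.pow_mem (natCast_mem _ _) _) (g i).2

theorem Coef.complete (h : Coef C p) : IsAdicComplete (Ideal.span {(p : C)}) C := by
  rw [adic_iff]
  refine ⟨fun x hx => Subtype.ext (haus_zero (maximalIdeal T) fun n => ?_), ?_⟩
  · obtain ⟨_, _, h1⟩ := h.pow_mem (hx n)
    exact h1
  · intro f hf
    have hg : ∀ n, ∃ g : C, f (n + 1) - f n = p ^ n * g := fun n => by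
      obtain ⟨c, h1, _⟩ := h.pow_mem (hf n); exact ⟨c, h1⟩
    choose g hg using hg
    have hsum : ∀ n k, f (n + k) = f n + p ^ n * ∑ i ∈ Finset.range k, p ^ i * g (n + i) := by
      intro n k
      induction k with
      | zero => simp
      | succ k ih =>
        have := hg (n + k)
        rw [← add_assoc, Finset.sum_range_succ, mul_add, ← add_assoc, ← ih, ← mul_assoc, ← pow_add, ← this]
        ring
    have hL := fun n => h.series (fun i => g (n + i))
    choose L hL using hL
    refine ⟨f 0 + L 0, fun n => ?_⟩
    have key : f 0 + L 0 - f n = p ^ n * L n := by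
      apply Subtype.ext
      rw [← sub_eq_zero]
      apply haus_zero (maximalIdeal T)
      intro k
      have h0 := hL 0 (n + k)
      have h1 := hL n k
      have h2 := congrArg Subtype.val (hsum 0 (n + k))
      have h3 := congrArg Subtype.val (hsum n k)
      simp only [Subring.coe_add, Subring.coe_mul, Subring.coe_pow, Subring.coe_natCast, zero_add, pow_zero, one_mul,
        AddSubmonoidClass.coe_finsetSum, AddSubgroupClass.coe_sub] at h0 h1 h2 h3 ⊢
      have : (f 0 : T) + L 0 - f n - p ^ n * L n =
        ((L 0 : T) - ∑ x ∈ Finset.range (n + k), (p : T) ^ x * (g x : T)) - p ^ n * ((L n : T) - ∑ x ∈ Finset.range k, (p : T) ^ x * (g (n + x) : T)) := by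
        linear_combination h3 - h2
      rw [this]
      exact sub_mem (Ideal.pow_le_pow_right (by omega) h0) (Ideal.mul_mem_left _ _ h1)
    rw [key, Ideal.span_singleton_pow]
    exact Ideal.mul_mem_right _ _ (Ideal.mem_span_singleton_self _)

theorem Coef.factor (h : Coef C p) {x : C} (hx : x ≠ 0) : ∃ n u, IsUnit u ∧ x = p ^ n * u := by
  classical
  haveI := h.isLocalRing
  have hex : ∃ n, x ∉ Ideal.span {(p : C)} ^ n := by
    by_contra hcon
    push Not at hcon
    haveI := h.complete
    exact hx (haus_zero _ hcon)
  have h0 := Nat.find_spec hex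
  have hpos : Nat.find hex ≠ 0 := by
    intro h1
    rw [h1] at h0
    simp at h0
  have h1 : x ∈ Ideal.span {(p : C)} ^ (Nat.find hex - 1) := by
    by_contra h2
    exact Nat.find_min hex (m := Nat.find hex - 1) (by omega) h2
  obtain ⟨u, hu, _⟩ := h.pow_mem h1
  refine ⟨_, u, ?_, hu⟩
  by_contra hnu
  have : u ∈ maximalIdeal C := by simpa using hnu
  rw [h.max_eq, Ideal.mem_span_singleton] at this
  obtain ⟨v, rfl⟩ := this
  apply h0
  rw [Ideal.span_singleton_pow, Ideal.mem_span_singleton]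
  refine ⟨v, ?_⟩
  refine hu.trans ?_
  rw [← mul_assoc, ← pow_succ]
  congr 2
  omega

theorem Coef.noeth (h : Coef C p) : IsNoetherianRing C := by
  classical
  suffices IsPrincipalIdealRing C by infer_instance
  refine ⟨fun I => ?_⟩
  rcases eq_or_ne I ⊥ with rfl | hI
  · infer_instance
  obtain ⟨x, hx, hx0⟩ := Submodule.exists_mem_ne_zero_of_ne_bot hI
  have hfac : ∀ x ∈ I, x ≠ 0 → ∃ n, (p : C) ^ n ∈ I ∧ (p : C) ^ n ∣ x := by
    intro x hx hx0
    obtain ⟨n, u, hu, rfl⟩ := h.factor hx0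
    exact ⟨n, (Ideal.mul_unit_mem_iff_mem I hu).1 hx, Dvd.intro _ rfl⟩
  have hex : ∃ n, (p : C) ^ n ∈ I := by
    obtain ⟨n, hn, _⟩ := hfac x hx hx0
    exact ⟨n, hn⟩
  refine ⟨⟨(p : C) ^ Nat.find hex, ?_⟩⟩
  apply le_antisymm
  · intro y hy
    rcases eq_or_ne y 0 with rfl | hy0
    · exact zero_mem _
    obtain ⟨m, hm, h1⟩ := hfac y hy hy0
    exact Ideal.mem_span_singleton.2 ((pow_dvd_pow _ (Nat.find_min' hex hm)).trans h1)
  · exact (Ideal.span_singleton_le_iff_mem I).2 (Nat.find_spec hex)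

theorem Coef.isDomain (h : Coef C p) : IsDomain C := by
  haveI := h.isLocalRing
  haveI := h.noeth
  rcases h.reg with h0 | hr
  · have : maximalIdeal C = ⊥ := by
      rw [h.max_eq, Ideal.span_singleton_eq_bot]
      exact Subtype.ext (by simpa using h0)
    exact ((IsLocalRing.isField_iff_maximalIdeal_eq).2 this).isDomain
  · refine isDomain_of_prime_element (u := (p : C)) ?_ ?_ ?_
    · rw [h.max_eq]; exact Ideal.mem_span_singleton_self _
    · rw [mem_nonZeroDivisors_iff_right]
      intro x hx
      apply Subtype.ext
      apply (mem_nonZeroDivisors_iff_right.1 hr)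
      simpa using congrArg Subtype.val hx
    · rw [← h.max_eq]; infer_instance

end
end GN

namespace GN

theorem formallySmooth_charZero (k l : Type*) [Field k] [Field l] [CharZero k] [Algebra k l] :
    Algebra.FormallySmooth k l := by
  obtain ⟨s, hs⟩ := exists_isTranscendenceBasis k l
  haveI : Algebra.IsAlgebraic (IntermediateField.adjoin k (Set.range ((↑) : s → l))) l := by
    have := hs.isAlgebraic_field
    simpa using this
  haveI : CharZero (IntermediateField.adjoin k (Set.range ((↑) : s → l))) :=
    charZero_of_injective_algebraMap (algebraMap k _).injective
  haveI : Algebra.IsSeparable (IntermediateField.adjoin k (Set.range ((↑) : s → l))) l :=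
    inferInstance
  exact Algebra.FormallySmooth.of_algebraicIndependent_of_isSeparable hs.1

theorem exists_section {T : Type*} [CommRing T] [IsLocalRing T] [IsAdicComplete (maximalIdeal T) T]
    {k : Type*} [Field k] [CharZero k] (g : k →+* T) :
    ∃ τ : ResidueField T →+* T, (∀ x, residue T (τ x) = x) ∧ ∀ a, τ (residue T (g a)) = g a := by
  letI := g.toAlgebra
  haveI := formallySmooth_charZero k (ResidueField T)
  let f : ResidueField T →ₐ[k] T ⧸ maximalIdeal T :=
    { RingHom.id (ResidueField T) with commutes' := fun _ => rfl }
  obtain ⟨τ, hτ⟩ := Algebra.FormallySmooth.exists_mkₐ_comp_eq_of_isAdicComplete f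
  refine ⟨τ, fun x => AlgHom.congr_fun hτ x, fun a => ?_⟩
  exact τ.commutes a

theorem coef_of_section {T : Type*} [CommRing T] [IsLocalRing T] [IsAdicComplete (maximalIdeal T) T]
    (τ : ResidueField T →+* T) (h : ∀ x, residue T (τ x) = x) : Coef τ.range 0 := by
  refine ⟨by simp, Or.inl (by simp), ?_, ?_, ?_⟩
  · rintro _ ⟨a, rfl⟩ ha
    rw [← residue_eq_zero_iff, h] at ha
    exact ⟨0, zero_mem _, by simp [ha]⟩
  · intro t
    refine ⟨τ (residue T t), ⟨_, rfl⟩, ?_⟩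
    rw [← residue_eq_zero_iff, map_sub, h, sub_self]
  · intro x hx
    refine ⟨residue T x, ?_⟩
    symm
    rw [← sub_eq_zero]
    apply haus_zero (maximalIdeal T)
    intro n
    obtain ⟨_, ⟨a, rfl⟩, h1⟩ := hx (n + 1)
    have : residue T x = a := by
      have := Ideal.pow_le_self (by omega) h1
      rw [← residue_eq_zero_iff, map_sub, h, sub_eq_zero] at this
      exact this
    rw [this]
    exact Ideal.pow_le_pow_right (by omega) h1

theorem map_max_le' {V T : Type*} [CommRing V] [CommRing T] [IsLocalRing V] [IsLocalRing T] [Algebra V T]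
    [IsLocalHom (algebraMap V T)] : (maximalIdeal V).map (algebraMap V T) ≤ maximalIdeal T := by
  rw [Ideal.map_le_iff_le_comap]
  intro x hx
  exact (map_mem_nonunits_iff (algebraMap V T) x).2 hx

theorem exists_coef2 {D : Type u} {E : Type v} [CommRing D] [CommRing E] [IsLocalRing D] [IsLocalRing E]
    [IsNoetherianRing D] [IsNoetherianRing E] [IsAdicComplete (maximalIdeal D) D]
    [IsAdicComplete (maximalIdeal E) E] [Algebra D E] [IsLocalHom (algebraMap D E)]
    (hsep : SepExt (ResidueField D) (ResidueField E))
    (hD : ∀ p : ℕ, (p : D) = 0 ∨ (p : D) ∈ nonZeroDivisors D)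
    (hE : ∀ p : ℕ, (p : E) = 0 ∨ (p : E) ∈ nonZeroDivisors E) :
    ∃ (p : ℕ) (C : Subring D) (C' : Subring E), Coef C p ∧ Coef C' p ∧ ∀ c ∈ C, algebraMap D E c ∈ C' := by
  classical
  obtain ⟨p, hp⟩ := CharP.exists (ResidueField D)
  rcases CharP.char_is_prime_or_zero (ResidueField D) p with hpp | rfl
  · haveI : Fact p.Prime := ⟨hpp⟩
    haveI : CharP (ResidueField E) p :=
      charP_of_injective_algebraMap (algebraMap (ResidueField D) (ResidueField E)).injective p
    obtain ⟨B, -, hB, hB'⟩ := exists_pbasis p (PInd.empty (κ := ResidueField D) p)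
    obtain ⟨B2, hB2, hB2i, hB2'⟩ := exists_pbasis p (PInd.image hsep p hB)
    choose σ hσ using (residue_surjective (R := D))
    have hsec : ∀ y : ResidueField E, ∃ t : E, residue E t = y ∧
        ∀ b ∈ B, algebraMap (ResidueField D) (ResidueField E) b = y → t = algebraMap D E (σ b) := by
      intro y
      by_cases hy : ∃ b ∈ B, algebraMap (ResidueField D) (ResidueField E) b = y
      · obtain ⟨b, hb, rfl⟩ := hy
        refine ⟨algebraMap D E (σ b), ?_, ?_⟩
        · conv_rhs => rw [← hσ b]
          rfl
        · intro b' _ h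
          rw [(algebraMap (ResidueField D) (ResidueField E)).injective h]
      · obtain ⟨t, rfl⟩ := residue_surjective y
        exact ⟨t, rfl, fun b hb h => absurd ⟨b, hb, h⟩ hy⟩
    choose σ' hσ' hσ'' using hsec
    refine ⟨p, CR p σ B, CR p σ' B2, CR_coef p σ (fun b _ => hσ b) hB hB' (hD p),
      CR_coef p σ' (fun b _ => hσ' b) hB2i hB2' (hE p), ?_⟩
    intro c hc N
    obtain ⟨s, hs, h1⟩ := hc N
    refine ⟨algebraMap D E s, ?_, ?_⟩
    · have h2 : algebraMap D E s ∈ (SN p σ B N).map (algebraMap D E) := ⟨s, hs, rfl⟩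
      rw [SN, RingHom.map_closure] at h2
      refine Subring.closure_le.2 ?_ h2
      rintro _ ⟨_, (⟨x, rfl⟩ | ⟨b, hb, rfl⟩), rfl⟩
      · simp only [map_pow]
        exact pow_mem_SN p σ' B2 N _
      · rw [← hσ'' (algebraMap (ResidueField D) (ResidueField E) b) b hb rfl]
        exact sec_mem_SN p σ' B2 N (hB2 ⟨b, hb, rfl⟩)
    · rw [← map_sub]
      have h3 := Ideal.mem_map_of_mem (algebraMap D E) h1
      rw [Ideal.map_pow] at h3
      exact Ideal.pow_right_mono (map_max_le' (V := D) (T := E)) _ h3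
  · haveI : CharZero (ResidueField D) := CharP.charP_to_charZero _
    have hu : ∀ y : nonZeroDivisors ℤ, IsUnit (Int.castRingHom D y) := by
      intro y
      have : Int.castRingHom D y ∉ maximalIdeal D := by
        rw [← residue_eq_zero_iff]
        have := nonZeroDivisors.ne_zero y.2
        simpa using this
      simpa using this
    let g : ℚ →+* D := IsLocalization.lift (M := nonZeroDivisors ℤ) hu
    obtain ⟨τ, hτ, -⟩ := exists_section g
    obtain ⟨τ', hτ', h1⟩ := exists_section ((algebraMap D E).comp τ)
    refine ⟨0, τ.range, τ'.range, coef_of_section τ hτ, coef_of_section τ' hτ', ?_⟩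
    rintro _ ⟨a, rfl⟩
    exact ⟨_, h1 a⟩

/-- single version -/
theorem exists_coef {D : Type u} [CommRing D] [IsLocalRing D]
    [IsNoetherianRing D] [IsAdicComplete (maximalIdeal D) D]
    (hD : ∀ p : ℕ, (p : D) = 0 ∨ (p : D) ∈ nonZeroDivisors D) :
    ∃ (p : ℕ) (C : Subring D), Coef C p := by
  classical
  obtain ⟨p, hp⟩ := CharP.exists (ResidueField D)
  rcases CharP.char_is_prime_or_zero (ResidueField D) p with hpp | rfl
  · haveI : Fact p.Prime := ⟨hpp⟩
    obtain ⟨B, -, hB, hB'⟩ := exists_pbasis p (PInd.empty (κ := ResidueField D) p)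
    choose σ hσ using (residue_surjective (R := D))
    exact ⟨p, CR p σ B, CR_coef p σ (fun b _ => hσ b) hB hB' (hD p)⟩
  · haveI : CharZero (ResidueField D) := CharP.charP_to_charZero _
    have hu : ∀ y : nonZeroDivisors ℤ, IsUnit (Int.castRingHom D y) := by
      intro y
      have : Int.castRingHom D y ∉ maximalIdeal D := by
        rw [← residue_eq_zero_iff]
        have := nonZeroDivisors.ne_zero y.2
        simpa using this
      simpa using this
    let g : ℚ →+* D := IsLocalization.lift (M := nonZeroDivisors ℤ) hu
    obtain ⟨τ, hτ, -⟩ := exists_section g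
    exact ⟨0, τ.range, coef_of_section τ hτ⟩

end GN

namespace GN

section
variable {C : Type*} [CommRing C] {n : ℕ}

abbrev PS (C : Type*) [CommRing C] (n : ℕ) := MvPowerSeries (Fin n) C

theorem ps_split (S : Finset (Fin n)) (g : PS C n) : ∃ h : Fin n → PS C n,
    (∀ i e, MvPowerSeries.coeff e (h i) = MvPowerSeries.coeff (e + Finsupp.single i 1) g ∨ MvPowerSeries.coeff e (h i) = 0) ∧
    ∀ e, MvPowerSeries.coeff e (∑ i ∈ S, MvPowerSeries.X i * h i) =
      if ∀ i ∈ S, e i = 0 then 0 else MvPowerSeries.coeff e g := by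
  classical
  let P : (Fin n →₀ ℕ) → Fin n → Prop := fun e i => i ∈ S ∧ e i ≠ 0 ∧ ∀ j ∈ S, e j ≠ 0 → i ≤ j
  have huniq : ∀ e i j, P e i → P e j → i = j := fun e i j hi hj =>
    le_antisymm (hi.2.2 j hj.1 hj.2.1) (hj.2.2 i hi.1 hi.2.1)
  have hex : ∀ e : Fin n →₀ ℕ, (¬ ∀ i ∈ S, e i = 0) → ∃ i, P e i := by
    intro e he
    push Not at he
    obtain ⟨i, hi, h0⟩ := he
    have hne : (S.filter fun i => e i ≠ 0).Nonempty := ⟨i, Finset.mem_filter.2 ⟨hi, h0⟩⟩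
    refine ⟨(S.filter fun i => e i ≠ 0).min' hne, ?_⟩
    have := Finset.mem_filter.1 ((S.filter fun i => e i ≠ 0).min'_mem hne)
    exact ⟨this.1, this.2, fun j hj hj0 => Finset.min'_le _ _ (Finset.mem_filter.2 ⟨hj, hj0⟩)⟩
  let h : Fin n → PS C n := fun i e => if P (e + Finsupp.single i 1) i then
    MvPowerSeries.coeff (e + Finsupp.single i 1) g else 0
  have hh : ∀ i e, MvPowerSeries.coeff e (h i) = if P (e + Finsupp.single i 1) i then
    MvPowerSeries.coeff (e + Finsupp.single i 1) g else 0 := fun _ _ => rfl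
  refine ⟨h, fun i e => ?_, fun e => ?_⟩
  · rw [hh]; split_ifs <;> simp
  · have hterm : ∀ i, MvPowerSeries.coeff e (MvPowerSeries.X i * h i) =
        if P e i then MvPowerSeries.coeff e g else 0 := by
      intro i
      by_cases hi : e i = 0
      · rw [if_neg (fun h' => h'.2.1 hi)]
        rw [MvPowerSeries.X, MvPowerSeries.coeff_monomial_mul, if_neg]
        intro h'
        have := h' i
        simp [hi] at this
      · have : e = (e - Finsupp.single i 1) + Finsupp.single i 1 := by
          rw [tsub_add_cancel_of_le]
          rw [Finsupp.single_le_iff]; omega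
        conv_lhs => rw [this, add_comm, MvPowerSeries.X, MvPowerSeries.coeff_add_monomial_mul, one_mul, hh, ← this]
    rw [map_sum, Finset.sum_congr rfl fun i _ => hterm i]
    split_ifs with h0
    · exact Finset.sum_eq_zero fun i hi => if_neg fun h' => h'.2.1 (h0 i hi)
    · obtain ⟨i, hi⟩ := hex e h0
      rw [Finset.sum_eq_single i, if_pos hi]
      · intro j _ hj
        exact if_neg fun h' => hj (huniq e j i h' hi)
      · intro h'; exact absurd hi.1 h'

noncomputable def PI (I : Ideal C) (S : Finset (Fin n)) : Ideal (PS C n) :=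
  I.map MvPowerSeries.C ⊔ Ideal.span (MvPowerSeries.X '' (S : Set (Fin n)))

theorem X_mem_PI (I : Ideal C) {S : Finset (Fin n)} {i : Fin n} (hi : i ∈ S) :
    (MvPowerSeries.X i : PS C n) ∈ PI I S :=
  Ideal.mem_sup_right (Ideal.subset_span ⟨i, hi, rfl⟩)

theorem C_mem_PI {I : Ideal C} {S : Finset (Fin n)} {c : C} (hc : c ∈ I) :
    (MvPowerSeries.C c : PS C n) ∈ PI I S :=
  Ideal.mem_sup_left (Ideal.mem_map_of_mem _ hc)

theorem mem_map_C_of_coeff {I : Ideal C} (hI : I.FG) {f : PS C n} (h : ∀ e, MvPowerSeries.coeff e f ∈ I) :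
    f ∈ I.map (MvPowerSeries.C : C →+* PS C n) := by
  classical
  obtain ⟨m, a, ha⟩ := (Submodule.fg_iff_exists_fin_generating_family).1 hI
  have h1 : ∀ e, ∃ b : Fin m → C, ∑ i, b i * a i = MvPowerSeries.coeff e f := fun e => by
    have := h e
    rw [← ha] at this
    simpa [Submodule.mem_span_range_iff_exists_fun] using this
  choose b hb using h1
  let g : Fin m → PS C n := fun i e => b e i
  have hg : ∀ i e, MvPowerSeries.coeff e (g i) = b e i := fun _ _ => rfl
  have : f = ∑ i, g i * MvPowerSeries.C (a i) := by
    ext e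
    rw [map_sum, ← hb e]
    refine Finset.sum_congr rfl fun i _ => ?_
    rw [MvPowerSeries.coeff_mul_C, hg]
  rw [this]
  refine sum_mem fun i _ => Ideal.mul_mem_left _ _ (Ideal.mem_map_of_mem _ ?_)
  rw [← ha]
  exact Submodule.subset_span ⟨i, rfl⟩

theorem mem_PI_iff {I : Ideal C} (hI : I.FG) {S : Finset (Fin n)} {f : PS C n} :
    f ∈ PI I S ↔ ∀ e : Fin n →₀ ℕ, (∀ i ∈ S, e i = 0) → MvPowerSeries.coeff e f ∈ I := by
  classical
  constructor
  · let K : Ideal (PS C n) :=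
      { carrier := {f | ∀ e : Fin n →₀ ℕ, (∀ i ∈ S, e i = 0) → MvPowerSeries.coeff e f ∈ I}
        zero_mem' := fun e _ => by simp
        add_mem' := fun {x y} hx hy e he => by
          rw [map_add]; exact add_mem (hx e he) (hy e he)
        smul_mem' := fun c x hx e he => by
          rw [smul_eq_mul, MvPowerSeries.coeff_mul]
          refine sum_mem fun d hd => Ideal.mul_mem_left _ _ (hx _ fun i hi => ?_)
          rw [Finset.HasAntidiagonal.mem_antidiagonal] at hd
          have := DFunLike.congr_fun hd i
          rw [Finsupp.add_apply, he i hi] at this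
          omega }
    suffices PI I S ≤ K from fun h => this h
    refine sup_le ?_ ?_
    · rw [Ideal.map_le_iff_le_comap]
      intro c hc e he
      rw [MvPowerSeries.coeff_C]
      split_ifs
      · exact hc
      · exact zero_mem _
    · rw [Ideal.span_le]
      rintro _ ⟨i, hi, rfl⟩ e he
      rw [MvPowerSeries.coeff_X, if_neg]
      · exact zero_mem _
      · rintro rfl
        have := he i hi
        simp at this
  · intro h
    obtain ⟨g, -, hg⟩ := ps_split S f
    have h1 : f - ∑ i ∈ S, MvPowerSeries.X i * g i ∈ I.map (MvPowerSeries.C : C →+* PS C n) := by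
      apply mem_map_C_of_coeff hI
      intro e
      rw [map_sub, hg]
      split_ifs with h0
      · simpa using h e h0
      · simp
    have : f = (f - ∑ i ∈ S, MvPowerSeries.X i * g i) + ∑ i ∈ S, MvPowerSeries.X i * g i := by ring
    rw [this]
    exact add_mem (Ideal.mem_sup_left h1) (sum_mem fun i hi => Ideal.mul_mem_right _ _ (X_mem_PI I hi))

theorem PI_regular {I : Ideal C} (hI : I.FG) {S : Finset (Fin n)} {i : Fin n} (hi : i ∉ S) {f : PS C n}
    (h : MvPowerSeries.X i * f ∈ PI I S) : f ∈ PI I S := by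
  rw [mem_PI_iff hI] at h ⊢
  intro e he
  have := h (Finsupp.single i 1 + e) (fun j hj => by
    rw [Finsupp.add_apply, he j hj, Finsupp.single_eq_of_ne (by rintro rfl; exact hi hj)])
  rwa [MvPowerSeries.X, MvPowerSeries.coeff_add_monomial_mul, one_mul] at this

theorem mem_PI_pow {I : Ideal C} (k : ℕ) {f : PS C n} :
    (∀ e : Fin n →₀ ℕ, MvPowerSeries.coeff e f ∈ I ^ (k - e.degree)) → f ∈ PI I Finset.univ ^ k := by
  classical
  induction k generalizing f with
  | zero => intro _; simp
  | succ k ih =>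
    intro h
    obtain ⟨g, hg0, hg⟩ := ps_split Finset.univ f
    have h1 : f = MvPowerSeries.C (MvPowerSeries.coeff 0 f) + ∑ i, MvPowerSeries.X i * g i := by
      ext e
      rw [map_add, hg, MvPowerSeries.coeff_C]
      by_cases he : e = 0
      · subst he; simp
      · rw [if_neg he, if_neg, zero_add]
        intro h'
        exact he (Finsupp.ext fun i => by simpa using h' i (Finset.mem_univ i))
    rw [h1]
    refine add_mem ?_ (sum_mem fun i _ => ?_)
    · have h2 := h 0
      simp only [map_zero, Nat.sub_zero] at h2
      have h3 := Ideal.mem_map_of_mem (MvPowerSeries.C : C →+* PS C n) h2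
      rw [Ideal.map_pow] at h3
      exact Ideal.pow_right_mono le_sup_left _ h3
    · rw [pow_succ']
      refine Ideal.mul_mem_mul (X_mem_PI I (Finset.mem_univ i)) (ih fun e => ?_)
      rcases hg0 i e with h2 | h2
      · rw [h2]
        have := h (e + Finsupp.single i 1)
        rw [map_add, Finsupp.degree_single] at this
        convert this using 2
        omega
      · rw [h2]; exact zero_mem _

theorem coeff_of_mem_PI_pow {I : Ideal C} (k : ℕ) {f : PS C n} (hf : f ∈ PI I Finset.univ ^ k)
    (e : Fin n →₀ ℕ) : MvPowerSeries.coeff e f ∈ I ^ (k - e.degree) := by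
  classical
  let K : ℕ → Ideal (PS C n) := fun k =>
    { carrier := {f | ∀ e : Fin n →₀ ℕ, MvPowerSeries.coeff e f ∈ I ^ (k - e.degree)}
      zero_mem' := fun e => by simp
      add_mem' := fun {x y} hx hy e => by
        rw [map_add]; exact add_mem (hx e) (hy e)
      smul_mem' := fun c x hx e => by
        rw [smul_eq_mul, MvPowerSeries.coeff_mul]
        refine sum_mem fun d hd => Ideal.mul_mem_left _ _ (Ideal.pow_le_pow_right ?_ (hx _))
        rw [Finset.HasAntidiagonal.mem_antidiagonal] at hd
        rw [← hd, map_add]; omega }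
  have hmul : ∀ a b, K a * K b ≤ K (a + b) := by
    intro a b
    rw [Ideal.mul_le]
    intro x hx y hy e
    rw [MvPowerSeries.coeff_mul]
    refine sum_mem fun d hd => ?_
    rw [Finset.HasAntidiagonal.mem_antidiagonal] at hd
    refine Ideal.pow_le_pow_right ?_ ((pow_add I _ _).symm ▸ Ideal.mul_mem_mul (hx d.1) (hy d.2))
    rw [← hd, map_add]; omega
  have h1 : PI I Finset.univ ≤ K 1 := by
    refine sup_le ?_ ?_
    · rw [Ideal.map_le_iff_le_comap]
      intro c hc e
      rw [MvPowerSeries.coeff_C]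
      split_ifs with h0
      · exact Ideal.pow_le_pow_right (n := 1) (by omega) (by simpa using hc)
      · exact zero_mem _
    · rw [Ideal.span_le]
      rintro _ ⟨i, hi, rfl⟩ e
      rw [MvPowerSeries.coeff_X]
      split_ifs with h0
      · subst h0; simp
      · exact zero_mem _
  have h2 : PI I Finset.univ ^ k ≤ K k := by
    clear hf
    induction k with
    | zero => intro f _ e; simp
    | succ k ih => exact (Ideal.mul_mono ih h1).trans (hmul k 1)
  exact h2 hf e

theorem ps_complete (I : Ideal C) [IsAdicComplete I C] :
    IsAdicComplete (PI I Finset.univ : Ideal (PS C n)) (PS C n) := by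
  rw [adic_iff]
  constructor
  · intro x hx
    ext e
    apply haus_zero I
    intro k
    have := coeff_of_mem_PI_pow _ (hx (k + e.degree)) e
    simpa using this
  · intro f hf
    have h1 : ∀ e : Fin n →₀ ℕ, ∃ L : C, ∀ k, L - MvPowerSeries.coeff e (f (k + e.degree)) ∈ I ^ k := by
      intro e
      refine exists_lim I (fun k => MvPowerSeries.coeff e (f (k + e.degree))) fun k => ?_
      have := coeff_of_mem_PI_pow _ (hf (k + e.degree)) e
      rw [map_sub] at this
      simpa [add_right_comm] using this
    choose L hL using h1
    let L' : PS C n := L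
    have hL' : ∀ e, MvPowerSeries.coeff e L' = L e := fun _ => rfl
    refine ⟨L', fun k => mem_PI_pow k fun e => ?_⟩
    rw [map_sub, hL']
    rcases le_total e.degree k with h | h
    · have := hL e (k - e.degree)
      rw [Nat.sub_add_cancel h] at this
      exact this
    · rw [Nat.sub_eq_zero_of_le h]; simp

variable [IsLocalRing C]

theorem ps_max (hI : (maximalIdeal C).FG) : maximalIdeal (PS C n) = PI (maximalIdeal C) Finset.univ := by
  ext f
  rw [mem_PI_iff hI, IsLocalRing.mem_maximalIdeal, mem_nonunits_iff, MvPowerSeries.isUnit_iff_constantCoeff]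
  rw [← mem_nonunits_iff, ← IsLocalRing.mem_maximalIdeal]
  constructor
  · intro h e he
    have : e = 0 := Finsupp.ext fun i => by simpa using he i (Finset.mem_univ i)
    rw [this]; exact h
  · intro h
    exact h 0 (by simp)

end
end GN

namespace GN

theorem ndom_quot_cut {T : Type*} [CommRing T] [IsNoetherianRing T] [IsLocalRing T] {J : Ideal T} {u : T}
    (hu : u ∈ maximalIdeal T) (hreg : ∀ x, u * x ∈ J → x ∈ J) (hN : NDom (T ⧸ (J ⊔ Ideal.span {u}))) :
    NDom (T ⧸ J) := by
  have hJ : J ≤ maximalIdeal T := by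
    refine IsLocalRing.le_maximalIdeal fun h => ?_
    have := hN.1
    have := Ideal.Quotient.nontrivial_iff.1 (inferInstance : Nontrivial (T ⧸ (J ⊔ Ideal.span {u})))
    exact this (by rw [h, top_sup_eq])
  haveI := isLocalRing_quot_of_le hJ
  refine ndom_of_cut (u := Ideal.Quotient.mk J u) ?_ ?_ ?_
  · rw [maximalIdeal_quot]; exact Ideal.mem_map_of_mem _ hu
  · rw [mem_nonZeroDivisors_iff_right]
    intro x hx
    obtain ⟨x, rfl⟩ := Ideal.Quotient.mk_surjective x
    rw [← map_mul, Ideal.Quotient.eq_zero_iff_mem] at hx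
    exact Ideal.Quotient.eq_zero_iff_mem.2 (hreg x (by rwa [mul_comm]))
  · refine NDom.of_equiv ((DoubleQuot.quotQuotEquivQuotSup J (Ideal.span {u})).symm.trans
      (Ideal.quotEquivOfEq ?_)) hN
    rw [Ideal.map_span, Set.image_singleton]

theorem NDom.of_quot_eq {T : Type*} [CommRing T] {J K : Ideal T} (h : NDom (T ⧸ J)) (e : J = K) : NDom (T ⧸ K) :=
  e ▸ h

theorem NDom.of_quot_bot {T : Type*} [CommRing T] (h : NDom (T ⧸ (⊥ : Ideal T))) : NDom T :=
  NDom.of_equiv (RingEquiv.quotientBot T) h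

section
variable {C : Type*} [CommRing C] {n : ℕ}

theorem PI_insert (I : Ideal C) (S : Finset (Fin n)) (i : Fin n) [DecidableEq (Fin n)] :
    PI I (insert i S) = PI I S ⊔ Ideal.span {(MvPowerSeries.X i : PS C n)} := by
  rw [PI, PI, Finset.coe_insert, Set.image_insert_eq, Ideal.span_insert, sup_assoc,
    sup_comm (Ideal.span {MvPowerSeries.X i})]

variable {T : Type*} [CommRing T] [IsNoetherianRing T] [IsLocalRing T] [Algebra (PS C n) T] [Module.Flat (PS C n) T]

theorem ndom_chain {I : Ideal C} (hI : I.FG) (S W : Finset (Fin n)) (hSW : Disjoint S W)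
    (hX : ∀ i ∈ W, algebraMap (PS C n) T (MvPowerSeries.X i) ∈ maximalIdeal T)
    (h : NDom (T ⧸ (PI I (S ∪ W)).map (algebraMap (PS C n) T))) :
    NDom (T ⧸ (PI I S).map (algebraMap (PS C n) T)) := by
  classical
  induction W using Finset.induction_on with
  | empty => exact NDom.of_quot_eq h (by rw [Finset.union_empty])
  | insert i W hi ih =>
    rw [Finset.disjoint_insert_right] at hSW
    refine ih hSW.2 (fun j hj => hX j (Finset.mem_insert_of_mem hj)) ?_
    refine ndom_quot_cut (hX i (Finset.mem_insert_self i W)) ?_ ?_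
    · exact flat_regular fun x hx => PI_regular hI (by simp [hSW.1, hi]) hx
    · refine NDom.of_quot_eq h ?_
      rw [Finset.union_insert, PI_insert, Ideal.map_sup, Ideal.map_span, Set.image_singleton]

/-- `T` flat over `C[[x]]`, closed under killing a nice prime. -/
theorem ndom_of_nice [IsDomain C] {c : C} (S : Finset (Fin n))
    (hX : ∀ i ∈ S, algebraMap (PS C n) T (MvPowerSeries.X i) ∈ maximalIdeal T)
    (hc : algebraMap (PS C n) T (MvPowerSeries.C c) ∈ maximalIdeal T)
    (h : NDom (T ⧸ (PI (Ideal.span {c}) S).map (algebraMap (PS C n) T))) : NDom T := by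
  have h0 : NDom (T ⧸ (PI (⊥ : Ideal C) S).map (algebraMap (PS C n) T)) := by
    by_cases hc0 : c = 0
    · subst hc0
      refine NDom.of_quot_eq h ?_
      rw [Ideal.span_singleton_eq_bot.2 rfl]
    · refine ndom_quot_cut hc (flat_regular fun x hx => ?_) (NDom.of_quot_eq h ?_)
      · rw [mem_PI_iff Submodule.fg_bot] at hx ⊢
        intro e he
        have := hx e he
        rw [MvPowerSeries.coeff_C_mul, Ideal.mem_bot, mul_eq_zero] at this
        exact this.resolve_left hc0
      · rw [PI, PI, Ideal.map_span, Set.image_singleton, Ideal.map_bot, bot_sup_eq, Ideal.map_sup, Ideal.map_span,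
          Set.image_singleton, sup_comm]
  have h1 := ndom_chain (T := T) (I := (⊥ : Ideal C)) Submodule.fg_bot ∅ S (by simp) hX (NDom.of_quot_eq h0 (by rw [Finset.empty_union]))
  refine NDom.of_quot_bot (NDom.of_quot_eq h1 ?_)
  simp [PI, Ideal.map_bot]

end

section
variable {C : Type*} [CommRing C] [IsNoetherianRing C] [IsLocalRing C] {n : ℕ}

theorem ndom_PS_quot {I : Ideal C} (hI : NDom (C ⧸ I)) (S : Finset (Fin n)) : NDom (PS C n ⧸ PI I S) := by
  classical
  have hfg : I.FG := IsNoetherian.noetherian I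
  have h1 : NDom (PS C n ⧸ PI I (Finset.univ : Finset (Fin n))) := by
    let f : PS C n →+* C ⧸ I := (Ideal.Quotient.mk I).comp MvPowerSeries.constantCoeff
    have hf : Function.Surjective f := by
      refine Ideal.Quotient.mk_surjective.comp fun c => ⟨MvPowerSeries.C c, by simp⟩
    have hk : RingHom.ker f = PI I Finset.univ := by
      ext x
      rw [mem_PI_iff hfg, RingHom.mem_ker, RingHom.comp_apply, Ideal.Quotient.eq_zero_iff_mem]
      constructor
      · intro h e he
        have : e = 0 := Finsupp.ext fun i => by simpa using he i (Finset.mem_univ i)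
        rw [this]; exact h
      · intro h
        exact h 0 (by simp)
    refine NDom.of_quot_eq (NDom.of_equiv (RingHom.quotientKerEquivOfSurjective hf).symm hI) hk
  have h2 := ndom_chain (T := PS C n) hfg S (Finset.univ \ S) Finset.disjoint_sdiff (fun i _ => by
    rw [ps_max (IsNoetherian.noetherian _)]
    exact X_mem_PI _ (Finset.mem_univ i)) (NDom.of_quot_eq h1 (by
      rw [Finset.union_sdiff_of_subset (Finset.subset_univ S)]; exact (Ideal.map_id _).symm))
  exact NDom.of_quot_eq h2 (Ideal.map_id _)

theorem ndom_PS (h : NDom C) : NDom (PS C n) := by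
  have h0 : NDom (C ⧸ (⊥ : Ideal C)) := NDom.of_equiv (RingEquiv.quotientBot C).symm h
  have := ndom_PS_quot h0 (∅ : Finset (Fin n))
  refine NDom.of_quot_bot (NDom.of_quot_eq this ?_)
  simp [PI, Ideal.map_bot]

theorem PI_prime {I : Ideal C} (h : NDom (C ⧸ I)) (S : Finset (Fin n)) : (PI I S).IsPrime :=
  (Ideal.Quotient.isDomain_iff_prime _).1 (ndom_PS_quot h S).1

end
end GN

namespace GN

section
variable {D : Type*} [CommRing D]

/-- dimension of `V(J)` at most `k` -/
def DK (J : Ideal D) (k : ℕ) : Prop :=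
  ∀ P : PrimeSpectrum D, J ≤ P.asIdeal → Order.coheight P ≤ k

theorem DK.drop {J : Ideal D} {k : ℕ} (h : DK J (k + 1)) {y : D}
    (hy : ∀ Q : PrimeSpectrum D, Q.asIdeal ∈ J.minimalPrimes → ¬ Order.coheight Q ≤ k → y ∉ Q.asIdeal) :
    DK (J ⊔ Ideal.span {y}) k := by
  intro P hP
  obtain ⟨Q, hQ, hQP⟩ := Ideal.exists_minimalPrimes_le (le_sup_left.trans hP)
  let Q' : PrimeSpectrum D := ⟨Q, hQ.1.1⟩
  have hle : Q' ≤ P := hQP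
  by_cases hQk : Order.coheight Q' ≤ k
  · exact (Order.coheight_anti hle).trans hQk
  · have hyQ := hy Q' hQ hQk
    have hlt : Q' < P := by
      refine lt_of_le_of_ne hle ?_
      rintro h'
      exact hyQ (h' ▸ hP (Ideal.mem_sup_right (Ideal.mem_span_singleton_self y)))
    have h1 := Order.coheight_add_one_le hlt
    have h2 := h1.trans (h Q' hQ.1.2)
    push_cast at h2
    exact (ENat.add_le_add_iff_right (by simp)).1 h2

variable [IsNoetherianRing D] [IsLocalRing D]

theorem bad_finite (J : Ideal D) (k : ℕ) :
    {Q : PrimeSpectrum D | Q.asIdeal ∈ J.minimalPrimes ∧ ¬ Order.coheight Q ≤ k}.Finite := by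
  have h := J.finite_minimalPrimes_of_isNoetherianRing
  refine Set.Finite.subset (h.preimage (f := PrimeSpectrum.asIdeal) (fun a _ b _ h => PrimeSpectrum.ext h)) ?_
  intro Q hQ
  exact hQ.1

theorem DK.drop_exists {J : Ideal D} {k : ℕ} (h : DK J (k + 1)) (𝔓 : Ideal D)
    (hP : ∀ Q : PrimeSpectrum D, J ≤ Q.asIdeal → ¬ Order.coheight Q ≤ k → ¬ 𝔓 ≤ Q.asIdeal) :
    ∃ y ∈ 𝔓, DK (J ⊔ Ideal.span {y}) k := by
  classical
  have hfin := bad_finite J k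
  have := (Ideal.subset_union_prime (s := hfin.toFinset) (f := PrimeSpectrum.asIdeal) (I := 𝔓)
    ⟨maximalIdeal D, inferInstance⟩ ⟨maximalIdeal D, inferInstance⟩
    (fun Q _ _ _ => Q.2)).not
  have h2 : ¬ (𝔓 : Set D) ⊆ ⋃ Q ∈ ((hfin.toFinset : Finset _) : Set (PrimeSpectrum D)), (Q.asIdeal : Set D) := by
    rw [this]
    rintro ⟨Q, hQ, hle⟩
    rw [Set.Finite.mem_toFinset] at hQ
    exact hP Q hQ.1.1.2 hQ.2 hle
  rw [Set.not_subset] at h2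
  obtain ⟨y, hy, hyn⟩ := h2
  refine ⟨y, hy, h.drop fun Q hQ hQk hyQ => hyn ?_⟩
  simp only [Set.mem_iUnion]
  exact ⟨Q, by simpa using ⟨hQ, by simpa using hQk⟩, hyQ⟩

theorem coheight_max : Order.coheight (⟨maximalIdeal D, inferInstance⟩ : PrimeSpectrum D) = 0 := by
  rw [Order.coheight_eq_zero]
  intro Q hQ
  exact IsLocalRing.le_maximalIdeal Q.2.ne_top

theorem DK.sop {J : Ideal D} {k : ℕ} (h : DK J k) :
    ∃ z : Fin k → D, (∀ i, z i ∈ maximalIdeal D) ∧ maximalIdeal D ≤ (J ⊔ Ideal.span (Set.range z)).radical := by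
  induction k generalizing J with
  | zero =>
    refine ⟨Fin.elim0, fun i => i.elim0, ?_⟩
    rw [Ideal.radical_eq_sInf]
    refine le_sInf fun P hP => ?_
    have h1 := h ⟨P, hP.2⟩ (le_sup_left.trans hP.1)
    have h2 : Order.coheight (⟨P, hP.2⟩ : PrimeSpectrum D) = 0 := by simpa using h1
    rw [Order.coheight_eq_zero] at h2
    exact h2 (b := ⟨maximalIdeal D, inferInstance⟩) (IsLocalRing.le_maximalIdeal hP.2.ne_top)
  | succ k ih =>
    obtain ⟨y, hy, hd⟩ := h.drop_exists (maximalIdeal D) (fun Q _ hQ hle => hQ (by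
      have : (⟨maximalIdeal D, inferInstance⟩ : PrimeSpectrum D) ≤ Q := hle
      refine (Order.coheight_anti this).trans ?_
      rw [coheight_max]; simp))
    obtain ⟨z, hz, hr⟩ := ih hd
    refine ⟨Fin.cons y z, fun i => ?_, ?_⟩
    · refine Fin.cases ?_ (fun i => ?_) i
      · simpa using hy
      · simpa using hz i
    · rwa [Fin.range_cons, Ideal.span_insert, ← sup_assoc]

theorem DK.of_sop {J : Ideal D} {k : ℕ} (z : Fin k → D) (hz : ∀ i, z i ∈ maximalIdeal D)
    (h : maximalIdeal D ≤ (J ⊔ Ideal.span (Set.range z)).radical) : DK J k := by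
  classical
  intro P hP
  haveI := P.2
  haveI : IsLocalRing (D ⧸ P.asIdeal) := isLocalRing_quot_of_le (IsLocalRing.le_maximalIdeal P.2.ne_top)
  have h1 : Order.coheight P = ringKrullDim (D ⧸ P.asIdeal) := by
    rw [ringKrullDim_quotient, Order.coheight_eq_krullDim_Ici]
    rfl
  have h2 : maximalIdeal (D ⧸ P.asIdeal) ∈ (Ideal.span (Ideal.Quotient.mk P.asIdeal '' Set.range z)).minimalPrimes := by
    refine ⟨⟨inferInstance, ?_⟩, ?_⟩
    · rw [Ideal.span_le]
      rintro _ ⟨_, ⟨i, rfl⟩, rfl⟩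
      rw [maximalIdeal_quot]
      exact Ideal.mem_map_of_mem _ (hz i)
    · rintro Q ⟨hQ, hQle⟩ _
      rw [maximalIdeal_quot, Ideal.map_le_iff_le_comap]
      refine h.trans ?_
      haveI := hQ
      haveI : (Q.comap (Ideal.Quotient.mk P.asIdeal)).IsPrime := Ideal.comap_isPrime _ _
      rw [Ideal.IsPrime.radical_le_iff this]
      refine sup_le ?_ ?_
      · intro x hx
        rw [Ideal.mem_comap, Ideal.Quotient.eq_zero_iff_mem.2 (hP hx)]
        exact zero_mem _
      · rw [← Ideal.map_le_iff_le_comap, Ideal.map_span]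
        exact hQle
  have h3 := Ideal.height_le_card_of_mem_minimalPrimes_span ((Set.finite_range z).image _) h2
  have h4 : (Ideal.Quotient.mk P.asIdeal '' Set.range z).ncard ≤ k := by
    refine (Set.ncard_image_le (Set.finite_range z)).trans ?_
    rw [← Set.image_univ]
    refine (Set.ncard_image_le Set.finite_univ).trans ?_
    simp
  have h5 := h1.trans (IsLocalRing.maximalIdeal_height_eq_ringKrullDim (R := D ⧸ P.asIdeal)).symm
  have h6 : Order.coheight P = (maximalIdeal (D ⧸ P.asIdeal)).height := by exact_mod_cast h5
  rw [h6]
  exact h3.trans (by exact_mod_cast h4)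

theorem DK.exists (J : Ideal D) : ∃ k, DK J k := by
  obtain ⟨n, a, ha⟩ := (Submodule.fg_iff_exists_fin_generating_family).1
    (IsNoetherian.noetherian (maximalIdeal D))
  refine ⟨n, DK.of_sop a (fun i => ha ▸ Submodule.subset_span ⟨i, rfl⟩) ?_⟩
  refine le_trans ?_ Ideal.le_radical
  refine le_trans ?_ le_sup_right
  exact ha.ge

/-- special parameters adapted to `𝔓` -/
theorem exists_params (J : Ideal D) (hJ : J ≤ maximalIdeal D) (𝔓 : Ideal D) (h𝔓 : 𝔓.IsPrime) :
    ∃ (n k : ℕ) (y : Fin n → D) (S : Finset (Fin n)), S.card + k = n ∧ (∀ i, y i ∈ maximalIdeal D) ∧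
      (∀ i ∈ S, y i ∈ 𝔓) ∧ maximalIdeal D ≤ (J ⊔ Ideal.span (Set.range y)).radical ∧
      (∃ Q : PrimeSpectrum D, J ≤ Q.asIdeal ∧ n ≤ Order.coheight Q) ∧
      (∃ Q : PrimeSpectrum D, J ≤ Q.asIdeal ∧ 𝔓 ≤ Q.asIdeal ∧ k ≤ Order.coheight Q) := by
  classical
  have hex := DK.exists J
  let n := Nat.find hex
  have hn : DK J n := Nat.find_spec hex
  have hmin : ∀ k, DK J k → n ≤ k := fun k hk => Nat.find_min' hex hk
  have hQ : ∃ Q : PrimeSpectrum D, J ≤ Q.asIdeal ∧ n ≤ Order.coheight Q := by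
    rcases Nat.eq_zero_or_pos n with h0 | h0
    · exact ⟨⟨maximalIdeal D, inferInstance⟩, hJ, by rw [h0]; simp⟩
    · by_contra hcon
      push Not at hcon
      have := hmin (n - 1) fun P hP => by
        have h1 := hcon P hP
        have h2 : Order.coheight P + 1 ≤ n := Order.add_one_le_of_lt h1
        have h3 : ((n - 1 : ℕ) : ℕ∞) + 1 = n := by exact_mod_cast Nat.sub_add_cancel h0
        rw [← h3] at h2
        exact (ENat.add_le_add_iff_right (by simp)).1 h2
      omega
  let PP : ℕ → Prop := fun k => ∃ r, r + k = n ∧ ∃ y : Fin r → D, (∀ i, y i ∈ 𝔓) ∧ DK (J ⊔ Ideal.span (Set.range y)) k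
  have hPP : ∃ k, PP k := ⟨n, 0, by simp, Fin.elim0, fun i => i.elim0, fun P hP => hn P (le_sup_left.trans hP)⟩
  let k := Nat.find hPP
  obtain ⟨r, hrk, y, hy, hd⟩ : PP k := Nat.find_spec hPP
  have hkmin : ∀ j, PP j → k ≤ j := fun j hj => Nat.find_min' hPP hj
  have hQ2 : ∃ Q : PrimeSpectrum D, J ≤ Q.asIdeal ∧ 𝔓 ≤ Q.asIdeal ∧ k ≤ Order.coheight Q := by
    rcases hk : k with _ | j
    · exact ⟨⟨maximalIdeal D, inferInstance⟩, hJ, IsLocalRing.le_maximalIdeal h𝔓.ne_top, by simp⟩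
    · by_contra hcon
      push Not at hcon
      rw [hk] at hd
      obtain ⟨x, hx, hdx⟩ := hd.drop_exists 𝔓 fun Q hQ hQj hle => by
        have := hcon Q (le_sup_left.trans hQ) hle
        push_cast at this
        exact hQj (Order.le_of_lt_add_one this)
      have := hkmin j ⟨r + 1, by omega, Fin.cons x y, fun i => by
        refine Fin.cases ?_ (fun i => ?_) i
        · simpa using hx
        · simpa using hy i, by
          rw [Fin.range_cons, Ideal.span_insert, sup_comm (Ideal.span {x}), ← sup_assoc]; exact hdx⟩
      omega
  obtain ⟨z, hz, hr⟩ := hd.sop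
  clear_value n k
  subst hrk
  refine ⟨r + k, k, Fin.append y z, Finset.univ.map (Fin.castAddEmb k), by simp, ?_, ?_, ?_, hQ, hQ2⟩
  · intro i
    refine Fin.addCases (fun i => ?_) (fun i => ?_) i
    · rw [Fin.append_left]; exact IsLocalRing.le_maximalIdeal h𝔓.ne_top (hy i)
    · rw [Fin.append_right]; exact hz i
  · intro i hi
    simp only [Finset.mem_map, Finset.mem_univ, true_and] at hi
    obtain ⟨i, rfl⟩ := hi
    simpa using hy i
  · refine hr.trans (Ideal.radical_mono ?_)
    refine sup_le (sup_le le_sup_left (le_trans (Ideal.span_mono ?_) le_sup_right)) (le_trans (Ideal.span_mono ?_) le_sup_right)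
    · rintro _ ⟨i, rfl⟩; exact ⟨Fin.castAdd k i, by simp⟩
    · rintro _ ⟨i, rfl⟩; exact ⟨Fin.natAdd r i, by simp⟩

end
end GN

namespace GN

section
variable {T : Type*} [CommRing T] [IsLocalRing T] [IsAdicComplete (maximalIdeal T) T]
  {C : Subring T} {p : ℕ}

theorem Coef.ndom (h : Coef C p) : NDom C := by
  haveI := h.isLocalRing
  haveI := h.noeth
  haveI := h.isDomain
  by_cases h0 : (p : C) = 0
  · apply ndom_of_max_bot
    rw [h.max_eq, h0, Ideal.span_singleton_eq_bot.2 rfl]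
  · exact ndom_of_principal h.max_eq (mem_nonZeroDivisors_of_ne_zero h0)

theorem Coef.ndom_quot (h : Coef C p) {c : C} (hc : c = 0 ∨ c = p) : NDom (C ⧸ Ideal.span {c}) := by
  haveI := h.isLocalRing
  rcases hc with rfl | rfl
  · rw [Ideal.span_singleton_eq_bot.2 rfl]
    exact NDom.of_equiv (RingEquiv.quotientBot C).symm h.ndom
  · rw [← h.max_eq]
    exact NDom.of_field (ResidueField C)

theorem Coef.approx [IsNoetherianRing T] (h : Coef C p) (N : ℕ) :
    ∃ W : Submodule C T, W.FG ∧ ∀ x, ∃ s ∈ W, x - s ∈ maximalIdeal T ^ N := by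
  classical
  induction N with
  | zero => exact ⟨⊥, Submodule.fg_bot, fun x => ⟨0, zero_mem _, by simp⟩⟩
  | succ N ih =>
    obtain ⟨W, hW, hx⟩ := ih
    obtain ⟨l, b, hb⟩ := (Submodule.fg_iff_exists_fin_generating_family).1
      (IsNoetherian.noetherian (maximalIdeal T ^ N))
    refine ⟨W ⊔ Submodule.span C (Set.range b), hW.sup (Submodule.fg_span (Set.finite_range b)), fun x => ?_⟩
    obtain ⟨s, hs, h1⟩ := hx x
    rw [← hb] at h1
    obtain ⟨d, hd⟩ := (Submodule.mem_span_range_iff_exists_fun _).1 h1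
    choose c hc hcm using fun j => h.surj (d j)
    refine ⟨s + ∑ j, (⟨c j, hc j⟩ : C) • b j, Submodule.add_mem_sup hs
      (sum_mem fun j _ => Submodule.smul_mem _ _ (Submodule.subset_span ⟨j, rfl⟩)), ?_⟩
    have : x - (s + ∑ j, (⟨c j, hc j⟩ : C) • b j) = ∑ j, (d j - c j) * b j := by
      rw [← sub_sub, ← hd, ← Finset.sum_sub_distrib]
      refine Finset.sum_congr rfl fun j _ => ?_
      rw [sub_mul]; rfl
    rw [this, pow_succ']
    refine sum_mem fun j _ => Ideal.mul_mem_mul (hcm j) ?_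
    rw [← hb]; exact Submodule.subset_span ⟨j, rfl⟩

variable [IsNoetherianRing T]

theorem Coef.ev_finite (h : Coef C p) {n : ℕ} (F : PS C n →+* T) (hC : ∀ c, F (MvPowerSeries.C c) = c)
    (hr : maximalIdeal T ≤ (Ideal.span {(p : T)} ⊔ Ideal.span (Set.range fun i => F (MvPowerSeries.X i))).radical)
    (hX : ∀ i, F (MvPowerSeries.X i) ∈ maximalIdeal T) : F.Finite := by
  classical
  haveI := h.isLocalRing
  haveI := h.complete
  haveI := ps_complete (C := C) (n := n) (Ideal.span {(p : C)})
  letI := F.toAlgebra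
  have hF : ∀ x, algebraMap (PS C n) T x = F x := fun _ => rfl
  have hmap : (PI (Ideal.span {(p : C)}) Finset.univ).map F =
      Ideal.span {(p : T)} ⊔ Ideal.span (Set.range fun i => F (MvPowerSeries.X i)) := by
    rw [PI, Ideal.map_sup, Ideal.map_span, Ideal.map_span, Ideal.map_span, Set.image_singleton, Set.image_singleton,
      hC, Finset.coe_univ, Set.image_univ, ← Set.range_comp]
    rfl
  obtain ⟨N, hN⟩ := Ideal.exists_pow_le_of_le_radical_of_fg hr (IsNoetherian.noetherian _)
  obtain ⟨W, hW, hx⟩ := h.approx N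
  obtain ⟨k, t, ht⟩ := (Submodule.fg_iff_exists_fin_generating_family).1 hW
  have hle : Ideal.map F (PI (Ideal.span {(p : C)}) Finset.univ) ≤ maximalIdeal T := by
    rw [hmap]
    refine sup_le ?_ ?_
    · rw [Ideal.span_le, Set.singleton_subset_iff]; exact h.pm
    · rw [Ideal.span_le]; rintro _ ⟨i, rfl⟩; exact hX i
  have hH : IsHausdorff (Ideal.map (algebraMap (PS C n) T) (PI (Ideal.span {(p : C)}) Finset.univ)) T := by
    apply IsHausdorff.of_le_jacobson
    rw [IsLocalRing.jacobson_eq_maximalIdeal _ bot_ne_top]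
    exact hle
  have key := complete_span (S := PS C n) (T := T) (PI (Ideal.span {(p : C)}) Finset.univ) hH t (fun x => by
    obtain ⟨s, hs, h1⟩ := hx x
    rw [← ht] at hs
    obtain ⟨c, hc⟩ := (Submodule.mem_span_range_iff_exists_fun _).1 hs
    refine ⟨fun i => MvPowerSeries.C (c i), ?_⟩
    have : ∑ i, (MvPowerSeries.C (c i) : PS C n) • t i = s := by
      rw [← hc]
      refine Finset.sum_congr rfl fun i _ => ?_
      rw [Algebra.smul_def, hF, hC]; rfl
    rw [this]
    exact hmap ▸ hN h1)
  show Module.Finite (PS C n) T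
  refine ⟨⟨Finset.univ.image t, ?_⟩⟩
  rw [eq_top_iff]
  intro x _
  obtain ⟨a, ha⟩ := key x
  rw [ha]
  exact sum_mem fun i _ => Submodule.smul_mem _ _ (Submodule.subset_span (by simp))

theorem Coef.comap_eq (h : Coef C p) {n k : ℕ} (F : PS C n →+* T) (hfin : F.Finite)
    (hC : ∀ c, F (MvPowerSeries.C c) = c)
    (P : Ideal T) [hP : P.IsPrime] (S : Finset (Fin n)) (hS : ∀ i ∈ S, F (MvPowerSeries.X i) ∈ P) (hk : S.card + k = n)
    (Q : PrimeSpectrum T) (hpQ : (p : T) ∈ Q.asIdeal) (hPQ : P ≤ Q.asIdeal) (hQk : k ≤ Order.coheight Q) :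
    ∃ c : C, (c = 0 ∨ c = p) ∧ (c : T) ∈ P ∧ P.comap F = PI (Ideal.span {c}) S := by
  classical
  haveI := h.isLocalRing
  haveI := h.noeth
  letI := F.toAlgebra
  haveI : Module.Finite (PS C n) T := hfin
  have hsm : StrictMono (PrimeSpectrum.comap F) := by
    intro a b hab
    exact Ideal.IsIntegral.comap_lt_comap (R := PS C n) (A := T) hab
  let P' : PrimeSpectrum T := ⟨P, hP⟩
  have hXm : ∀ i, (MvPowerSeries.X i : PS C n) ∈ maximalIdeal (PS C n) := fun i => by
    rw [ps_max (IsNoetherian.noetherian _)]; exact X_mem_PI _ (Finset.mem_univ i)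
  have hpm : (MvPowerSeries.C (p : C) : PS C n) ∈ maximalIdeal (PS C n) := by
    rw [ps_max (IsNoetherian.noetherian _), h.max_eq]
    exact C_mem_PI (Ideal.mem_span_singleton_self _)
  obtain ⟨e⟩ : Nonempty (Fin k ≃ {i // i ∈ Sᶜ}) := by
    apply Fintype.card_eq.1
    rw [Fintype.card_fin, Fintype.card_coe, Finset.card_compl, Fintype.card_fin]
    omega
  let z : Fin k → PS C n := fun j => MvPowerSeries.X (e j).1
  have hmle : ∀ J : Ideal (PS C n), MvPowerSeries.C (p : C) ∈ J → (∀ i ∈ S, MvPowerSeries.X i ∈ J) →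
      (Set.range z ⊆ J) → maximalIdeal (PS C n) ≤ J := by
    intro J h1 h2 h3
    rw [ps_max (IsNoetherian.noetherian _), h.max_eq, PI, Ideal.map_span, Set.image_singleton]
    refine sup_le ?_ ?_
    · rw [Ideal.span_le, Set.singleton_subset_iff]; exact h1
    · rw [Ideal.span_le]
      rintro _ ⟨i, -, rfl⟩
      by_cases hi : i ∈ S
      · exact h2 i hi
      · refine h3 ⟨e.symm ⟨i, by simpa using hi⟩, ?_⟩
        simp [z]
  have fin : ∀ (c : C) (d : ℕ), (c = 0 ∨ c = p) → (c : T) ∈ P → DK (PI (Ideal.span {c}) S) d → d ≤ Order.coheight P' →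
      ∃ c : C, (c = 0 ∨ c = p) ∧ (c : T) ∈ P ∧ P.comap F = PI (Ideal.span {c}) S := by
    intro c d hc hcP hDK hd
    refine ⟨c, hc, hcP, ?_⟩
    haveI hpr : (PI (Ideal.span {c}) S : Ideal (PS C n)).IsPrime := PI_prime (h.ndom_quot hc) S
    let R0 : PrimeSpectrum (PS C n) := ⟨_, hpr⟩
    have hle : R0 ≤ PrimeSpectrum.comap F P' := by
      show PI _ S ≤ P.comap F
      rw [PI, Ideal.map_span, Set.image_singleton]
      refine sup_le ?_ ?_
      · rw [Ideal.span_le, Set.singleton_subset_iff]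
        show F _ ∈ P
        rw [hC]; exact hcP
      · rw [Ideal.span_le]; rintro _ ⟨i, hi, rfl⟩
        exact hS i hi
    by_contra hne
    have hlt : R0 < PrimeSpectrum.comap F P' := lt_of_le_of_ne hle fun h' => hne (congrArg PrimeSpectrum.asIdeal h').symm
    have h1 := Order.coheight_add_one_le hlt
    have h2 := Order.coheight_le_coheight_apply_of_strictMono _ hsm P'
    have h3 := hDK R0 le_rfl
    have h4 : (d : ℕ∞) + 1 ≤ d := by
      calc (d : ℕ∞) + 1 ≤ Order.coheight (PrimeSpectrum.comap F P') + 1 := by gcongr; exact hd.trans h2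
        _ ≤ _ := h1.trans h3
    have : d + 1 ≤ d := by exact_mod_cast h4
    omega
  by_cases hpP : (p : T) ∈ P
  · refine fin p k (Or.inr rfl) (by simpa using hpP) (DK.of_sop z (fun j => hXm _) ?_) ?_
    · refine le_trans (hmle _ ?_ ?_ ?_) Ideal.le_radical
      · exact Ideal.mem_sup_left (C_mem_PI (Ideal.mem_span_singleton_self _))
      · exact fun i hi => Ideal.mem_sup_left (X_mem_PI _ hi)
      · exact fun x hx => Ideal.mem_sup_right (Ideal.subset_span hx)
    · exact hQk.trans (Order.coheight_anti (show P' ≤ Q from hPQ))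
  · refine fin 0 (k + 1) (Or.inl rfl) (by simp) (DK.of_sop (Fin.cons (MvPowerSeries.C (p : C)) z) (fun j => ?_) ?_) ?_
    · refine Fin.cases ?_ (fun j => ?_) j
      · simpa using hpm
      · simpa using hXm _
    · rw [Fin.range_cons]
      refine le_trans (hmle _ ?_ ?_ ?_) Ideal.le_radical
      · exact Ideal.mem_sup_right (Ideal.subset_span (Set.mem_insert _ _))
      · exact fun i hi => Ideal.mem_sup_left (X_mem_PI _ hi)
      · exact fun x hx => Ideal.mem_sup_right (Ideal.subset_span (Set.mem_insert_of_mem _ hx))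
    · have hlt : P' < Q := lt_of_le_of_ne hPQ fun h' => hpP (by
        have : P = Q.asIdeal := congrArg PrimeSpectrum.asIdeal h'
        rw [this]; exact hpQ)
      have := Order.coheight_add_one_le hlt
      push_cast
      exact le_trans (by gcongr) this

/-- Noether normalization adapted to a prime. -/
theorem Coef.normalization [IsDomain T] (h : Coef C p) (P : Ideal T) [hP : P.IsPrime] :
    ∃ (n : ℕ) (F : PS C n →+* T) (S : Finset (Fin n)) (c : C), (∀ c, F (MvPowerSeries.C c) = c) ∧
      (∀ i, F (MvPowerSeries.X i) ∈ maximalIdeal T) ∧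
      F.Finite ∧ Function.Injective F ∧ (c = 0 ∨ c = p) ∧ P.comap F = PI (Ideal.span {c}) S := by
  classical
  obtain ⟨n, k, y, S, hk, hy, hyP, hr, ⟨Q0, hQ0, hn⟩, ⟨Q, hpQ, hPQ, hQk⟩⟩ := exists_params (Ideal.span {(p : T)})
    (by rw [Ideal.span_le, Set.singleton_subset_iff]; exact h.pm) P hP
  rw [Ideal.span_le, Set.singleton_subset_iff] at hQ0 hpQ
  obtain ⟨F, hC, hX⟩ := exists_evalPS (maximalIdeal T) C.subtype y hy
  have hX' : ∀ i, F (MvPowerSeries.X i) ∈ maximalIdeal T := fun i => by rw [hX]; exact hy i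
  have hfin : F.Finite := h.ev_finite F hC (by simpa only [hX] using hr) hX'
  obtain ⟨c, hc, -, hcP⟩ := h.comap_eq F hfin hC P S (fun i hi => by rw [hX]; exact hyP i hi) hk Q hpQ hPQ hQk
  obtain ⟨c0, -, hc0, hker⟩ := h.comap_eq F hfin hC (⊥ : Ideal T) ∅ (fun i hi => by simp at hi)
    (by simp : _ + n = n) Q0 hQ0 bot_le hn
  refine ⟨n, F, S, c, hC, hX', hfin, ?_, hc, hcP⟩
  rw [RingHom.injective_iff_ker_eq_bot]
  have : c0 = 0 := Subtype.ext (by simpa using hc0)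
  show (⊥ : Ideal T).comap F = ⊥
  rw [hker, this, PI]
  simp

end
end GN

namespace GN

/-- `q`-root-linear additive endomorphisms -/
def QL (q : ℕ) {R : Type*} [CommRing R] (ψ : R →+ R) : Prop := ∀ h g, ψ (h ^ q * g) = h * ψ g

theorem exists_dual {R : Type*} [CommRing R] [IsDomain R] (q : ℕ)
    (G : Submodule R (R →+ R)) (hG : ∀ ψ ∈ G, QL q ψ) (hsep : ∀ g : R, g ≠ 0 → ∃ ψ ∈ G, ψ g ≠ 0)
    {m : ℕ} (u : Fin m → R) (hu : ∀ d : Fin m → R, ∑ j, u j * d j ^ q = 0 → ∀ j, d j = 0) :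
    ∃ c : R, c ≠ 0 ∧ ∀ i, ∃ ψ ∈ G, ∀ j, ψ (u j) = if j = i then c else 0 := by
  classical
  let K := FractionRing R
  let ι := algebraMap R K
  have hι : Function.Injective ι := IsFractionRing.injective R K
  let W : Submodule K (Fin m → K) :=
    { carrier := {x | ∃ c : R, c ≠ 0 ∧ ∃ ψ ∈ G, ∀ j, ι c * x j = ι (ψ (u j))}
      zero_mem' := ⟨1, one_ne_zero, 0, zero_mem _, fun j => by simp⟩
      add_mem' := by
        rintro x y ⟨c, hc, ψ, hψ, h1⟩ ⟨c', hc', ψ', hψ', h2⟩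
        refine ⟨c * c', mul_ne_zero hc hc', c' • ψ + c • ψ', add_mem (G.smul_mem _ hψ) (G.smul_mem _ hψ'), fun j => ?_⟩
        simp only [Pi.add_apply, AddMonoidHom.add_apply, AddMonoidHom.smul_apply, smul_eq_mul, map_add, map_mul,
          ← h1, ← h2]
        ring
      smul_mem' := by
        rintro a x ⟨c, hc, ψ, hψ, h1⟩
        obtain ⟨⟨n, d⟩, hd⟩ := IsLocalization.surj (nonZeroDivisors R) a
        refine ⟨d * c, mul_ne_zero (nonZeroDivisors.ne_zero d.2) hc, n • ψ, G.smul_mem _ hψ, fun j => ?_⟩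
        simp only [Pi.smul_apply, AddMonoidHom.smul_apply, smul_eq_mul, map_mul, ← h1]
        have hd' : a * ι d = ι n := hd
        linear_combination (ι c * x j) * hd' }
  have htop : W = ⊤ := by
    by_contra hne
    obtain ⟨f, hf, hle⟩ := Submodule.exists_le_ker_of_lt_top W (lt_top_iff_ne_top.2 hne)
    obtain ⟨b, hb⟩ := IsLocalization.exist_integer_multiples (nonZeroDivisors R) Finset.univ
      (fun j : Fin m => f (Pi.single j 1))
    choose d hd using fun j => hb j (Finset.mem_univ j)
    have hfx : ∀ x : Fin m → K, f x = ∑ j, x j * f (Pi.single j 1) := fun x => by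
      conv_lhs => rw [pi_eq_sum_univ' x]
      simp only [map_sum, map_smul, smul_eq_mul]
    have hzero : ∀ ψ ∈ G, ∑ j, d j * ψ (u j) = 0 := by
      intro ψ hψ
      apply hι
      have hmem : (fun j => ι (ψ (u j))) ∈ W := ⟨1, one_ne_zero, ψ, hψ, fun j => by simp⟩
      have := hle hmem
      rw [LinearMap.mem_ker, hfx] at this
      rw [map_sum, map_zero]
      calc ∑ j, ι (d j * ψ (u j)) = ∑ j, ι b * (ι (ψ (u j)) * f (Pi.single j 1)) := by
            refine Finset.sum_congr rfl fun j _ => ?_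
            have h3 : ι (d j) = ι b * f (Pi.single j 1) := by
              have := hd j
              rwa [Algebra.smul_def] at this
            rw [map_mul, h3]; ring
        _ = 0 := by rw [← Finset.mul_sum, this, mul_zero]
    have h0 : ∑ j, u j * d j ^ q = 0 := by
      by_contra hne0
      obtain ⟨ψ, hψ, h1⟩ := hsep _ hne0
      apply h1
      rw [map_sum, ← hzero ψ hψ]
      refine Finset.sum_congr rfl fun j _ => ?_
      rw [mul_comm, hG ψ hψ]
    have hd0 := hu d h0
    apply hf
    apply LinearMap.ext
    intro x
    rw [hfx]
    refine Finset.sum_eq_zero fun j _ => ?_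
    have := hd j
    rw [hd0 j, map_zero, Algebra.smul_def] at this
    have hbne : ι b ≠ 0 := by
      rw [Ne, map_eq_zero_iff _ hι]; exact nonZeroDivisors.ne_zero b.2
    rw [(mul_eq_zero.1 this.symm).resolve_left hbne, mul_zero]
  have hi : ∀ i : Fin m, ∃ c : R, c ≠ 0 ∧ ∃ ψ ∈ G, ∀ j, ι c * (Pi.single i 1 : Fin m → K) j = ι (ψ (u j)) := by
    intro i
    have : (Pi.single i 1 : Fin m → K) ∈ W := htop ▸ trivial
    exact this
  choose c hc ψ hψ h1 using hi
  refine ⟨∏ i, c i, Finset.prod_ne_zero_iff.2 fun i _ => hc i, fun i =>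
    ⟨(∏ k ∈ Finset.univ.erase i, c k) • ψ i, G.smul_mem _ (hψ i), fun j => ?_⟩⟩
  have h2 : ψ i (u j) = if j = i then c i else 0 := by
    apply hι
    rw [← h1, Pi.single_apply]
    split_ifs <;> simp
  rw [AddMonoidHom.smul_apply, h2, smul_eq_mul]
  split_ifs
  · exact Finset.prod_erase_mul _ _ (Finset.mem_univ i)
  · simp

/-- the key divisibility property -/
def ZC (q : ℕ) (R S : Type*) [CommRing R] [CommRing S] [Algebra R S] : Prop :=
  ∀ (m : ℕ) (u : Fin m → R), (∀ d : Fin m → R, ∑ j, u j * d j ^ q = 0 → ∀ j, d j = 0) →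
    ∃ c : R, c ≠ 0 ∧ ∀ (s w : S) (o : Fin m → S), s ^ q * w = ∑ j, algebraMap R S (u j) * o j ^ q →
      ∀ i, s ∣ algebraMap R S c * o i

theorem zc_of_extend {R S : Type*} [CommRing R] [CommRing S] [IsDomain R] [Algebra R S] (q : ℕ)
    (h : ∀ g : R, g ≠ 0 → ∃ (ψ : R →+ R) (φ : S →+ S), QL q ψ ∧ QL q φ ∧
      (∀ x, φ (algebraMap R S x) = algebraMap R S (ψ x)) ∧ ψ g ≠ 0) : ZC q R S := by
  classical
  intro m u hu
  let G : Submodule R (R →+ R) :=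
    { carrier := {ψ | QL q ψ ∧ ∃ φ : S →+ S, QL q φ ∧ ∀ x, φ (algebraMap R S x) = algebraMap R S (ψ x)}
      zero_mem' := ⟨fun _ _ => by simp, 0, fun _ _ => by simp, fun x => by simp⟩
      add_mem' := by
        rintro ψ ψ' ⟨h1, φ, h2, h3⟩ ⟨h1', φ', h2', h3'⟩
        refine ⟨fun a b => ?_, φ + φ', fun a b => ?_, fun x => ?_⟩
        · simp only [AddMonoidHom.add_apply]; rw [h1, h1']; ring
        · simp only [AddMonoidHom.add_apply]; rw [h2, h2']; ring
        · simp only [AddMonoidHom.add_apply, h3, h3', map_add]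
      smul_mem' := by
        rintro r ψ ⟨h1, φ, h2, h3⟩
        refine ⟨fun a b => ?_, (AddMonoidHom.mulLeft (algebraMap R S r)).comp φ, fun a b => ?_, fun x => ?_⟩
        · simp only [AddMonoidHom.smul_apply, smul_eq_mul]; rw [h1]; ring
        · simp only [AddMonoidHom.comp_apply, AddMonoidHom.coe_mulLeft]; rw [h2]; ring
        · simp only [AddMonoidHom.comp_apply, AddMonoidHom.coe_mulLeft, AddMonoidHom.smul_apply, smul_eq_mul,
            h3, map_mul] }
  obtain ⟨c, hc, hψ⟩ := exists_dual q G (fun ψ hψ => hψ.1) (fun g hg => by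
    obtain ⟨ψ, φ, h1, h2, h3, h4⟩ := h g hg
    exact ⟨ψ, ⟨h1, φ, h2, h3⟩, h4⟩) u hu
  refine ⟨c, hc, fun s w o ho i => ?_⟩
  obtain ⟨ψ, ⟨h1, φ, h2, h3⟩, h4⟩ := hψ i
  refine ⟨φ w, ?_⟩
  rw [← h2, ho, map_sum, Finset.sum_eq_single i]
  · rw [mul_comm, mul_comm (algebraMap R S (u i)), h2, h3, h4, if_pos rfl]
  · intro j _ hj
    rw [mul_comm, h2, h3, h4, if_neg hj]; simp
  · simp

theorem zc_of_dense {R S : Type*} [CommRing R] [CommRing S] [IsDomain R] [IsNoetherianRing R] [IsNoetherianRing S]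
    [IsLocalRing S] [Algebra R S] (q : ℕ) (hq : q ≠ 0) (P : Ideal R)
    (hsep : ∀ g : R, g ≠ 0 → ∃ ψ : R →+ R, QL q ψ ∧ ψ g ≠ 0)
    (hd : ∀ N (t : S), ∃ r g : R, IsUnit (algebraMap R S r) ∧ algebraMap R S r * t - algebraMap R S g ∈ maximalIdeal S ^ N)
    (hs : ∀ N (g : R), algebraMap R S g ∈ maximalIdeal S ^ N → ∃ r : R, IsUnit (algebraMap R S r) ∧ r * g ∈ P ^ N)
    (hP : P.map (algebraMap R S) ≤ maximalIdeal S) : ZC q R S := by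
  classical
  intro m u hu
  let G : Submodule R (R →+ R) :=
    { carrier := {ψ | QL q ψ}
      zero_mem' := fun _ _ => by simp
      add_mem' := by
        rintro ψ ψ' h1 h1' a b
        simp only [AddMonoidHom.add_apply]; rw [h1, h1']; ring
      smul_mem' := by
        rintro r ψ h1 a b
        simp only [AddMonoidHom.smul_apply, smul_eq_mul]; rw [h1]; ring }
  obtain ⟨c, hc, hψ⟩ := exists_dual q G (fun ψ hψ => hψ) hsep u hu
  let ι := algebraMap R S
  refine ⟨c, hc, fun s w o ho i => ?_⟩
  obtain ⟨ψ, h1, h4⟩ := hψ i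
  have hrad : ∀ M, ∃ N, M ≤ N ∧ ∀ g ∈ P ^ N, ψ g ∈ P ^ M := by
    intro M
    let J : Ideal R := Ideal.span ((fun x => x ^ q) '' (P ^ M : Ideal R))
    have hJ : ∀ y ∈ J, ∀ a, ψ (a * y) ∈ P ^ M := by
      intro y hy
      induction hy using Submodule.span_induction with
      | mem y hy =>
        obtain ⟨x, hx, rfl⟩ := hy
        intro a
        have := h1 x a
        rw [mul_comm] at this
        change ψ (a * x ^ q) ∈ _
        rw [this]
        exact Ideal.mul_mem_right _ _ hx
      | zero => intro a; simp
      | add x y _ _ hx hy => intro a; rw [mul_add, map_add]; exact add_mem (hx a) (hy a)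
      | smul b x _ hx => intro a; rw [smul_eq_mul, ← mul_assoc]; exact hx _
    have hPJ : P ≤ J.radical := by
      intro x hx
      refine ⟨M * q, ?_⟩
      rw [pow_mul]
      exact Ideal.subset_span ⟨x ^ M, Ideal.pow_mem_pow hx M, rfl⟩
    obtain ⟨N, hN⟩ := Ideal.exists_pow_le_of_le_radical_of_fg hPJ (IsNoetherian.noetherian P)
    refine ⟨max M N, le_max_left _ _, fun g hg => ?_⟩
    have := hJ g (hN (Ideal.pow_le_pow_right (le_max_right _ _) hg)) 1
    rwa [one_mul] at this
  have key : ∀ M, ∃ y, ι c * o i - s * y ∈ maximalIdeal S ^ M := by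
    intro M
    obtain ⟨N, hMN, hN⟩ := hrad M
    choose rr gg hrr hgg using hd N
    have hcl : ∀ t r, rr t ∣ r → ∃ g, ι r * t - ι g ∈ maximalIdeal S ^ N := by
      rintro t r ⟨a, rfl⟩
      refine ⟨a * gg t, ?_⟩
      have := Ideal.mul_mem_left _ (ι a) (hgg t)
      convert this using 1
      simp only [map_mul, ι]; ring
    let r := rr s * rr w * ∏ j, rr (o j)
    have hr : IsUnit (ι r) := by
      simp only [r, map_mul, map_prod]
      refine ((hrr s).mul (hrr w)).mul ?_
      rw [IsUnit.prod_univ_iff]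
      exact fun j => hrr (o j)
    obtain ⟨gs, hgs⟩ := hcl s r ⟨rr w * ∏ j, rr (o j), by simp only [r]; ring⟩
    obtain ⟨gw, hgw⟩ := hcl w (r ^ q) (Dvd.dvd.trans ⟨rr s * ∏ j, rr (o j), by simp only [r]; ring⟩ (dvd_pow_self r hq))
    choose go hgo using fun j => hcl (o j) r (Dvd.dvd.mul_left (Finset.dvd_prod_of_mem _ (Finset.mem_univ j)) _)
    have hmod : ∀ a b : S, a - b ∈ maximalIdeal S ^ N ↔
      Ideal.Quotient.mk (maximalIdeal S ^ N) a = Ideal.Quotient.mk (maximalIdeal S ^ N) b := fun a b =>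
      Ideal.Quotient.eq.symm
    have hZ : ι (gs ^ q * gw - ∑ j, u j * (r * go j) ^ q) ∈ maximalIdeal S ^ N := by
      rw [← Ideal.Quotient.eq_zero_iff_mem]
      rw [hmod] at hgs hgw
      simp only [hmod] at hgo
      simp only [map_sub, map_mul, map_pow, map_sum, ← hgs, ← hgo]
      rw [← hgw]
      have := congrArg (Ideal.Quotient.mk (maximalIdeal S ^ N)) (congrArg (fun x => ι r ^ q * ι r ^ q * x) ho)
      simp only [map_mul, map_pow, map_sum, Finset.mul_sum] at this
      rw [sub_eq_zero]
      convert this using 1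
      · simp only [map_pow, map_mul]; ring
      · refine Finset.sum_congr rfl fun j _ => ?_
        ring
    obtain ⟨r', hr', hrZ⟩ := hs N _ hZ
    have hrZ' : r' ^ q * (gs ^ q * gw - ∑ j, u j * (r * go j) ^ q) ∈ P ^ N := by
      obtain ⟨k, rfl⟩ := Nat.exists_eq_succ_of_ne_zero hq
      rw [pow_succ, mul_assoc]
      exact Ideal.mul_mem_left _ _ hrZ
    have h5 := hN _ hrZ'
    have h6 : ψ (∑ j, u j * (r * go j) ^ q) = r * go i * c := by
      rw [map_sum, Finset.sum_eq_single i]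
      · rw [mul_comm, h1, h4, if_pos rfl]
      · intro j _ hj
        rw [mul_comm, h1, h4, if_neg hj]; simp
      · simp
    rw [h1, map_sub, h1, h6] at h5
    have h7 : ι r' * (ι gs * ι (ψ gw) - ι r * ι (go i) * ι c) ∈ maximalIdeal S ^ M := by
      have h8 : (P ^ M).map ι ≤ maximalIdeal S ^ M := by
        rw [Ideal.map_pow]; exact Ideal.pow_right_mono hP M
      have := h8 (Ideal.mem_map_of_mem ι h5)
      simpa only [map_mul, map_sub] using this
    have hgs' := Ideal.pow_le_pow_right hMN hgs
    have hgo' := Ideal.pow_le_pow_right hMN (hgo i)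
    obtain ⟨v, hv⟩ := hr
    obtain ⟨v', hv'⟩ := hr'
    have hv'' : ι r' = v' := hv'.symm
    refine ⟨↑(v⁻¹) * ι (ψ gw), ?_⟩
    have h9 : (v : S) * (↑(v⁻¹) : S) = 1 := Units.mul_inv v
    have h10 : (v' : S) * (↑(v'⁻¹) : S) = 1 := Units.mul_inv v'
    rw [← hv] at hgs' hgo' h7
    rw [hv''] at h7
    have e1 := Ideal.mul_mem_left _ ((↑(v'⁻¹) : S) * (↑(v⁻¹) : S) ^ 2) h7
    have e2 := Ideal.mul_mem_left _ ((↑(v⁻¹) : S) ^ 2 * ι (ψ gw)) hgs'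
    have e3 := Ideal.mul_mem_left _ ((↑(v⁻¹) : S) * ι c) hgo'
    have := sub_mem e3 (add_mem e1 e2)
    convert this using 1
    generalize (↑(v⁻¹) : S) = a at *
    generalize (↑(v'⁻¹) : S) = a' at *
    generalize ι (ψ gw) = y at *
    generalize (v : S) = b at *
    generalize (v' : S) = b' at *
    linear_combination (-ι c * o i + s * a * y - ι c * a * ι (go i)) * h9 + (- ι c * a * ι (go i) * a * b + a ^ 2 * y * ι gs) * h10
  obtain ⟨N, hN⟩ : ∃ N : Submodule S (Fin 1 → S), N = Submodule.span S {fun _ => s} := ⟨_, rfl⟩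
  have := mem_of_krull (maximalIdeal S) (by rw [IsLocalRing.jacobson_eq_maximalIdeal _ bot_ne_top]) N (fun _ => ι c * o i)
    (fun n => by
      obtain ⟨y, hy⟩ := key n
      refine ⟨fun _ => s * y, ?_, fun _ => hy⟩
      rw [hN, Submodule.mem_span_singleton]
      exact ⟨y, by ext; simp [mul_comm]⟩)
  rw [hN, Submodule.mem_span_singleton] at this
  obtain ⟨a, ha⟩ := this
  refine ⟨a, ?_⟩
  have := congrFun ha 0
  simp only [Pi.smul_apply, smul_eq_mul] at this
  rw [mul_comm s a, this]

end GN

namespace GN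

theorem x1 {O N : Type*} [CommRing O] [CommRing N] [Algebra O N] (p e : ℕ) [Fact p.Prime] [CharP N p]
    (hO : NDom O) (hinj : Function.Injective (algebraMap O N)) {m : ℕ} (w : Fin m → N) (u : Fin m → O)
    (hw : ∀ j, w j ^ p ^ e = algebraMap O N (u j))
    (hspan : ∀ x : N, ∃ o : Fin m → O, x = ∑ j, algebraMap O N (o j) * w j)
    (hZ : ∀ (s t : O) (o : Fin m → O), s ^ p ^ e * t = ∑ j, u j * o j ^ p ^ e → ∀ i, s ∣ o i) : NDom N := by
  set q := p ^ e with hq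
  have hq0 : q ≠ 0 := pow_ne_zero _ (Fact.out : p.Prime).ne_zero
  have hsum : ∀ o : Fin m → O, (∑ j, algebraMap O N (o j) * w j) ^ q = algebraMap O N (∑ j, u j * o j ^ q) := by
    intro o
    rw [hq, sum_pow_char_pow, map_sum]
    refine Finset.sum_congr rfl fun j _ => ?_
    rw [mul_pow, ← hq, hw, map_mul, map_pow, mul_comm]
  have hex : ∀ x : N, ∃ y : O, algebraMap O N y = x ^ q := fun x => by
    obtain ⟨o, rfl⟩ := hspan x
    exact ⟨_, (hsum o).symm⟩
  choose φ hφ using hex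
  let Φ : N →+* O :=
    { toFun := φ
      map_one' := hinj (by rw [hφ]; simp)
      map_zero' := hinj (by rw [hφ]; simp [hq0])
      map_mul' := fun x y => hinj (by rw [hφ, map_mul, hφ, hφ, mul_pow])
      map_add' := fun x y => hinj (by rw [hφ, map_add, hφ, hφ, hq, add_pow_char_pow]) }
  have hΦ : ∀ x, algebraMap O N (Φ x) = x ^ q := hφ
  have hΦo : ∀ o : Fin m → O, Φ (∑ j, algebraMap O N (o j) * w j) = ∑ j, u j * o j ^ q := fun o =>
    hinj (by rw [hΦ, hsum])
  have hΦ0 : ∀ x, Φ x = 0 → x = 0 := by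
    intro x hx
    obtain ⟨o, rfl⟩ := hspan x
    rw [hΦo] at hx
    refine Finset.sum_eq_zero fun j _ => ?_
    have := hZ 0 0 o (by rw [hx, mul_zero]) j
    rw [zero_dvd_iff.1 this]; simp
  obtain ⟨hOd, hOi⟩ := (ndom_iff O).1 hO
  have : Nontrivial N := hinj.nontrivial
  have hND : NoZeroDivisors N := ⟨fun {a b} hab => by
    have := congrArg Φ hab
    rw [map_mul, map_zero] at this
    exact (mul_eq_zero.1 this).imp (hΦ0 a) (hΦ0 b)⟩
  rw [ndom_iff]
  refine ⟨NoZeroDivisors.to_isDomain N, fun a b hb hab => ?_⟩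
  have hdvd := hOi _ _ (fun h => hb (hΦ0 b h)) (hab.map Φ)
  obtain ⟨t, ht⟩ := hdvd
  obtain ⟨o, ho⟩ := hspan (a * b ^ (q - 1))
  have h1 : Φ b ^ q * t = ∑ j, u j * o j ^ q := by
    rw [← hΦo, ← ho, map_mul, map_pow, ht]
    obtain ⟨k, hk⟩ := Nat.exists_eq_succ_of_ne_zero hq0
    rw [hk]; simp only [Nat.succ_eq_add_one, Nat.add_sub_cancel]; ring
  have h2 := hZ _ _ _ h1
  choose y hy using h2
  have h3 : a * b ^ (q - 1) = b ^ q * ∑ j, algebraMap O N (y j) * w j := by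
    rw [ho, ← hΦ, Finset.mul_sum]
    refine Finset.sum_congr rfl fun j _ => ?_
    rw [hy, map_mul]; ring
  refine ⟨∑ j, algebraMap O N (y j) * w j, mul_right_cancel₀ (pow_ne_zero (q - 1) hb) (h3.trans ?_)⟩
  obtain ⟨k, hk⟩ := Nat.exists_eq_succ_of_ne_zero hq0
  rw [hk]; simp only [Nat.succ_eq_add_one, Nat.add_sub_cancel]
  ring

/-- purely inseparable case -/
theorem ndom_pins {R S K O M : Type*} [CommRing R] [IsDomain R] [CommRing S] [Algebra R S]
    [Field K] [Algebra R K] [IsFractionRing R K] [CommRing O] [Algebra S O] [Algebra R O] [Algebra K O]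
    [IsScalarTower R S O] [IsScalarTower R K O] [IsLocalization (Algebra.algebraMapSubmonoid S (nonZeroDivisors R)) O]
    (hS : NDom S) (hinj : Function.Injective (algebraMap R S))
    [Field M] [Algebra K M] [FiniteDimensional K M] (p e : ℕ) [Fact p.Prime] [CharP K p]
    (hM : ∀ x : M, ∃ y : K, algebraMap K M y = x ^ p ^ e) (hZ : ZC (p ^ e) R S) : NDom (M ⊗[K] O) := by
  classical
  obtain ⟨hSd, hSi⟩ := hS
  have hq0 : p ^ e ≠ 0 := pow_ne_zero _ (Fact.out : p.Prime).ne_zero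
  have hle : Algebra.algebraMapSubmonoid S (nonZeroDivisors R) ≤ nonZeroDivisors S := by
    rintro _ ⟨r, hr, rfl⟩
    rw [mem_nonZeroDivisors_iff_ne_zero, Ne, map_eq_zero_iff _ hinj]
    exact nonZeroDivisors.ne_zero hr
  have hOd : IsDomain O := IsLocalization.isDomain_of_le_nonZeroDivisors (R := S) (S := O) hle
  have hOi : IsIntegrallyClosed O := isIntegrallyClosed_of_isLocalization O _ hle
  have hSO : Function.Injective (algebraMap S O) := IsLocalization.injective O hle
  have hRO : ∀ r : R, algebraMap S O (algebraMap R S r) = algebraMap K O (algebraMap R K r) := fun r => by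
    rw [← IsScalarTower.algebraMap_apply, ← IsScalarTower.algebraMap_apply]
  have hRK : Function.Injective (algebraMap R K) := IsFractionRing.injective R K
  -- scaled basis
  let m := Module.finrank K M
  let b : Module.Basis (Fin m) K M := Module.finBasis K M
  have hsc : ∀ j, ∃ (r : R) (v : R), r ≠ 0 ∧ algebraMap K M (algebraMap R K v) = (algebraMap K M (algebraMap R K r) * b j) ^ p ^ e := by
    intro j
    obtain ⟨y, hy⟩ := hM (b j)
    obtain ⟨⟨n, d⟩, hd⟩ := IsLocalization.surj (nonZeroDivisors R) y
    refine ⟨d, d ^ (p ^ e - 1) * n, nonZeroDivisors.ne_zero d.2, ?_⟩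
    obtain ⟨k, hk⟩ := Nat.exists_eq_succ_of_ne_zero hq0
    have hd' : y * algebraMap R K d = algebraMap R K n := hd
    rw [mul_pow, ← hy, hk]
    simp only [Nat.succ_eq_add_one, Nat.add_sub_cancel, ← map_pow, ← map_mul]
    congr 1
    simp only [map_pow, map_mul, ← hd']
    ring
  choose r v hr hv using hsc
  have hrK : ∀ j, algebraMap R K (r j) ≠ 0 := fun j => by rw [Ne, map_eq_zero_iff _ hRK]; exact hr j
  let w : Fin m → M := fun j => algebraMap K M (algebraMap R K (r j)) * b j
  have hCM : CharP M p := charP_of_injective_algebraMap (algebraMap K M).injective p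
  have hind : ∀ d : Fin m → K, ∑ j, algebraMap K M (d j) * w j = 0 → ∀ j, d j = 0 := by
    intro d hd j
    have := (Fintype.linearIndependent_iff.1 b.linearIndependent) (fun j => d j * algebraMap R K (r j)) (by
      rw [← hd]
      refine Finset.sum_congr rfl fun j _ => ?_
      rw [Algebra.smul_def, map_mul, mul_assoc]) j
    exact (mul_eq_zero.1 this).resolve_right (hrK j)
  obtain ⟨c, hc, hZc⟩ := hZ m v (by
    intro d hd j
    apply hRK
    rw [map_zero]
    refine hind (fun j => algebraMap R K (d j)) ?_ j
    rw [← pow_eq_zero_iff hq0, sum_pow_char_pow]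
    have := congrArg (fun x => algebraMap K M (algebraMap R K x)) hd
    simp only [map_sum, map_mul, map_pow, map_zero] at this
    rw [← this]
    refine Finset.sum_congr rfl fun j _ => ?_
    rw [mul_pow, hv]; ring)
  have hunit : ∀ x : R, x ≠ 0 → IsUnit (algebraMap K O (algebraMap R K x)) := fun x hx =>
    (IsUnit.mk0 _ (by rw [Ne, map_eq_zero_iff _ hRK]; exact hx)).map _
  -- the ring
  let N := O ⊗[K] M
  refine NDom.of_equiv (Algebra.TensorProduct.comm K O M).toRingEquiv ?_
  have hN : Nontrivial (O ⊗[K] M) := inferInstance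
  have hCN : CharP (O ⊗[K] M) p := charP_of_injective_algebraMap (algebraMap K (O ⊗[K] M)).injective p
  have hT : ∀ (x : K) (y : M), (algebraMap K O x) ⊗ₜ[K] y = (1 : O) ⊗ₜ[K] (algebraMap K M x * y) := by
    intro x y
    rw [Algebra.algebraMap_eq_smul_one, TensorProduct.smul_tmul, Algebra.smul_def]
  let bN := Algebra.TensorProduct.basis O b
  refine x1 p e ⟨hOd, hOi⟩ (FaithfulSMul.algebraMap_injective O (O ⊗[K] M)) (fun j => (1 : O) ⊗ₜ[K] w j)
    (fun j => algebraMap S O (algebraMap R S (v j))) ?_ ?_ ?_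
  · intro j
    rw [Algebra.TensorProduct.tmul_pow, one_pow, ← hv, hRO, Algebra.TensorProduct.algebraMap_apply]
    simp only [Algebra.algebraMap_self_apply]
    rw [hT, mul_one]
  · intro x
    have := bN.sum_repr x
    refine ⟨fun j => bN.repr x j * algebraMap K O (algebraMap R K (r j))⁻¹, ?_⟩
    conv_lhs => rw [← this]
    refine Finset.sum_congr rfl fun j _ => ?_
    rw [Algebra.smul_def, map_mul, mul_assoc]
    congr 1
    simp only [bN, Algebra.TensorProduct.basis_apply, w]
    rw [Algebra.TensorProduct.algebraMap_apply, Algebra.TensorProduct.tmul_mul_tmul, mul_one]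
    simp only [Algebra.algebraMap_self_apply]
    rw [hT, one_mul, ← mul_assoc, ← map_mul]
    rw [inv_mul_cancel₀ (hrK j), map_one, one_mul]
  · intro s t o h i
    -- clear denominators
    obtain ⟨bb, hbb⟩ := IsLocalization.exist_integer_multiples (Algebra.algebraMapSubmonoid S (nonZeroDivisors R))
      (Finset.univ : Finset (Fin m ⊕ Fin 2)) (Sum.elim o ![s, t])
    obtain ⟨rr, hrr, hrr'⟩ := bb.2
    have hcl : ∀ x : Fin m ⊕ Fin 2, ∃ y : S, algebraMap S O y = algebraMap S O (algebraMap R S rr) * Sum.elim o ![s, t] x := by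
      intro x
      obtain ⟨y, hy⟩ := hbb x (Finset.mem_univ x)
      refine ⟨y, ?_⟩
      rw [hrr', hy, Algebra.smul_def]
    choose y hy using hcl
    set ρ := algebraMap R S rr with hρ
    have hys : algebraMap S O (y (Sum.inr 0)) = algebraMap S O ρ * s := hy _
    have hyt : algebraMap S O (y (Sum.inr 1)) = algebraMap S O ρ * t := hy _
    have hyo : ∀ j, algebraMap S O (y (Sum.inl j)) = algebraMap S O ρ * o j := fun j => hy _
    have h3 := hZc (y (Sum.inr 0)) (ρ ^ (p ^ e - 1) * y (Sum.inr 1)) (fun j => ρ * y (Sum.inl j)) (by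
      apply hSO
      have := congrArg (fun x => algebraMap S O ρ ^ p ^ e * algebraMap S O ρ ^ p ^ e * x) h
      simp only [Finset.mul_sum] at this
      simp only [map_mul, map_pow, map_sum, hys, hyt, hyo]
      obtain ⟨k, hk⟩ := Nat.exists_eq_succ_of_ne_zero hq0
      rw [hk] at this ⊢
      simp only [Nat.succ_eq_add_one, Nat.add_sub_cancel] at this ⊢
      refine Eq.trans ?_ (this.trans ?_)
      · ring
      · refine Finset.sum_congr rfl fun j _ => ?_
        ring) i
    obtain ⟨z, hz⟩ := h3
    have h4 := congrArg (algebraMap S O) hz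
    simp only [map_mul, hys, hyo] at h4
    have h5 : IsUnit (algebraMap S O (algebraMap R S c) * (algebraMap S O ρ * algebraMap S O ρ)) := by
      have h6 : IsUnit (algebraMap S O ρ) := by rw [hρ, hRO]; exact hunit _ (nonZeroDivisors.ne_zero hrr)
      refine IsUnit.mul ?_ (h6.mul h6)
      rw [hRO]; exact hunit _ hc
    rw [← h5.dvd_mul_left]
    exact ⟨algebraMap S O ρ * algebraMap S O z, by linear_combination h4⟩

end GN

section
open IntermediateField
namespace GN
theorem exists_pins_sep (K : Type u) (L : Type v) [Field K] [Field L] [Algebra K L] [FiniteDimensional K L] (p : ℕ) [Fact p.Prime] [CharP K p] :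
    ∃ (M E : Type v) (_ : Field M) (_ : Field E) (_ : Algebra K M) (_ : Algebra M E) (_ : Algebra K E) (_ : Algebra L E),
      IsScalarTower K M E ∧ IsScalarTower K L E ∧ FiniteDimensional K M ∧ FiniteDimensional M E ∧ Algebra.IsSeparable M E ∧
      ∃ e, ∀ x : M, ∃ y : K, algebraMap K M y = x ^ p ^ e := by
  classical
  obtain ⟨E, hE, a1, a2, t1, hf, hn⟩ : ∃ (E : Type v) (_ : Field E) (_ : Algebra K E) (_ : Algebra L E), IsScalarTower K L E ∧
    FiniteDimensional K E ∧ Normal K E :=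
    ⟨normalClosure K L (AlgebraicClosure L), inferInstance, inferInstance, inferInstance, inferInstance, inferInstance, inferInstance⟩
  let M := fixedField (⊤ : Subgroup (E ≃ₐ[K] E))
  have hg : IsGalois M E := IsGalois.of_fixed_field E (⊤ : Subgroup (E ≃ₐ[K] E))
  refine ⟨M, E, inferInstance, hE, inferInstance, inferInstance, a1, a2, inferInstance, t1, inferInstance, inferInstance, inferInstance, ?_⟩
  have hpi : IsPurelyInseparable K M := by
    rw [isPurelyInseparable_iff_natSepDegree_eq_one]
    intro x
    have h1 : minpoly K x = minpoly K (x : E) := (minpoly.algebraMap_eq (algebraMap M E).injective x).symm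
    rw [h1, Polynomial.natSepDegree_eq_of_splits _ (hn.splits (x : E)), Finset.card_eq_one]
    refine ⟨(x : E), ?_⟩
    ext y
    have hnt : IsIntegral K (x : E) := Algebra.IsIntegral.isIntegral _
    rw [Multiset.mem_toFinset, Polynomial.mem_aroots, Finset.mem_singleton]
    constructor
    · rintro ⟨_, h⟩
      obtain ⟨σ, hσ⟩ := minpoly.exists_algEquiv_of_root' hnt.isAlgebraic h
      rw [← hσ]
      exact x.2 ⟨σ, trivial⟩
    · rintro rfl
      exact ⟨minpoly.ne_zero hnt, minpoly.aeval _ _⟩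
  rw [isPurelyInseparable_iff_pow_mem K p] at hpi
  let b := Module.finBasis K M
  choose n hn using hpi
  have hCM : CharP M p := charP_of_injective_algebraMap (algebraMap K M).injective p
  refine ⟨∑ i, n (b i), fun x => ?_⟩
  have h2 : ∀ j, ∃ y : K, algebraMap K M y = b j ^ p ^ (∑ i, n (b i)) := by
    intro j
    obtain ⟨y, hy⟩ := hn (b j)
    rw [← Finset.add_sum_erase _ _ (Finset.mem_univ j), pow_add, pow_mul, ← hy]
    exact ⟨y ^ _, map_pow _ _ _⟩
  choose y hy using h2
  refine ⟨∑ j, (b.repr x j) ^ p ^ (∑ i, n (b i)) * y j, ?_⟩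
  conv_rhs => rw [← b.sum_repr x]
  rw [sum_pow_char_pow, map_sum]
  refine Finset.sum_congr rfl fun j _ => ?_
  rw [Algebra.smul_def, mul_pow, map_mul, hy, map_pow]

theorem normal_of_tensor_ext {K L E O : Type*} [Field L] [Field E] [CommRing K] [CommRing O] [Algebra K L] [Algebra K E]
    [Algebra L E] [IsScalarTower K L E] [Algebra K O] (h : IsNormalRing (E ⊗[K] O)) : IsNormalRing (L ⊗[K] O) := by
  have e1 : (E ⊗[L] (L ⊗[K] O)) ≃ₐ[L] E ⊗[K] O := Algebra.TensorProduct.cancelBaseChange K L L E O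
  have e2 : ((L ⊗[K] O) ⊗[L] E) ≃ₐ[L] E ⊗[L] (L ⊗[K] O) := Algebra.TensorProduct.comm L _ _
  have h2 : IsNormalRing ((L ⊗[K] O) ⊗[L] E) := isNormalRing_of_ringEquiv (e2.trans e1).symm.toRingEquiv h
  exact IsNormalRing.descent h2

section
attribute [local instance] Algebra.TensorProduct.rightAlgebra
theorem thmX {R S : Type*} (K L : Type*) [CommRing R] [IsDomain R] [CommRing S] [Algebra R S] [IsNoetherianRing S]
    [Field K] [Algebra R K] [IsFractionRing R K] [Field L] [Algebra K L] [Algebra R L] [IsScalarTower R K L]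
    [FiniteDimensional K L]
    (hS : NDom S) (hinj : Function.Injective (algebraMap R S))
    (hZ : ∀ p : ℕ, p.Prime → (p : R) = 0 → ∀ e, ZC (p ^ e) R S) : IsNormalRing (L ⊗[R] S) := by
  let O := K ⊗[R] S
  have hloc : IsLocalization (Algebra.algebraMapSubmonoid S (nonZeroDivisors R)) O := IsLocalization.tensorRight K (nonZeroDivisors R)
  have hNO : IsNoetherianRing O := IsLocalization.isNoetherianRing (Algebra.algebraMapSubmonoid S (nonZeroDivisors R)) O inferInstance
  have e0 : (L ⊗[K] O) ≃ₐ[K] L ⊗[R] S := Algebra.TensorProduct.cancelBaseChange R K K L S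
  refine isNormalRing_of_ringEquiv e0.toRingEquiv ?_
  have hON : IsNormalRing O := isNormalRing_of_isLocalization (Algebra.algebraMapSubmonoid S (nonZeroDivisors R)) O hS.isNormalRing
  obtain ⟨p, hp⟩ := CharP.exists K
  rcases CharP.char_is_prime_or_zero K p with hpp | rfl
  · have : Fact p.Prime := ⟨hpp⟩
    have hp0 : (p : R) = 0 := IsFractionRing.injective R K (by rw [map_natCast, map_zero]; exact CharP.cast_eq_zero K p)
    obtain ⟨M, E, _, _, _, _, _, _, t1, t2, f1, f2, hsep, e, he⟩ := exists_pins_sep K L p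
    apply normal_of_tensor_ext (E := E)
    have h1 : NDom (M ⊗[K] O) := ndom_pins (R := R) (S := S) hS hinj p e he (hZ p hpp hp0 e)
    have : IsNoetherianRing (M ⊗[K] O) := by
      have : IsNoetherianRing (O ⊗[K] M) := Algebra.FiniteType.isNoetherianRing O _
      exact isNoetherianRing_of_ringEquiv _ (Algebra.TensorProduct.comm K O M).toRingEquiv
    have h2 : IsNormalRing (E ⊗[M] (M ⊗[K] O)) := isNormalRing_tensor_separable M E (M ⊗[K] O) h1.isNormalRing
    exact isNormalRing_of_ringEquiv (Algebra.TensorProduct.cancelBaseChange K M M E O).toRingEquiv h2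
  · have : CharZero K := CharP.charP_to_charZero K
    exact isNormalRing_tensor_separable K L O hON
end
end GN
end

namespace GN

/-- a `q`-twisted copy of a ring -/
def Tw (k : Type*) (q : ℕ) : Type _ := k

theorem exists_lam {k l : Type*} [Field k] [Field l] (f : k →+* l) (p e : ℕ) [Fact p.Prime] [CharP k p] [CharP l p]
    (hsep : ∀ (m : ℕ) (c : Fin m → k), (∀ d : Fin m → k, ∑ i, c i * d i ^ p ^ e = 0 → ∀ i, d i = 0) →
      ∀ y : Fin m → l, ∑ i, f (c i) * y i ^ p ^ e = 0 → ∀ i, y i = 0)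
    (a : k) (ha : a ≠ 0) : ∃ (lam : k →+ k) (lam' : l →+ l), QL (p ^ e) lam ∧ QL (p ^ e) lam' ∧
      (∀ x, lam' (f x) = f (lam x)) ∧ lam a ≠ 0 := by
  classical
  letI i1 : AddCommGroup (Tw k (p ^ e)) := inferInstanceAs (AddCommGroup k)
  letI i2 : Module k (Tw k (p ^ e)) := Module.compHom (R := k) k (iterateFrobenius k p e)
  letI j1 : AddCommGroup (Tw l (p ^ e)) := inferInstanceAs (AddCommGroup l)
  letI j2 : Module l (Tw l (p ^ e)) := Module.compHom (R := l) l (iterateFrobenius l p e)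
  let V := Tw k (p ^ e)
  let W := Tw l (p ^ e)
  let tk : k →+ V := AddMonoidHom.id k
  let tl : l →+ W := AddMonoidHom.id l
  let sk : V →+ k := AddMonoidHom.id k
  let sl : W →+ l := AddMonoidHom.id l
  have hk : ∀ (c : k) (x : V), sk (c • x) = c ^ p ^ e * sk x := fun c x => rfl
  have hl : ∀ (c : l) (x : W), sl (c • x) = c ^ p ^ e * sl x := fun c x => rfl
  obtain ⟨lam, hlam⟩ : ∃ lam : V →ₗ[k] k, lam (tk a) ≠ 0 := by
    by_contra hcon
    push Not at hcon
    exact ha ((Module.forall_dual_apply_eq_zero_iff k (tk a)).1 hcon)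
  let b := Module.Basis.ofVectorSpace k V
  let fV : V →ₛₗ[f] W :=
    { toFun := fun x => tl (f (sk x))
      map_add' := fun x y => by simp
      map_smul' := fun c x => by
        apply (show Function.Injective sl from fun _ _ h => h)
        rw [hl, hk, map_mul, map_pow]; rfl }
  have hli : LinearIndependent l (fun i => fV (b i)) := by
    rw [linearIndependent_iff']
    intro s g hg i hi
    let ε := s.equivFin
    have := hsep s.card (fun j => sk (b (ε.symm j))) (by
      intro d hd j
      have h1 := linearIndependent_iff'.1 b.linearIndependent s (fun i => if h : i ∈ s then d (ε ⟨i, h⟩) else 0) (by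
        apply (show Function.Injective sk from fun _ _ h => h)
        rw [map_zero, ← hd, map_sum, ← Finset.sum_coe_sort, ← ε.symm.sum_comp]
        refine Finset.sum_congr rfl fun j _ => ?_
        rw [hk, dif_pos (ε.symm j).2]; simp [mul_comm]) (ε.symm j) (ε.symm j).2
      rw [dif_pos (ε.symm j).2] at h1
      simpa using h1) (fun j => g (ε.symm j)) (by
        have h1 := congrArg sl hg
        rw [map_zero, map_sum, ← Finset.sum_coe_sort, ← ε.symm.sum_comp] at h1
        rw [← h1]
        refine Finset.sum_congr rfl fun j _ => ?_
        rw [hl, mul_comm]; rfl) (ε ⟨i, hi⟩)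
    simpa using this
  obtain ⟨φ, hφ⟩ := LinearMap.exists_extend
    ((Finsupp.linearCombination l (fun i => f (lam (b i)))).comp hli.repr)
  have hφb : ∀ i, φ (fV (b i)) = f (lam (b i)) := by
    intro i
    have h1 := LinearMap.congr_fun hφ ⟨fV (b i), Submodule.subset_span ⟨i, rfl⟩⟩
    simp only [LinearMap.comp_apply, Submodule.subtype_apply] at h1
    rw [h1]
    have h2 := hli.repr_eq_single i ⟨fV (b i), Submodule.subset_span ⟨i, rfl⟩⟩ rfl
    rw [h2]; simp
  let F1 : V →ₛₗ[f] l :=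
    { toFun := fun x => φ (fV x), map_add' := fun x y => by simp, map_smul' := fun c x => by simp }
  let F2 : V →ₛₗ[f] l :=
    { toFun := fun x => f (lam x), map_add' := fun x y => by simp, map_smul' := fun c x => by simp }
  have hF : F1 = F2 := b.ext fun i => hφb i
  refine ⟨lam.toAddMonoidHom.comp tk, φ.toAddMonoidHom.comp tl, ?_, ?_, ?_, hlam⟩
  · intro h g
    exact lam.map_smul h (tk g)
  · intro h g
    exact φ.map_smul h (tl g)
  · intro x
    exact LinearMap.congr_fun hF (tk x)

/-- the operator on power series -/
noncomputable def psi {C : Type*} [CommRing C] {n : ℕ} (lam : C →+ C) (q : ℕ) (f : Fin n →₀ ℕ) : PS C n →+ PS C n where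
  toFun g := fun γ => lam (MvPowerSeries.coeff (f + q • γ) g)
  map_zero' := by ext γ; change lam (MvPowerSeries.coeff _ 0) = 0; simp
  map_add' x y := by
    ext γ
    change lam (MvPowerSeries.coeff _ (x + y)) = lam (MvPowerSeries.coeff _ x) + lam (MvPowerSeries.coeff _ y)
    simp

theorem coeff_psi {C : Type*} [CommRing C] {n : ℕ} (lam : C →+ C) (q : ℕ) (f : Fin n →₀ ℕ) (g : PS C n) (γ) :
    MvPowerSeries.coeff γ (psi lam q f g) = lam (MvPowerSeries.coeff (f + q • γ) g) := rfl

theorem coeff_qpow {C : Type*} [CommRing C] {n : ℕ} (p e : ℕ) [Fact p.Prime] [CharP C p] (h : PS C n) (γ : Fin n →₀ ℕ) :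
    MvPowerSeries.coeff (p ^ e • γ) (h ^ p ^ e) = (MvPowerSeries.coeff γ h) ^ p ^ e := by
  rw [← MvPowerSeries.map_iterateFrobenius_expand p (Fact.out : p.Prime).ne_zero, MvPowerSeries.coeff_map,
    MvPowerSeries.coeff_expand_smul]
  rfl

theorem coeff_qpow_zero {C : Type*} [CommRing C] {n : ℕ} (p e : ℕ) [Fact p.Prime] [CharP C p] (h : PS C n) (γ : Fin n →₀ ℕ)
    (i : Fin n) (hi : ¬ p ^ e ∣ γ i) : MvPowerSeries.coeff γ (h ^ p ^ e) = 0 := by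
  rw [← MvPowerSeries.map_iterateFrobenius_expand p (Fact.out : p.Prime).ne_zero, MvPowerSeries.coeff_map,
    MvPowerSeries.coeff_expand_of_not_dvd _ _ _ hi, map_zero]

theorem psi_QL {C : Type*} [CommRing C] {n : ℕ} (p e : ℕ) [Fact p.Prime] [CharP C p] (lam : C →+ C) (hlam : QL (p ^ e) lam)
    (f : Fin n →₀ ℕ) (hf : ∀ i, f i < p ^ e) : QL (p ^ e) (psi lam (p ^ e) f) := by
  classical
  have hq0 : p ^ e ≠ 0 := pow_ne_zero _ (Fact.out : p.Prime).ne_zero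
  have hq1 : 0 < p ^ e := Nat.pos_of_ne_zero hq0
  intro h g
  ext γ
  rw [coeff_psi, MvPowerSeries.coeff_mul, MvPowerSeries.coeff_mul, map_sum]
  symm
  refine Finset.sum_of_injOn (fun x => (p ^ e • x.1, f + p ^ e • x.2)) ?_ ?_ ?_ ?_
  · rintro ⟨a, b⟩ _ ⟨a', b'⟩ _ hab
    simp only [Prod.mk.injEq] at hab
    have h1 : a = a' := by
      ext i
      have := DFunLike.congr_fun hab.1 i
      simp only [Finsupp.smul_apply, smul_eq_mul] at this
      exact Nat.eq_of_mul_eq_mul_left hq1 this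
    have h2 : b = b' := by
      ext i
      have := DFunLike.congr_fun hab.2 i
      simp only [Finsupp.add_apply, Finsupp.smul_apply, smul_eq_mul] at this
      exact Nat.eq_of_mul_eq_mul_left hq1 (by omega)
    rw [h1, h2]
  · rintro ⟨a, b⟩ hab
    have hab' : a + b = γ := Finset.HasAntidiagonal.mem_antidiagonal.1 (Finset.mem_coe.1 hab)
    rw [Finset.mem_coe, Finset.HasAntidiagonal.mem_antidiagonal]
    simp only
    rw [← hab', smul_add]; abel
  · rintro ⟨a, b⟩ hab hne
    rw [Finset.HasAntidiagonal.mem_antidiagonal] at hab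
    simp only at hab
    by_cases hd : ∀ i, p ^ e ∣ a i
    · exfalso
      apply hne
      have hb : ∀ i, a i + b i = f i + p ^ e * γ i := fun i => DFunLike.congr_fun hab i
      have h1 : ∀ i, p ^ e * ediv (p ^ e) a i = a i := fun i => Nat.mul_div_cancel' (hd i)
      have h2 : ∀ i, ediv (p ^ e) a i ≤ γ i := by
        intro i
        by_contra hlt
        push Not at hlt
        have h3 := Nat.mul_le_mul_left (p ^ e) (Nat.succ_le_of_lt hlt)
        rw [h1, Nat.succ_eq_add_one, mul_add, mul_one] at h3
        have := hb i; have := hf i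
        omega
      refine ⟨(ediv (p ^ e) a, γ - ediv (p ^ e) a), ?_, ?_⟩
      · rw [Finset.mem_coe, Finset.HasAntidiagonal.mem_antidiagonal]
        ext i; simp only [Finsupp.add_apply, Finsupp.coe_tsub, Pi.sub_apply]
        have := h2 i; omega
      · ext i
        · simp only [Finsupp.smul_apply, smul_eq_mul]; exact h1 i
        · simp only [Finsupp.smul_apply, smul_eq_mul, Finsupp.add_apply, Finsupp.coe_tsub, Pi.sub_apply]
          have h5 := h2 i
          have h6 := hb i
          have h7 := h1 i
          rw [Nat.mul_sub]
          have h8 := Nat.mul_le_mul_left (p ^ e) h5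
          omega
    · push Not at hd
      obtain ⟨i, hi⟩ := hd
      simp only
      rw [coeff_qpow_zero p e h a i hi, zero_mul, map_zero]
  · rintro ⟨a, b⟩ hab
    simp only
    rw [coeff_psi, coeff_qpow, hlam]

theorem psi_sep {C : Type*} [CommRing C] {n : ℕ} (q : ℕ) (g : PS C n) (e : Fin n →₀ ℕ) (lam : C →+ C)
    (h : lam (MvPowerSeries.coeff e g) ≠ 0) : psi lam q (emod q e) g ≠ 0 := by
  intro h0
  apply h
  have := congrArg (MvPowerSeries.coeff (ediv q e)) h0
  rw [coeff_psi, map_zero] at this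
  rwa [emod_add_ediv] at this

theorem charP_of_prime {k : Type*} [CommRing k] [Nontrivial k] (p : ℕ) (hp : p.Prime) (h : (p : k) = 0) : CharP k p := by
  obtain ⟨q, hq⟩ := CharP.exists k
  have h1 := (CharP.cast_eq_zero_iff k q p).1 h
  rcases (Nat.dvd_prime hp).1 h1 with h2 | h2
  · exact absurd h2 (CharP.char_ne_one k q)
  · exact h2 ▸ hq

theorem ps_isDomain {k : Type*} [CommRing k] [IsDomain k] (n : ℕ) : IsDomain (PS k n) := NoZeroDivisors.to_isDomain _

/-- (ZC) for a separable coefficient extension -/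
theorem zc_ps {k l : Type*} [CommRing k] [CommRing l] (hk : IsField k) (hl : IsField l) (f : k →+* l) (p e : ℕ) (hp : p.Prime)
    (hpk : (p : k) = 0)
    (hsep : ∀ (m : ℕ) (c : Fin m → k), (∀ d : Fin m → k, ∑ i, c i * d i ^ p ^ e = 0 → ∀ i, d i = 0) →
      ∀ y : Fin m → l, ∑ i, f (c i) * y i ^ p ^ e = 0 → ∀ i, y i = 0)
    (n : ℕ) [Algebra (PS k n) (PS l n)] (halg : algebraMap (PS k n) (PS l n) = MvPowerSeries.map f) :
    ZC (p ^ e) (PS k n) (PS l n) := by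
  have : IsDomain k := hk.isDomain
  have : IsDomain (PS k n) := ps_isDomain n
  letI := hk.toField
  letI := hl.toField
  have : Fact p.Prime := ⟨hp⟩
  have : CharP k p := charP_of_prime p hp hpk
  have : CharP l p := charP_of_injective_ringHom f.injective p
  refine zc_of_extend (p ^ e) fun g hg => ?_
  obtain ⟨d, hd⟩ : ∃ d, MvPowerSeries.coeff d g ≠ 0 := by
    by_contra hcon
    push Not at hcon
    exact hg (MvPowerSeries.ext hcon)
  obtain ⟨lam, lam', h1, h2, h3, h4⟩ := exists_lam f p e hsep _ hd
  have hlt : ∀ i, emod (p ^ e) d i < p ^ e := fun i => by rw [emod_apply]; exact Nat.mod_lt _ (pow_pos hp.pos e)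
  refine ⟨psi lam _ (emod (p ^ e) d), psi lam' _ (emod (p ^ e) d), psi_QL p e lam h1 _ hlt, psi_QL p e lam' h2 _ hlt, fun x => ?_,
    psi_sep _ _ _ _ h4⟩
  ext γ
  rw [halg, coeff_psi, MvPowerSeries.coeff_map, MvPowerSeries.coeff_map, coeff_psi, h3]

theorem ql_sep {k : Type*} [CommRing k] (hk : IsField k) (p e : ℕ) (hp : p.Prime)
    (hpk : (p : k) = 0) (n : ℕ) (g : PS k n) (hg : g ≠ 0) : ∃ ψ : PS k n →+ PS k n, QL (p ^ e) ψ ∧ ψ g ≠ 0 := by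
  letI := hk.toField
  have : Fact p.Prime := ⟨hp⟩
  have : CharP k p := charP_of_prime p hp hpk
  obtain ⟨d, hd⟩ : ∃ d, MvPowerSeries.coeff d g ≠ 0 := by
    by_contra hcon
    push Not at hcon
    exact hg (MvPowerSeries.ext hcon)
  obtain ⟨lam, lam', h1, h2, h3, h4⟩ := exists_lam (RingHom.id k) p e (fun m c hc y hy => hc y hy) _ hd
  have hlt : ∀ i, emod (p ^ e) d i < p ^ e := fun i => by rw [emod_apply]; exact Nat.mod_lt _ (pow_pos hp.pos e)
  exact ⟨psi lam _ (emod (p ^ e) d), psi_QL p e lam h1 _ hlt, psi_sep _ _ _ _ h4⟩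

theorem zc_self {k : Type*} [CommRing k] (hk : IsField k) (p e : ℕ) (hp : p.Prime)
    (hpk : (p : k) = 0) (n : ℕ) : ZC (p ^ e) (PS k n) (PS k n) := by
  have : IsDomain k := hk.isDomain
  have : IsDomain (PS k n) := ps_isDomain n
  refine zc_of_extend (p ^ e) fun g hg => ?_
  obtain ⟨ψ, h1, h2⟩ := ql_sep hk p e hp hpk n g hg
  exact ⟨ψ, ψ, h1, h1, fun x => rfl, h2⟩
end GN

namespace GN

theorem finite_closure_pins {R K M : Type*} [CommRing R] [IsDomain R] [IsNoetherianRing R] [IsIntegrallyClosed R]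
    [Field K] [Algebra R K] [IsFractionRing R K] [Field M] [Algebra K M] [Algebra R M] [IsScalarTower R K M]
    [FiniteDimensional K M] (p e : ℕ) [Fact p.Prime] [CharP K p]
    (hM : ∀ x : M, ∃ y : K, algebraMap K M y = x ^ p ^ e) (hZ : ZC (p ^ e) R R) :
    Module.Finite R (integralClosure R M) := by
  classical
  have hCM : CharP M p := charP_of_injective_algebraMap (algebraMap K M).injective p
  obtain ⟨q, hqe⟩ : ∃ q, q = p ^ e := ⟨_, rfl⟩
  have hq : 0 < q := hqe ▸ pow_pos (Fact.out : p.Prime).pos e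
  have hsum : ∀ (n : ℕ) (z : Fin n → M), (∑ j, z j) ^ q = ∑ j, z j ^ q := fun n z => by
    rw [hqe]; exact sum_pow_char_pow p e _ _
  rw [← hqe] at hM hZ
  have hinjK : Function.Injective (algebraMap R K) := IsFractionRing.injective R K
  have hinj : Function.Injective (algebraMap R M) := by
    rw [IsScalarTower.algebraMap_eq R K M]
    exact (algebraMap K M).injective.comp hinjK
  let n := Module.finrank K M
  let b0 := Module.finBasis K M
  -- scale
  choose y hy using fun j => hM (b0 j)
  obtain ⟨a, ha⟩ := IsLocalization.exist_integer_multiples (nonZeroDivisors R) Finset.univ y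
  have ha0 : (a : R) ≠ 0 := nonZeroDivisors.coe_ne_zero a
  choose v hv using fun j => ha j (Finset.mem_univ j)
  let w : Fin n → M := fun j => algebraMap R M a * b0 j
  let u : Fin n → R := fun j => (a : R) ^ (q - 1) * v j
  have hwu : ∀ j, w j ^ q = algebraMap R M (u j) := by
    intro j
    have h1 := congrArg (algebraMap K M) (hv j)
    rw [← IsScalarTower.algebraMap_apply, Algebra.smul_def, map_mul, ← IsScalarTower.algebraMap_apply, hy] at h1
    simp only [w, u, mul_pow, map_mul, h1, map_pow]
    rw [← mul_assoc, ← pow_succ, Nat.sub_add_cancel hq]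
  have haM : algebraMap R M a ≠ 0 := by
    rw [Ne, map_eq_zero_iff _ hinj]; exact ha0
  have hu : ∀ d : Fin n → R, ∑ j, u j * d j ^ q = 0 → ∀ j, d j = 0 := by
    intro d hd
    have h1 : ∑ j, algebraMap R M (d j) * w j = 0 := by
      have h2 : (∑ j, algebraMap R M (d j) * w j) ^ q = 0 := by
        rw [hsum, ← map_zero (algebraMap R M), ← hd, map_sum]
        refine Finset.sum_congr rfl fun j _ => ?_
        rw [mul_pow, hwu, mul_comm, ← map_pow, ← map_mul]
      exact pow_eq_zero_iff hq.ne' |>.1 h2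
    have h2 := Fintype.linearIndependent_iff.1 b0.linearIndependent (fun j => algebraMap R K (d j * a)) (by
      rw [← h1]
      refine Finset.sum_congr rfl fun j _ => ?_
      rw [Algebra.smul_def, ← IsScalarTower.algebraMap_apply, map_mul, mul_assoc])
    intro j
    have h3 := h2 j
    rw [map_eq_zero_iff _ hinjK] at h3
    exact (mul_eq_zero.1 h3).resolve_right ha0
  obtain ⟨c, hc0, hc⟩ := hZ n u hu
  have hcM : algebraMap R M c ≠ 0 := by
    rw [Ne, map_eq_zero_iff _ hinj]; exact hc0
  let N : Submodule R M := Submodule.span R (Set.range w)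
  have key : ∀ x ∈ integralClosure R M, algebraMap R M c * x ∈ N := by
    intro x hx
    obtain ⟨y', hy'⟩ := hM x
    obtain ⟨z, hz⟩ : ∃ z, algebraMap R K z = y' := by
      refine IsIntegrallyClosed.isIntegral_iff.1 ?_
      rw [← isIntegral_algebraMap_iff (algebraMap K M).injective, hy']
      exact IsIntegral.pow hx q
    have hxz : x ^ q = algebraMap R M z := by
      rw [← hy', ← hz, ← IsScalarTower.algebraMap_apply]
    obtain ⟨s, hs⟩ := IsLocalization.exist_integer_multiples (nonZeroDivisors R) Finset.univ (fun j => b0.repr x j)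
    choose o ho using fun j => hs j (Finset.mem_univ j)
    have hs0 : (s : R) ≠ 0 := nonZeroDivisors.coe_ne_zero s
    have hx1 : algebraMap R M (s * a) * x = ∑ j, algebraMap R M (o j) * w j := by
      conv_lhs => rw [← b0.sum_repr x]
      rw [Finset.mul_sum]
      refine Finset.sum_congr rfl fun j _ => ?_
      have h1 := congrArg (algebraMap K M) (ho j)
      rw [← IsScalarTower.algebraMap_apply, Algebra.smul_def, map_mul, ← IsScalarTower.algebraMap_apply] at h1
      rw [h1, Algebra.smul_def, map_mul]
      simp only [w]
      ring
    have hsa : algebraMap R M (s * a) ≠ 0 := by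
      rw [Ne, map_eq_zero_iff _ hinj]; exact mul_ne_zero hs0 ha0
    have hdiv := hc (s * a) z o (hinj (by
      simp only [Algebra.algebraMap_self, RingHom.id_apply]
      rw [map_mul, map_pow, ← hxz, ← mul_pow, hx1, hsum, map_sum]
      refine Finset.sum_congr rfl fun j _ => ?_
      rw [mul_pow, hwu, mul_comm, ← map_pow, ← map_mul]))
    simp only [Algebra.algebraMap_self, RingHom.id_apply] at hdiv
    choose g hg using hdiv
    have : algebraMap R M c * x = ∑ j, g j • w j := by
      apply mul_left_cancel₀ hsa
      rw [mul_left_comm, hx1, Finset.mul_sum, Finset.mul_sum]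
      refine Finset.sum_congr rfl fun j _ => ?_
      rw [← mul_assoc, ← map_mul, hg, Algebra.smul_def, map_mul, mul_assoc]
    rw [this]
    exact sum_mem fun j _ => Submodule.smul_mem _ _ (Submodule.subset_span ⟨j, rfl⟩)
  let f : integralClosure R M →ₗ[R] N :=
    { toFun := fun x => ⟨algebraMap R M c * x, key x x.2⟩
      map_add' := fun x y => by ext; simp [mul_add]
      map_smul' := fun r x => by ext; simp }
  have hf : Function.Injective f := by
    intro x y hxy
    have := congrArg Subtype.val hxy
    exact Subtype.ext (mul_left_cancel₀ hcM this)
  have : IsNoetherian R N := isNoetherian_of_fg_of_noetherian _ (Submodule.fg_span (Set.finite_range w))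
  have : Module.Finite R N := Module.Finite.of_fg (Submodule.fg_span (Set.finite_range w))
  exact Module.Finite.of_injective f hf

theorem finite_closure {R : Type*} {K : Type u} {L : Type v} [CommRing R] [IsDomain R] [IsNoetherianRing R] [IsIntegrallyClosed R]
    [Field K] [Algebra R K] [IsFractionRing R K] [Field L] [Algebra K L] [Algebra R L] [IsScalarTower R K L]
    [FiniteDimensional K L] (hZ : ∀ p : ℕ, p.Prime → (p : R) = 0 → ∀ e, ZC (p ^ e) R R) :
    Module.Finite R (integralClosure R L) := by
  classical
  have hinjK : Function.Injective (algebraMap R K) := IsFractionRing.injective R K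
  obtain ⟨p, hp⟩ := CharP.exists K
  rcases CharP.char_is_prime_or_zero K p with hpp | rfl
  · have : Fact p.Prime := ⟨hpp⟩
    have hpR : (p : R) = 0 := hinjK (by simp)
    obtain ⟨M, E, _, _, _, _, _, _, t1, t2, f1, f2, hsep, e, he⟩ := exists_pins_sep K L p
    letI : Algebra R M := ((algebraMap K M).comp (algebraMap R K)).toAlgebra
    letI : Algebra R E := ((algebraMap K E).comp (algebraMap R K)).toAlgebra
    have : IsScalarTower R K M := IsScalarTower.of_algebraMap_eq fun x => rfl
    have : IsScalarTower R K E := IsScalarTower.of_algebraMap_eq fun x => rfl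
    have : IsScalarTower R M E := IsScalarTower.of_algebraMap_eq fun x => IsScalarTower.algebraMap_apply K M E _
    have : IsScalarTower R L E := IsScalarTower.of_algebraMap_eq fun x => by
      rw [IsScalarTower.algebraMap_apply R K E, IsScalarTower.algebraMap_apply R K L, IsScalarTower.algebraMap_apply K L E]
    have hfin : Module.Finite R (integralClosure R M) := finite_closure_pins (K := K) p e he (hZ p hpp hpR e)
    have : IsFractionRing (integralClosure R M) M := integralClosure.isFractionRing_of_finite_extension K M
    have : IsNoetherianRing (integralClosure R M) := IsNoetherianRing.of_finite R _
    have : IsIntegrallyClosed (integralClosure R M) := integralClosure.isIntegrallyClosedOfFiniteExtension K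
    have h2 : Module.Finite (integralClosure R M) (integralClosure (integralClosure R M) E) :=
      IsIntegralClosure.finite (integralClosure R M) M E _
    have h3 : Module.Finite R (integralClosure (integralClosure R M) E) := Module.Finite.trans (integralClosure R M) _
    let f : integralClosure R L →ₗ[R] (integralClosure (integralClosure R M) E) :=
      { toFun := fun x => ⟨algebraMap L E x, (IsIntegral.algebraMap x.2).tower_top⟩
        map_add' := fun x y => by ext; simp
        map_smul' := fun r x => by ext; simp [Algebra.smul_def, ← IsScalarTower.algebraMap_apply] }
    have hf : Function.Injective f := by
      intro x y hxy
      have := congrArg Subtype.val hxy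
      exact Subtype.ext ((algebraMap L E).injective this)
    exact Module.Finite.of_injective f hf
  · have : CharZero K := CharP.charP_to_charZero K
    exact IsIntegralClosure.finite R K L _
end GN

namespace GN

/-- `L` is a finite extension of the residue field of `A` at the kernel of `A → L`. -/
def FF (A L : Type*) [CommRing A] [Field L] [Algebra A L] : Prop :=
  ∃ s : Finset L, ∀ x : L, ∃ a : A, algebraMap A L a ≠ 0 ∧ a • x ∈ Submodule.span A (s : Set L)

theorem FF.of_tower {A A₁ L : Type*} [CommRing A] [CommRing A₁] [Field L] [Algebra A L] [Algebra A A₁] [Algebra A₁ L]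
    [IsScalarTower A A₁ L] (h : FF A L) : FF A₁ L := by
  obtain ⟨s, hs⟩ := h
  refine ⟨s, fun x => ?_⟩
  obtain ⟨a, ha, hx⟩ := hs x
  refine ⟨algebraMap A A₁ a, by rwa [← IsScalarTower.algebraMap_apply], ?_⟩
  rw [algebraMap_smul]
  exact Submodule.span_subset_span A A₁ _ hx

theorem exists_mul_integral {A A₁ L : Type*} [CommRing A] [CommRing A₁] [Field L] [Algebra A L] [Algebra A A₁] [Algebra A₁ L]
    [IsScalarTower A A₁ L] [Algebra.IsIntegral A A₁] (x : A₁) (hx : algebraMap A₁ L x ≠ 0) :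
    ∃ (b : A₁) (a : A), algebraMap A L a ≠ 0 ∧ algebraMap A L a = algebraMap A₁ L (x * b) := by
  let P : Ideal A₁ := RingHom.ker (algebraMap A₁ L)
  have hP : P.IsPrime := RingHom.ker_isPrime _
  have hlt : P < Ideal.span {x} ⊔ P := by
    refine lt_of_le_of_ne le_sup_right fun h => hx ?_
    have : x ∈ P := by rw [h]; exact Ideal.mem_sup_left (Ideal.mem_span_singleton_self x)
    exact this
  have := Ideal.IsIntegral.comap_lt_comap (R := A) hlt
  obtain ⟨a, h1, h2⟩ := SetLike.exists_of_lt this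
  rw [Ideal.mem_comap] at h1 h2
  obtain ⟨y, hy, z, hz, hyz⟩ := Submodule.mem_sup.1 h1
  obtain ⟨b, rfl⟩ := Ideal.mem_span_singleton.1 hy
  refine ⟨b, a, ?_, ?_⟩
  · rw [IsScalarTower.algebraMap_apply A A₁ L]; exact h2
  · have hz' : algebraMap A₁ L z = 0 := hz
    rw [IsScalarTower.algebraMap_apply A A₁ L, ← hyz, map_add, hz', add_zero]

theorem FF.of_finite {A A₁ L : Type*} [CommRing A] [CommRing A₁] [Field L] [Algebra A L] [Algebra A A₁] [Algebra A₁ L]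
    [IsScalarTower A A₁ L] [Module.Finite A A₁] (h : FF A₁ L) : FF A L := by
  classical
  obtain ⟨s, hs⟩ := h
  obtain ⟨t, ht⟩ := (Module.Finite.fg_top (R := A) (M := A₁))
  refine ⟨(s ×ˢ t).image (fun z => z.2 • z.1), fun x => ?_⟩
  obtain ⟨a₁, ha₁, hx⟩ := hs x
  obtain ⟨b, a, ha, hab⟩ := exists_mul_integral (A := A) a₁ ha₁
  refine ⟨a, ha, ?_⟩
  have h1 : a • x = b • (a₁ • x) := by
    rw [Algebra.smul_def, Algebra.smul_def, Algebra.smul_def, hab, map_mul]; ring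
  rw [h1]
  have h2 : ∀ y ∈ Submodule.span A₁ (s : Set L), y ∈ Submodule.span A (((s ×ˢ t).image (fun z => z.2 • z.1) : Finset L) : Set L) := by
    intro y hy
    refine Submodule.span_induction (p := fun y _ => ∀ c : A₁, c • y ∈ Submodule.span A (((s ×ˢ t).image (fun z => z.2 • z.1) : Finset L) : Set L)) ?_ ?_ ?_ ?_ hy 1 |> fun h => by simpa using h
    · intro y hy c
      have hc : c ∈ Submodule.span A (t : Set A₁) := by rw [ht]; trivial
      refine Submodule.span_induction (p := fun c _ => c • y ∈ Submodule.span A (((s ×ˢ t).image (fun z => z.2 • z.1) : Finset L) : Set L)) ?_ ?_ ?_ ?_ hc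
      · intro c hc
        refine Submodule.subset_span ?_
        rw [Finset.coe_image]
        exact ⟨(y, c), by simpa using ⟨hy, hc⟩, rfl⟩
      · simp
      · intro c c' _ _ h h'; rw [add_smul]; exact add_mem h h'
      · intro r c _ h; rw [smul_assoc]; exact Submodule.smul_mem _ _ h
    · simp
    · intro y z _ _ h h' c; rw [smul_add]; exact add_mem (h c) (h' c)
    · intro r y _ h c; rw [smul_smul]; exact h _
  exact h2 _ (Submodule.smul_mem _ _ hx)

theorem FF.finiteDimensional {A K L : Type*} [CommRing A] [Field K] [Field L] [Algebra A L] [Algebra A K] [Algebra K L]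
    [IsScalarTower A K L] (h : FF A L) : FiniteDimensional K L := by
  obtain ⟨s, hs⟩ := h
  refine ⟨⟨s, eq_top_iff.2 fun x _ => ?_⟩⟩
  obtain ⟨a, ha, hx⟩ := hs x
  have h1 := Submodule.span_subset_span A K _ hx
  have ha' : algebraMap A K a ≠ 0 := by
    intro h; apply ha; rw [IsScalarTower.algebraMap_apply A K L, h, map_zero]
  have : x = (algebraMap A K a)⁻¹ • (a • x) := by
    rw [← algebraMap_smul K a x, inv_smul_smul₀ ha']
  rw [this]; exact Submodule.smul_mem _ _ h1

theorem FF.of_localization {A A₁ L : Type*} [CommRing A] [CommRing A₁] [Field L] [Algebra A L] [Algebra A A₁] [Algebra A₁ L]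
    [IsScalarTower A A₁ L] (h : FF A₁ L) (hd : ∀ x : A₁, ∃ (a b : A), algebraMap A L a ≠ 0 ∧ algebraMap A A₁ a * x = algebraMap A A₁ b) :
    FF A L := by
  classical
  obtain ⟨s, hs⟩ := h
  refine ⟨s, fun x => ?_⟩
  have h2 : ∀ y ∈ Submodule.span A₁ (s : Set L), ∃ a : A, algebraMap A L a ≠ 0 ∧ a • y ∈ Submodule.span A (s : Set L) := by
    intro y hy
    refine Submodule.span_induction (p := fun y _ => ∃ a : A, algebraMap A L a ≠ 0 ∧ a • y ∈ Submodule.span A (s : Set L)) ?_ ?_ ?_ ?_ hy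
    · intro y hy
      exact ⟨1, by simp, by simpa using Submodule.subset_span hy⟩
    · exact ⟨1, by simp, by simp⟩
    · rintro y z _ _ ⟨a, ha, h⟩ ⟨a', ha', h'⟩
      refine ⟨a * a', by rw [map_mul]; exact mul_ne_zero ha ha', ?_⟩
      rw [smul_add]
      refine add_mem ?_ ?_
      · rw [mul_comm, mul_smul]; exact Submodule.smul_mem _ _ h
      · rw [mul_smul]; exact Submodule.smul_mem _ _ h'
    · rintro r y _ ⟨a, ha, h⟩
      obtain ⟨c, b, hc, hcb⟩ := hd r
      refine ⟨c * a, by rw [map_mul]; exact mul_ne_zero hc ha, ?_⟩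
      have : (c * a) • r • y = b • (a • y) := by
        rw [Algebra.smul_def r, Algebra.smul_def, Algebra.smul_def, Algebra.smul_def, IsScalarTower.algebraMap_apply A A₁ L b, ← hcb]
        simp only [map_mul, ← IsScalarTower.algebraMap_apply]; ring
      rw [this]; exact Submodule.smul_mem _ _ h
  obtain ⟨a₁, ha₁, hx⟩ := hs x
  obtain ⟨a, ha, h3⟩ := h2 _ hx
  obtain ⟨c, b, hc, hcb⟩ := hd a₁
  refine ⟨a * b, ?_, ?_⟩
  · rw [map_mul, IsScalarTower.algebraMap_apply A A₁ L b, ← hcb, map_mul, ← IsScalarTower.algebraMap_apply A A₁ L]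
    exact mul_ne_zero ha (mul_ne_zero hc ha₁)
  · have : (a * b) • x = c • (a • (a₁ • x)) := by
        rw [Algebra.smul_def, Algebra.smul_def, Algebra.smul_def, Algebra.smul_def, map_mul, IsScalarTower.algebraMap_apply A A₁ L b, ← hcb]
        simp only [map_mul, ← IsScalarTower.algebraMap_apply]; ring
    rw [this]; exact Submodule.smul_mem _ _ h3

theorem FF.of_field {K L : Type*} [Field K] [Field L] [Algebra K L] [FiniteDimensional K L] : FF K L := by
  obtain ⟨s, hs⟩ := Module.Finite.fg_top (R := K) (M := L)
  exact ⟨s, fun x => ⟨1, by simp, by rw [hs]; trivial⟩⟩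

theorem Coef.isField {T : Type*} [CommRing T] [IsLocalRing T] [IsAdicComplete (maximalIdeal T) T]
    {C : Subring T} {p : ℕ} (h : Coef C p) (p' : ℕ) (hp' : p'.Prime) (h0 : (p' : T) = 0) : IsField C := by
  haveI := h.isLocalRing
  have hpT : (p : T) = 0 := by
    by_cases hd : p' ∣ p
    · obtain ⟨k, rfl⟩ := hd; rw [Nat.cast_mul, h0, zero_mul]
    · exfalso
      have hc : IsCoprime (p' : ℤ) (p : ℤ) := Nat.isCoprime_iff_coprime.2 ((Nat.Prime.coprime_iff_not_dvd hp').2 hd)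
      have hc' := hc.map (Int.castRingHom T)
      simp only [map_natCast, h0, isCoprime_zero_left] at hc'
      exact h.pm hc'
  have hpC : (p : C) = 0 := Subtype.ext (by simpa using hpT)
  rw [IsLocalRing.isField_iff_maximalIdeal_eq, h.max_eq, hpC]
  simp

/-- complete local domains are Japanese -/
theorem japanese {D : Type u} {L : Type v} [CommRing D] [IsLocalRing D] [IsDomain D]
    [IsNoetherianRing D] [IsAdicComplete (maximalIdeal D) D] [Field L] [Algebra D L]
    (hinj : Function.Injective (algebraMap D L)) (hL : FF D L) : Module.Finite D (integralClosure D L) := by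
  classical
  obtain ⟨p, C, hC⟩ := exists_coef (D := D) fun p => by
    by_cases h : (p : D) = 0
    · exact Or.inl h
    · exact Or.inr (mem_nonZeroDivisors_of_ne_zero h)
  obtain ⟨n, F, S, c, h1, h2, h3, h4, h5, h6⟩ := hC.normalization (⊥ : Ideal D)
  haveI := hC.isLocalRing
  haveI := hC.noeth
  haveI := hC.isDomain
  obtain ⟨hd, hi⟩ := ndom_PS (n := n) hC.ndom
  letI : Algebra (PS C n) D := F.toAlgebra
  letI : Algebra (PS C n) L := ((algebraMap D L).comp F).toAlgebra
  have : IsScalarTower (PS C n) D L := IsScalarTower.of_algebraMap_eq fun x => rfl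
  have hfin : Module.Finite (PS C n) D := h3
  have hinj' : Function.Injective (algebraMap (PS C n) L) := hinj.comp h4
  have : FaithfulSMul (PS C n) L := (faithfulSMul_iff_algebraMap_injective _ _).2 hinj'
  have hL' : FF (PS C n) L := FF.of_finite (A₁ := D) hL
  letI := FractionRing.liftAlgebra (PS C n) L
  have : FiniteDimensional (FractionRing (PS C n)) L := FF.finiteDimensional hL'
  have key : Module.Finite (PS C n) (integralClosure (PS C n) L) := by
    refine finite_closure (K := FractionRing (PS C n)) fun p' hp' h0 e => ?_
    have h0' : (p' : D) = 0 := by rw [← map_natCast F, h0, map_zero]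
    have hF := hC.isField p' hp' h0'
    refine zc_self hF p' e hp' ?_ n
    exact Subtype.ext (by simpa using h0')
  obtain ⟨s, hs⟩ := (Module.Finite.iff_fg (N := Subalgebra.toSubmodule (integralClosure (PS C n) L))).1 key
  refine (Module.Finite.iff_fg (N := Subalgebra.toSubmodule (integralClosure D L))).2 ⟨s, le_antisymm ?_ ?_⟩
  · rw [Submodule.span_le]
    intro x hx
    have : x ∈ integralClosure (PS C n) L := by
      have : x ∈ Subalgebra.toSubmodule (integralClosure (PS C n) L) := hs ▸ Submodule.subset_span hx
      exact this
    exact IsIntegral.tower_top (A := D) this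
  · intro x hx
    have hx' : IsIntegral D x := hx
    have : x ∈ Subalgebra.toSubmodule (integralClosure (PS C n) L) := isIntegral_trans (R := PS C n) x hx'
    rw [← hs] at this
    exact Submodule.span_subset_span (PS C n) D _ this
end GN

namespace GN

theorem adic_of_pow' {T : Type*} [CommRing T] (I J : Ideal T) [IsAdicComplete J T] (hJI : J ≤ I) (N : ℕ)
    (hIJ : I ^ N ≤ J) : IsAdicComplete I T := by
  have hc := (adic_iff J).mp inferInstance
  have hIJ' : I ^ (N + 1) ≤ J := (Ideal.pow_le_pow_right (Nat.le_succ N)).trans hIJ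
  rw [adic_iff]
  have hp : ∀ n, I ^ ((N + 1) * n) ≤ J ^ n := fun n => by rw [pow_mul]; exact Ideal.pow_right_mono hIJ' n
  refine ⟨fun x hx => hc.1 x fun n => hp n (hx _), fun f hf => ?_⟩
  have hf' : ∀ m n, n ≤ m → f m - f n ∈ I ^ n := by
    intro m n hmn
    induction m, hmn using Nat.le_induction with
    | base => simp
    | succ k hk ih =>
      have := add_mem (Ideal.pow_le_pow_right hk (hf k)) ih
      simpa using this
  obtain ⟨L, hL⟩ := hc.2 (fun n => f ((N + 1) * n)) (fun n => hp n (hf' _ _ (Nat.mul_le_mul_left _ (Nat.le_succ n))))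
  refine ⟨L, fun n => ?_⟩
  have h1 := Ideal.pow_right_mono hJI n (hL n)
  have h2 := hf' ((N + 1) * n) n (Nat.le_mul_of_pos_left n (Nat.succ_pos N))
  simpa using add_mem h1 h2

theorem iso_of {R D R' E : Type*} [CommRing R] [CommRing D] [CommRing R'] [CommRing E] [Algebra R D] [Algebra R R']
    [Algebra D E] [Algebra R E] [Algebra R' E] [IsScalarTower R D E] [IsScalarTower R R' E] [IsNoetherianRing R']
    [Module.Finite R D] [Module.Flat D E] [IsLocalRing D] [IsLocalRing E] (hm : (maximalIdeal D).map (algebraMap D E) = maximalIdeal E)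
    (hH : IsHausdorff (maximalIdeal E) E) (K : Ideal R) (hK : IsAdicComplete (K.map (algebraMap R R')) R')
    (hKD : K.map (algebraMap R D) ≤ maximalIdeal D) (N : ℕ) (hN : maximalIdeal D ^ N ≤ K.map (algebraMap R D))
    (h1 : ∀ d : D, ∃ r : R, d - algebraMap R D r ∈ maximalIdeal D)
    (h2 : ∀ r : R', algebraMap R' E r ∈ maximalIdeal E → r ∈ K.map (algebraMap R R'))
    (h3 : ∀ x : E, ∃ r : R', x - algebraMap R' E r ∈ maximalIdeal E) :
    Nonempty (D ⊗[R] R' ≃ₐ[D] E) := by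
  classical
  let φ : D ⊗[R] R' →ₐ[D] E := Algebra.TensorProduct.lift (Algebra.ofId D E) (IsScalarTower.toAlgHom R R' E) (fun _ _ => Commute.all _ _)
  have hφ : ∀ d r, φ (d ⊗ₜ r) = algebraMap D E d * algebraMap R' E r := fun d r => rfl
  let I : Ideal (D ⊗[R] R') := (maximalIdeal D).map (algebraMap D (D ⊗[R] R'))
  let J : Ideal (D ⊗[R] R') := (K.map (algebraMap R D)).map (algebraMap D (D ⊗[R] R'))
  have hJI : J ≤ I := Ideal.map_mono hKD
  have hIJ : I ^ N ≤ J := by rw [← Ideal.map_pow]; exact Ideal.map_mono hN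
  have hIφ : I.map (φ : D ⊗[R] R' →+* E) = maximalIdeal E := by
    rw [Ideal.map_map, ← hm]; congr 1; ext d; simp
  letI : Algebra R' (D ⊗[R] R') := Algebra.TensorProduct.rightAlgebra
  have hJ' : J = (K.map (algebraMap R R')).map (algebraMap R' (D ⊗[R] R')) := by
    simp only [J, Ideal.map_map]
    congr 1; ext r
    change (algebraMap R D r) ⊗ₜ (1 : R') = (1 : D) ⊗ₜ (algebraMap R R' r)
    rw [Algebra.algebraMap_eq_smul_one, Algebra.algebraMap_eq_smul_one, TensorProduct.smul_tmul]
  have hfin : Module.Finite R' (D ⊗[R] R') :=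
    Module.Finite.equiv (Algebra.TensorProduct.commRight R R' D).toLinearEquiv
  have hnoeth : IsNoetherianRing (D ⊗[R] R') := IsNoetherianRing.of_finite R' _
  have hJc : IsAdicComplete J (D ⊗[R] R') := by rw [hJ']; exact adic_of_finite _
  have hIc : IsAdicComplete I (D ⊗[R] R') := adic_of_pow' I J hJI N hIJ
  have hsurj : Function.Surjective φ := by
    refine surj_of_complete (φ : D ⊗[R] R' →+* E) I (by rw [hIφ]; exact hH) fun x => ?_
    obtain ⟨r, hr⟩ := h3 x
    refine ⟨1 ⊗ₜ r, ?_⟩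
    rw [hIφ]; simpa [hφ] using hr
  have hred : ∀ x : D ⊗[R] R', ∃ r : R', x - (1 : D) ⊗ₜ r ∈ I := by
    intro x
    induction x with
    | zero => exact ⟨0, by simp⟩
    | add x y hx hy =>
      obtain ⟨r, hr⟩ := hx; obtain ⟨s, hs⟩ := hy
      refine ⟨r + s, ?_⟩
      rw [TensorProduct.tmul_add, add_sub_add_comm]; exact add_mem hr hs
    | tmul d s =>
      obtain ⟨r, hr⟩ := h1 d
      refine ⟨r • s, ?_⟩
      have : d ⊗ₜ[R] s - (1 : D) ⊗ₜ[R] (r • s) = algebraMap D (D ⊗[R] R') (d - algebraMap R D r) * ((1 : D) ⊗ₜ s) := by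
        rw [← TensorProduct.smul_tmul, ← Algebra.algebraMap_eq_smul_one, ← TensorProduct.sub_tmul]
        change _ = (_ ⊗ₜ[R] 1) * _
        rw [Algebra.TensorProduct.tmul_mul_tmul, mul_one, one_mul]; rfl
      rw [this]
      exact Ideal.mul_mem_right _ _ (Ideal.mem_map_of_mem _ hr)
  have hmemI : ∀ x, φ x ∈ maximalIdeal E → x ∈ I := by
    intro x hx
    obtain ⟨r, hr⟩ := hred x
    have h4 : φ (x - (1 : D) ⊗ₜ r) ∈ maximalIdeal E := by rw [← hIφ]; exact Ideal.mem_map_of_mem _ hr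
    rw [map_sub, hφ, map_one, one_mul] at h4
    have h5 := h2 r (by have := sub_mem hx h4; simpa using this)
    have h6 : (1 : D) ⊗ₜ[R] r ∈ J := by rw [hJ']; exact Ideal.mem_map_of_mem (algebraMap R' (D ⊗[R] R')) h5
    have := add_mem hr (hJI h6)
    simpa using this
  have hinj : Function.Injective φ := by
    rw [injective_iff_map_eq_zero]
    have hker : RingHom.ker φ = ⊥ := by
      refine (Submodule.eq_bot_of_le_smul_of_le_jacobson_bot I (RingHom.ker φ) (IsNoetherian.noetherian _) ?_ (IsAdicComplete.le_jacobson_bot I))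
      intro x hx
      have hx0 : φ x = 0 := hx
      have hxI : x ∈ I := hmemI x (by rw [hx0]; exact zero_mem _)
      have hxI' : ∃ (s : Finset (D ⊗[R] R')) (g : D ⊗[R] R' → D), (∀ i, g i ∈ maximalIdeal D) ∧ x = ∑ i : s, g i • (i : D ⊗[R] R') := by
        have hx' : x ∈ (maximalIdeal D) • (Submodule.span D (Set.range (id : D ⊗[R] R' → D ⊗[R] R'))) := by
          rw [Set.range_id, Submodule.span_univ, Ideal.smul_top_eq_map]; exact hxI
        rw [Submodule.mem_ideal_smul_span_iff_exists_sum] at hx'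
        obtain ⟨a, ha, hsum⟩ := hx'
        refine ⟨a.support, a, ha, ?_⟩
        rw [← hsum, Finsupp.sum, ← Finset.sum_coe_sort]; rfl
      obtain ⟨s, g, hg, hxs⟩ := hxI'
      have hrel : ∑ i : s, (g i) • φ (i : D ⊗[R] R') = 0 := by
        rw [← hx0, hxs, map_sum]
        refine Finset.sum_congr rfl fun i _ => ?_
        rw [map_smul]
      obtain ⟨k, a, z, hz1, hz2⟩ := Module.Flat.isTrivialRelation_of_sum_smul_eq_zero (R := D) (M := E) (f := fun i : s => g i) hrel
      choose z' hz' using fun j => hsurj (z j)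
      have hx2 : x = ∑ i : s, g i • ((i : D ⊗[R] R') - ∑ j, a i j • z' j) := by
        have : ∑ i : s, g i • (∑ j, a i j • z' j) = 0 := by
          simp only [Finset.smul_sum, smul_smul]
          rw [Finset.sum_comm]
          refine Finset.sum_eq_zero fun j _ => ?_
          rw [← Finset.sum_smul, hz2, zero_smul]
        simp only [smul_sub, Finset.sum_sub_distrib, this, sub_zero]
        exact hxs
      rw [hx2]
      refine sum_mem fun i _ => ?_
      rw [← algebraMap_smul (D ⊗[R] R') (g i)]
      refine Submodule.smul_mem_smul (Ideal.mem_map_of_mem _ (hg i)) ?_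
      change φ _ = 0
      rw [map_sub, show φ (i : D ⊗[R] R') = _ from hz1 i, map_sum, sub_eq_zero]
      refine Finset.sum_congr rfl fun j _ => ?_
      rw [map_smul, hz']
    intro x hx
    have : x ∈ RingHom.ker φ := hx
    rw [hker] at this; exact this
  exact ⟨AlgEquiv.ofBijective φ ⟨hinj, hsurj⟩⟩

end GN

namespace GN

theorem ps_hom_ext {C T : Type*} [CommRing C] [CommRing T] {n : ℕ} (J : Ideal T) [IsHausdorff J T] (f g : PS C n →+* T)
    (h0 : ∀ c, f (MvPowerSeries.C c) = g (MvPowerSeries.C c)) (hX : ∀ i, f (MvPowerSeries.X i) = g (MvPowerSeries.X i))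
    (hJ : ∀ i, f (MvPowerSeries.X i) ∈ J) : f = g := by
  classical
  have key : ∀ N x, f x - g x ∈ J ^ N := by
    intro N
    induction N with
    | zero => intro x; simp
    | succ N ih =>
      intro x
      obtain ⟨h, -, hh⟩ := ps_split Finset.univ x
      have hx : x = MvPowerSeries.C (MvPowerSeries.coeff 0 x) + ∑ i, MvPowerSeries.X i * h i := by
        ext e
        rw [map_add, hh, MvPowerSeries.coeff_C]
        by_cases he : e = 0
        · subst he; simp
        · have : ¬ ∀ i ∈ Finset.univ, e i = 0 := fun h => he (Finsupp.ext fun i => h i (Finset.mem_univ i))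
          rw [if_neg he, if_neg this, zero_add]
      rw [hx, map_add, map_add, h0, add_sub_add_left_eq_sub, map_sum, map_sum, ← Finset.sum_sub_distrib]
      refine sum_mem fun i _ => ?_
      rw [map_mul, map_mul, ← hX, ← mul_sub, pow_succ']
      exact Ideal.mul_mem_mul (hJ i) (ih _)
  ext x
  exact sub_eq_zero.1 (haus_zero J (fun N => key N x))

theorem sep_coef {D : Type u} {E : Type v} [CommRing D] [CommRing E] [IsLocalRing D] [IsLocalRing E]
    [IsAdicComplete (maximalIdeal D) D]
    [IsAdicComplete (maximalIdeal E) E] [Algebra D E] [IsLocalHom (algebraMap D E)]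
    (hsep : SepExt (ResidueField D) (ResidueField E)) {p : ℕ} {C : Subring D} {C' : Subring E} (hC : Coef C p) (hC' : Coef C' p)
    (f : C →+* C') (hf : ∀ c, (f c : E) = algebraMap D E c) (p' e : ℕ) (hp' : p'.Prime) (h0 : (p' : D) = 0)
    (m : ℕ) (c : Fin m → C) (hc : ∀ d : Fin m → C, ∑ i, c i * d i ^ p' ^ e = 0 → ∀ i, d i = 0)
    (y : Fin m → C') (hy : ∑ i, f (c i) * y i ^ p' ^ e = 0) : ∀ i, y i = 0 := by
  have hF := hC.isField p' hp' h0
  have h0' : (p' : E) = 0 := by rw [← map_natCast (algebraMap D E), h0, map_zero]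
  have hF' := hC'.isField p' hp' h0'
  have : Fact p'.Prime := ⟨hp'⟩
  have : CharP (ResidueField D) p' := charP_of_prime p' hp' (by rw [← map_natCast (residue D), h0, map_zero])
  have hz : ∀ x : C, (x : D) ∈ maximalIdeal D → x = 0 := by
    intro x hx
    by_contra hne
    obtain ⟨b, hb⟩ := hF.mul_inv_cancel hne
    have : (x : D) * b = 1 := by rw [← Subring.coe_mul, hb]; rfl
    have h1 := (maximalIdeal D).mul_mem_right (b : D) hx
    rw [this] at h1
    exact (maximalIdeal.isMaximal D).ne_top ((Ideal.eq_top_iff_one _).2 h1)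
  have hz' : ∀ x : C', (x : E) ∈ maximalIdeal E → x = 0 := by
    intro x hx
    by_contra hne
    obtain ⟨b, hb⟩ := hF'.mul_inv_cancel hne
    have : (x : E) * b = 1 := by rw [← Subring.coe_mul, hb]; rfl
    have h1 := (maximalIdeal E).mul_mem_right (b : E) hx
    rw [this] at h1
    exact (maximalIdeal.isMaximal E).ne_top ((Ideal.eq_top_iff_one _).2 h1)
  have key := sep_q (ResidueField D) (ResidueField E) hsep p' e (fun i => residue D (c i)) ?_ (fun i => residue E (y i)) ?_
  · intro i
    exact hz' _ ((residue_eq_zero_iff _).1 (key i))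
  · intro d hd
    have hl : ∀ i, ∃ x : C, residue D x = d i := by
      intro i
      obtain ⟨t, ht⟩ := residue_surjective (d i)
      obtain ⟨x, hx, hx'⟩ := hC.surj t
      refine ⟨⟨x, hx⟩, ?_⟩
      rw [← ht, eq_comm, ← sub_eq_zero, ← map_sub]
      exact (residue_eq_zero_iff _).2 hx'
    choose x hx using hl
    have h1 : ∑ i, c i * x i ^ p' ^ e = 0 := by
      apply hz
      rw [← residue_eq_zero_iff, AddSubmonoidClass.coe_finsetSum, map_sum, ← hd]
      refine Finset.sum_congr rfl fun i _ => ?_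
      rw [Subring.coe_mul, Subring.coe_pow, map_mul, map_pow, hx]
    intro i
    rw [← hx, hc x h1 i]; simp
  · have := congrArg (fun z : C' => residue E (z : E)) hy
    simp only [AddSubmonoidClass.coe_finsetSum, map_sum, Subring.coe_mul, Subring.coe_pow, map_mul, map_pow, hf] at this
    simpa using this

/-- Formally smooth-like extensions of complete local domains have geometrically normal generic fibre. -/
theorem thmII {D : Type u} {E : Type v} {Λ : Type*} [CommRing D] [CommRing E] [IsLocalRing D] [IsLocalRing E] [IsDomain D]
    [IsNoetherianRing D] [IsNoetherianRing E] [IsAdicComplete (maximalIdeal D) D]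
    [IsAdicComplete (maximalIdeal E) E] [Algebra D E] [IsLocalHom (algebraMap D E)] [Module.Flat D E]
    (hsep : SepExt (ResidueField D) (ResidueField E)) (hm : (maximalIdeal D).map (algebraMap D E) = maximalIdeal E)
    [Field Λ] [Algebra D Λ] (hinj : Function.Injective (algebraMap D Λ)) (hΛ : FF D Λ) : IsNormalRing (Λ ⊗[D] E) := by
  classical
  have hD : ∀ p : ℕ, (p : D) = 0 ∨ (p : D) ∈ nonZeroDivisors D := fun p => by
    by_cases h : (p : D) = 0
    · exact Or.inl h
    · exact Or.inr (mem_nonZeroDivisors_of_ne_zero h)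
  obtain ⟨p, C, C', hC, hC', hCC'⟩ := exists_coef2 hsep hD (fun p => by
    rcases hD p with h | h
    · left; rw [← map_natCast (algebraMap D E), h, map_zero]
    · right; rw [← map_natCast (algebraMap D E)]; exact flat_nzd h)
  obtain ⟨n, F, S, c, hF1, hF2, hF3, hF4, -, -⟩ := hC.normalization (⊥ : Ideal D)
  haveI := hC.isLocalRing
  haveI := hC.noeth
  haveI := hC.isDomain
  haveI := hC'.isLocalRing
  haveI := hC'.noeth
  haveI := hC'.isDomain
  haveI := hC'.complete
  let f : C →+* C' := ((algebraMap D E).comp C.subtype).codRestrict C' (fun c => hCC' c c.2)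
  have hf : ∀ c, (f c : E) = algebraMap D E c := fun c => rfl
  have hfinj : Function.Injective f := by
    have : Module.FaithfullyFlat D E := Module.FaithfullyFlat.of_flat_of_isLocalHom
    intro x y hxy
    have := congrArg Subtype.val hxy
    exact Subtype.ext (FaithfulSMul.algebraMap_injective D E this)
  obtain ⟨hd, -⟩ := ndom_PS (n := n) hC.ndom
  have hR' := ndom_PS (n := n) hC'.ndom
  obtain ⟨F', hF'1, hF'2⟩ := exists_evalPS (maximalIdeal E) C'.subtype (fun i : Fin n => algebraMap D E (F (MvPowerSeries.X i)))
    (fun i => by rw [← hm]; exact Ideal.mem_map_of_mem _ (hF2 i))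
  letI : Algebra (PS C n) (PS C' n) := (MvPowerSeries.map f).toAlgebra
  letI : Algebra (PS C n) D := F.toAlgebra
  letI : Algebra (PS C n) E := ((algebraMap D E).comp F).toAlgebra
  letI : Algebra (PS C' n) E := F'.toAlgebra
  letI : Algebra (PS C n) Λ := ((algebraMap D Λ).comp F).toAlgebra
  have : IsScalarTower (PS C n) D E := IsScalarTower.of_algebraMap_eq fun x => rfl
  have : IsScalarTower (PS C n) D Λ := IsScalarTower.of_algebraMap_eq fun x => rfl
  have hcomm : (algebraMap D E).comp F = F'.comp (MvPowerSeries.map f) := by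
    refine ps_hom_ext (maximalIdeal E) _ _ (fun c => ?_) (fun i => ?_) (fun i => ?_)
    · simp [hF1, hF'1, hf]
    · simp [hF'2]
    · rw [← hm]; exact Ideal.mem_map_of_mem _ (hF2 i)
  have : IsScalarTower (PS C n) (PS C' n) E := IsScalarTower.of_algebraMap_eq fun x => RingHom.congr_fun hcomm x
  have hfin : Module.Finite (PS C n) D := hF3
  let K : Ideal (PS C n) := PI (Ideal.span {(p : C)}) Finset.univ
  have hK' : K.map (algebraMap (PS C n) (PS C' n)) = PI (Ideal.span {(p : C')}) Finset.univ := by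
    simp only [K, PI]
    rw [Ideal.map_sup, Ideal.map_map, Ideal.map_span, Ideal.map_span, Ideal.map_span]
    congr 2
    · simp [RingHom.algebraMap_toAlgebra]
    · rw [← Set.image_comp]
      refine Set.image_congr fun i _ => ?_
      exact MvPowerSeries.map_X f i
  have hKmax : K = maximalIdeal (PS C n) := by rw [ps_max (IsNoetherian.noetherian _), hC.max_eq]
  have hKmax' : PI (Ideal.span {(p : C')}) Finset.univ = maximalIdeal (PS C' n) := by rw [ps_max (IsNoetherian.noetherian _), hC'.max_eq]
  have hKD : K.map (algebraMap (PS C n) D) ≤ maximalIdeal D := by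
    simp only [K, PI]
    rw [Ideal.map_sup, Ideal.map_map, Ideal.map_span, Ideal.map_span]
    refine sup_le ?_ ?_
    · rw [Ideal.span_le, Set.image_singleton, Set.singleton_subset_iff]
      simpa using hC.pm
    · rw [Ideal.span_le]
      rintro _ ⟨_, ⟨i, -, rfl⟩, rfl⟩
      exact hF2 i
  obtain ⟨N, hN⟩ : ∃ N, maximalIdeal D ^ N ≤ K.map (algebraMap (PS C n) D) := by
    refine Ideal.exists_pow_le_of_le_radical_of_fg ?_ (IsNoetherian.noetherian _)
    rw [Ideal.radical_eq_sInf]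
    refine le_sInf ?_
    rintro Q ⟨hQ, hQp⟩
    have : (Q.comap (algebraMap (PS C n) D)).IsMaximal := by
      have h1 : K ≤ Q.comap (algebraMap (PS C n) D) := Ideal.map_le_iff_le_comap.1 hQ
      have h2 : (Q.comap (algebraMap (PS C n) D)) = maximalIdeal (PS C n) := by
        refine le_antisymm (IsLocalRing.le_maximalIdeal (Ideal.IsPrime.ne_top inferInstance)) (hKmax ▸ h1)
      rw [h2]; infer_instance
    have := Ideal.isMaximal_of_isIntegral_of_isMaximal_comap Q this
    exact (IsLocalRing.eq_maximalIdeal this).ge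
  obtain ⟨e⟩ := iso_of (R := PS C n) (D := D) (R' := PS C' n) (E := E) hm inferInstance K (by rw [hK']; exact ps_complete _) hKD N hN
    (fun d => by
      obtain ⟨c, hc, hdc⟩ := hC.surj d
      refine ⟨MvPowerSeries.C ⟨c, hc⟩, ?_⟩
      change d - F _ ∈ _
      rw [hF1]; exact hdc)
    (fun r hr => by
      rw [hK', hKmax']
      by_contra hcon
      have hu : IsUnit r := by simpa using hcon
      exact hr (hu.map F'))
    (fun x => by
      obtain ⟨c, hc, hdc⟩ := hC'.surj x
      refine ⟨MvPowerSeries.C ⟨c, hc⟩, ?_⟩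
      change x - F' _ ∈ _
      rw [hF'1]; exact hdc)
  have hinj' : Function.Injective (algebraMap (PS C n) Λ) := hinj.comp hF4
  have : FaithfulSMul (PS C n) Λ := (faithfulSMul_iff_algebraMap_injective _ _).2 hinj'
  have hΛ' : FF (PS C n) Λ := FF.of_finite (A₁ := D) hΛ
  letI := FractionRing.liftAlgebra (PS C n) Λ
  have : FiniteDimensional (FractionRing (PS C n)) Λ := FF.finiteDimensional hΛ'
  have key : IsNormalRing (Λ ⊗[PS C n] PS C' n) := by
    refine thmX (FractionRing (PS C n)) Λ hR' ?_ fun p' hp' h0 e => ?_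
    · intro x y hxy
      ext γ
      have := congrArg (MvPowerSeries.coeff γ) hxy
      change MvPowerSeries.coeff γ (MvPowerSeries.map f x) = MvPowerSeries.coeff γ (MvPowerSeries.map f y) at this
      rw [MvPowerSeries.coeff_map, MvPowerSeries.coeff_map] at this
      rw [hfinj this]
    · have h0' : (p' : D) = 0 := by rw [← map_natCast F, h0, map_zero]
      have h0'' : (p' : E) = 0 := by rw [← map_natCast (algebraMap D E), h0', map_zero]
      exact zc_ps (hC.isField p' hp' h0') (hC'.isField p' hp' h0'') f p' e hp' (Subtype.ext (by simpa using h0'))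
        (sep_coef hsep hC hC' f hf p' e hp' h0') n rfl
  have e1 : Λ ⊗[D] (D ⊗[PS C n] PS C' n) ≃ₐ[D] Λ ⊗[PS C n] PS C' n := Algebra.TensorProduct.cancelBaseChange (PS C n) D D Λ (PS C' n)
  have e2 : Λ ⊗[D] (D ⊗[PS C n] PS C' n) ≃ₐ[D] Λ ⊗[D] E := Algebra.TensorProduct.congr AlgEquiv.refl e
  exact isNormalRing_of_ringEquiv (e1.symm.trans e2).toRingEquiv key
end GN

namespace GN

theorem local_of_finite {S T : Type*} [CommRing S] [IsLocalRing S] [IsNoetherianRing S] [IsAdicComplete (maximalIdeal S) S]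
    [CommRing T] [IsDomain T] [Algebra S T] [Module.Finite S T] :
    ∃ _ : IsLocalRing T, IsAdicComplete (maximalIdeal T) T ∧ (maximalIdeal S).map (algebraMap S T) ≤ maximalIdeal T := by
  classical
  let I := (maximalIdeal S).map (algebraMap S T)
  have hI : IsAdicComplete I T := adic_of_finite _
  have hjac := IsAdicComplete.le_jacobson_bot I
  have : IsNoetherianRing T := IsNoetherianRing.of_finite S T
  have hmaxI : ∀ M : Ideal T, M.IsMaximal → I ≤ M := by
    intro M hM
    refine hjac.trans ?_
    rw [Ideal.jacobson]
    exact sInf_le ⟨bot_le, hM⟩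
  have hcm : ∀ M : Ideal T, M.IsPrime → I ≤ M → M.IsMaximal := by
    intro M hM hIM
    have h1 : (M.comap (algebraMap S T)) = maximalIdeal S := by
      refine le_antisymm (IsLocalRing.le_maximalIdeal (Ideal.IsPrime.ne_top inferInstance)) (Ideal.map_le_iff_le_comap.1 hIM)
    have : (M.comap (algebraMap S T)).IsMaximal := by rw [h1]; infer_instance
    exact Ideal.isMaximal_of_isIntegral_of_isMaximal_comap M this
  have hart : IsArtinianRing (T ⧸ I) := by
    have : Module.Finite (S ⧸ maximalIdeal S) (T ⧸ I) := by
      have : Module.Finite S (T ⧸ I) := Module.Finite.trans T _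
      exact Module.Finite.of_restrictScalars_finite S _ _
    letI := Ideal.Quotient.field (maximalIdeal S)
    exact IsArtinianRing.of_finite (S ⧸ maximalIdeal S) _
  have huniq : ∀ M₁ M₂ : Ideal T, M₁.IsMaximal → M₂.IsMaximal → M₁ = M₂ := by
    intro M₁ M₂ h1 h2
    by_contra hne
    have hk1 : RingHom.ker (Ideal.Quotient.mk I) ≤ M₁ := by rw [Ideal.mk_ker]; exact hmaxI _ h1
    have hk2 : RingHom.ker (Ideal.Quotient.mk I) ≤ M₂ := by rw [Ideal.mk_ker]; exact hmaxI _ h2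
    have hp1 : (M₁.map (Ideal.Quotient.mk I)).IsPrime := Ideal.map_isPrime_of_surjective Ideal.Quotient.mk_surjective hk1
    have hp2 : (M₂.map (Ideal.Quotient.mk I)).IsPrime := Ideal.map_isPrime_of_surjective Ideal.Quotient.mk_surjective hk2
    obtain ⟨r, hr, hid, hall⟩ := IsArtinianRing.exists_not_mem_forall_mem_of_ne (M₁.map (Ideal.Quotient.mk I))
    have hr2 := hall _ hp2 (fun h => hne (by
      rw [← sup_eq_left.2 (hmaxI _ h1), ← sup_eq_left.2 (hmaxI _ h2)]
      have := congrArg (Ideal.comap (Ideal.Quotient.mk I)) h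
      rw [Ideal.comap_map_of_surjective _ Ideal.Quotient.mk_surjective,
        Ideal.comap_map_of_surjective _ Ideal.Quotient.mk_surjective] at this
      rw [← RingHom.ker_eq_comap_bot, Ideal.mk_ker] at this
      exact this.symm))
    obtain ⟨r, rfl⟩ := Ideal.Quotient.mk_surjective r
    have hrr : r * r - r ∈ I := by
      rw [← Ideal.Quotient.eq, map_mul]; exact hid
    obtain ⟨a, ha, har⟩ := HenselianRing.is_henselian (I := I) (Polynomial.X ^ 2 - Polynomial.X : Polynomial T) (by
      refine Polynomial.monic_X_pow_sub ?_
      rw [Polynomial.degree_X]; norm_num) r (by simpa [pow_two] using hrr) (by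
      simp only [Polynomial.derivative_sub, Polynomial.derivative_X_pow, Polynomial.derivative_X]
      refine IsUnit.of_mul_eq_one (Ideal.Quotient.mk I (2 * r - 1)) ?_
      rw [← map_mul, ← map_one (Ideal.Quotient.mk I), Ideal.Quotient.eq]
      simp
      convert I.mul_mem_left 4 hrr using 1
      ring)
    have : a * (a - 1) = 0 := by
      have : a ^ 2 - a = 0 := by simpa using ha
      linear_combination this
    rcases mul_eq_zero.1 this with h | h
    · subst h
      refine hr (Ideal.mem_map_of_mem _ ?_)
      simpa using hmaxI _ h1 har
    · have ha1 : a = 1 := sub_eq_zero.1 h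
      subst ha1
      have : Ideal.Quotient.mk I r = 1 := by
        rw [← map_one (Ideal.Quotient.mk I), eq_comm, Ideal.Quotient.eq]; exact har
      rw [this] at hr2
      exact hp2.ne_top ((Ideal.eq_top_iff_one _).2 hr2)
  obtain ⟨M, hM⟩ := Ideal.exists_maximal T
  have hloc : IsLocalRing T := IsLocalRing.of_unique_max_ideal ⟨M, hM, fun N hN => huniq _ _ hN hM⟩
  refine ⟨hloc, ?_, hmaxI _ inferInstance⟩
  obtain ⟨N, hN⟩ : ∃ N, maximalIdeal T ^ N ≤ I := by
    refine Ideal.exists_pow_le_of_le_radical_of_fg ?_ (IsNoetherian.noetherian _)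
    rw [Ideal.radical_eq_sInf]
    refine le_sInf ?_
    rintro Q ⟨hQ, hQp⟩
    exact (IsLocalRing.eq_maximalIdeal (hcm Q hQp hQ)).ge
  exact adic_of_pow' _ I (hmaxI _ inferInstance) N hN
end GN

namespace GN

theorem thmI {D : Type*} [CommRing D] [IsLocalRing D] [IsDomain D]
    [IsNoetherianRing D] [IsAdicComplete (maximalIdeal D) D] {p : ℕ} {C : Subring D} (hC : Coef C p) {n : ℕ}
    (S : Finset (Fin n)) (c : C) {T : Type*} [CommRing T] [IsLocalRing T] [IsNoetherianRing T]
    [Algebra (PS C n) T] [Module.Flat (PS C n) T] (hm : (PI (Ideal.span {c}) S).map (algebraMap (PS C n) T) = maximalIdeal T)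
    (hd : ∀ N (t : T), ∃ r g : PS C n, IsUnit (algebraMap _ T r) ∧ algebraMap _ T r * t - algebraMap _ T g ∈ maximalIdeal T ^ N)
    (hs : ∀ N (g : PS C n), algebraMap _ T g ∈ maximalIdeal T ^ N → ∃ r : PS C n, IsUnit (algebraMap _ T r) ∧ r * g ∈ (PI (Ideal.span {c}) S) ^ N)
    {L : Type*} [Field L] [Algebra (PS C n) L] (hinj : Function.Injective (algebraMap (PS C n) L)) (hL : FF (PS C n) L) :
    IsNormalRing (L ⊗[PS C n] T) := by
  classical
  haveI := hC.isLocalRing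
  haveI := hC.noeth
  haveI := hC.isDomain
  obtain ⟨hdom, -⟩ := ndom_PS (n := n) hC.ndom
  have hT : NDom T := by
    refine ndom_of_nice (c := c) S (fun i hi => ?_) ?_ ?_
    · rw [← hm]; exact Ideal.mem_map_of_mem _ (X_mem_PI _ hi)
    · rw [← hm]; exact Ideal.mem_map_of_mem _ (C_mem_PI (Ideal.mem_span_singleton_self c))
    · rw [hm]
      letI := Ideal.Quotient.field (maximalIdeal T)
      exact NDom.of_field _
  have : FaithfulSMul (PS C n) L := (faithfulSMul_iff_algebraMap_injective _ _).2 hinj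
  letI := FractionRing.liftAlgebra (PS C n) L
  have : FiniteDimensional (FractionRing (PS C n)) L := FF.finiteDimensional hL
  refine thmX (FractionRing (PS C n)) L hT ?_ fun p' hp' h0 e => ?_
  · rw [injective_iff_map_eq_zero]
    intro r hr
    by_contra hne
    have := flat_nzd (V := PS C n) (T := T) (mem_nonZeroDivisors_of_ne_zero hne)
    rw [hr] at this
    exact zero_notMem_nonZeroDivisors this
  · have h0C : (p' : C) = 0 := by
      have := congrArg (MvPowerSeries.constantCoeff) h0
      simpa using this
    have h0' : (p' : D) = 0 := by
      have := congrArg Subtype.val h0C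
      simpa using this
    refine zc_of_dense _ (pow_ne_zero _ hp'.ne_zero) (PI (Ideal.span {c}) S) (fun g hg => ?_) hd hs hm.le
    exact ql_sep (hC.isField p' hp' h0') p' e hp' h0C n g hg
end GN

namespace GN

/-- The completion `T` of the localization of `R` at the prime `p`. -/
structure CLoc {R : Type u} [CommRing R] (p : Ideal R) (T : Type u) [CommRing T] [Algebra R T] : Prop where
  loc : IsLocalRing T
  noeth : IsNoetherianRing T
  flat : Module.Flat R T
  max : p.map (algebraMap R T) = maximalIdeal T
  complete : IsAdicComplete (maximalIdeal T) T
  unit : ∀ r, r ∉ p → IsUnit (algebraMap R T r)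
  dense : ∀ N (t : T), ∃ r g : R, r ∉ p ∧ algebraMap R T r * t - algebraMap R T g ∈ maximalIdeal T ^ N
  sat : ∀ N (g : R), algebraMap R T g ∈ maximalIdeal T ^ N → ∃ r, r ∉ p ∧ r * g ∈ p ^ N
  ext : ∀ (E : Type v) [CommRing E] [IsLocalRing E] [IsAdicComplete (maximalIdeal E) E] (f : R →+* E),
    (maximalIdeal E).comap f = p → ∃ F : T →+* E, F.comp (algebraMap R T) = f

theorem exists_cloc {R : Type u} [CommRing R] [IsNoetherianRing R] (p : Ideal R) [p.IsPrime] :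
    ∃ (T : Type u) (_ : CommRing T) (_ : Algebra R T), CLoc.{u, v} p T := by
  let R' := Localization.AtPrime p
  let T := AdicCompletion (maximalIdeal R') R'
  have hfg : (maximalIdeal R').FG := IsNoetherian.noetherian _
  have hmap : (maximalIdeal R').map (algebraMap R' T) = maximalIdeal T := (AdicCompletion.maximalIdeal_eq_map ..).symm
  have hflat : Module.Flat R T := Module.Flat.trans R R' T
  have hsc : ∀ r, algebraMap R T r = algebraMap R' T (algebraMap R R' r) := fun r => IsScalarTower.algebraMap_apply R R' T r
  have hmax : p.map (algebraMap R T) = maximalIdeal T := by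
    have h := congrArg (Ideal.map (algebraMap R' T)) (Localization.AtPrime.map_eq_maximalIdeal (I := p))
    rw [Ideal.map_map, ← IsScalarTower.algebraMap_eq R R' T] at h
    exact h.trans hmap
  have hunit : ∀ r, r ∉ p → IsUnit (algebraMap R T r) := fun r hr => by
    rw [hsc]
    exact (IsLocalization.map_units R' (⟨r, hr⟩ : p.primeCompl)).map _
  refine ⟨T, inferInstance, inferInstance, inferInstance, comp_noeth _, hflat, hmax, hmap ▸ comp_complete _ hfg, hunit, ?_, ?_, ?_⟩
  · intro N t
    obtain ⟨x, hx⟩ := comp_dense _ hfg N t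
    obtain ⟨⟨g, r⟩, hgr⟩ := IsLocalization.surj p.primeCompl x
    refine ⟨r, g, r.2, ?_⟩
    rw [hsc, hsc, ← hgr, map_mul, mul_comm, ← sub_mul, ← hmap]
    exact Ideal.mul_mem_right _ _ hx
  · intro N g hg
    rw [hsc, ← hmap, comp_comap _ hfg, ← Localization.AtPrime.map_eq_maximalIdeal, ← Ideal.map_pow,
      IsLocalization.algebraMap_mem_map_algebraMap_iff p.primeCompl] at hg
    obtain ⟨r, hr, h⟩ := hg
    exact ⟨r, hr, h⟩
  · intro E _ _ _ f hf
    let f' : R' →+* E := IsLocalization.lift (M := p.primeCompl) (g := f) (fun y => by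
      have : (y : R) ∉ (maximalIdeal E).comap f := by rw [hf]; exact y.2
      simpa using this)
    have hf' : ∀ r, f' (algebraMap R R' r) = f r := fun r => IsLocalization.lift_eq _ _
    obtain ⟨F, hF⟩ := exists_extend (maximalIdeal R') (maximalIdeal E) f' (by
      rw [← Localization.AtPrime.map_eq_maximalIdeal, Ideal.map_map, Ideal.map_le_iff_le_comap]
      intro r hr
      rw [← hf] at hr
      rw [Ideal.mem_comap, RingHom.comp_apply, hf']; exact hr)
    refine ⟨F, RingHom.ext fun r => ?_⟩
    rw [RingHom.comp_apply, hsc, ← RingHom.comp_apply F, hF, hf']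
end GN

namespace GN

theorem flat_of_dense' {A A₁ B : Type*} [CommRing A] [CommRing A₁] [CommRing B] [Algebra A A₁]
    [Algebra A₁ B] [Algebra A B] [IsScalarTower A A₁ B] [IsNoetherianRing A] [IsNoetherianRing A₁]
    [IsNoetherianRing B] [Module.Flat A B] (I : Ideal A)
    (hjac : I.map (algebraMap A B) ≤ Ideal.jacobson ⊥)
    (hd : ∀ n (x : A₁), ∃ s a, IsUnit (algebraMap A A₁ s) ∧ algebraMap A A₁ s * x - algebraMap A A₁ a ∈ (I.map (algebraMap A A₁)) ^ n) :
    Module.Flat A₁ B := by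
  rw [Module.Flat.iff_forall_isTrivialRelation]
  intro l f x hfx
  set J := I.map (algebraMap A A₁) with hJ
  let N : Submodule B (Fin l → B) := Submodule.span B
    ((fun r : Fin l → A₁ => fun i => algebraMap A₁ B (r i)) '' {r | ∑ i, f i * r i = 0})
  have hJB : J.map (algebraMap A₁ B) = I.map (algebraMap A B) := by
    rw [hJ, Ideal.map_map, ← IsScalarTower.algebraMap_eq]
  have hx : x ∈ N := by
    refine mem_of_krull (I.map (algebraMap A B)) hjac N x fun n => ?_
    obtain ⟨k, hk⟩ := Ideal.exists_pow_inf_eq_pow_smul J (Ideal.span (Set.range f))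
    choose s' a hu ha using fun i => hd (n + k) (f i)
    have hx' : ∀ i, ∃ y, algebraMap A B (s' i) * y = x i := fun i => by
      have : IsUnit (algebraMap A B (s' i)) := by
        rw [IsScalarTower.algebraMap_apply A A₁ B]; exact (hu i).map _
      obtain ⟨c, hc⟩ := this.exists_right_inv
      exact ⟨c * x i, by rw [← mul_assoc, hc, one_mul]⟩
    choose x' hx' using hx'
    have h1 : ∑ i, a i • x' i ∈ (I ^ (n + k)).map (algebraMap A B) := by
      have h2 : ∑ i, a i • x' i = - ∑ i, (algebraMap A A₁ (s' i) * f i - algebraMap A A₁ (a i)) • x' i := by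
        have h3 : ∑ i, (algebraMap A A₁ (s' i) * f i) • x' i = 0 := by
          rw [← hfx]
          refine Finset.sum_congr rfl fun i _ => ?_
          rw [← hx' i, Algebra.smul_def, Algebra.smul_def, map_mul, ← IsScalarTower.algebraMap_apply]; ring
        simp only [sub_smul, Finset.sum_sub_distrib, h3, algebraMap_smul]
        simp
      rw [h2]
      refine neg_mem (Ideal.sum_mem _ fun i _ => ?_)
      rw [Algebra.smul_def]
      refine Ideal.mul_mem_right _ _ ?_
      rw [Ideal.map_pow, ← hJB, ← Ideal.map_pow]
      exact Ideal.mem_map_of_mem _ (ha i)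
    obtain ⟨s, c, hc⟩ := Submodule.fg_iff_exists_fin_generating_family.mp (IsNoetherian.noetherian (I ^ (n + k)))
    have hc' : Ideal.span (Set.range c) = I ^ (n + k) := hc
    have hcI : ∀ j, c j ∈ I ^ (n + k) := fun j => hc' ▸ Ideal.subset_span ⟨j, rfl⟩
    rw [← hc', Ideal.map_span, ← Set.range_comp, Ideal.mem_span_range_iff_exists_fun] at h1
    obtain ⟨d, hdd⟩ := h1
    obtain ⟨t, r, z, hr, hz⟩ := Module.Flat.isTrivialRelation_of_sum_smul_eq_zero (R := A) (M := B)
      (ι := Fin l ⊕ Fin s) (f := Sum.elim a (fun j => - c j)) (x := Sum.elim x' d) (by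
        rw [Fintype.sum_sum_type]
        simp only [Sum.elim_inl, Sum.elim_inr, neg_smul, Finset.sum_neg_distrib]
        rw [← hdd, ← sub_eq_add_neg, sub_eq_zero]
        refine Finset.sum_congr rfl fun j _ => ?_
        rw [Algebra.smul_def, mul_comm]; rfl)
    -- each column is approximately a relation
    have h3 : ∀ j, ∃ e : Fin l → A₁, (∀ i, e i ∈ J ^ n) ∧
        ∑ i, f i * (algebraMap A A₁ (s' i) * algebraMap A A₁ (r (Sum.inl i) j)) = ∑ i, e i * f i := by
      intro j
      have h4 : ∑ i, f i * (algebraMap A A₁ (s' i) * algebraMap A A₁ (r (Sum.inl i) j)) ∈ (J ^ (n + k) • ⊤ ⊓ Ideal.span (Set.range f) : Submodule A₁ A₁) := by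
        constructor
        · rw [smul_eq_mul, Ideal.mul_top]
          have h5 : ∑ i, f i * (algebraMap A A₁ (s' i) * algebraMap A A₁ (r (Sum.inl i) j)) =
              ∑ i, (algebraMap A A₁ (s' i) * f i - algebraMap A A₁ (a i)) * algebraMap A A₁ (r (Sum.inl i) j) +
              algebraMap A A₁ (∑ i, a i * r (Sum.inl i) j) := by
            rw [map_sum, ← Finset.sum_add_distrib]
            refine Finset.sum_congr rfl fun i _ => ?_
            rw [map_mul]; ring
          rw [h5]
          refine add_mem (Ideal.sum_mem _ fun i _ => Ideal.mul_mem_right _ _ (ha i)) ?_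
          rw [hJ, ← Ideal.map_pow]
          apply Ideal.mem_map_of_mem
          have h6 := hz j
          rw [Fintype.sum_sum_type] at h6
          simp only [Sum.elim_inl, Sum.elim_inr, neg_mul, Finset.sum_neg_distrib] at h6
          rw [← sub_eq_add_neg, sub_eq_zero] at h6
          rw [h6]
          exact Ideal.sum_mem _ fun i _ => Ideal.mul_mem_right _ _ (hcI i)
        · exact Ideal.sum_mem _ fun i _ => Ideal.mul_mem_right _ _ (Ideal.subset_span ⟨i, rfl⟩)
      rw [hk (n + k) (Nat.le_add_left _ _), Nat.add_sub_cancel] at h4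
      have h5 := Submodule.smul_mono le_rfl inf_le_right h4
      have h6 := (Submodule.mem_ideal_smul_span_iff_exists_sum (J ^ n) f _).mp h5
      obtain ⟨e, he, hes⟩ := h6
      refine ⟨fun i => e i, he, ?_⟩
      rw [← hes, Finsupp.sum_fintype _ _ (by simp)]
      rfl
    choose e he hes using h3
    refine ⟨∑ j, z j • (fun i => algebraMap A₁ B (algebraMap A A₁ (s' i) * algebraMap A A₁ (r (Sum.inl i) j) - e j i)), ?_, ?_⟩
    · refine Submodule.sum_mem _ fun j _ => Submodule.smul_mem _ _ (Submodule.subset_span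
        ⟨fun i => algebraMap A A₁ (s' i) * algebraMap A A₁ (r (Sum.inl i) j) - e j i, ?_, rfl⟩)
      simp only [Set.mem_setOf_eq, mul_sub, Finset.sum_sub_distrib, hes]
      rw [sub_eq_zero]
      exact Finset.sum_congr rfl fun i _ => mul_comm _ _
    · intro i
      have h7 := hr (Sum.inl i)
      simp only [Sum.elim_inl] at h7
      rw [← hx' i, h7, Finset.mul_sum, Finset.sum_apply, ← Finset.sum_sub_distrib]
      refine Ideal.sum_mem _ fun j _ => ?_
      have h8 : algebraMap A B (s' i) * r (Sum.inl i) j • z j - (z j • (fun i => algebraMap A₁ B (algebraMap A A₁ (s' i) * algebraMap A A₁ (r (Sum.inl i) j) - e j i))) i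
          = algebraMap A₁ B (e j i) * z j := by
        rw [Pi.smul_apply, smul_eq_mul, map_sub, map_mul, ← IsScalarTower.algebraMap_apply, ← IsScalarTower.algebraMap_apply, Algebra.smul_def]; ring
      rw [h8, ← hJB, ← Ideal.map_pow]
      exact Ideal.mul_mem_right _ _ (Ideal.mem_map_of_mem _ (he j i))
  obtain ⟨k, b, g, hbg⟩ := Submodule.mem_span_set'.mp hx
  choose r hr using fun j => (g j).2
  refine ⟨k, fun i j => r j i, b, fun i => ?_, fun j => (hr j).1⟩
  rw [← hbg, Finset.sum_apply]
  refine Finset.sum_congr rfl fun j _ => ?_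
  rw [Pi.smul_apply, ← (hr j).2, smul_eq_mul, Algebra.smul_def, mul_comm]

end GN

namespace GN

theorem exists_resField (A L : Type*) [CommRing A] [Field L] [Algebra A L] :
    ∃ (p : Ideal A) (_ : p.IsPrime) (_ : Algebra p.ResidueField L), IsScalarTower A p.ResidueField L ∧ p = RingHom.ker (algebraMap A L) := by
  have hp : (RingHom.ker (algebraMap A L)).IsPrime := RingHom.ker_isPrime _
  let f : (RingHom.ker (algebraMap A L)).ResidueField →+* L := Ideal.ResidueField.lift _ (algebraMap A L) le_rfl (by
    intro x hx
    have : algebraMap A L x ≠ 0 := hx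
    change IsUnit (algebraMap A L x)
    simpa using this)
  letI := f.toAlgebra
  refine ⟨_, hp, inferInstance, IsScalarTower.of_algebraMap_eq fun x => ?_, rfl⟩
  exact (Ideal.ResidueField.lift_algebraMap _ _ _ _ _).symm

theorem resField_frac {A : Type*} [CommRing A] (p : Ideal A) [p.IsPrime] (x : p.ResidueField) :
    ∃ a b : A, a ∉ p ∧ algebraMap A p.ResidueField a * x = algebraMap A p.ResidueField b := by
  obtain ⟨⟨b, a⟩, h⟩ := IsLocalization.surj (nonZeroDivisors (A ⧸ p)) x
  obtain ⟨b, rfl⟩ := Ideal.Quotient.mk_surjective b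
  obtain ⟨a, ha⟩ := a
  obtain ⟨a, rfl⟩ := Ideal.Quotient.mk_surjective a
  refine ⟨a, b, fun hap => ?_, ?_⟩
  · rw [Ideal.Quotient.eq_zero_iff_mem.2 hap] at ha
    exact zero_notMem_nonZeroDivisors ha
  · rw [mul_comm]
    simpa using h

theorem FF.of_resField {A : Type*} [CommRing A] {L : Type*} [Field L] [Algebra A L] (p : Ideal A) [p.IsPrime] [Algebra p.ResidueField L]
    [IsScalarTower A p.ResidueField L] [FiniteDimensional p.ResidueField L] : FF A L := by
  refine FF.of_localization (A₁ := p.ResidueField) FF.of_field fun x => ?_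
  obtain ⟨a, b, ha, h⟩ := resField_frac p x
  refine ⟨a, b, ?_, h⟩
  rw [IsScalarTower.algebraMap_apply A p.ResidueField L, Ne, map_eq_zero]
  simpa using ha

theorem FF.essFiniteType {A L : Type*} [CommRing A] [Field L] [Algebra A L] (h : FF A L) : Algebra.EssFiniteType A L := by
  obtain ⟨p, _, _, _, -⟩ := exists_resField A L
  have : FiniteDimensional p.ResidueField L := h.finiteDimensional
  exact Algebra.EssFiniteType.comp A p.ResidueField L

theorem noeth_tensor {A L M : Type*} [CommRing A] [Field L] [Algebra A L] [CommRing M] [Algebra A M] [IsNoetherianRing M]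
    (h : FF A L) : IsNoetherianRing (M ⊗[A] L) := by
  have := h.essFiniteType
  exact Algebra.EssFiniteType.isNoetherianRing M (M ⊗[A] L)

theorem FF.of_gen {M D Λ : Type*} [CommRing M] [CommRing D] [Field Λ] [Algebra M D] [Algebra D Λ] [Algebra M Λ] [IsScalarTower M D Λ]
    (s : Finset Λ) (hD : ∀ d : D, ∃ a : M, algebraMap M Λ a ≠ 0 ∧ a • algebraMap D Λ d ∈ Submodule.span M (s : Set Λ))
    (hΛ : ∀ y : Λ, ∃ d₁ d₂ : D, algebraMap D Λ d₂ ≠ 0 ∧ algebraMap D Λ d₂ * y = algebraMap D Λ d₁) : FF M Λ := by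
  obtain ⟨p, _, _, _, -⟩ := exists_resField M Λ
  let K := p.ResidueField
  let V : Submodule K Λ := Submodule.span K (s : Set Λ)
  have hV : ∀ d : D, algebraMap D Λ d ∈ V := by
    intro d
    obtain ⟨a, ha, h⟩ := hD d
    have h1 : a • algebraMap D Λ d ∈ V := Submodule.span_le_restrictScalars M K _ h
    have h2 : algebraMap M K a ≠ 0 := fun h0 => ha (by rw [IsScalarTower.algebraMap_apply M K Λ, h0, map_zero])
    have := V.smul_mem (algebraMap M K a)⁻¹ h1
    rwa [← algebraMap_smul K a, smul_smul, inv_mul_cancel₀ h2, one_smul] at this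
  let W : Subalgebra K Λ := Algebra.adjoin K (Set.range (algebraMap D Λ))
  have hWV : Subalgebra.toSubmodule W ≤ V := by
    change Subalgebra.toSubmodule (Algebra.adjoin K ((algebraMap D Λ).range : Set Λ)) ≤ V
    rw [Algebra.adjoin_eq_span]
    have : (Submonoid.closure ((algebraMap D Λ).range : Set Λ) : Set Λ) = ((algebraMap D Λ).range : Set Λ) :=
      congrArg SetLike.coe (Submonoid.closure_eq ((algebraMap D Λ).range.toSubmonoid))
    rw [this, Submodule.span_le]
    rintro _ ⟨d, rfl⟩
    exact hV d
  have hVfin : FiniteDimensional K V := FiniteDimensional.span_finset K s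
  have hWfin : FiniteDimensional K W := Submodule.finiteDimensional_of_le hWV
  have hWf : IsField W := isField_of_isIntegral_of_isField' (Field.toIsField K)
  have htop : V = ⊤ := by
    rw [eq_top_iff]
    intro y _
    apply hWV
    obtain ⟨d₁, d₂, h2, h⟩ := hΛ y
    have m1 : algebraMap D Λ d₁ ∈ W := Algebra.subset_adjoin ⟨_, rfl⟩
    have m2 : algebraMap D Λ d₂ ∈ W := Algebra.subset_adjoin ⟨_, rfl⟩
    obtain ⟨b, hb⟩ := hWf.mul_inv_cancel (a := ⟨_, m2⟩) (by simpa [Subtype.ext_iff] using h2)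
    have hb' : algebraMap D Λ d₂ * b = 1 := congrArg Subtype.val hb
    have : y = algebraMap D Λ d₁ * b := by
      rw [← h]; linear_combination (-y) * hb'
    rw [this]
    exact W.mul_mem m1 b.2
  have : FiniteDimensional K Λ := by
    rw [htop] at hVfin
    exact Module.finite_def.2 ((Submodule.fg_top _).1 (Module.finite_def.1 hVfin)) 
  exact FF.of_resField p

theorem FF.of_prime {A L M : Type*} [CommRing A] [Field L] [Algebra A L] [CommRing M] [Algebra A M] (h : FF A L)
    (Q : Ideal (M ⊗[A] L)) [Q.IsPrime] : FF M Q.ResidueField := by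
  classical
  obtain ⟨s, hs⟩ := h
  let g : L → Q.ResidueField := fun x => algebraMap (M ⊗[A] L) Q.ResidueField (1 ⊗ₜ x)
  have hmem : ∀ (d : M ⊗[A] L), ∃ a : A, algebraMap A L a ≠ 0 ∧ algebraMap A M a • algebraMap (M ⊗[A] L) Q.ResidueField d ∈ Submodule.span M (s.image g : Set Q.ResidueField) := by
    intro d
    induction d using TensorProduct.induction_on with
    | zero => exact ⟨1, by simp, by simp⟩
    | tmul m x =>
      obtain ⟨a, ha, hx⟩ := hs x
      refine ⟨a, ha, ?_⟩
      have h1 : algebraMap A M a • algebraMap (M ⊗[A] L) Q.ResidueField (m ⊗ₜ x) = m • g (a • x) := by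
        simp only [g, Algebra.smul_def, IsScalarTower.algebraMap_apply M (M ⊗[A] L) Q.ResidueField, ← map_mul]
        congr 1
        rw [Algebra.TensorProduct.algebraMap_apply, Algebra.TensorProduct.algebraMap_apply, Algebra.TensorProduct.tmul_mul_tmul,
          Algebra.TensorProduct.tmul_mul_tmul, one_mul, one_mul, mul_one, ← Algebra.smul_def a x, ← TensorProduct.smul_tmul]
        simp [Algebra.smul_def]
      rw [h1]
      refine Submodule.smul_mem _ _ ?_
      generalize a • x = w at hx
      induction hx using Submodule.span_induction with
      | mem y hy => exact Submodule.subset_span (by simpa using ⟨y, hy, rfl⟩)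
      | zero => simp [g]
      | add y z _ _ hy hz =>
        have : g (y + z) = g y + g z := by simp [g, TensorProduct.tmul_add]
        rw [this]; exact add_mem hy hz
      | smul b y _ hy =>
        have : g (b • y) = algebraMap A M b • g y := by
          simp only [g, Algebra.smul_def, IsScalarTower.algebraMap_apply M (M ⊗[A] L) Q.ResidueField, ← map_mul]
          congr 1
          rw [Algebra.TensorProduct.algebraMap_apply, Algebra.TensorProduct.tmul_mul_tmul, one_mul, mul_one, ← Algebra.smul_def,
            ← TensorProduct.smul_tmul]
          simp [Algebra.smul_def]
        rw [this]; exact Submodule.smul_mem _ _ hy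
    | add x y hx hy =>
      obtain ⟨a, ha, hx⟩ := hx
      obtain ⟨b, hb, hy⟩ := hy
      refine ⟨a * b, by rw [map_mul]; exact mul_ne_zero ha hb, ?_⟩
      rw [map_add, smul_add, map_mul]
      refine add_mem ?_ ?_
      · rw [mul_comm, mul_smul]; exact Submodule.smul_mem _ _ hx
      · rw [mul_smul]; exact Submodule.smul_mem _ _ hy
  refine FF.of_gen (D := M ⊗[A] L) (s.image g) (fun d => ?_) (fun y => ?_)
  · obtain ⟨a, ha, h⟩ := hmem d
    refine ⟨algebraMap A M a, ?_, h⟩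
    rw [← IsScalarTower.algebraMap_apply A M, IsScalarTower.algebraMap_apply A (M ⊗[A] L)]
    have : algebraMap A (M ⊗[A] L) a = Algebra.TensorProduct.includeRight (algebraMap A L a) := by simp
    rw [this]
    exact (((Ne.isUnit ha).map (Algebra.TensorProduct.includeRight : L →ₐ[A] M ⊗[A] L)).map _).ne_zero
  · obtain ⟨a, b, ha, h⟩ := resField_frac Q y
    exact ⟨b, a, by simpa using ha, h⟩

theorem normal_two {A L M E : Type*} [CommRing A] [Field L] [Algebra A L] [CommRing M] [Algebra A M] [IsNoetherianRing M]
    [CommRing E] [Algebra A E] [Algebra M E] [IsScalarTower A M E] [IsNoetherianRing E] [Module.Flat M E]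
    (h : FF A L) (h1 : IsNormalRing (L ⊗[A] M))
    (h2 : ∀ (Q : Ideal (M ⊗[A] L)) [Q.IsPrime], FF M Q.ResidueField → IsNormalRing (Q.ResidueField ⊗[M] E)) :
    IsNormalRing (L ⊗[A] E) := by
  have n1 : IsNoetherianRing (M ⊗[A] L) := noeth_tensor h
  have n2 : IsNoetherianRing (E ⊗[A] L) := noeth_tensor h
  have e0 : L ⊗[A] M ≃ₐ[A] M ⊗[A] L := Algebra.TensorProduct.comm _ _ _
  have e1 : (M ⊗[A] L) ⊗[M] E ≃ₐ[M] E ⊗[M] (M ⊗[A] L) := Algebra.TensorProduct.comm _ _ _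
  have e2 : E ⊗[M] (M ⊗[A] L) ≃ₐ[E] E ⊗[A] L := Algebra.TensorProduct.cancelBaseChange A M E E L
  have e3 : E ⊗[A] L ≃ₐ[A] L ⊗[A] E := Algebra.TensorProduct.comm _ _ _
  have e : (M ⊗[A] L) ⊗[M] E ≃+* E ⊗[A] L := e1.toRingEquiv.trans e2.toRingEquiv
  have n3 : IsNoetherianRing ((M ⊗[A] L) ⊗[M] E) := isNoetherianRing_of_ringEquiv _ e.symm
  refine isNormalRing_of_ringEquiv (e.trans e3.toRingEquiv) ?_
  refine isNormalRing_of_flat' (D := M ⊗[A] L) (isNormalRing_of_ringEquiv e0.toRingEquiv h1) fun Q _ => ?_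
  have e4 : Q.ResidueField ⊗[M ⊗[A] L] ((M ⊗[A] L) ⊗[M] E) ≃ₐ[M ⊗[A] L] Q.ResidueField ⊗[M] E :=
    Algebra.TensorProduct.cancelBaseChange M (M ⊗[A] L) (M ⊗[A] L) Q.ResidueField E
  exact isNormalRing_of_ringEquiv e4.symm.toRingEquiv (h2 Q (FF.of_prime h Q))
end GN

namespace GN

theorem isNormalRing_of_subsingleton (R : Type*) [CommRing R] [Subsingleton R] : IsNormalRing R := by
  intro P hP
  exact absurd (Subsingleton.elim P ⊤) hP.ne_top

theorem quot_flat {M E : Type*} [CommRing M] [CommRing E] [Algebra M E] [Module.Flat M E] (I : Ideal M) :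
    Module.Flat (M ⧸ I) (E ⧸ I.map (algebraMap M E)) :=
  Module.Flat.of_linearEquiv (Algebra.TensorProduct.quotIdealMapEquivQuotTensor E I).toLinearEquiv

theorem tensor_quot {M E Λ : Type*} [CommRing M] [CommRing E] [Algebra M E] (I : Ideal M) [CommRing Λ] [Algebra M Λ]
    [Algebra (M ⧸ I) Λ] [IsScalarTower M (M ⧸ I) Λ]
    (h : IsNormalRing (Λ ⊗[M ⧸ I] (E ⧸ I.map (algebraMap M E)))) : IsNormalRing (Λ ⊗[M] E) := by
  have e1 : Λ ⊗[M ⧸ I] (E ⧸ I.map (algebraMap M E)) ≃ₐ[M ⧸ I] Λ ⊗[M ⧸ I] ((M ⧸ I) ⊗[M] E) :=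
    Algebra.TensorProduct.congr AlgEquiv.refl (Algebra.TensorProduct.quotIdealMapEquivQuotTensor E I)
  have e2 : Λ ⊗[M ⧸ I] ((M ⧸ I) ⊗[M] E) ≃ₐ[M ⧸ I] Λ ⊗[M] E := Algebra.TensorProduct.cancelBaseChange M (M ⧸ I) (M ⧸ I) Λ E
  exact isNormalRing_of_ringEquiv (e1.trans e2).toRingEquiv h

theorem tensor_surj_equiv {M k : Type*} (X Y : Type*) [CommRing M] [CommRing k] [Algebra M k] [CommRing X] [CommRing Y]
    [Algebra M X] [Algebra M Y] [Algebra k X] [Algebra k Y] [IsScalarTower M k X] [IsScalarTower M k Y]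
    (hs : Function.Surjective (algebraMap M k)) : Nonempty (X ⊗[k] Y ≃+* X ⊗[M] Y) := by
  haveI : CompatibleSMul M k X Y := ⟨fun r x y => by
    obtain ⟨m, rfl⟩ := hs r
    rw [algebraMap_smul, algebraMap_smul, smul_tmul]⟩
  haveI : CompatibleSMul k M X Y := ⟨fun r x y => by
    rw [← algebraMap_smul k r x, ← algebraMap_smul k r y, smul_tmul]⟩
  exact ⟨(Algebra.TensorProduct.equivOfCompatibleSMul M k M X Y).toRingEquiv⟩

theorem bad_fiber {T : Type*} {M : Type u} {E : Type v} {Λ : Type*} [CommRing T] [IsLocalRing T] [IsNoetherianRing T]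
    [IsAdicComplete (maximalIdeal T) T] [CommRing M] [Algebra T M] [Module.Finite T M]
    [CommRing E] [IsLocalRing E] [IsNoetherianRing E] [IsAdicComplete (maximalIdeal E) E]
    [Algebra T E] [Algebra M E] [IsScalarTower T M E] [Module.Flat M E]
    (hTE : (maximalIdeal T).map (algebraMap T E) ≤ maximalIdeal E)
    (hm : ((maximalIdeal E).comap (algebraMap M E)).map (algebraMap M E) = maximalIdeal E)
    (hsep : ∀ (κ' : Type u) [Field κ'] [Algebra M κ'], FF M κ' →
      RingHom.ker (algebraMap M κ') = (maximalIdeal E).comap (algebraMap M E) → IsReduced (κ' ⊗[M] ResidueField E))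
    [Field Λ] [Algebra M Λ] (hΛ : FF M Λ) : IsNormalRing (Λ ⊗[M] E) := by
  by_cases hle : RingHom.ker (algebraMap M Λ) ≤ (maximalIdeal E).comap (algebraMap M E)
  swap
  · obtain ⟨r, hr, hr'⟩ := Set.not_subset.1 hle
    have hu : IsUnit (algebraMap M E r) := by simpa using hr'
    have : Subsingleton (Λ ⊗[M] E) := by
      refine subsingleton_of_zero_eq_one ?_
      obtain ⟨v, hv⟩ := hu.exists_right_inv
      have : (1 : Λ ⊗[M] E) = (1 : Λ) ⊗ₜ[M] (r • v) := by
        rw [Algebra.smul_def, hv]; rfl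
      rw [this, ← smul_tmul, Algebra.smul_def, (RingHom.mem_ker).1 hr]; simp
    exact isNormalRing_of_subsingleton _
  have hle' : (RingHom.ker (algebraMap M Λ)).map (algebraMap M E) ≤ maximalIdeal E := Ideal.map_le_iff_le_comap.2 hle
  have hker : RingHom.ker (algebraMap M Λ) = RingHom.ker (algebraMap M Λ) := rfl
  haveI hpr : (RingHom.ker (algebraMap M Λ)).IsPrime := RingHom.ker_isPrime _
  generalize hI : RingHom.ker (algebraMap M Λ) = I at *
  letI : Algebra (M ⧸ I) Λ := (Ideal.Quotient.lift I (algebraMap M Λ) (fun a ha => by rw [← hI] at ha; exact ha)).toAlgebra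
  haveI : IsScalarTower M (M ⧸ I) Λ := IsScalarTower.of_algebraMap_eq fun x => by
    rw [RingHom.algebraMap_toAlgebra]; rfl
  refine tensor_quot I ?_
  haveI : Module.Flat (M ⧸ I) (E ⧸ I.map (algebraMap M E)) := quot_flat I
  haveI : IsNoetherianRing M := IsNoetherianRing.of_finite T M
  haveI : IsLocalRing (E ⧸ I.map (algebraMap M E)) := isLocalRing_quot_of_le hle'
  haveI : IsAdicComplete (maximalIdeal (E ⧸ I.map (algebraMap M E))) (E ⧸ I.map (algebraMap M E)) := by
    rw [maximalIdeal_quot]; exact adic_quot _ _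
  haveI : Module.Finite T (M ⧸ I) := Module.Finite.trans M _
  obtain ⟨hloc, hcomp, hTD⟩ := local_of_finite (S := T) (T := M ⧸ I)
  have hcomm : ∀ x : M, algebraMap (M ⧸ I) (E ⧸ I.map (algebraMap M E)) (Ideal.Quotient.mk I x) =
      Ideal.Quotient.mk _ (algebraMap M E x) := fun x => rfl
  have hcm : (maximalIdeal (E ⧸ I.map (algebraMap M E))).comap (algebraMap (M ⧸ I) (E ⧸ I.map (algebraMap M E))) =
      maximalIdeal (M ⧸ I) := by
    haveI : Algebra.IsIntegral T (M ⧸ I) := inferInstance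
    refine IsLocalRing.eq_maximalIdeal ?_
    refine Ideal.isMaximal_of_isIntegral_of_isMaximal_comap (R := T) _ ?_
    rw [Ideal.comap_comap]
    have h1 : maximalIdeal T ≤ (maximalIdeal (E ⧸ I.map (algebraMap M E))).comap
      ((algebraMap (M ⧸ I) (E ⧸ I.map (algebraMap M E))).comp (algebraMap T (M ⧸ I))) := by
      intro t ht
      rw [Ideal.mem_comap, RingHom.comp_apply, IsScalarTower.algebraMap_apply T M (M ⧸ I), Ideal.Quotient.algebraMap_eq, hcomm,
        ← IsScalarTower.algebraMap_apply T M E, maximalIdeal_quot]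
      exact Ideal.mem_map_of_mem _ (hTE (Ideal.mem_map_of_mem _ ht))
    rw [← (IsLocalRing.maximalIdeal.isMaximal T).eq_of_le (Ideal.IsPrime.ne_top inferInstance) h1]
    infer_instance
  haveI : IsLocalHom (algebraMap (M ⧸ I) (E ⧸ I.map (algebraMap M E))) :=
    (((IsLocalRing.local_hom_TFAE (algebraMap (M ⧸ I) (E ⧸ I.map (algebraMap M E)))).out 0 4 :
      _ ↔ (maximalIdeal (E ⧸ I.map (algebraMap M E))).comap (algebraMap (M ⧸ I) (E ⧸ I.map (algebraMap M E))) =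
      maximalIdeal (M ⧸ I))).2 hcm
  have hcm' : (maximalIdeal (M ⧸ I)).comap (Ideal.Quotient.mk I) = (maximalIdeal E).comap (algebraMap M E) := by
    ext x
    rw [← hcm, Ideal.mem_comap, Ideal.mem_comap, hcomm, maximalIdeal_quot, Ideal.mem_comap,
      Ideal.mem_map_iff_of_surjective _ Ideal.Quotient.mk_surjective]
    constructor
    · rintro ⟨y, hy, hxy⟩
      have := hle' (Ideal.Quotient.eq.1 hxy)
      simpa using sub_mem hy this
    · exact fun h => ⟨_, h, rfl⟩
  have hmm : (maximalIdeal (M ⧸ I)).map (algebraMap (M ⧸ I) (E ⧸ I.map (algebraMap M E))) =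
      maximalIdeal (E ⧸ I.map (algebraMap M E)) := by
    refine le_antisymm (Ideal.map_le_iff_le_comap.2 hcm.ge) ?_
    rw [maximalIdeal_quot, ← hm, Ideal.map_map, Ideal.map_le_iff_le_comap]
    intro x hx
    rw [Ideal.mem_comap, RingHom.comp_apply, ← hcomm]
    rw [← hcm'] at hx
    exact Ideal.mem_map_of_mem _ hx
  refine thmII ?_ hmm ?_ ?_
  · intro κ' _ _ _
    letI : Algebra M κ' := Algebra.compHom κ' (algebraMap M (ResidueField (M ⧸ I)))
    haveI : IsScalarTower M (ResidueField (M ⧸ I)) κ' := IsScalarTower.of_algebraMap_eq fun x => rfl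
    have hsurj : Function.Surjective (algebraMap M (ResidueField (M ⧸ I))) := by
      rw [IsScalarTower.algebraMap_eq M (M ⧸ I) (ResidueField (M ⧸ I)), RingHom.coe_comp]
      exact IsLocalRing.residue_surjective.comp Ideal.Quotient.mk_surjective
    have hF : FF M κ' := FF.of_localization (A₁ := ResidueField (M ⧸ I)) FF.of_field fun x => by
      obtain ⟨b, rfl⟩ := hsurj x
      exact ⟨1, b, by simp, by simp⟩
    have hk : RingHom.ker (algebraMap M κ') = (maximalIdeal E).comap (algebraMap M E) := by
      rw [← hcm']
      ext x
      rw [RingHom.mem_ker, IsScalarTower.algebraMap_apply M (ResidueField (M ⧸ I)) κ', map_eq_zero, Ideal.mem_comap,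
        IsScalarTower.algebraMap_apply M (M ⧸ I) (ResidueField (M ⧸ I)), IsLocalRing.ResidueField.algebraMap_eq, IsLocalRing.residue_eq_zero_iff]
      rfl
    have hred := hsep κ' hF hk
    obtain ⟨e⟩ := tensor_surj_equiv κ' (ResidueField (E ⧸ I.map (algebraMap M E))) hsurj
    let f : E →ₐ[M] ResidueField (E ⧸ I.map (algebraMap M E)) :=
      IsScalarTower.toAlgHom M E (ResidueField (E ⧸ I.map (algebraMap M E)))
    have hfs : Function.Surjective f := by
      intro x
      obtain ⟨y, rfl⟩ := IsLocalRing.residue_surjective x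
      obtain ⟨z, rfl⟩ := Ideal.Quotient.mk_surjective y
      exact ⟨z, rfl⟩
    have hfk : RingHom.ker (algebraMap E (ResidueField (E ⧸ I.map (algebraMap M E)))) = maximalIdeal E := by
      haveI : (RingHom.ker (algebraMap E (ResidueField (E ⧸ I.map (algebraMap M E))))).IsMaximal :=
        RingHom.ker_isMaximal_of_surjective _ hfs
      exact IsLocalRing.eq_maximalIdeal this
    let g : (E ⧸ maximalIdeal E) →ₐ[M] ResidueField (E ⧸ I.map (algebraMap M E)) :=
      Ideal.Quotient.liftₐ (maximalIdeal E) f (fun a ha => by rw [← hfk] at ha; exact ha)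
    have hgb : Function.Bijective g := by
      letI : Field (E ⧸ maximalIdeal E) := Ideal.Quotient.field _
      refine ⟨g.toRingHom.injective, fun x => ?_⟩
      obtain ⟨y, rfl⟩ := hfs x
      exact ⟨Ideal.Quotient.mk _ y, rfl⟩
    have e2 : ResidueField E ≃ₐ[M] ResidueField (E ⧸ I.map (algebraMap M E)) := AlgEquiv.ofBijective g hgb
    have e3 : κ' ⊗[M] ResidueField E ≃ₐ[M] κ' ⊗[M] ResidueField (E ⧸ I.map (algebraMap M E)) :=
      Algebra.TensorProduct.congr AlgEquiv.refl e2
    have e4 := e.trans e3.symm.toRingEquiv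
    exact isReduced_of_injective e4 e4.injective
  · rw [RingHom.algebraMap_toAlgebra]
    refine RingHom.lift_injective_of_ker_le_ideal _ _ hI.le
  · exact FF.of_tower hΛ
end GN

namespace GN

theorem FF.of_localization_map {A A₁ L : Type*} [CommRing A] [CommRing A₁] [Field L] [Algebra A L] [Algebra A A₁] [Algebra A₁ L]
    [IsScalarTower A A₁ L] (h : FF A₁ L) (hd : ∀ x : A₁, ∃ (a b : A), algebraMap A L a ≠ 0 ∧ algebraMap A L a * algebraMap A₁ L x = algebraMap A L b) :
    FF A L := by
  classical
  obtain ⟨s, hs⟩ := h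
  refine ⟨s, fun x => ?_⟩
  have h2 : ∀ y ∈ Submodule.span A₁ (s : Set L), ∃ a : A, algebraMap A L a ≠ 0 ∧ a • y ∈ Submodule.span A (s : Set L) := by
    intro y hy
    refine Submodule.span_induction (p := fun y _ => ∃ a : A, algebraMap A L a ≠ 0 ∧ a • y ∈ Submodule.span A (s : Set L)) ?_ ?_ ?_ ?_ hy
    · intro y hy
      exact ⟨1, by simp, by simpa using Submodule.subset_span hy⟩
    · exact ⟨1, by simp, by simp⟩
    · rintro y z _ _ ⟨a, ha, h⟩ ⟨a', ha', h'⟩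
      refine ⟨a * a', by rw [map_mul]; exact mul_ne_zero ha ha', ?_⟩
      rw [smul_add]
      refine add_mem ?_ ?_
      · rw [mul_comm, mul_smul]; exact Submodule.smul_mem _ _ h
      · rw [mul_smul]; exact Submodule.smul_mem _ _ h'
    · rintro r y _ ⟨a, ha, h⟩
      obtain ⟨c, b, hc, hcb⟩ := hd r
      refine ⟨c * a, by rw [map_mul]; exact mul_ne_zero hc ha, ?_⟩
      have : (c * a) • r • y = b • (a • y) := by
        rw [Algebra.smul_def r, Algebra.smul_def, Algebra.smul_def, Algebra.smul_def, ← hcb]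
        simp only [map_mul]; ring
      rw [this]; exact Submodule.smul_mem _ _ h
  obtain ⟨a₁, ha₁, hx⟩ := hs x
  obtain ⟨a, ha, h3⟩ := h2 _ hx
  obtain ⟨c, b, hc, hcb⟩ := hd a₁
  refine ⟨a * b, ?_, ?_⟩
  · rw [map_mul, ← hcb]
    exact mul_ne_zero ha (mul_ne_zero hc ha₁)
  · have : (a * b) • x = c • (a • (a₁ • x)) := by
        rw [Algebra.smul_def, Algebra.smul_def, Algebra.smul_def, Algebra.smul_def, map_mul, ← hcb]
        ring
    rw [this]; exact Submodule.smul_mem _ _ h3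


theorem bad1_aux {T A' M L : Type u} {E : Type v} [CommRing A'] [IsNoetherianRing A'] [CommRing T] [IsLocalRing T] [IsNoetherianRing T]
    [IsAdicComplete (maximalIdeal T) T] [CommRing M] [Algebra T M] [Module.Finite T M] [Algebra A' M]
    [CommRing E] [IsLocalRing E] [IsNoetherianRing E] [IsAdicComplete (maximalIdeal E) E]
    [Algebra T E] [Algebra M E] [Algebra A' E] [IsScalarTower T M E] [IsScalarTower A' M E] [Module.Flat A' E]
    (I : Ideal A') (hI : I ≤ (maximalIdeal E).comap (algebraMap A' E))
    (hTE : (maximalIdeal T).map (algebraMap T E) ≤ maximalIdeal E)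
    (hm : ((maximalIdeal E).comap (algebraMap A' E)).map (algebraMap A' E) = maximalIdeal E)
    (hd : ∀ n (x : M), ∃ s a, IsUnit (algebraMap A' M s) ∧ algebraMap A' M s * x - algebraMap A' M a ∈ (I.map (algebraMap A' M)) ^ n)
    (hsep : ∀ (κ' : Type u) [Field κ'] [Algebra A' κ'], FF A' κ' →
      RingHom.ker (algebraMap A' κ') = (maximalIdeal E).comap (algebraMap A' E) → IsReduced (κ' ⊗[A'] ResidueField E))
    [Field L] [Algebra A' L] (hL : FF A' L) (hn : IsNormalRing (L ⊗[A'] M)) : IsNormalRing (L ⊗[A'] E) := by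
  haveI : IsNoetherianRing M := IsNoetherianRing.of_finite T M
  haveI : Module.Flat M E := flat_of_dense' (A := A') I (by
    rw [IsLocalRing.jacobson_eq_maximalIdeal _ bot_ne_top]
    exact Ideal.map_le_iff_le_comap.2 hI) hd
  have hIM : I.map (algebraMap A' M) ≤ (maximalIdeal E).comap (algebraMap M E) := by
    rw [Ideal.map_le_iff_le_comap, Ideal.comap_comap, ← IsScalarTower.algebraMap_eq]
    exact hI
  refine normal_two hL hn fun Q _ hQ => ?_
  refine bad_fiber (T := T) hTE ?_ ?_ hQ
  · refine le_antisymm (Ideal.map_comap_le) ?_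
    conv_lhs => rw [← hm]
    rw [IsScalarTower.algebraMap_eq A' M E, ← Ideal.map_map, ← Ideal.comap_comap]
    exact Ideal.map_mono Ideal.map_comap_le
  · intro κ' _ _ hF hk
    letI : Algebra A' κ' := Algebra.compHom κ' (algebraMap A' M)
    haveI : IsScalarTower A' M κ' := IsScalarTower.of_algebraMap_eq fun x => rfl
    have key : ∀ x : M, ∃ s a : A', IsUnit (algebraMap A' M s) ∧ (∀ y : κ', s • (x • y) = a • y) ∧
        (∀ y : ResidueField E, s • (x • y) = a • y) := by
      intro x
      obtain ⟨s, a, hs, h⟩ := hd 1 x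
      rw [pow_one] at h
      have h := hIM h
      refine ⟨s, a, hs, fun y => ?_, fun y => ?_⟩
      · rw [← hk, RingHom.mem_ker, map_sub, map_mul, sub_eq_zero] at h
        rw [← algebraMap_smul M s, ← algebraMap_smul M a, Algebra.smul_def, Algebra.smul_def, Algebra.smul_def, ← mul_assoc, h]
      · rw [Ideal.mem_comap, ← IsLocalRing.residue_eq_zero_iff, ← IsLocalRing.ResidueField.algebraMap_eq,
          ← IsScalarTower.algebraMap_apply M E, map_sub, map_mul, sub_eq_zero] at h
        rw [← algebraMap_smul M s, ← algebraMap_smul M a, Algebra.smul_def, Algebra.smul_def, Algebra.smul_def, ← mul_assoc, h]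
    have hF' : FF A' κ' := hF.of_localization_map fun x => by
      obtain ⟨s, a, hs, h, -⟩ := key x
      refine ⟨s, a, ?_, ?_⟩
      · rw [IsScalarTower.algebraMap_apply A' M κ']
        exact (hs.map _).ne_zero
      · have := h 1
        rwa [Algebra.smul_def, Algebra.smul_def, Algebra.smul_def, mul_one, mul_one] at this
    have hk' : RingHom.ker (algebraMap A' κ') = (maximalIdeal E).comap (algebraMap A' E) := by
      rw [IsScalarTower.algebraMap_eq A' M κ', IsScalarTower.algebraMap_eq A' M E, ← Ideal.comap_comap, ← hk]
      rfl
    have hred := hsep κ' hF' hk'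
    haveI : CompatibleSMul A' M κ' (ResidueField E) := ⟨fun r x y => by
      obtain ⟨s, a, hs, h, h'⟩ := key r
      obtain ⟨t, ht⟩ := hs.exists_right_inv
      have hx : x = s • (t • x) := by
        rw [← algebraMap_smul M s, smul_smul, ht, one_smul]
      have h2 : r • x = a • (t • x) := by
        rw [← h]; conv_lhs => rw [hx]
        rw [← algebraMap_smul M s, ← algebraMap_smul M s, smul_comm]
      rw [h2, smul_tmul, ← h', ← smul_tmul, ← hx]⟩
    haveI : CompatibleSMul M A' κ' (ResidueField E) := ⟨fun r x y => by
      rw [← algebraMap_smul M r x, ← algebraMap_smul M r y, smul_tmul]⟩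
    have e := (Algebra.TensorProduct.equivOfCompatibleSMul A' M A' κ' (ResidueField E)).toRingEquiv
    exact isReduced_of_injective e e.injective
end GN

namespace GN

theorem bad1 {R A' T L : Type u} {E : Type v} [CommRing R] [IsNoetherianRing R] [CommRing A'] [Algebra R A'] [Module.Finite R A']
    (p : Ideal R) [p.IsPrime] [CommRing T] [Algebra R T] (hT : CLoc.{u, v} p T)
    [CommRing E] [IsLocalRing E] [IsNoetherianRing E] [IsAdicComplete (maximalIdeal E) E]
    [Algebra R E] [Algebra A' E] [IsScalarTower R A' E] [Module.Flat A' E]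
    (hp : (maximalIdeal E).comap (algebraMap R E) = p)
    (hm : ((maximalIdeal E).comap (algebraMap A' E)).map (algebraMap A' E) = maximalIdeal E)
    (hsep : ∀ (κ' : Type u) [Field κ'] [Algebra A' κ'], FF A' κ' →
      RingHom.ker (algebraMap A' κ') = (maximalIdeal E).comap (algebraMap A' E) → IsReduced (κ' ⊗[A'] ResidueField E))
    [Field L] [Algebra A' L] [Algebra R L] [IsScalarTower R A' L] (hL : FF A' L) (hn : IsNormalRing (L ⊗[R] T)) :
    IsNormalRing (L ⊗[A'] E) := by
  obtain ⟨F, hF⟩ := hT.ext E (algebraMap R E) hp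
  haveI := hT.loc
  haveI := hT.noeth
  haveI := hT.complete
  letI : Algebra T E := F.toAlgebra
  haveI : IsScalarTower R T E := IsScalarTower.of_algebraMap_eq' hF.symm
  haveI : IsNoetherianRing A' := IsNoetherianRing.of_finite R A'
  letI : Algebra T (A' ⊗[R] T) := Algebra.TensorProduct.rightAlgebra
  haveI : Module.Finite T (A' ⊗[R] T) := Module.Finite.equiv (Algebra.TensorProduct.commRight R T A').toLinearEquiv
  let G : A' ⊗[R] T →ₐ[R] E := Algebra.TensorProduct.lift (IsScalarTower.toAlgHom R A' E) (IsScalarTower.toAlgHom R T E) (fun _ _ => Commute.all _ _)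
  letI : Algebra (A' ⊗[R] T) E := G.toRingHom.toAlgebra
  have hG : ∀ x, algebraMap (A' ⊗[R] T) E x = G x := fun x => rfl
  haveI : IsScalarTower T (A' ⊗[R] T) E := IsScalarTower.of_algebraMap_eq fun x => by
    rw [hG, Algebra.TensorProduct.right_algebraMap_apply]; simp [G]
  haveI : IsScalarTower A' (A' ⊗[R] T) E := IsScalarTower.of_algebraMap_eq fun x => by
    rw [hG, Algebra.TensorProduct.algebraMap_apply]; simp [G]
  haveI : IsScalarTower R T (A' ⊗[R] T) := Algebra.TensorProduct.right_isScalarTower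
  have hd : ∀ N (x : A' ⊗[R] T), ∃ (s : R) (a : A'), s ∉ p ∧
      algebraMap R (A' ⊗[R] T) s * x - algebraMap A' (A' ⊗[R] T) a ∈ ((p.map (algebraMap R A')).map (algebraMap A' (A' ⊗[R] T))) ^ N := by
    intro N x
    have hmap : (p.map (algebraMap R A')).map (algebraMap A' (A' ⊗[R] T)) = (maximalIdeal T).map (algebraMap T (A' ⊗[R] T)) := by
      rw [← hT.max, Ideal.map_map, Ideal.map_map, ← IsScalarTower.algebraMap_eq, ← IsScalarTower.algebraMap_eq]
    rw [hmap]
    induction x with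
    | zero => exact ⟨1, 0, p.primeCompl.one_mem, by simp⟩
    | tmul a t =>
      obtain ⟨r, g, hr, h⟩ := hT.dense N t
      refine ⟨r, algebraMap R A' g * a, hr, ?_⟩
      have : algebraMap R (A' ⊗[R] T) r * a ⊗ₜ[R] t - algebraMap A' (A' ⊗[R] T) (algebraMap R A' g * a) =
          algebraMap A' (A' ⊗[R] T) a * algebraMap T (A' ⊗[R] T) (algebraMap R T r * t - algebraMap R T g) := by
        have h1 : a ⊗ₜ[R] t = algebraMap A' (A' ⊗[R] T) a * algebraMap T (A' ⊗[R] T) t := by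
          rw [Algebra.TensorProduct.right_algebraMap_apply, Algebra.TensorProduct.algebraMap_apply]; simp
        rw [h1]
        simp only [map_sub, map_mul, ← IsScalarTower.algebraMap_apply]
        ring
      rw [this]
      refine Ideal.mul_mem_left _ _ ?_
      rw [← Ideal.map_pow]
      exact Ideal.mem_map_of_mem _ h
    | add x y hx hy =>
      obtain ⟨s, a, hs, h⟩ := hx
      obtain ⟨s', a', hs', h'⟩ := hy
      refine ⟨s * s', algebraMap R A' s' * a + algebraMap R A' s * a', p.primeCompl.mul_mem hs hs', ?_⟩
      have : algebraMap R (A' ⊗[R] T) (s * s') * (x + y) - algebraMap A' (A' ⊗[R] T) (algebraMap R A' s' * a + algebraMap R A' s * a') =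
        algebraMap R (A' ⊗[R] T) s' * (algebraMap R (A' ⊗[R] T) s * x - algebraMap A' (A' ⊗[R] T) a) +
        algebraMap R (A' ⊗[R] T) s * (algebraMap R (A' ⊗[R] T) s' * y - algebraMap A' (A' ⊗[R] T) a') := by
        simp only [map_add, map_mul, ← IsScalarTower.algebraMap_apply]
        ring
      rw [this]
      exact add_mem (Ideal.mul_mem_left _ _ h) (Ideal.mul_mem_left _ _ h')
  refine bad1_aux (T := T) (M := A' ⊗[R] T) (p.map (algebraMap R A')) ?_ ?_ hm ?_ hsep hL ?_
  · rw [Ideal.map_le_iff_le_comap, Ideal.comap_comap, ← IsScalarTower.algebraMap_eq, hp]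
  · rw [← hT.max, Ideal.map_map, ← IsScalarTower.algebraMap_eq, Ideal.map_le_iff_le_comap, hp]
  · intro n x
    obtain ⟨s, a, hs, h⟩ := hd n x
    refine ⟨algebraMap R A' s, a, ?_, ?_⟩
    · rw [← IsScalarTower.algebraMap_apply R A', IsScalarTower.algebraMap_apply R T (A' ⊗[R] T)]
      exact (hT.unit s hs).map _
    · rw [← IsScalarTower.algebraMap_apply R A']; exact h
  · have e : L ⊗[A'] (A' ⊗[R] T) ≃ₐ[A'] L ⊗[R] T := Algebra.TensorProduct.cancelBaseChange R A' A' L T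
    exact isNormalRing_of_ringEquiv e.symm.toRingEquiv hn
end GN

namespace GN

theorem normal_descent_tensor {A L E E' : Type*} [CommRing A] [CommRing L] [Algebra A L] [CommRing E] [CommRing E'] [Algebra A E]
    [Algebra A E'] [Algebra E E'] [IsScalarTower A E E'] [Module.FaithfullyFlat E E'] (h : IsNormalRing (L ⊗[A] E')) :
    IsNormalRing (L ⊗[A] E) := by
  have e3 : E ⊗[A] L ≃ₐ[A] L ⊗[A] E := Algebra.TensorProduct.comm _ _ _
  have e0 : (E ⊗[A] L) ⊗[E] E' ≃ₐ[E] E' ⊗[E] (E ⊗[A] L) := Algebra.TensorProduct.comm _ _ _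
  have e1 : E' ⊗[E] (E ⊗[A] L) ≃ₐ[E] E' ⊗[A] L := Algebra.TensorProduct.cancelBaseChange A E E E' L
  have e2 : E' ⊗[A] L ≃ₐ[A] L ⊗[A] E' := Algebra.TensorProduct.comm _ _ _
  refine isNormalRing_of_ringEquiv e3.toRingEquiv ?_
  refine IsNormalRing.descent (S := (E ⊗[A] L) ⊗[E] E') ?_
  exact isNormalRing_of_ringEquiv ((e0.trans e1).toRingEquiv.trans e2.toRingEquiv).symm h

theorem bad2 {A' L : Type u} {E : Type v} [CommRing A'] [IsDomain A'] [IsLocalRing A'] [IsNoetherianRing A']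
    [IsAdicComplete (maximalIdeal A') A']
    [CommRing E] [IsLocalRing E] [IsNoetherianRing E] [IsAdicComplete (maximalIdeal E) E]
    [Algebra A' E] [Module.Flat A' E]
    (hm : ((maximalIdeal E).comap (algebraMap A' E)).map (algebraMap A' E) = maximalIdeal E)
    (hsep : ∀ (κ' : Type u) [Field κ'] [Algebra A' κ'], FF A' κ' →
      RingHom.ker (algebraMap A' κ') = (maximalIdeal E).comap (algebraMap A' E) → IsReduced (κ' ⊗[A'] ResidueField E))
    [Field L] [Algebra A' L] (hinj : Function.Injective (algebraMap A' L)) (hL : FF A' L) :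
    IsNormalRing (L ⊗[A'] E) := by
  obtain ⟨p, C, hC⟩ := exists_coef (D := A') (fun q => by
    by_cases h : (q : A') = 0
    · exact Or.inl h
    · exact Or.inr (mem_nonZeroDivisors_of_ne_zero h))
  haveI := hC.isLocalRing
  haveI := hC.noeth
  haveI := hC.isDomain
  obtain ⟨n, F, S, c, -, -, hfin, hFi, hc, hP⟩ := hC.normalization ((maximalIdeal E).comap (algebraMap A' E))
  letI : Algebra (PS C n) A' := F.toAlgebra
  haveI : Module.Finite (PS C n) A' := hfin
  letI : Algebra (PS C n) E := Algebra.compHom E F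
  haveI : IsScalarTower (PS C n) A' E := IsScalarTower.of_algebraMap_eq fun x => rfl
  letI : Algebra (PS C n) L := Algebra.compHom L F
  haveI : IsScalarTower (PS C n) A' L := IsScalarTower.of_algebraMap_eq fun x => rfl
  haveI : (PI (Ideal.span {c}) S).IsPrime := PI_prime (hC.ndom_quot hc) S
  obtain ⟨T, _, _, hT⟩ := exists_cloc.{u, v} (R := PS C n) (PI (Ideal.span {c}) S)
  refine bad1 (R := PS C n) (PI (Ideal.span {c}) S) hT ?_ hm hsep hL ?_
  · rw [IsScalarTower.algebraMap_eq (PS C n) A' E, ← Ideal.comap_comap]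
    exact hP
  · haveI := hT.loc
    haveI := hT.noeth
    haveI := hT.flat
    refine thmI hC S c hT.max ?_ ?_ ?_ ?_
    · intro N t
      obtain ⟨r, g, hr, h⟩ := hT.dense N t
      exact ⟨r, g, hT.unit r hr, h⟩
    · intro N g hg
      obtain ⟨r, hr, h⟩ := hT.sat N g hg
      exact ⟨r, hT.unit r hr, h⟩
    · rw [IsScalarTower.algebraMap_eq (PS C n) A' L, RingHom.coe_comp]
      exact hinj.comp hFi
    · exact FF.of_finite hL

theorem bad3 {A' L : Type u} {E : Type v} [CommRing A'] [IsDomain A'] [IsLocalRing A'] [IsNoetherianRing A']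
    [IsAdicComplete (maximalIdeal A') A']
    [CommRing E] [IsLocalRing E] [IsNoetherianRing E]
    [Algebra A' E] [Module.Flat A' E]
    (hm : ((maximalIdeal E).comap (algebraMap A' E)).map (algebraMap A' E) = maximalIdeal E)
    (hsep : ∀ (κ' : Type u) [Field κ'] [Algebra A' κ'], FF A' κ' →
      RingHom.ker (algebraMap A' κ') = (maximalIdeal E).comap (algebraMap A' E) → IsReduced (κ' ⊗[A'] ResidueField E))
    [Field L] [Algebra A' L] (hinj : Function.Injective (algebraMap A' L)) (hL : FF A' L) :
    IsNormalRing (L ⊗[A'] E) := by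
  haveI : IsNoetherianRing (AdicCompletion (maximalIdeal E) E) := comp_noeth _
  haveI : Module.FaithfullyFlat E (AdicCompletion (maximalIdeal E) E) := Module.FaithfullyFlat.of_flat_of_isLocalHom
  haveI : IsScalarTower A' E (AdicCompletion (maximalIdeal E) E) := inferInstance
  haveI : Module.Flat A' (AdicCompletion (maximalIdeal E) E) := Module.Flat.trans A' E _
  have hc : (maximalIdeal (AdicCompletion (maximalIdeal E) E)).comap (algebraMap E (AdicCompletion (maximalIdeal E) E)) = maximalIdeal E :=
    IsLocalRing.maximalIdeal_comap _
  have hc' : (maximalIdeal (AdicCompletion (maximalIdeal E) E)).comap (algebraMap A' (AdicCompletion (maximalIdeal E) E)) =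
    (maximalIdeal E).comap (algebraMap A' E) := by
    rw [IsScalarTower.algebraMap_eq A' E, ← Ideal.comap_comap, hc]
  refine normal_descent_tensor (E' := AdicCompletion (maximalIdeal E) E) (bad2 ?_ ?_ hinj hL)
  · rw [hc', IsScalarTower.algebraMap_eq A' E, ← Ideal.map_map, hm, ← AdicCompletion.maximalIdeal_eq_map]
  · intro κ' _ _ hF hk
    rw [hc'] at hk
    have := hsep κ' hF hk
    let g : ResidueField E →ₐ[A'] ResidueField (AdicCompletion (maximalIdeal E) E) :=
      { IsLocalRing.ResidueField.map (algebraMap E (AdicCompletion (maximalIdeal E) E)) with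
        commutes' := fun r => rfl }
    have e2 : ResidueField E ≃ₐ[A'] ResidueField (AdicCompletion (maximalIdeal E) E) :=
      AlgEquiv.ofBijective g (AdicCompletion.residueField_map_bijective E)
    have e3 : κ' ⊗[A'] ResidueField E ≃ₐ[A'] κ' ⊗[A'] ResidueField (AdicCompletion (maximalIdeal E) E) :=
      Algebra.TensorProduct.congr AlgEquiv.refl e2
    exact isReduced_of_injective e3.symm e3.symm.injective
end GN

namespace GN

theorem ndom_at_of_loc {E N : Type*} [CommRing E] [CommRing N] [Algebra E N] (M : Submonoid E) [IsLocalization M N]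
    (q : Ideal E) [q.IsPrime] (hd : Disjoint (M : Set E) q) (h : IsNormalRing N) : NDom (Localization.AtPrime q) := by
  have hq := IsLocalization.comap_map_of_isPrime_disjoint M N (I := q) inferInstance hd
  haveI : (q.map (algebraMap E N)).IsPrime := IsLocalization.isPrime_of_isPrime_disjoint M N q inferInstance hd
  generalize hQ : q.map (algebraMap E N) = Q at *
  have := IsLocalization.isLocalization_isLocalization_atPrime_isLocalization M (Localization.AtPrime Q) Q
  subst hq
  exact NDom.of_equiv (IsLocalization.algEquiv (Q.comap (algebraMap E N)).primeCompl (Localization.AtPrime Q) (Localization.AtPrime (Q.comap (algebraMap E N)))).toRingEquiv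
    (h Q inferInstance)

theorem ndom_at_of_le {E : Type*} [CommRing E] {q P : Ideal E} [q.IsPrime] [P.IsPrime] (hle : q ≤ P)
    (h : NDom (Localization.AtPrime P)) : NDom (Localization.AtPrime q) := by
  refine ndom_at_of_loc (N := Localization.AtPrime P) P.primeCompl q ?_ h.isNormalRing
  rw [Set.disjoint_left]
  exact fun x hx hx' => hx (hle hx')

theorem ndom_at_of_tensor_frac {V L E : Type*} [CommRing V] [IsDomain V] [Field L] [Algebra V L] [IsFractionRing V L] [CommRing E]
    [Algebra V E] (h : IsNormalRing (L ⊗[V] E)) (q : Ideal E) [q.IsPrime] (hq : q.under V = ⊥) : NDom (Localization.AtPrime q) := by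
  letI : Algebra E (L ⊗[V] E) := Algebra.TensorProduct.rightAlgebra
  haveI : IsLocalization (Algebra.algebraMapSubmonoid E (nonZeroDivisors V)) (L ⊗[V] E) := IsLocalization.tensorRight L (nonZeroDivisors V)
  refine ndom_at_of_loc (N := L ⊗[V] E) (Algebra.algebraMapSubmonoid E (nonZeroDivisors V)) q ?_ h
  rw [Set.disjoint_left]
  rintro x ⟨y, hy, rfl⟩ hx
  have : y ∈ q.under V := hx
  rw [hq] at this
  exact nonZeroDivisors.ne_zero hy this

theorem normal_tensor_frac {V L E : Type*} [CommRing V] [IsDomain V] [Field L] [Algebra V L] [IsFractionRing V L] [CommRing E]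
    [Algebra V E] [IsNoetherianRing E]
    (h : ∀ (q : Ideal E) [q.IsPrime], q.under V = ⊥ → Dep1 (Localization.AtPrime q) → NDom (Localization.AtPrime q)) :
    IsNormalRing (L ⊗[V] E) := by
  letI : Algebra E (L ⊗[V] E) := Algebra.TensorProduct.rightAlgebra
  haveI : IsLocalization (Algebra.algebraMapSubmonoid E (nonZeroDivisors V)) (L ⊗[V] E) := IsLocalization.tensorRight L (nonZeroDivisors V)
  haveI : IsNoetherianRing (L ⊗[V] E) :=
    IsLocalization.isNoetherianRing (Algebra.algebraMapSubmonoid E (nonZeroDivisors V)) _ inferInstance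
  refine isNormalRing_of_dep1 _ fun Q _ hd => ?_
  have := IsLocalization.isLocalization_isLocalization_atPrime_isLocalization (Algebra.algebraMapSubmonoid E (nonZeroDivisors V))
    (Localization.AtPrime Q) Q
  have e := (IsLocalization.algEquiv (Q.comap (algebraMap E (L ⊗[V] E))).primeCompl (Localization.AtPrime Q) (Localization.AtPrime (Q.comap (algebraMap E (L ⊗[V] E))))).toRingEquiv
  refine NDom.of_equiv e.symm (h _ ?_ (hd.of_equiv e))
  refine (Submodule.eq_bot_iff _).2 fun v hv => ?_
  by_contra h0
  have h1 : algebraMap E (L ⊗[V] E) (algebraMap V E v) ∈ Q := hv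
  have h2 : IsUnit (algebraMap E (L ⊗[V] E) (algebraMap V E v)) :=
    IsLocalization.map_units (L ⊗[V] E) (⟨algebraMap V E v, v, mem_nonZeroDivisors_of_ne_zero h0, rfl⟩ : Algebra.algebraMapSubmonoid E (nonZeroDivisors V))
  exact (‹Q.IsPrime›).ne_top (Ideal.eq_top_of_isUnit_mem _ h1 h2)

end GN

namespace GN

/-- the localization of `V` at the contraction of `P` has nonzero principal maximal ideal -/
def PrinAt {V : Type*} [CommRing V] (p : Ideal V) [p.IsPrime] : Prop :=
  ∃ π : Localization.AtPrime p, π ≠ 0 ∧ maximalIdeal (Localization.AtPrime p) = Ideal.span {π}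

section
variable {V B : Type*} [CommRing V] [IsDomain V] [IsNoetherianRing V] [CommRing B] [IsNoetherianRing B] [Algebra V B] [Module.Flat V B]

theorem prinAt_of_ass (hV : NDom V) (P : Ideal B) [P.IsPrime] {t : V} (ht : t ≠ 0) (h : AssMod P (Ideal.span {algebraMap V B t})) :
    PrinAt (P.under V) := by
  obtain ⟨_, h1, h2, h3⟩ := exists_flat_localization (R := V) P
  have : IsNoetherianRing (Localization.AtPrime (P.under V)) :=
    IsLocalization.isNoetherianRing (P.under V).primeCompl _ inferInstance
  have h4 := h.localization P le_rfl (Localization.AtPrime P)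
  rw [Localization.AtPrime.map_eq_maximalIdeal, Ideal.map_span, Set.image_singleton, ← IsScalarTower.algebraMap_apply,
    IsScalarTower.algebraMap_apply V (Localization.AtPrime (P.under V)), ← Set.image_singleton, ← Ideal.map_span] at h4
  refine principal_of_assMod (hV.localization _) (t := algebraMap V _ t) ?_ (flatAss_base h4)
  exact fun h0 => ht ((IsLocalization.injective (Localization.AtPrime (P.under V)) (P.under V).primeCompl_le_nonZeroDivisors) (by simpa using h0))

theorem ndom_of_prinAt (hV : NDom V) (P : Ideal B) [P.IsPrime] (hF : IsNormalRing ((P.under V).Fiber B)) (h : PrinAt (P.under V)) :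
    NDom (Localization.AtPrime P) := by
  obtain ⟨_, h1, h2, h3⟩ := exists_flat_localization (R := V) P
  have : IsNoetherianRing (Localization.AtPrime P) :=
    IsLocalization.isNoetherianRing P.primeCompl _ inferInstance
  obtain ⟨π, h0, hπ⟩ := h
  have h5 := ndom_fiber_local P hF
  rw [Ideal.map_map, ← IsScalarTower.algebraMap_eq, IsScalarTower.algebraMap_eq V (Localization.AtPrime (P.under V)), ← Ideal.map_map,
    Localization.AtPrime.map_eq_maximalIdeal, hπ, Ideal.map_span, Set.image_singleton] at h5
  refine ndom_of_cut (u := algebraMap _ _ π) ?_ ?_ h5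
  · rw [IsLocalRing.mem_maximalIdeal, map_mem_nonunits_iff, ← IsLocalRing.mem_maximalIdeal, hπ]
    exact Ideal.mem_span_singleton_self π
  · exact flat_nzd (mem_nonZeroDivisors_of_ne_zero h0)

theorem exists_min_over {q : Ideal B} {P0 : Ideal B} [P0.IsPrime] (hq : q ≤ P0) {t : B} (ht : t ∈ P0) :
    ∃ P, P ∈ (q ⊔ Ideal.span {t}).minimalPrimes := by
  obtain ⟨P, hP, -⟩ := Ideal.exists_minimalPrimes_le (I := q ⊔ Ideal.span {t}) (J := P0)
    (sup_le hq ((Ideal.span_singleton_le_iff_mem _).2 ht))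
  exact ⟨P, hP⟩

/-- depth zero -/
theorem field_of_ass (hV : NDom V) [IsLocalRing V] (hnf : maximalIdeal V ≠ ⊥)
    (hjac : (maximalIdeal V).map (algebraMap V B) ≤ Ideal.jacobson ⊥)
    (hF : ∀ (P : Ideal B) [P.IsPrime], P.under V ≠ ⊥ → IsNormalRing ((P.under V).Fiber B))
    (q : Ideal B) [q.IsPrime] (hq : AssMod q ⊥) : maximalIdeal (Localization.AtPrime q) = ⊥ := by
  obtain ⟨P0, hP0, hqP0⟩ := Ideal.exists_le_maximal q (Ideal.IsPrime.ne_top inferInstance)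
  obtain ⟨t, ht, ht0⟩ := Submodule.exists_mem_ne_zero_of_ne_bot hnf
  have htP : algebraMap V B t ∈ P0 := by
    have := hjac (Ideal.mem_map_of_mem _ ht)
    rw [Ideal.jacobson] at this
    exact (Submodule.mem_sInf.1 this) P0 ⟨bot_le, hP0⟩
  obtain ⟨P, hP⟩ := exists_min_over hqP0 htP
  haveI : P.IsPrime := hP.1.1
  have hreg : algebraMap V B t ∈ nonZeroDivisors B := flat_nzd (mem_nonZeroDivisors_of_ne_zero ht0)
  have h1 := hq.lift (u := algebraMap V B t) (fun x hx => by
    rw [Ideal.mem_bot] at hx ⊢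
    rw [mul_comm] at hx
    exact (mem_nonZeroDivisors_iff_right.1 hreg) x hx) hP
  rw [bot_sup_eq] at h1
  have hqP : q ≤ P := le_sup_left.trans hP.1.2
  have htP : t ∈ P.under V := hP.1.2 (Ideal.mem_sup_right (Ideal.mem_span_singleton_self _))
  have h2 := ndom_of_prinAt hV P (hF P fun h => ht0 (by rw [h] at htP; exact htP)) (prinAt_of_ass hV P ht0 h1)
  haveI := h2.1
  -- an element of q dies in `B_P`
  obtain ⟨-, x, hx⟩ := hq
  rw [eq_bot_iff, ← Localization.AtPrime.map_eq_maximalIdeal, Ideal.map_le_iff_le_comap]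
  intro y hy
  have h3 : y * x = 0 := (hx y).1 hy
  have hx0 : algebraMap B (Localization.AtPrime P) x ≠ 0 := by
    intro h0
    obtain ⟨m, hm⟩ := (IsLocalization.map_eq_zero_iff P.primeCompl (Localization.AtPrime P) x).1 h0
    exact m.2 (hqP ((hx _).2 hm))
  have h4 : algebraMap B (Localization.AtPrime P) y = 0 := by
    have := congrArg (algebraMap B (Localization.AtPrime P)) h3
    rw [map_mul, map_zero] at this
    exact (mul_eq_zero.1 this).resolve_right hx0
  obtain ⟨m, hm⟩ := (IsLocalization.map_eq_zero_iff P.primeCompl (Localization.AtPrime P) y).1 h4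
  rw [Ideal.mem_comap, Ideal.mem_bot, IsLocalization.map_eq_zero_iff q.primeCompl]
  exact ⟨⟨m.1, fun h => m.2 (hqP h)⟩, hm⟩
end
end GN

namespace GN

theorem ass_swap {E : Type*} [CommRing E] [IsLocalRing E] {s t u : E} (hs : s ∈ nonZeroDivisors E)
    (hts : ∀ x, t * x ∈ Ideal.span {s} → x ∈ Ideal.span {s}) (hut : ∀ x, u * x ∈ Ideal.span {t} → x ∈ Ideal.span {t})
    (hu : u ∈ maximalIdeal E)
    (h : AssMod (maximalIdeal E) (Ideal.span {s} ⊔ Ideal.span {t})) :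
    AssMod (maximalIdeal E) (Ideal.span {t} ⊔ Ideal.span {u}) := by
  rw [assMod_max_iff] at h ⊢
  have key : ∀ a b x : E, x ∈ Ideal.span {a} ⊔ Ideal.span {b} ↔ ∃ y z, x = a * y + b * z := by
    intro a b x
    rw [← Ideal.span_union, Set.singleton_union, Ideal.mem_span_pair]
    constructor
    · rintro ⟨y, z, h⟩; exact ⟨y, z, by rw [← h]; ring⟩
    · rintro ⟨y, z, h⟩; exact ⟨y, z, by rw [h]; ring⟩
  have hst : ∀ x, s * x ∈ Ideal.span {t} → x ∈ Ideal.span {t} := by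
    intro x hx
    obtain ⟨y, hy⟩ := Ideal.mem_span_singleton.1 hx
    obtain ⟨z, hz⟩ := Ideal.mem_span_singleton.1 (hts y (Ideal.mem_span_singleton.2 ⟨x, hy.symm⟩))
    have : s * (x - t * z) = 0 := by rw [mul_sub, hy, hz]; ring
    have h0 := (mem_nonZeroDivisors_iff_right.1 hs) (x - t * z) (by rw [mul_comm]; exact this)
    exact Ideal.mem_span_singleton.2 ⟨z, sub_eq_zero.1 h0⟩
  obtain ⟨x, hx, hm⟩ := h
  obtain ⟨y, z, hyz⟩ := (key _ _ _).1 (hm u hu)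
  refine ⟨y, fun hy => ?_, fun w hw => ?_⟩
  · obtain ⟨c, a, hca⟩ := (key _ _ _).1 hy
    have h1 : u * (x - s * a) ∈ Ideal.span {t} := Ideal.mem_span_singleton.2 ⟨s * c + z, by
      rw [mul_sub, hyz, hca]; ring⟩
    obtain ⟨d, hd⟩ := Ideal.mem_span_singleton.1 (hut _ h1)
    exact hx ((key _ _ _).2 ⟨a, d, by rw [← hd]; ring⟩)
  · obtain ⟨b, c, hbc⟩ := (key _ _ _).1 (hm w hw)
    have h1 : s * (w * y - u * b) ∈ Ideal.span {t} := Ideal.mem_span_singleton.2 ⟨u * c - w * z, by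
      have : s * (w * y) = w * (u * x) - w * (t * z) := by rw [hyz]; ring
      rw [mul_sub, this]
      have : w * (u * x) = u * (s * b + t * c) := by rw [← hbc]; ring
      rw [this]; ring⟩
    obtain ⟨d, hd⟩ := Ideal.mem_span_singleton.1 (hst _ h1)
    exact (key _ _ _).2 ⟨d, b, by rw [← hd]; ring⟩

section
variable {V B : Type*} [CommRing V] [IsDomain V] [IsNoetherianRing V] [CommRing B] [IsNoetherianRing B] [Algebra V B] [Module.Flat V B]

theorem bad_point (hV : NDom V) (P : Ideal B) [P.IsPrime] (hF : IsNormalRing ((P.under V).Fiber B))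
    (hnp : ¬ PrinAt (P.under V)) {t : V} (ht : t ≠ 0) {s : B} (hs : s ∈ nonZeroDivisors B)
    (hts : ∀ x, algebraMap V B t * x ∈ Ideal.span {s} → x ∈ Ideal.span {s})
    (h : AssMod P (Ideal.span {s} ⊔ Ideal.span {algebraMap V B t})) :
    (P.under V).map (algebraMap V (Localization.AtPrime P)) = maximalIdeal (Localization.AtPrime P) := by
  obtain ⟨_, h1, h2, h3⟩ := exists_flat_localization (R := V) P
  have : IsNoetherianRing (Localization.AtPrime P) :=
    IsLocalization.isNoetherianRing P.primeCompl _ inferInstance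
  have : IsNoetherianRing (Localization.AtPrime (P.under V)) :=
    IsLocalization.isNoetherianRing (P.under V).primeCompl _ inferInstance
  have ht0 : algebraMap V (Localization.AtPrime (P.under V)) t ≠ 0 := fun h0 =>
    ht ((IsLocalization.injective (Localization.AtPrime (P.under V)) (P.under V).primeCompl_le_nonZeroDivisors) (by simpa using h0))
  obtain ⟨u, hu, hur⟩ := exists_regular (Ideal.span {algebraMap V (Localization.AtPrime (P.under V)) t}) (maximalIdeal _) (fun Q hQ hle => by
    refine hnp (principal_of_assMod (hV.localization _) ht0 ?_)
    rwa [(IsLocalRing.maximalIdeal.isMaximal _).eq_of_le hQ.1.ne_top hle])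
  have hsE : algebraMap B (Localization.AtPrime P) s ∈ nonZeroDivisors (Localization.AtPrime P) := flat_nzd hs
  have htt : algebraMap V (Localization.AtPrime P) t = algebraMap B (Localization.AtPrime P) (algebraMap V B t) :=
    IsScalarTower.algebraMap_apply _ _ _ _
  have htt' : algebraMap V (Localization.AtPrime P) t = algebraMap (Localization.AtPrime (P.under V)) (Localization.AtPrime P) (algebraMap _ _ t) :=
    IsScalarTower.algebraMap_apply _ _ _ _
  have htsE : ∀ x, algebraMap V (Localization.AtPrime P) t * x ∈ Ideal.span {algebraMap B (Localization.AtPrime P) s} →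
      x ∈ Ideal.span {algebraMap B (Localization.AtPrime P) s} := by
    intro x hx
    have := regular_localization hts P.primeCompl (Localization.AtPrime P) x
    rw [Ideal.map_span, Set.image_singleton, ← htt] at this
    exact this hx
  have hutE : ∀ x, algebraMap (Localization.AtPrime (P.under V)) (Localization.AtPrime P) u * x ∈ Ideal.span {algebraMap V (Localization.AtPrime P) t} →
      x ∈ Ideal.span {algebraMap V (Localization.AtPrime P) t} := by
    intro x hx
    have := flat_regular (T := Localization.AtPrime P) hur x
    rw [Ideal.map_span, Set.image_singleton, ← htt'] at this
    exact this hx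
  have huE : algebraMap (Localization.AtPrime (P.under V)) (Localization.AtPrime P) u ∈ maximalIdeal (Localization.AtPrime P) := by
    rw [IsLocalRing.mem_maximalIdeal, map_mem_nonunits_iff]; exact hu
  have h4 := h.localization P le_rfl (Localization.AtPrime P)
  rw [Localization.AtPrime.map_eq_maximalIdeal, Ideal.map_sup, Ideal.map_span, Ideal.map_span, Set.image_singleton, Set.image_singleton, ← htt] at h4
  have h5 := ass_swap hsE htsE hutE huE h4
  rw [htt', ← Set.image_singleton, ← Set.image_singleton (f := algebraMap _ _) (a := u), ← Ideal.map_span, ← Ideal.map_span, ← Ideal.map_sup] at h5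
  have h6 := flatAss_fiber h5
  have h7 := ndom_fiber_local P hF
  rw [Ideal.map_map, ← IsScalarTower.algebraMap_eq, IsScalarTower.algebraMap_eq V (Localization.AtPrime (P.under V)), ← Ideal.map_map,
    Localization.AtPrime.map_eq_maximalIdeal] at h7
  rw [IsScalarTower.algebraMap_eq V (Localization.AtPrime (P.under V)), ← Ideal.map_map,
    Localization.AtPrime.map_eq_maximalIdeal]
  exact (eq_max_of_ass_fiber h7.1 h6).symm
end
end GN

namespace GN

theorem normal_reduced {R : Type*} [CommRing R] (h : IsNormalRing R) : IsReduced R :=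
  isReduced_ofLocalizationMaximal R fun P hP => by
    haveI := (h P inferInstance).1
    infer_instance

theorem sep_at {V B κ' : Type*} [CommRing V] [CommRing B] [Algebra V B] (P : Ideal B) [P.IsPrime] [Field κ'] [Algebra V κ']
    (hN : IsNormalRing (κ' ⊗[V] B)) (hk : RingHom.ker (algebraMap V κ') = P.under V)
    (hm : (P.under V).map (algebraMap V (Localization.AtPrime P)) = maximalIdeal (Localization.AtPrime P)) :
    IsReduced (κ' ⊗[V] ResidueField (Localization.AtPrime P)) := by
  have e3 : B ⊗[V] κ' ≃ₐ[V] κ' ⊗[V] B := Algebra.TensorProduct.comm _ _ _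
  have e1 : (Localization.AtPrime P) ⊗[B] (B ⊗[V] κ') ≃ₐ[B] (Localization.AtPrime P) ⊗[V] κ' :=
    Algebra.TensorProduct.cancelBaseChange V B B (Localization.AtPrime P) κ'
  have e2 : (Localization.AtPrime P) ⊗[V] κ' ≃ₐ[V] κ' ⊗[V] (Localization.AtPrime P) := Algebra.TensorProduct.comm _ _ _
  letI : Algebra (B ⊗[V] κ') ((Localization.AtPrime P) ⊗[B] (B ⊗[V] κ')) := Algebra.TensorProduct.rightAlgebra
  haveI : IsLocalization (Algebra.algebraMapSubmonoid (B ⊗[V] κ') P.primeCompl) ((Localization.AtPrime P) ⊗[B] (B ⊗[V] κ')) :=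
    IsLocalization.tensorRight _ _
  have h1 : IsNormalRing ((Localization.AtPrime P) ⊗[B] (B ⊗[V] κ')) :=
    isNormalRing_of_isLocalization (Algebra.algebraMapSubmonoid (B ⊗[V] κ') P.primeCompl) _ (isNormalRing_of_ringEquiv e3.symm.toRingEquiv hN)
  have h2 := isNormalRing_of_ringEquiv (e1.toRingEquiv.trans e2.toRingEquiv) h1
  have h3 := normal_reduced h2
  let g : Localization.AtPrime P →ₐ[V] ResidueField (Localization.AtPrime P) := IsScalarTower.toAlgHom V _ _
  have hg : Function.Surjective g := IsLocalRing.residue_surjective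
  have hker := Algebra.TensorProduct.lTensor_ker (A := κ') g hg
  have hgk : RingHom.ker g = maximalIdeal (Localization.AtPrime P) := IsLocalRing.ker_residue
  rw [hgk, ← hm] at hker
  have hbot : Ideal.map ((Algebra.TensorProduct.includeRight : Localization.AtPrime P →ₐ[V] κ' ⊗[V] Localization.AtPrime P).toRingHom.comp
      (algebraMap V (Localization.AtPrime P))) (P.under V) = ⊥ := by
    rw [eq_bot_iff, Ideal.map_le_iff_le_comap]
    intro x hx
    rw [← hk, RingHom.mem_ker] at hx
    rw [Ideal.mem_comap, Ideal.mem_bot]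
    have : (1 : κ') ⊗ₜ[V] (algebraMap V (Localization.AtPrime P) x) = 0 := by
      rw [Algebra.algebraMap_eq_smul_one, ← smul_tmul, ← Algebra.algebraMap_eq_smul_one, hx, zero_tmul]
    exact this
  have hker' : RingHom.ker (Algebra.TensorProduct.map (AlgHom.id V κ') g) = ⊥ := hker.trans ((Ideal.map_map _ _).trans hbot)
  have hb : Function.Bijective (Algebra.TensorProduct.map (AlgHom.id V κ') g) :=
    ⟨(RingHom.injective_iff_ker_eq_bot _).2 hker', TensorProduct.map_surjective Function.surjective_id hg⟩
  have e := AlgEquiv.ofBijective _ hb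
  exact isReduced_of_injective e.symm e.symm.injective

theorem PrinAt.ne_bot {V : Type*} [CommRing V] [IsDomain V] {p : Ideal V} [p.IsPrime] (h : PrinAt p) : p ≠ ⊥ := by
  obtain ⟨π, h0, hπ⟩ := h
  rintro rfl
  rw [← Localization.AtPrime.map_eq_maximalIdeal, Ideal.map_bot] at hπ
  exact h0 (Ideal.span_singleton_eq_bot.1 hπ.symm)

theorem PrinAt.congr {V : Type*} [CommRing V] {p p' : Ideal V} [p.IsPrime] [p'.IsPrime] (e : p = p') (h : PrinAt p) : PrinAt p' := by
  subst e; exact h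

theorem core {V L : Type u} {B : Type v} [CommRing V] [IsDomain V] [IsLocalRing V] [IsNoetherianRing V]
    [IsAdicComplete (maximalIdeal V) V] (hV : NDom V) [CommRing B] [IsNoetherianRing B] [Algebra V B] [Module.Flat V B]
    (hnf : maximalIdeal V ≠ ⊥) (hjac : (maximalIdeal V).map (algebraMap V B) ≤ Ideal.jacobson ⊥)
    (hF : ∀ (κ' : Type u) [Field κ'] [Algebra V κ'], FF V κ' → RingHom.ker (algebraMap V κ') ≠ ⊥ → IsNormalRing (κ' ⊗[V] B))
    [Field L] [Algebra V L] [IsFractionRing V L] : IsNormalRing (L ⊗[V] B) := by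
  classical
  have hF' : ∀ (P : Ideal B) [P.IsPrime], P.under V ≠ ⊥ → IsNormalRing ((P.under V).Fiber B) := by
    intro P _ hP
    refine hF _ (FF.of_resField (P.under V)) ?_
    rwa [Ideal.ker_algebraMap_residueField]
  have hLF : FF V L := FF.of_localization (A₁ := L) FF.of_field fun x => by
    obtain ⟨⟨b, a⟩, h⟩ := IsLocalization.surj (nonZeroDivisors V) x
    refine ⟨a, b, ?_, by rw [mul_comm]; exact h⟩
    exact (IsLocalization.map_units L a).ne_zero
  have hLi : Function.Injective (algebraMap V L) := IsFractionRing.injective V L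
  refine normal_tensor_frac fun q _ hq0 hd => ?_
  have : IsNoetherianRing (Localization.AtPrime q) :=
    IsLocalization.isNoetherianRing q.primeCompl _ inferInstance
  by_cases hq : AssMod q ⊥
  · exact ndom_of_max_bot (field_of_ass hV hnf hjac hF' q hq)
  rcases hd with hd | ⟨s₀, hs₀, hd⟩
  · exact absurd (AssMod.of_localization (Localization.AtPrime q) (by rwa [Ideal.map_bot])) hq
  obtain ⟨s, hsq, hs⟩ := exists_regular (⊥ : Ideal B) q (fun Q hQ hle => by
    haveI := hQ.1
    have h1 := field_of_ass hV hnf hjac hF' Q hQ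
    have : Q ≤ q := by
      intro y hy
      have h2 : algebraMap B (Localization.AtPrime Q) y = 0 := by
        have : algebraMap B (Localization.AtPrime Q) y ∈ maximalIdeal (Localization.AtPrime Q) := by
          rw [← Localization.AtPrime.map_eq_maximalIdeal]; exact Ideal.mem_map_of_mem _ hy
        rwa [h1] at this
      obtain ⟨m, hm⟩ := (IsLocalization.map_eq_zero_iff Q.primeCompl (Localization.AtPrime Q) y).1 h2
      exact ((‹q.IsPrime›).mem_or_mem (hm ▸ q.zero_mem : m.1 * y ∈ q)).resolve_left fun h => m.2 (hle h)
    exact hq (le_antisymm this hle ▸ hQ))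
  have hs : s ∈ nonZeroDivisors B := by
    rw [mem_nonZeroDivisors_iff_right]
    intro x hx
    exact hs x (by rw [mul_comm]; exact hx)
  have hqs : AssMod q (Ideal.span {s}) := by
    refine AssMod.of_localization (Localization.AtPrime q) ?_
    rw [Ideal.map_span, Set.image_singleton]
    refine hd.change hs₀ (flat_nzd hs) ?_
    rw [← Localization.AtPrime.map_eq_maximalIdeal]; exact Ideal.mem_map_of_mem _ hsq
  by_cases hex : ∃ (P : Ideal B) (_ : P.IsPrime), q ≤ P ∧ PrinAt (P.under V)
  · obtain ⟨P, _, hqP, hP⟩ := hex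
    exact ndom_at_of_le hqP (ndom_of_prinAt hV P (hF' P hP.ne_bot) hP)
  obtain ⟨P0, hP0, hqP0⟩ := Ideal.exists_le_maximal q (Ideal.IsPrime.ne_top inferInstance)
  have hP0V : P0.under V = maximalIdeal V := by
    refine ((IsLocalRing.maximalIdeal.isMaximal V).eq_of_le (Ideal.IsPrime.ne_top inferInstance) ?_).symm
    intro t ht
    have := hjac (Ideal.mem_map_of_mem _ ht)
    rw [Ideal.jacobson] at this
    exact (Submodule.mem_sInf.1 this) P0 ⟨bot_le, hP0⟩
  let F : Finset (Ideal V) := ((assMod_finite (Ideal.span {s})).toFinset.image (fun Q => Q.under V)).filter (fun p => p ≠ ⊥)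
  have hFm : ∀ p, p ∈ F ↔ (∃ Q, AssMod Q (Ideal.span {s}) ∧ Q.under V = p) ∧ p ≠ ⊥ := by
    intro p; simp [F]
  obtain ⟨t, htm, ht0, htF⟩ := exists_regular' (⊥ : Ideal V) (maximalIdeal V) F (fun p hp => by
      obtain ⟨⟨Q, hQ, rfl⟩, -⟩ := (hFm p).1 hp
      haveI := hQ.1
      infer_instance) (fun Q hQ hle => by
      obtain ⟨hQp, x, hx⟩ := hQ
      have hx0 : x ≠ 0 := by
        rintro rfl
        exact hQp.ne_top ((Ideal.eq_top_iff_one _).2 ((hx 1).2 (by simp)))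
      apply hnf
      rw [eq_bot_iff]
      intro y hy
      have := (hx y).1 (hle hy)
      exact (mul_eq_zero.1 this).resolve_right hx0) (fun p hp hle => by
      obtain ⟨⟨Q, hQ, rfl⟩, hne⟩ := (hFm p).1 hp
      haveI := hQ.1
      obtain ⟨t, ht, ht0⟩ := Submodule.exists_mem_ne_zero_of_ne_bot hne
      have h1 : AssMod Q (Ideal.span {algebraMap V B t}) :=
        hQ.change hs (flat_nzd (mem_nonZeroDivisors_of_ne_zero ht0)) ht
      have h2 := prinAt_of_ass hV Q ht0 h1
      have h3 : Q.under V = P0.under V := by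
        rw [hP0V]
        exact ((IsLocalRing.maximalIdeal.isMaximal V).eq_of_le (Ideal.IsPrime.ne_top inferInstance) hle).symm
      exact hex ⟨P0, hP0.isPrime, hqP0, h2.congr h3⟩)
  have ht0 : t ≠ 0 := by
    rintro rfl
    have := ht0 1 (by simp)
    simp at this
  have hts : ∀ x, algebraMap V B t * x ∈ Ideal.span {s} → x ∈ Ideal.span {s} := by
    intro x hx
    by_contra hx'
    obtain ⟨Q, hQ, h⟩ := exists_assMod _ x hx'
    have h1 : t ∈ Q.under V := h _ hx
    refine htF (Q.under V) ((hFm _).2 ⟨⟨Q, hQ, rfl⟩, ?_⟩) h1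
    intro h0
    rw [h0] at h1
    exact ht0 h1
  obtain ⟨P, hP⟩ := exists_min_over hqP0 (t := algebraMap V B t) (by rw [← hP0V] at htm; exact htm)
  haveI : P.IsPrime := hP.1.1
  have hqP : q ≤ P := le_sup_left.trans hP.1.2
  have htP : t ∈ P.under V := hP.1.2 (Ideal.mem_sup_right (Ideal.mem_span_singleton_self _))
  have hne : P.under V ≠ ⊥ := fun h => ht0 (by rw [h] at htP; exact htP)
  have hm := bad_point hV P (hF' P hne) (fun h => hex ⟨P, inferInstance, hqP, h⟩) ht0 hs hts (hqs.lift hts hP)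
  have : IsNoetherianRing (Localization.AtPrime P) :=
    IsLocalization.isNoetherianRing P.primeCompl _ inferInstance
  haveI : Module.Flat V (Localization.AtPrime P) := Module.Flat.trans V B _
  have hc : (maximalIdeal (Localization.AtPrime P)).comap (algebraMap V (Localization.AtPrime P)) = P.under V := by
    rw [IsScalarTower.algebraMap_eq V B, ← Ideal.comap_comap]
    exact congrArg (Ideal.comap (algebraMap V B)) Localization.AtPrime.comap_maximalIdeal
  have hbad : IsNormalRing (L ⊗[V] Localization.AtPrime P) := by
    refine bad3 (by rw [hc, hm]) (fun κ' _ _ hκ hk => ?_) hLi hLF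
    rw [hc] at hk
    exact sep_at P (hF κ' hκ (by rwa [hk])) hk hm
  -- `B_q` is a localization of `B_P` at a prime lying over zero
  have hdis : Disjoint (P.primeCompl : Set B) q := by
    rw [Set.disjoint_left]
    exact fun x hx hx' => hx (hqP hx')
  have hq' := IsLocalization.comap_map_of_isPrime_disjoint P.primeCompl (Localization.AtPrime P) (I := q) inferInstance hdis
  haveI : (q.map (algebraMap B (Localization.AtPrime P))).IsPrime :=
    IsLocalization.isPrime_of_isPrime_disjoint P.primeCompl (Localization.AtPrime P) q inferInstance hdis
  have h8 := ndom_at_of_tensor_frac hbad (q.map (algebraMap B (Localization.AtPrime P))) (by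
    rw [Ideal.under, IsScalarTower.algebraMap_eq V B, ← Ideal.comap_comap]; exact (congrArg (Ideal.comap (algebraMap V B)) hq').trans hq0)
  generalize q.map (algebraMap B (Localization.AtPrime P)) = Q at *
  have h9 := IsLocalization.isLocalization_isLocalization_atPrime_isLocalization P.primeCompl (Localization.AtPrime Q) Q
  subst hq'
  exact NDom.of_equiv (IsLocalization.algEquiv (Q.comap (algebraMap B (Localization.AtPrime P))).primeCompl (Localization.AtPrime Q)
    (Localization.AtPrime (Q.comap (algebraMap B (Localization.AtPrime P))))).toRingEquiv h8
end GN

namespace GN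

theorem tensor_finite_noeth {A V B : Type*} [CommRing A] [CommRing V] [Algebra A V] [Module.Finite A V]
    [CommRing B] [IsNoetherianRing B] [Algebra A B] : IsNoetherianRing (V ⊗[A] B) := by
  letI : Algebra B (V ⊗[A] B) := Algebra.TensorProduct.rightAlgebra
  haveI : Module.Finite B (V ⊗[A] B) := Module.Finite.equiv (Algebra.TensorProduct.commRight A B V).toLinearEquiv
  exact IsNoetherianRing.of_finite B _

theorem tensor_finite_jac {A V B : Type*} [CommRing A] [IsLocalRing A] [CommRing V] [IsLocalRing V] [Algebra A V] [Module.Finite A V]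
    [CommRing B] [IsLocalRing B] [Algebra A B] [IsLocalHom (algebraMap A B)] :
    (maximalIdeal V).map (algebraMap V (V ⊗[A] B)) ≤ Ideal.jacobson ⊥ := by
  letI : Algebra B (V ⊗[A] B) := Algebra.TensorProduct.rightAlgebra
  haveI : Module.Finite B (V ⊗[A] B) := Module.Finite.equiv (Algebra.TensorProduct.commRight A B V).toLinearEquiv
  haveI : Algebra.IsIntegral B (V ⊗[A] B) := Algebra.IsIntegral.of_finite _ _
  haveI : Algebra.IsIntegral A V := Algebra.IsIntegral.of_finite _ _
  rw [Ideal.jacobson]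
  refine le_sInf ?_
  rintro P ⟨-, hP⟩
  haveI := hP
  have h1 : (P.comap (algebraMap B (V ⊗[A] B))).IsMaximal := Ideal.isMaximal_comap_of_isIntegral_of_isMaximal P
  have h2 : P.comap (algebraMap B (V ⊗[A] B)) = maximalIdeal B := IsLocalRing.eq_maximalIdeal h1
  have h3 : ((P.comap (algebraMap V (V ⊗[A] B))).comap (algebraMap A V)) = maximalIdeal A := by
    rw [← (IsLocalRing.maximalIdeal_comap (algebraMap A B)), ← h2, Ideal.comap_comap, Ideal.comap_comap]
    congr 1
    ext a
    simp only [RingHom.comp_apply, Algebra.TensorProduct.right_algebraMap_apply, Algebra.TensorProduct.algebraMap_apply, Algebra.algebraMap_self, RingHom.id_apply]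
    rw [Algebra.algebraMap_eq_smul_one, Algebra.algebraMap_eq_smul_one, smul_tmul]
  haveI : (P.comap (algebraMap V (V ⊗[A] B))).IsPrime := Ideal.comap_isPrime _ _
  have h4 : (P.comap (algebraMap V (V ⊗[A] B))).IsMaximal :=
    Ideal.isMaximal_of_isIntegral_of_isMaximal_comap (R := A) _ (by rw [h3]; infer_instance)
  rw [Ideal.map_le_iff_le_comap, IsLocalRing.eq_maximalIdeal h4]

theorem step {A V L : Type u} {B : Type v} [CommRing A] [IsLocalRing A] [CommRing V] [IsDomain V] [IsLocalRing V] [IsNoetherianRing V]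
    [IsAdicComplete (maximalIdeal V) V] (hV : NDom V) [Algebra A V] [Module.Finite A V] (hnf : maximalIdeal V ≠ ⊥)
    [Field L] [Algebra A L] [Algebra V L] [IsScalarTower A V L] [IsFractionRing V L]
    [CommRing B] [IsLocalRing B] [IsNoetherianRing B] [Algebra A B] [Module.Flat A B] [IsLocalHom (algebraMap A B)]
    (hIH : ∀ (κ' : Type u) [Field κ'] [Algebra A κ'], FF A κ' → RingHom.ker (algebraMap A L) < RingHom.ker (algebraMap A κ') →
      IsNormalRing (κ' ⊗[A] B)) : IsNormalRing (L ⊗[A] B) := by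
  haveI : IsNoetherianRing (V ⊗[A] B) := tensor_finite_noeth
  haveI : Algebra.IsIntegral A V := Algebra.IsIntegral.of_finite _ _
  have hLi : Function.Injective (algebraMap V L) := IsFractionRing.injective V L
  have key : IsNormalRing (L ⊗[V] (V ⊗[A] B)) := by
    refine core hV hnf tensor_finite_jac (fun κ' _ _ hκ hk => ?_)
    letI : Algebra A κ' := Algebra.compHom κ' (algebraMap A V)
    haveI : IsScalarTower A V κ' := IsScalarTower.of_algebraMap_eq fun x => rfl
    have e : κ' ⊗[V] (V ⊗[A] B) ≃ₐ[V] κ' ⊗[A] B := Algebra.TensorProduct.cancelBaseChange A V V κ' B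
    refine isNormalRing_of_ringEquiv e.symm.toRingEquiv (hIH κ' (FF.of_finite (A₁ := V) hκ) ?_)
    have h := Ideal.IsIntegral.comap_lt_comap (R := A) (I := (⊥ : Ideal V)) (bot_lt_iff_ne_bot.2 hk)
    rw [RingHom.comap_ker, ← IsScalarTower.algebraMap_eq, ← (RingHom.injective_iff_ker_eq_bot _).1 hLi,
      RingHom.comap_ker, ← IsScalarTower.algebraMap_eq] at h
    exact h
  have e : L ⊗[V] (V ⊗[A] B) ≃ₐ[V] L ⊗[A] B := Algebra.TensorProduct.cancelBaseChange A V V L B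
  exact isNormalRing_of_ringEquiv e.toRingEquiv key

theorem main_complete {A : Type u} {B : Type v} [CommRing A] [IsLocalRing A] [IsNoetherianRing A] [IsAdicComplete (maximalIdeal A) A]
    [CommRing B] [IsLocalRing B] [IsNoetherianRing B] [Algebra A B] [Module.Flat A B] [IsLocalHom (algebraMap A B)]
    (hfib : ∀ (L : Type u) [Field L] [Algebra A L], FF A L → RingHom.ker (algebraMap A L) = maximalIdeal A →
      IsNormalRing (L ⊗[A] B)) (L : Type u) [Field L] [Algebra A L] (hL : FF A L) : IsNormalRing (L ⊗[A] B) := by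
  suffices H : ∀ (I : Ideal A) (L : Type u) [Field L] [Algebra A L], FF A L → RingHom.ker (algebraMap A L) = I →
      IsNormalRing (L ⊗[A] B) from H _ L hL rfl
  intro I
  induction I using IsNoetherian.induction with
  | hgt I' ih =>
    let I : Ideal A := I'
    change ∀ (J : Ideal A), I < J → _ at ih
    change ∀ (L : Type u) [Field L] [Algebra A L], FF A L → RingHom.ker (algebraMap A L) = I → IsNormalRing (L ⊗[A] B)
    clear_value I
    intro L _ _ hL hI
    by_cases hm : I = maximalIdeal A
    · exact hfib L hL (hI.trans hm)
    haveI hIp : I.IsPrime := hI ▸ RingHom.ker_isPrime _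
    haveI : IsLocalRing (A ⧸ I) := isLocalRing_quot_of_le (IsLocalRing.le_maximalIdeal hIp.ne_top)
    haveI : IsAdicComplete (maximalIdeal (A ⧸ I)) (A ⧸ I) := by
      rw [maximalIdeal_quot]; exact adic_quot _ _
    letI : Algebra (A ⧸ I) L := (Ideal.Quotient.lift I (algebraMap A L) (fun x hx => by rw [← hI] at hx; exact hx)).toAlgebra
    haveI : IsScalarTower A (A ⧸ I) L := IsScalarTower.of_algebraMap_eq fun x => rfl
    have hinj : Function.Injective (algebraMap (A ⧸ I) L) := RingHom.lift_injective_of_ker_le_ideal _ _ hI.le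
    have hD : FF (A ⧸ I) L := FF.of_tower hL
    haveI : Module.Finite (A ⧸ I) (integralClosure (A ⧸ I) L) := japanese hinj hD
    haveI : FaithfulSMul (A ⧸ I) L := (faithfulSMul_iff_algebraMap_injective _ _).2 hinj
    letI : Algebra (FractionRing (A ⧸ I)) L := FractionRing.liftAlgebra _ _
    haveI : IsScalarTower (A ⧸ I) (FractionRing (A ⧸ I)) L := FractionRing.isScalarTower_liftAlgebra _ _
    haveI : FiniteDimensional (FractionRing (A ⧸ I)) L := FF.finiteDimensional hD
    haveI : IsIntegrallyClosed (integralClosure (A ⧸ I) L) := integralClosure.isIntegrallyClosedOfFiniteExtension (FractionRing (A ⧸ I))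
    haveI : IsFractionRing (integralClosure (A ⧸ I) L) L := integralClosure.isFractionRing_of_finite_extension (FractionRing (A ⧸ I)) L
    haveI : IsNoetherianRing (integralClosure (A ⧸ I) L) := IsNoetherianRing.of_finite (A ⧸ I) _
    obtain ⟨h1, h2, h3⟩ := local_of_finite (S := A ⧸ I) (T := integralClosure (A ⧸ I) L)
    haveI := h1
    haveI := h2
    haveI : Module.Finite A (A ⧸ I) := inferInstance
    haveI : Module.Finite A (integralClosure (A ⧸ I) L) := Module.Finite.trans (A ⧸ I) _
    refine step (V := integralClosure (A ⧸ I) L) ⟨inferInstance, inferInstance⟩ ?_ (fun κ' _ _ hκ hk => ih _ (hI ▸ hk) κ' hκ rfl)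
    intro h0
    rw [h0, le_bot_iff, Ideal.map_eq_bot_iff_of_injective] at h3
    · rw [maximalIdeal_quot, Ideal.map_eq_bot_iff_le_ker, Ideal.mk_ker] at h3
      exact hm (((IsLocalRing.maximalIdeal.isMaximal A).eq_of_le hIp.ne_top h3).symm)
    · intro x y hxy
      exact hinj (congrArg Subtype.val hxy)
end GN

namespace GN

theorem tensor_kill {A L B Y : Type*} [CommRing A] [CommRing L] [Algebra A L] [CommRing B] [Algebra A B] [CommRing Y] [Algebra A Y]
    (g : B →ₐ[A] Y) (hg : Function.Surjective g) (m : Ideal A) (hm : m ≤ RingHom.ker (algebraMap A L))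
    (hk : RingHom.ker g ≤ m.map (algebraMap A B)) : Nonempty (L ⊗[A] B ≃+* L ⊗[A] Y) := by
  have hker := Algebra.TensorProduct.lTensor_ker (A := L) g hg
  have hbot : Ideal.map ((Algebra.TensorProduct.includeRight : B →ₐ[A] L ⊗[A] B).toRingHom.comp (algebraMap A B)) m = ⊥ := by
    rw [eq_bot_iff, Ideal.map_le_iff_le_comap]
    intro x hx
    have hx' : algebraMap A L x = 0 := hm hx
    rw [Ideal.mem_comap, Ideal.mem_bot]
    have : (1 : L) ⊗ₜ[A] (algebraMap A B x) = 0 := by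
      rw [Algebra.algebraMap_eq_smul_one, ← smul_tmul, ← Algebra.algebraMap_eq_smul_one, hx', zero_tmul]
    exact this
  have hker' : RingHom.ker (Algebra.TensorProduct.map (AlgHom.id A L) g) = ⊥ := by
    rw [hker, eq_bot_iff]
    exact (Ideal.map_mono hk).trans ((Ideal.map_map _ _).trans hbot).le
  have hb : Function.Bijective (Algebra.TensorProduct.map (AlgHom.id A L) g) :=
    ⟨(RingHom.injective_iff_ker_eq_bot _).2 hker', TensorProduct.map_surjective Function.surjective_id hg⟩
  exact ⟨(AlgEquiv.ofBijective _ hb).toRingEquiv⟩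

theorem red_abs {A A₁ : Type u} {B E : Type v} [CommRing A] [IsLocalRing A] [IsNoetherianRing A]
    [CommRing A₁] [IsLocalRing A₁] [IsNoetherianRing A₁] [IsAdicComplete (maximalIdeal A₁) A₁]
    [CommRing B] [CommRing E] [IsLocalRing E] [IsNoetherianRing E] [Algebra A A₁] [Algebra A B] [Algebra A E] [Algebra B E]
    [Algebra A₁ E] [IsScalarTower A A₁ E] [IsScalarTower A B E] [Module.FaithfullyFlat B E] [Module.Flat A₁ E]
    [IsLocalHom (algebraMap A₁ E)] (hmax : maximalIdeal A₁ = (maximalIdeal A).map (algebraMap A A₁))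
    (hd : ∀ x : A₁, ∃ a, x - algebraMap A A₁ a ∈ maximalIdeal A₁)
    (hdE : ∀ x : E, ∃ b, x - algebraMap B E b ∈ (maximalIdeal A).map (algebraMap A E))
    (hcE : ∀ b, algebraMap B E b ∈ (maximalIdeal A).map (algebraMap A E) → b ∈ (maximalIdeal A).map (algebraMap A B))
    (hfib : ∀ (L : Type u) [Field L] [Algebra A L], FF A L → maximalIdeal A ≤ RingHom.ker (algebraMap A L) → IsNormalRing (L ⊗[A] B))
    (hformal : ∀ (L : Type u) [Field L] [Algebra A L], FF A L → IsNormalRing (L ⊗[A] A₁))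
    (L : Type u) [Field L] [Algebra A L] (hL : FF A L) : IsNormalRing (L ⊗[A] B) := by
  refine normal_descent_tensor (E' := E) (normal_two (M := A₁) hL (hformal L hL) fun Q _ hQ => main_complete ?_ _ hQ)
  intro L _ _ hL hk
  letI : Algebra A L := Algebra.compHom L (algebraMap A A₁)
  haveI : IsScalarTower A A₁ L := IsScalarTower.of_algebraMap_eq fun x => rfl
  have hLA : FF A L := by
    refine FF.of_localization_map hL fun x => ?_
    obtain ⟨a, ha⟩ := hd x
    refine ⟨1, a, by simp, ?_⟩
    rw [← hk, RingHom.mem_ker, map_sub, sub_eq_zero] at ha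
    rw [map_one, one_mul, ha, IsScalarTower.algebraMap_apply A A₁ L]
  have hmL : maximalIdeal A ≤ RingHom.ker (algebraMap A L) := by
    intro x hx
    have : algebraMap A A₁ x ∈ RingHom.ker (algebraMap A₁ L) := by
      rw [hk, hmax]; exact Ideal.mem_map_of_mem _ hx
    rw [RingHom.mem_ker] at this ⊢
    rw [IsScalarTower.algebraMap_apply A A₁ L, this]
  have h1 := hfib L hLA hmL
  letI : Algebra (A₁ ⧸ maximalIdeal A₁) L :=
    (Ideal.Quotient.lift (maximalIdeal A₁) (algebraMap A₁ L) (fun x hx => by rw [← hk] at hx; exact hx)).toAlgebra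
  haveI : IsScalarTower A₁ (A₁ ⧸ maximalIdeal A₁) L := IsScalarTower.of_algebraMap_eq fun x => rfl
  haveI : IsScalarTower A (A₁ ⧸ maximalIdeal A₁) L := IsScalarTower.of_algebraMap_eq fun x => rfl
  refine tensor_quot (maximalIdeal A₁) ?_
  have hmE : (maximalIdeal A₁).map (algebraMap A₁ E) = (maximalIdeal A).map (algebraMap A E) := by
    rw [hmax, Ideal.map_map, ← IsScalarTower.algebraMap_eq]
  haveI : IsScalarTower A (A₁ ⧸ maximalIdeal A₁) (E ⧸ (maximalIdeal A₁).map (algebraMap A₁ E)) :=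
    IsScalarTower.of_algebraMap_eq fun x => by
      rw [IsScalarTower.algebraMap_apply A A₁ (A₁ ⧸ maximalIdeal A₁), ← IsScalarTower.algebraMap_apply A₁ (A₁ ⧸ maximalIdeal A₁),
        ← IsScalarTower.algebraMap_apply A A₁]
  have hs : Function.Surjective (algebraMap A (A₁ ⧸ maximalIdeal A₁)) := by
    intro y
    obtain ⟨x, rfl⟩ := Ideal.Quotient.mk_surjective y
    obtain ⟨a, ha⟩ := hd x
    exact ⟨a, ((Ideal.Quotient.mk_eq_mk_iff_sub_mem _ _).2 ha).symm⟩
  obtain ⟨e⟩ := tensor_surj_equiv L (E ⧸ (maximalIdeal A₁).map (algebraMap A₁ E)) hs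
  refine isNormalRing_of_ringEquiv e.symm ?_
  let g : B →ₐ[A] E ⧸ (maximalIdeal A₁).map (algebraMap A₁ E) :=
    (Ideal.Quotient.mkₐ A ((maximalIdeal A₁).map (algebraMap A₁ E))).comp (IsScalarTower.toAlgHom A B E)
  have hgv : ∀ b, g b = Ideal.Quotient.mk ((maximalIdeal A₁).map (algebraMap A₁ E)) (algebraMap B E b) := fun b => rfl
  obtain ⟨e'⟩ := tensor_kill (L := L) g (by
    intro y
    obtain ⟨x, rfl⟩ := Ideal.Quotient.mk_surjective y
    obtain ⟨b, hb⟩ := hdE x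
    rw [← hmE] at hb
    exact ⟨b, (hgv b).trans ((Ideal.Quotient.mk_eq_mk_iff_sub_mem _ _).2 hb).symm⟩) (maximalIdeal A) hmL (by
    intro b hb
    rw [RingHom.mem_ker, hgv, Ideal.Quotient.eq_zero_iff_mem, hmE] at hb
    exact hcE b hb)
  exact isNormalRing_of_ringEquiv e' h1

theorem comp_local {B : Type*} [CommRing B] [IsLocalRing B] [IsNoetherianRing B] (I : Ideal B) (hI : I ≤ maximalIdeal B) :
    ∃ _ : IsLocalRing (AdicCompletion I B), maximalIdeal (AdicCompletion I B) = (maximalIdeal B).map (algebraMap B (AdicCompletion I B)) := by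
  have hfg : I.FG := IsNoetherian.noetherian I
  have hM := AdicCompletion.isMaximal_map_of_le I (maximalIdeal B) hI hfg
  haveI := comp_complete I hfg
  have hl : IsLocalRing (AdicCompletion I B) := by
    refine IsLocalRing.of_unique_max_ideal ⟨_, hM, fun P hP => ?_⟩
    refine hP.eq_of_le hM.ne_top ?_
    have hjac : I.map (algebraMap B (AdicCompletion I B)) ≤ P := by
      intro x hx
      have := IsAdicComplete.le_jacobson_bot _ hx
      rw [Ideal.jacobson] at this
      exact (Submodule.mem_sInf.1 this) P ⟨bot_le, hP⟩
    intro x hx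
    obtain ⟨r, hr⟩ := comp_dense I hfg 1 x
    rw [pow_one] at hr
    have h1 : algebraMap B (AdicCompletion I B) r ∈ P := by
      have := P.sub_mem hx (hjac hr)
      rwa [sub_sub_cancel] at this
    have h2 : r ∈ maximalIdeal B := by
      haveI := hP.isPrime
      exact IsLocalRing.le_maximalIdeal (Ideal.IsPrime.ne_top (I := P.comap (algebraMap B (AdicCompletion I B))) inferInstance) h1
    have := Ideal.add_mem _ (Ideal.map_mono hI hr) (Ideal.mem_map_of_mem (algebraMap B (AdicCompletion I B)) h2)
    rwa [sub_add_cancel] at this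
  exact ⟨hl, (IsLocalRing.eq_maximalIdeal hM).symm⟩

theorem red {A : Type u} {B : Type v} [CommRing A] [IsLocalRing A] [IsNoetherianRing A]
    [CommRing B] [IsLocalRing B] [IsNoetherianRing B] [Algebra A B] [IsLocalHom (algebraMap A B)] [Module.Flat A B]
    (hfib : ∀ (L : Type u) [Field L] [Algebra A L], FF A L → maximalIdeal A ≤ RingHom.ker (algebraMap A L) → IsNormalRing (L ⊗[A] B))
    (hformal : ∀ (L : Type u) [Field L] [Algebra A L], FF A L → IsNormalRing (L ⊗[A] AdicCompletion (maximalIdeal A) A))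
    (L : Type u) [Field L] [Algebra A L] (hL : FF A L) : IsNormalRing (L ⊗[A] B) := by
  have hle : (maximalIdeal A).map (algebraMap A B) ≤ maximalIdeal B := by
    rw [Ideal.map_le_iff_le_comap, IsLocalRing.maximalIdeal_comap]
  obtain ⟨l1, hl1⟩ := comp_local _ hle
  have hmE : (maximalIdeal A).map (algebraMap A (AdicCompletion ((maximalIdeal A).map (algebraMap A B)) B)) =
      ((maximalIdeal A).map (algebraMap A B)).map (algebraMap B _) := by
    rw [Ideal.map_map, ← IsScalarTower.algebraMap_eq]
  generalize hI : (maximalIdeal A).map (algebraMap A B) = I at *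
  have hfg : I.FG := IsNoetherian.noetherian I
  haveI := comp_complete I hfg
  haveI := comp_noeth I
  haveI := comp_flat I
  haveI := comp_noeth (maximalIdeal A)
  have hfgA : (maximalIdeal A).FG := IsNoetherian.noetherian _
  haveI : IsLocalHom (algebraMap B (AdicCompletion I B)) :=
    ((IsLocalRing.local_hom_TFAE (algebraMap B (AdicCompletion I B))).out 0 2 :
      IsLocalHom (algebraMap B (AdicCompletion I B)) ↔ _).2 hl1.ge
  haveI : Module.FaithfullyFlat B (AdicCompletion I B) := Module.FaithfullyFlat.of_flat_of_isLocalHom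
  haveI : Module.Flat A (AdicCompletion I B) := Module.Flat.trans A B _
  obtain ⟨F, hF⟩ := exists_extend (maximalIdeal A) (I.map (algebraMap B (AdicCompletion I B)))
    (algebraMap A (AdicCompletion I B)) hmE.le
  letI : Algebra (AdicCompletion (maximalIdeal A) A) (AdicCompletion I B) := F.toAlgebra
  haveI : IsScalarTower A (AdicCompletion (maximalIdeal A) A) (AdicCompletion I B) :=
    IsScalarTower.of_algebraMap_eq' hF.symm
  haveI : Module.Flat (AdicCompletion (maximalIdeal A) A) (AdicCompletion I B) :=
    flat_of_dense (maximalIdeal A) (by rw [hmE]; exact IsAdicComplete.le_jacobson_bot _) (comp_dense _ hfgA)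
  have hmax := AdicCompletion.maximalIdeal_eq_map (R := A)
  haveI : IsLocalHom (algebraMap (AdicCompletion (maximalIdeal A) A) (AdicCompletion I B)) := by
    refine ((IsLocalRing.local_hom_TFAE (algebraMap (AdicCompletion (maximalIdeal A) A) (AdicCompletion I B))).out 0 2 :
      IsLocalHom (algebraMap (AdicCompletion (maximalIdeal A) A) (AdicCompletion I B)) ↔ _).2 ?_
    rw [hmax, Ideal.map_map, ← IsScalarTower.algebraMap_eq, hmE, hl1]
    exact Ideal.map_mono hle
  refine red_abs (A₁ := AdicCompletion (maximalIdeal A) A) (E := AdicCompletion I B) hmax (fun x => ?_) (fun x => ?_) (fun b hb => ?_)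
    hfib hformal L hL
  · have := comp_dense _ hfgA 1 x
    rwa [pow_one, ← hmax] at this
  · have := comp_dense _ hfg 1 x
    rwa [pow_one, ← hmE] at this
  · have := (comp_comap _ hfg 1 b).1 (by rwa [pow_one, ← hmE])
    rwa [pow_one, ← hI] at this

end GN

/-- **Statement 13 (localization theorem, normal case).** Let `σ : A → B` be a flat
local homomorphism of Noetherian local commutative rings, `m` the maximal ideal of `A`.
If the formal fibers of `A` are geometrically normal (for every prime `p` of `A`, the
fiber `κ(p) ⊗[A] Â` of `A → Â` is geometrically normal over `κ(p)`), and the closed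
fiber `B ⧸ mB = κ(m) ⊗[A] B` is geometrically normal over `A ⧸ m`, then `σ` is normal:
for every prime `p` of `A`, the fiber `κ(p) ⊗[A] B` is geometrically normal over
`κ(p)`. -/
theorem geometricallyNormal_fibers_of_closed_fiber
    (A B : Type*) [CommRing A] [CommRing B] [IsNoetherianRing A] [IsNoetherianRing B]
    [IsLocalRing A] [IsLocalRing B]
    [Algebra A B] [IsLocalHom (algebraMap A B)] [Module.Flat A B]
    (hformal : ∀ (p : Ideal A) (hp : p.IsPrime),
      haveI : p.IsPrime := hp
      GeometricallyNormal (ResidueField (Localization.AtPrime p))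
        (ResidueField (Localization.AtPrime p) ⊗[A] AdicCompletion (maximalIdeal A) A))
    (hfib : GeometricallyNormal (ResidueField A) (ResidueField A ⊗[A] B)) :
    ∀ (p : Ideal A) (hp : p.IsPrime),
      haveI : p.IsPrime := hp
      GeometricallyNormal (ResidueField (Localization.AtPrime p))
        (ResidueField (Localization.AtPrime p) ⊗[A] B) := by
  intro p hp L _ _ _
  letI : Algebra p.ResidueField L := ‹Algebra (ResidueField (Localization.AtPrime p)) L›
  haveI : FiniteDimensional p.ResidueField L := ‹FiniteDimensional (ResidueField (Localization.AtPrime p)) L›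
  letI : Algebra A L := Algebra.compHom L (algebraMap A p.ResidueField)
  haveI : IsScalarTower A p.ResidueField L := IsScalarTower.of_algebraMap_eq fun x => rfl
  have e : L ⊗[p.ResidueField] (p.ResidueField ⊗[A] B) ≃ₐ[p.ResidueField] L ⊗[A] B :=
    Algebra.TensorProduct.cancelBaseChange A p.ResidueField p.ResidueField L B
  refine GN.isNormalRing_of_ringEquiv e.symm.toRingEquiv (GN.red ?_ ?_ L (GN.FF.of_resField p))
  · intro L _ _ hL hk
    letI : Algebra (ResidueField A) L := (Ideal.Quotient.lift (maximalIdeal A) (algebraMap A L) hk).toAlgebra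
    haveI : IsScalarTower A (ResidueField A) L := IsScalarTower.of_algebraMap_eq fun x => rfl
    haveI : FiniteDimensional (ResidueField A) L := GN.FF.finiteDimensional hL
    have e : L ⊗[ResidueField A] (ResidueField A ⊗[A] B) ≃ₐ[ResidueField A] L ⊗[A] B :=
      Algebra.TensorProduct.cancelBaseChange A (ResidueField A) (ResidueField A) L B
    exact GN.isNormalRing_of_ringEquiv e.toRingEquiv (hfib L)
  · intro L _ _ hL
    obtain ⟨p, hp, _, _, -⟩ := GN.exists_resField A L
    haveI : FiniteDimensional p.ResidueField L := GN.FF.finiteDimensional hL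
    have e : L ⊗[p.ResidueField] (p.ResidueField ⊗[A] AdicCompletion (maximalIdeal A) A) ≃ₐ[p.ResidueField]
        L ⊗[A] AdicCompletion (maximalIdeal A) A :=
      Algebra.TensorProduct.cancelBaseChange A p.ResidueField p.ResidueField L _
    exact GN.isNormalRing_of_ringEquiv e.toRingEquiv (hformal p hp L)
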